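/- Let β : ℝ^d → ℝ^d be a Borel vector field and set Lφ(x) = trace(A(x)D²φ(x)) + ⟨β(x), ∇φ(x)⟩. Assume there are constants Λ₁, Λ > 0 and N₁ > 0 with LV(x) ≤ Λ₁ − ΛV(x) and |β(x)| ≤ N₁ V(x)^{1/2−γ} for all x. Let μ ∈ 𝒫_V(ℝ^d) be a probability solution of the stationary equation L^*μ = 0, i.e. ∫Lφ dμ = 0 for all φ ∈ C_0^∞(ℝ^d). Then there exist numbers N > 0 and λ > 0, depending only on d, K₁, K₂, Λ₁, Λ, N₁, γ and V (in particular not on the individual measure μ beyond these quantities), such that for every μ₀ ∈ 𝒫_V(ℝ^d) and every family (η_t)_{t≥0} ⊂ 𝒫_V(ℝ^d) solving the linear Cauchy problem ∂_tη_t = L^*η_t, η_0 = μ₀ (i.e. ∫φ dη_t − ∫φ dμ₀ = ∫₀^t ∫ Lφ dη_s ds for all φ ∈ C_0^∞(ℝ^d) and all t), one has ‖η_t − μ‖_W ≤ N e^{−λ t} ‖μ₀ − μ‖_W for all t > 0. -/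

import Mathlib

open MeasureTheory Real Set Filter Metric
open scoped Topology RealInnerProductSpace NNReal ENNReal

noncomputable section

abbrev Ed (d : ℕ) : Type := EuclideanSpace ℝ (Fin d)

variable {d : ℕ}

/-- Second-order partial derivative `∂_i ∂_j φ (x)`. -/
def hess2 (φ : Ed d → ℝ) (x : Ed d) (i j : Fin d) : ℝ :=
  iteratedFDeriv ℝ 2 φ x ![EuclideanSpace.single i 1, EuclideanSpace.single j 1]

/-- The Kolmogorov operator `L φ = trace (A D²φ) + ⟨β, ∇φ⟩`. -/
def Lop (A : Ed d → Matrix (Fin d) (Fin d) ℝ) (B : Ed d → Ed d)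
    (φ : Ed d → ℝ) (x : Ed d) : ℝ :=
  (∑ i, ∑ j, A x i j * hess2 φ x i j) + ⟪B x, gradient φ x⟫

/-- Membership in `𝒫_V(ℝ^d)`. -/
def memPV (V : Ed d → ℝ) (μ : Measure (Ed d)) : Prop :=
  IsProbabilityMeasure μ ∧ Integrable V μ

/-- `C_0^∞` test functions. -/
def IsTestFun (φ : Ed d → ℝ) : Prop :=
  ContDiff ℝ (⊤ : ℕ∞) φ ∧ HasCompactSupport φ

/-- Weighted total-variation distance `‖W·(μ - ν)‖_{TV}` expressed by duality. -/
def wDist (W : Ed d → ℝ) (μ ν : Measure (Ed d)) : ℝ :=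
  ⨆ f : {f : Ed d → ℝ // Measurable f ∧ ∀ x, |f x| ≤ W x},
    (∫ x, f.1 x ∂μ - ∫ x, f.1 x ∂ν)

/-- Probability solution of the stationary equation `L^*μ = 0`. -/
def IsStationarySol (A : Ed d → Matrix (Fin d) (Fin d) ℝ) (B : Ed d → Ed d)
    (μ : Measure (Ed d)) : Prop :=
  ∀ φ : Ed d → ℝ, IsTestFun φ → ∫ x, Lop A B φ x ∂μ = 0

/-- Solution of the linear Cauchy problem `∂_t η_t = L^* η_t`, `η_0 = μ₀`. -/
def IsLinCauchySol (A : Ed d → Matrix (Fin d) (Fin d) ℝ) (B : Ed d → Ed d)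
    (μ₀ : Measure (Ed d)) (η : ℝ → Measure (Ed d)) : Prop :=
  η 0 = μ₀ ∧ ∀ φ : Ed d → ℝ, IsTestFun φ → ∀ t : ℝ, 0 ≤ t →
    ∫ x, φ x ∂(η t) - ∫ x, φ x ∂μ₀
      = ∫ s in (0:ℝ)..t, ∫ x, Lop A B φ x ∂(η s)

set_option linter.unusedSectionVars false

/-- Partial derivative in the `i`-th coordinate direction. -/
def pd (f : Ed d → ℝ) (i : Fin d) (x : Ed d) : ℝ := fderiv ℝ f x (EuclideanSpace.single i 1)

lemma contDiff_pd {n : ℕ∞} {f : Ed d → ℝ} (hf : ContDiff ℝ (n + 1 : ℕ∞) f) (i : Fin d) :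
    ContDiff ℝ n (pd f i) := by
  have : ContDiff ℝ n (fderiv ℝ f) := hf.fderiv_right (by norm_cast)
  exact this.clm_apply contDiff_const

lemma contDiff_one_pd {f : Ed d → ℝ} (hf : ContDiff ℝ 2 f) (i : Fin d) :
    ContDiff ℝ 1 (pd f i) :=
  contDiff_pd (n := 1) (by norm_num; exact hf) i

lemma continuous_pd {f : Ed d → ℝ} (hf : ContDiff ℝ 1 f) (i : Fin d) : Continuous (pd f i) :=
  (hf.continuous_fderiv one_ne_zero).clm_apply continuous_const

lemma continuous_pd_pd {f : Ed d → ℝ} (hf : ContDiff ℝ 2 f) (i j : Fin d) :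
    Continuous (pd (pd f j) i) :=
  continuous_pd (contDiff_one_pd hf j) i

lemma fderiv_apply_eq_sum_pd (f : Ed d → ℝ) (x w : Ed d) :
    fderiv ℝ f x w = ∑ i, w i * pd f i x := by
  conv_lhs => rw [← (EuclideanSpace.basisFun (Fin d) ℝ).sum_repr w]
  simp [pd, map_sum]

lemma norm_fderiv_le_sum_pd (f : Ed d → ℝ) (x : Ed d) :
    ‖fderiv ℝ f x‖ ≤ ∑ i, |pd f i x| := by
  refine ContinuousLinearMap.opNorm_le_bound _ (Finset.sum_nonneg fun _ _ => abs_nonneg _) ?_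
  intro w
  rw [fderiv_apply_eq_sum_pd, Finset.sum_mul]
  refine (Finset.abs_sum_le_sum_abs _ _).trans (Finset.sum_le_sum fun i _ => ?_)
  rw [abs_mul, mul_comm]
  exact mul_le_mul_of_nonneg_left (PiLp.norm_apply_le w i) (abs_nonneg _)

lemma pd_add {f g : Ed d → ℝ} {x : Ed d} (hf : DifferentiableAt ℝ f x)
    (hg : DifferentiableAt ℝ g x) (i : Fin d) :
    pd (fun y => f y + g y) i x = pd f i x + pd g i x := by
  simp only [pd]
  rw [fderiv_fun_add hf hg]; rfl

lemma pd_sub {f g : Ed d → ℝ} {x : Ed d} (hf : DifferentiableAt ℝ f x)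
    (hg : DifferentiableAt ℝ g x) (i : Fin d) :
    pd (fun y => f y - g y) i x = pd f i x - pd g i x := by
  simp only [pd]
  rw [fderiv_fun_sub hf hg]; rfl

lemma pd_mul {f g : Ed d → ℝ} {x : Ed d} (hf : DifferentiableAt ℝ f x)
    (hg : DifferentiableAt ℝ g x) (i : Fin d) :
    pd (fun y => f y * g y) i x = f x * pd g i x + g x * pd f i x := by
  simp only [pd]
  rw [fderiv_fun_mul hf hg]; rfl

@[simp] lemma pd_const (c : ℝ) (i : Fin d) (x : Ed d) : pd (fun _ => c) i x = 0 := by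
  simp [pd]

lemma pd_comp {g : ℝ → ℝ} {f : Ed d → ℝ} {x : Ed d} {g' : ℝ} (hg : HasDerivAt g g' (f x))
    (hf : DifferentiableAt ℝ f x) (i : Fin d) :
    pd (fun y => g (f y)) i x = g' * pd f i x := by
  have := (hg.comp_hasFDerivAt x hf.hasFDerivAt).fderiv
  simp only [pd]
  rw [show (fun y => g (f y)) = g ∘ f from rfl, this]; simp

lemma pd_sum {ι : Type*} (s : Finset ι) {f : ι → Ed d → ℝ} {x : Ed d}
    (hf : ∀ a ∈ s, DifferentiableAt ℝ (f a) x) (i : Fin d) :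
    pd (fun y => ∑ a ∈ s, f a y) i x = ∑ a ∈ s, pd (f a) i x := by
  simp only [pd]
  rw [fderiv_fun_sum hf]; simp

lemma pd_congr {f g : Ed d → ℝ} {x : Ed d} (h : f =ᶠ[𝓝 x] g) (i : Fin d) :
    pd f i x = pd g i x := by
  simp only [pd, h.fderiv_eq]

lemma pd_comp_sub_left {f : Ed d → ℝ} (hf : Differentiable ℝ f) (a : Ed d) (i : Fin d)
    (y : Ed d) : pd (fun y => f (a - y)) i y = - pd f i (a - y) := by
  have h1 : HasFDerivAt (fun y : Ed d => a - y) (-ContinuousLinearMap.id ℝ (Ed d)) y := by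
    simpa using (hasFDerivAt_id (𝕜 := ℝ) y).const_sub a
  have h2 := ((hf (a - y)).hasFDerivAt.comp y h1).fderiv
  simp only [pd]
  rw [show (fun y => f (a - y)) = f ∘ (fun y => a - y) from rfl, h2]
  simp

lemma Lop_eq (A : Ed d → Matrix (Fin d) (Fin d) ℝ) (B : Ed d → Ed d) {φ : Ed d → ℝ}
    (hφ : ContDiff ℝ 2 φ) (x : Ed d) :
    Lop A B φ x = (∑ i, ∑ j, A x i j * pd (pd φ j) i x) + ∑ i, B x i * pd φ i x := by
  unfold Lop
  congr 1
  · refine Finset.sum_congr rfl fun i _ => Finset.sum_congr rfl fun j _ => ?_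
    congr 1
    unfold hess2
    rw [iteratedFDeriv_two_apply]
    change _ = fderiv ℝ (fun y => fderiv ℝ φ y (EuclideanSpace.single j 1)) x _
    have h1 : DifferentiableAt ℝ (fderiv ℝ φ) x :=
      ((hφ.fderiv_right (m := 1) (by norm_num)).differentiable one_ne_zero) x
    rw [fderiv_clm_apply h1 (differentiableAt_const _)]
    simp
  · rw [← fderiv_apply_eq_sum_pd]
    unfold gradient
    rw [real_inner_comm, InnerProductSpace.toDual_symm_apply]

lemma Lop_const (A : Ed d → Matrix (Fin d) (Fin d) ℝ) (B : Ed d → Ed d) (c : ℝ) (x : Ed d) :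
    Lop A B (fun _ => c) x = 0 := by
  rw [Lop_eq A B contDiff_const]
  have : ∀ j, pd (fun _ : Ed d => c) j = fun _ => 0 := fun j => by ext; simp
  simp [this]

lemma Lop_add (A : Ed d → Matrix (Fin d) (Fin d) ℝ) (B : Ed d → Ed d) {f g : Ed d → ℝ}
    (hf : ContDiff ℝ 2 f) (hg : ContDiff ℝ 2 g) (x : Ed d) :
    Lop A B (fun y => f y + g y) x = Lop A B f x + Lop A B g x := by
  rw [Lop_eq A B (hf.add hg), Lop_eq A B hf, Lop_eq A B hg]
  have h1 : ∀ j, pd (fun y => f y + g y) j = fun y => pd f j y + pd g j y := fun j => by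
    ext y; exact pd_add (hf.differentiable two_ne_zero y) (hg.differentiable two_ne_zero y) j
  have h2 : ∀ i j, pd (fun y => pd f j y + pd g j y) i x = pd (pd f j) i x + pd (pd g j) i x :=
    fun i j => pd_add ((contDiff_one_pd hf j).differentiable one_ne_zero x)
      ((contDiff_one_pd hg j).differentiable one_ne_zero x) i
  simp only [h1, h2, mul_add, Finset.sum_add_distrib]
  ring

lemma Lop_comp (A : Ed d → Matrix (Fin d) (Fin d) ℝ) (B : Ed d → Ed d) {f : Ed d → ℝ}
    {g g' g'' : ℝ → ℝ} (hf : ContDiff ℝ 2 f) (hgf : ContDiff ℝ 2 (fun y => g (f y)))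
    (hg : ∀ y, HasDerivAt g (g' (f y)) (f y)) (hg' : ∀ y, HasDerivAt g' (g'' (f y)) (f y))
    (x : Ed d) :
    Lop A B (fun y => g (f y)) x
      = g' (f x) * Lop A B f x + g'' (f x) * ∑ i, ∑ j, A x i j * pd f i x * pd f j x := by
  rw [Lop_eq A B hgf, Lop_eq A B hf]
  have hd := hf.differentiable two_ne_zero
  have h1 : ∀ j, pd (fun y => g (f y)) j = fun y => g' (f y) * pd f j y := fun j => by
    ext y; exact pd_comp (hg y) (hd y) j
  have h2 : ∀ i j, pd (fun y => g' (f y) * pd f j y) i x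
      = g' (f x) * pd (pd f j) i x + pd f j x * (g'' (f x) * pd f i x) := fun i j => by
    rw [pd_mul (f := fun y => g' (f y)) ((hg' x).differentiableAt.comp x (hd x))
      ((contDiff_one_pd hf j).differentiable one_ne_zero x), pd_comp (hg' x) (hd x)]
  simp only [h1, h2, mul_add, Finset.sum_add_distrib, Finset.mul_sum]
  have e1 : ∀ i j, A x i j * (pd f j x * (g'' (f x) * pd f i x))
      = g'' (f x) * (A x i j * pd f i x * pd f j x) := fun i j => by ring
  have e2 : ∀ i j, A x i j * (g' (f x) * pd (pd f j) i x)
      = g' (f x) * (A x i j * pd (pd f j) i x) := fun i j => by ring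
  have e3 : ∀ i, B x i * (g' (f x) * pd f i x) = g' (f x) * (B x i * pd f i x) :=
    fun i => by ring
  simp only [e1, e2, e3]
  ring

lemma measurable_Lop {A : Ed d → Matrix (Fin d) (Fin d) ℝ} {B : Ed d → Ed d}
    (hA : ∀ i j, Measurable fun x => A x i j) (hB : Measurable B) {f : Ed d → ℝ}
    (hf : ContDiff ℝ 2 f) : Measurable (Lop A B f) := by
  have : Lop A B f = fun x =>
      (∑ i, ∑ j, A x i j * pd (pd f j) i x) + ∑ i, B x i * pd f i x :=
    funext fun x => Lop_eq A B hf x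
  rw [this]
  refine Measurable.add ?_ ?_
  · exact Finset.measurable_sum _ fun i _ => Finset.measurable_sum _ fun j _ =>
      (hA i j).mul (continuous_pd_pd hf i j).measurable
  · refine Finset.measurable_sum _ fun i _ =>
      Measurable.mul ?_ (continuous_pd (hf.of_le one_le_two) i).measurable
    exact ((EuclideanSpace.proj i : Ed d →L[ℝ] ℝ).continuous.measurable).comp hB

/-- Standing assumptions on the coefficients: ellipticity, boundedness and Lipschitz continuity
of `A`, and a continuous majorant `bb ≥ 1` of the drift. -/
structure Coef (A : Ed d → Matrix (Fin d) (Fin d) ℝ) (β : Ed d → Ed d) (bb : Ed d → ℝ)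
    (C : ℝ) : Prop where
  one_le : 1 ≤ C
  low : ∀ x (w : Fin d → ℝ), ∑ i, w i ^ 2 ≤ C * ∑ i, ∑ j, A x i j * w i * w j
  bdd : ∀ x i j, |A x i j| ≤ C
  lip : ∀ x y i j, |A x i j - A y i j| ≤ C * ‖x - y‖
  meas : Measurable β
  cont : Continuous bb
  one_le_bb : ∀ x, 1 ≤ bb x
  le : ∀ x i, |β x i| ≤ bb x

lemma Coef.continuous_A {A : Ed d → Matrix (Fin d) (Fin d) ℝ} {β : Ed d → Ed d} {bb : Ed d → ℝ}
    {C : ℝ} (hc : Coef A β bb C) (i j : Fin d) : Continuous fun x => A x i j := by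
  have : LipschitzWith (Real.toNNReal C) fun x => A x i j := by
    refine LipschitzWith.of_dist_le_mul fun x y => ?_
    rw [Real.dist_eq, dist_eq_norm, Real.coe_toNNReal _ (by linarith [hc.one_le])]
    exact hc.lip x y i j
  exact this.continuous

lemma Coef.measurable_β {A : Ed d → Matrix (Fin d) (Fin d) ℝ} {β : Ed d → Ed d} {bb : Ed d → ℝ}
    {C : ℝ} (hc : Coef A β bb C) (i : Fin d) : Measurable fun x => β x i :=
  ((EuclideanSpace.proj i : Ed d →L[ℝ] ℝ).continuous.measurable).comp hc.meas

lemma Coef.measurable_Lop {A : Ed d → Matrix (Fin d) (Fin d) ℝ} {β : Ed d → Ed d}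
    {bb : Ed d → ℝ} {C : ℝ} (hc : Coef A β bb C) {f : Ed d → ℝ} (hf : ContDiff ℝ 2 f) :
    Measurable (Lop A β f) :=
  _root_.measurable_Lop (fun i j => (hc.continuous_A i j).measurable) hc.meas hf

/-- `C²` functions bounded by `M` together with their first and second partial derivatives. -/
structure Cb2 (φ : Ed d → ℝ) (M : ℝ) : Prop where
  contDiff : ContDiff ℝ 2 φ
  bound : ∀ x, |φ x| ≤ M
  bound_pd : ∀ i x, |pd φ i x| ≤ M
  bound_pd_pd : ∀ i j x, |pd (pd φ j) i x| ≤ M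

lemma Cb2.nonneg {φ : Ed d → ℝ} {M : ℝ} (h : Cb2 φ M) : 0 ≤ M :=
  (abs_nonneg _).trans (h.bound 0)

lemma hasCompactSupport_pd {f : Ed d → ℝ} (hf : HasCompactSupport f) (i : Fin d) :
    HasCompactSupport (pd f i) :=
  hf.fderiv_apply (𝕜 := ℝ) (EuclideanSpace.single i 1)

lemma Coef.abs_Lop_le {A : Ed d → Matrix (Fin d) (Fin d) ℝ} {β : Ed d → Ed d} {bb : Ed d → ℝ}
    {C : ℝ} (hc : Coef A β bb C) {φ : Ed d → ℝ} (hφ : ContDiff ℝ 2 φ) {M : ℝ} {x : Ed d}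
    (h1 : ∀ i, |pd φ i x| ≤ M) (h2 : ∀ i j, |pd (pd φ j) i x| ≤ M) :
    |Lop A β φ x| ≤ (d * d * C + d) * |M| * bb x := by
  have hC := hc.one_le
  have hb := hc.one_le_bb x
  rw [Lop_eq A β hφ]
  have e1 : |∑ i, ∑ j, A x i j * pd (pd φ j) i x| ≤ d * d * (C * |M|) := by
    refine (Finset.abs_sum_le_sum_abs _ _).trans ?_
    have : ∀ i ∈ (Finset.univ : Finset (Fin d)),
        |∑ j, A x i j * pd (pd φ j) i x| ≤ d * (C * |M|) := fun i _ => by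
      refine (Finset.abs_sum_le_sum_abs _ _).trans ?_
      refine (Finset.sum_le_card_nsmul _ _ (C * |M|) fun j _ => ?_).trans (by simp)
      rw [abs_mul]
      exact mul_le_mul (hc.bdd x i j) ((h2 i j).trans (le_abs_self M)) (abs_nonneg _)
        (by linarith)
    refine (Finset.sum_le_card_nsmul _ _ _ this).trans ?_
    simp; ring_nf; rfl
  have e2 : |∑ i, β x i * pd φ i x| ≤ d * (bb x * |M|) := by
    refine (Finset.abs_sum_le_sum_abs _ _).trans ?_
    refine (Finset.sum_le_card_nsmul _ _ (bb x * |M|) fun i _ => ?_).trans (by simp)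
    rw [abs_mul]
    exact mul_le_mul (hc.le x i) ((h1 i).trans (le_abs_self M)) (abs_nonneg _) (by linarith)
  refine (abs_add_le _ _).trans ((add_le_add e1 e2).trans ?_)
  have : d * d * (C * |M|) ≤ d * d * (C * |M|) * bb x :=
    le_mul_of_one_le_right (by positivity) hb
  nlinarith [this]

lemma tendsto_integral_Lop {A : Ed d → Matrix (Fin d) (Fin d) ℝ} {β : Ed d → Ed d}
    {bb : Ed d → ℝ} {C : ℝ} (hc : Coef A β bb C) {ν : Measure (Ed d)} {φn : ℕ → Ed d → ℝ}
    {φ : Ed d → ℝ} {G : Ed d → ℝ} (hφn : ∀ n, ContDiff ℝ 2 (φn n)) (hφ : ContDiff ℝ 2 φ)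
    (h1 : ∀ i x, Tendsto (fun n => pd (φn n) i x) atTop (𝓝 (pd φ i x)))
    (h2 : ∀ i j x, Tendsto (fun n => pd (pd (φn n) j) i x) atTop (𝓝 (pd (pd φ j) i x)))
    (hG : Integrable G ν) (hL : ∀ n x, |Lop A β (φn n) x| ≤ G x) :
    Tendsto (fun n => ∫ x, Lop A β (φn n) x ∂ν) atTop (𝓝 (∫ x, Lop A β φ x ∂ν)) := by
  refine tendsto_integral_of_dominated_convergence G
    (fun n => (hc.measurable_Lop (hφn n)).aestronglyMeasurable) hG
    (fun n => Eventually.of_forall fun x => hL n x) (Eventually.of_forall fun x => ?_)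
  rw [Lop_eq A β hφ]
  simp_rw [fun n => Lop_eq A β (hφn n)]
  refine Tendsto.add ?_ ?_
  · exact tendsto_finsetSum _ fun i _ => tendsto_finsetSum _ fun j _ => (h2 i j x).const_mul _
  · exact tendsto_finsetSum _ fun i _ => (h1 i x).const_mul _

lemma exists_Cb2_of_hasCompactSupport {φ : Ed d → ℝ} (hφ : ContDiff ℝ 2 φ)
    (hs : HasCompactSupport φ) : ∃ M, 0 ≤ M ∧ Cb2 φ M := by
  obtain ⟨M0, h0⟩ := hs.exists_bound_of_continuous hφ.continuous
  have h1 : ∀ i, ∃ M, ∀ x, ‖pd φ i x‖ ≤ M := fun i =>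
    (hasCompactSupport_pd hs i).exists_bound_of_continuous
      (continuous_pd (hφ.of_le one_le_two) i)
  have h2 : ∀ i j, ∃ M, ∀ x, ‖pd (pd φ j) i x‖ ≤ M := fun i j =>
    (hasCompactSupport_pd (hasCompactSupport_pd hs j) i).exists_bound_of_continuous
      (continuous_pd_pd hφ i j)
  choose M1 h1 using h1
  choose M2 h2 using h2
  have hM1 : ∀ i, M1 i ≤ ∑ i, |M1 i| := fun i =>
    (le_abs_self _).trans (Finset.single_le_sum (f := fun i => |M1 i|)
      (fun _ _ => abs_nonneg _) (Finset.mem_univ i))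
  have hM2 : ∀ i j, M2 i j ≤ ∑ i, ∑ j, |M2 i j| := fun i j =>
    (le_abs_self _).trans ((Finset.single_le_sum (f := fun j => |M2 i j|)
      (fun _ _ => abs_nonneg _) (Finset.mem_univ j)).trans
      (Finset.single_le_sum (f := fun i => ∑ j, |M2 i j|)
      (fun _ _ => Finset.sum_nonneg fun _ _ => abs_nonneg _) (Finset.mem_univ i)))
  have p1 : 0 ≤ ∑ i, |M1 i| := Finset.sum_nonneg fun _ _ => abs_nonneg _
  have p2 : 0 ≤ ∑ i, ∑ j, |M2 i j| :=
    Finset.sum_nonneg fun _ _ => Finset.sum_nonneg fun _ _ => abs_nonneg _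
  refine ⟨|M0| + ∑ i, |M1 i| + ∑ i, ∑ j, |M2 i j|, by positivity, hφ, fun x => ?_,
    fun i x => ?_, fun i j x => ?_⟩
  · linarith [h0 x, le_abs_self M0, Real.norm_eq_abs (φ x)]
  · linarith [h1 i x, hM1 i, abs_nonneg M0, Real.norm_eq_abs (pd φ i x)]
  · linarith [h2 i j x, hM2 i j, abs_nonneg M0, Real.norm_eq_abs (pd (pd φ j) i x)]

lemma pd_pd_mul {f g : Ed d → ℝ} (hf : ContDiff ℝ 2 f) (hg : ContDiff ℝ 2 g) (i j : Fin d)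
    (x : Ed d) : pd (pd (fun y => f y * g y) j) i x
      = f x * pd (pd g j) i x + pd g j x * pd f i x + (g x * pd (pd f j) i x
        + pd f j x * pd g i x) := by
  have hf1 := hf.differentiable two_ne_zero
  have hg1 := hg.differentiable two_ne_zero
  have hf2 := (contDiff_one_pd hf j).differentiable one_ne_zero
  have hg2 := (contDiff_one_pd hg j).differentiable one_ne_zero
  have : pd (fun y => f y * g y) j = fun y => f y * pd g j y + g y * pd f j y := by
    ext y; exact pd_mul (hf1 y) (hg1 y) j
  rw [this, pd_add ((hf1 x).fun_mul (hg2 x)) ((hg1 x).fun_mul (hf2 x)),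
    pd_mul (hf1 x) (hg2 x), pd_mul (hg1 x) (hf2 x)]

lemma Cb2.mul {f g : Ed d → ℝ} {M N : ℝ} (hf : Cb2 f M) (hg : Cb2 g N) :
    Cb2 (fun x => f x * g x) (4 * (M * N)) := by
  have hM := hf.nonneg
  have hN := hg.nonneg
  have hMN : 0 ≤ M * N := by positivity
  have key : ∀ a b : ℝ, |a| ≤ M → |b| ≤ N → |a * b| ≤ M * N := fun a b ha hb => by
    rw [abs_mul]; exact mul_le_mul ha hb (abs_nonneg _) hM
  refine ⟨hf.contDiff.mul hg.contDiff, fun x => ?_, fun i x => ?_, fun i j x => ?_⟩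
  · linarith [key _ _ (hf.bound x) (hg.bound x)]
  · rw [pd_mul (hf.contDiff.differentiable two_ne_zero x)
      (hg.contDiff.differentiable two_ne_zero x)]
    have h1 := key _ _ (hf.bound x) (hg.bound_pd i x)
    have h2 := key _ _ (hf.bound_pd i x) (hg.bound x)
    rw [mul_comm (g x)]
    linarith [abs_add_le (f x * pd g i x) (pd f i x * g x)]
  · rw [pd_pd_mul hf.contDiff hg.contDiff]
    have h1 := key _ _ (hf.bound x) (hg.bound_pd_pd i j x)
    have h2 := key _ _ (hf.bound_pd i x) (hg.bound_pd j x)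
    have h3 := key _ _ (hf.bound_pd_pd i j x) (hg.bound x)
    have h4 := key _ _ (hf.bound_pd j x) (hg.bound_pd i x)
    rw [mul_comm (g x), mul_comm (pd g j x)]
    refine (abs_add_le _ _).trans ?_
    linarith [abs_add_le (f x * pd (pd g j) i x) (pd f i x * pd g j x),
      abs_add_le (pd (pd f j) i x * g x) (pd f j x * pd g i x)]

lemma pd_comp_smul {f : Ed d → ℝ} (hf : Differentiable ℝ f) (c : ℝ) (i : Fin d) (x : Ed d) :
    pd (fun y => f (c • y)) i x = c * pd f i (c • x) := by
  have h1 : HasFDerivAt (fun y : Ed d => c • y) (c • ContinuousLinearMap.id ℝ (Ed d)) x :=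
    (hasFDerivAt_id (𝕜 := ℝ) x).const_smul c
  have h2 := ((hf (c • x)).hasFDerivAt.comp x h1).fderiv
  simp only [pd]
  rw [show (fun y => f (c • y)) = f ∘ (fun y => c • y) from rfl, h2]
  simp

lemma pd_pd_comp_smul {f : Ed d → ℝ} (hf : ContDiff ℝ 2 f) (c : ℝ) (i j : Fin d) (x : Ed d) :
    pd (pd (fun y => f (c • y)) j) i x = c * (c * pd (pd f j) i (c • x)) := by
  have hf2 := (contDiff_one_pd hf j).differentiable one_ne_zero
  have : pd (fun y => f (c • y)) j = fun y => c * pd f j (c • y) := by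
    ext y; exact pd_comp_smul (hf.differentiable two_ne_zero) c j y
  rw [this, pd_mul (g := fun y => pd f j (c • y)) (differentiableAt_const _)
    (hf2.comp (differentiable_id.const_smul c) x),
    pd_comp_smul hf2]
  simp

/-- Smooth cut-off functions, equal to one on larger and larger balls, with uniform bounds. -/
lemma exists_cutoff (d : ℕ) : ∃ (M : ℝ) (χ : ℕ → Ed d → ℝ), 0 ≤ M ∧ ∀ n, Cb2 (χ n) M ∧
    HasCompactSupport (χ n) ∧ (∀ x, 0 ≤ χ n x ∧ χ n x ≤ 1) ∧
    (∀ x, ‖x‖ < n + 1 → χ n =ᶠ[𝓝 x] fun _ => 1) ∧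
    (∀ i x, |pd (χ n) i x| ≤ M / (n + 1)) := by
  let b : ContDiffBump (0 : Ed d) := ⟨1, 2, one_pos, one_lt_two⟩
  have hb : ContDiff ℝ 2 b := b.contDiff
  obtain ⟨M, hM, hCb⟩ := exists_Cb2_of_hasCompactSupport hb b.hasCompactSupport
  have hbd := hb.differentiable two_ne_zero
  refine ⟨M, fun n x => b (((n : ℝ) + 1)⁻¹ • x), hM, fun n => ?_⟩
  have hn : (0 : ℝ) < (n : ℝ) + 1 := by positivity
  have hn1 : ((n : ℝ) + 1)⁻¹ ≤ 1 := inv_le_one_of_one_le₀ (by linarith [Nat.cast_nonneg (α := ℝ) n])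
  have hn0 : 0 ≤ ((n : ℝ) + 1)⁻¹ := by positivity
  have hpd : ∀ i x, |pd (fun x => b (((n : ℝ) + 1)⁻¹ • x)) i x| ≤ M / (n + 1) := fun i x => by
    rw [pd_comp_smul hbd, abs_mul, abs_of_nonneg hn0, div_eq_inv_mul]
    exact mul_le_mul_of_nonneg_left (hCb.bound_pd i _) hn0
  refine ⟨⟨hb.comp (contDiff_const_smul _), fun x => hCb.bound _, fun i x => ?_, fun i j x => ?_⟩,
    ?_, fun x => ⟨b.nonneg, b.le_one⟩, fun x hx => ?_, hpd⟩
  · exact (hpd i x).trans (div_le_self hM (by linarith [Nat.cast_nonneg (α := ℝ) n]))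
  · rw [pd_pd_comp_smul hb, abs_mul, abs_mul, abs_of_nonneg hn0]
    have := hCb.bound_pd_pd i j (((n : ℝ) + 1)⁻¹ • x)
    calc _ ≤ 1 * (1 * M) := by gcongr
      _ = M := by ring
  · exact b.hasCompactSupport.comp_homeomorph (Homeomorph.smulOfNeZero _ (inv_ne_zero hn.ne'))
  · have : ∀ᶠ y in 𝓝 x, ‖y‖ < n + 1 := continuous_norm.continuousAt.eventually_lt
      continuousAt_const hx
    filter_upwards [this] with y hy
    refine b.one_of_mem_closedBall ?_
    simp only [mem_closedBall, dist_zero_right, norm_smul]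
    rw [Real.norm_of_nonneg hn0, inv_mul_le_iff₀ hn]
    change ‖y‖ ≤ (n + 1) * 1
    linarith

lemma Cb2.const (c : ℝ) : Cb2 (fun _ : Ed d => c) |c| := by
  have : ∀ j, pd (fun _ : Ed d => c) j = fun _ => 0 := fun j => by ext; simp
  exact ⟨contDiff_const, fun x => le_rfl, fun i x => by simp, fun i j x => by simp [this]⟩

lemma Cb2.add {f g : Ed d → ℝ} {M N : ℝ} (hf : Cb2 f M) (hg : Cb2 g N) :
    Cb2 (fun x => f x + g x) (M + N) := by
  have h1 : ∀ j, pd (fun y => f y + g y) j = fun y => pd f j y + pd g j y := fun j => by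
    ext y; exact pd_add (hf.contDiff.differentiable two_ne_zero y)
      (hg.contDiff.differentiable two_ne_zero y) j
  refine ⟨hf.contDiff.add hg.contDiff, fun x => ?_, fun i x => ?_, fun i j x => ?_⟩
  · exact (abs_add_le _ _).trans (add_le_add (hf.bound x) (hg.bound x))
  · rw [h1]; exact (abs_add_le _ _).trans (add_le_add (hf.bound_pd i x) (hg.bound_pd i x))
  · rw [h1, pd_add ((contDiff_one_pd hf.contDiff j).differentiable one_ne_zero x)
      ((contDiff_one_pd hg.contDiff j).differentiable one_ne_zero x)]
    exact (abs_add_le _ _).trans (add_le_add (hf.bound_pd_pd i j x) (hg.bound_pd_pd i j x))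

/-- Approximation of `C_b²` functions by compactly supported ones. -/
lemma Cb2.exists_seq {φ : Ed d → ℝ} {M : ℝ} (hφ : Cb2 φ M) :
    ∃ φn : ℕ → Ed d → ℝ, (∀ n, ContDiff ℝ 2 (φn n) ∧ HasCompactSupport (φn n)) ∧
      ((∀ x, 0 ≤ φ x) → ∀ n x, 0 ≤ φn n x) ∧
      ∀ (A : Ed d → Matrix (Fin d) (Fin d) ℝ) (β : Ed d → Ed d) (bb : Ed d → ℝ) (C : ℝ),
        Coef A β bb C → ∀ ν : Measure (Ed d), IsFiniteMeasure ν →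
        Tendsto (fun n => ∫ x, φn n x ∂ν) atTop (𝓝 (∫ x, φ x ∂ν)) ∧
        (Integrable bb ν →
        Tendsto (fun n => ∫ x, Lop A β (φn n) x ∂ν) atTop (𝓝 (∫ x, Lop A β φ x ∂ν))) := by
  obtain ⟨M', χ, hM', hχ⟩ := exists_cutoff d
  have hC : ∀ n, Cb2 (fun x => χ n x * φ x) (4 * (M' * M)) := fun n => (hχ n).1.mul hφ
  have hev : ∀ x, ∀ᶠ n : ℕ in atTop, (fun x => χ n x * φ x) =ᶠ[𝓝 x] φ := fun x => by
    filter_upwards [eventually_gt_atTop ⌈‖x‖⌉₊] with n hn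
    have hx : ‖x‖ < n + 1 := by
      have := Nat.le_ceil ‖x‖
      have h2 : ((⌈‖x‖⌉₊ : ℕ) : ℝ) < n := by exact_mod_cast hn
      linarith
    filter_upwards [(hχ n).2.2.2.1 x hx] with y hy
    simp [hy]
  have hevpd : ∀ x j, ∀ᶠ n : ℕ in atTop, pd (fun x => χ n x * φ x) j =ᶠ[𝓝 x] pd φ j :=
    fun x j => by
      filter_upwards [hev x] with n hn
      filter_upwards [hn.eventually_nhds] with y hy
      exact pd_congr hy j
  refine ⟨fun n x => χ n x * φ x, fun n => ⟨(hC n).contDiff, (hχ n).2.1.mul_right⟩,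
    fun h n x => mul_nonneg ((hχ n).2.2.1 x).1 (h x), fun A β bb C hc ν hν => ⟨?_, fun hbb => ?_⟩⟩
  · refine tendsto_integral_of_dominated_convergence (fun _ => 4 * (M' * M))
      (fun n => (hC n).contDiff.continuous.aestronglyMeasurable) (integrable_const _)
      (fun n => Eventually.of_forall fun x => (hC n).bound x) (Eventually.of_forall fun x => ?_)
    refine tendsto_const_nhds.congr' ?_
    filter_upwards [hev x] with n hn using hn.eq_of_nhds.symm
  · refine tendsto_integral_Lop hc (fun n => (hC n).contDiff) hφ.contDiff (fun i x => ?_)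
      (fun i j x => ?_) (hbb.const_mul ((d * d * C + d) * |4 * (M' * M)|))
      (fun n x => hc.abs_Lop_le (hC n).contDiff (fun i => (hC n).bound_pd i x)
        (fun i j => (hC n).bound_pd_pd i j x))
    · refine tendsto_const_nhds.congr' ?_
      filter_upwards [hev x] with n hn using (pd_congr hn i).symm
    · refine tendsto_const_nhds.congr' ?_
      filter_upwards [hevpd x j] with n hn using (pd_congr hn i).symm

section

open scoped Convolution in
lemma pd_convolution {ψ φ : Ed d → ℝ} (hψ : Continuous ψ) (hφ : ContDiff ℝ 1 φ)
    (hs : HasCompactSupport φ) (i : Fin d) :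
    pd (ψ ⋆[ContinuousLinearMap.lsmul ℝ ℝ, volume] φ) i
      = (ψ ⋆[ContinuousLinearMap.lsmul ℝ ℝ, volume] (pd φ i)) := by
  ext x
  unfold pd
  have h := hs.hasFDerivAt_convolution_right (ContinuousLinearMap.lsmul ℝ ℝ)
    (μ := (volume : Measure (Ed d))) hψ.locallyIntegrable hφ x
  rw [h.fderiv]
  rw [MeasureTheory.convolution_precompR_apply _ hψ.locallyIntegrable (hs.fderiv (𝕜 := ℝ))
    (hφ.continuous_fderiv one_ne_zero)]

open scoped Convolution Pointwise in
/-- Approximation of `C_c²` functions by smooth compactly supported ones. -/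
lemma exists_seq_test {φ : Ed d → ℝ} (hφ : ContDiff ℝ 2 φ) (hs : HasCompactSupport φ) :
    ∃ (φn : ℕ → Ed d → ℝ) (K : Set (Ed d)) (M : ℝ), IsCompact K ∧ (∀ n, IsTestFun (φn n)) ∧
      (∀ n, Cb2 (φn n) M) ∧ (∀ n, ∀ x ∉ K, φn n =ᶠ[𝓝 x] fun _ => 0) ∧
      (∀ x, Tendsto (fun n => φn n x) atTop (𝓝 (φ x))) ∧
      (∀ i x, Tendsto (fun n => pd (φn n) i x) atTop (𝓝 (pd φ i x))) ∧
      (∀ i j x, Tendsto (fun n => pd (pd (φn n) j) i x) atTop (𝓝 (pd (pd φ j) i x))) := by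
  obtain ⟨M, hM, hCb⟩ := exists_Cb2_of_hasCompactSupport hφ hs
  let b : ℕ → ContDiffBump (0 : Ed d) := fun n =>
    ⟨1 / (2 * ((n : ℝ) + 1)), 1 / ((n : ℝ) + 1), by positivity, by
      apply one_div_lt_one_div_of_lt <;> linarith [Nat.cast_nonneg (α := ℝ) n]⟩
  have hbr : Tendsto (fun n => (b n).rOut) atTop (𝓝 0) := tendsto_one_div_add_atTop_nhds_zero_nat
  let ψ : ℕ → Ed d → ℝ := fun n => (b n).normed volume
  have hψc : ∀ n, Continuous (ψ n) := fun n => (b n).continuous_normed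
  have hφ1 : ContDiff ℝ 1 φ := hφ.of_le one_le_two
  let φn : ℕ → Ed d → ℝ := fun n => ψ n ⋆[ContinuousLinearMap.lsmul ℝ ℝ, volume] φ
  have h1 : ∀ n j, pd (φn n) j = ψ n ⋆[ContinuousLinearMap.lsmul ℝ ℝ, volume] pd φ j :=
    fun n j => pd_convolution (hψc n) hφ1 hs j
  have h2 : ∀ n i j, pd (pd (φn n) j) i
      = ψ n ⋆[ContinuousLinearMap.lsmul ℝ ℝ, volume] pd (pd φ j) i := fun n i j => by
    rw [h1]; exact pd_convolution (hψc n) (contDiff_one_pd hφ j) (hasCompactSupport_pd hs j) i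
  have hbd : ∀ n (g : Ed d → ℝ), (∀ x, |g x| ≤ M) → ∀ x,
      |(ψ n ⋆[ContinuousLinearMap.lsmul ℝ ℝ, volume] g) x| ≤ M := fun n g hg x => by
    rw [convolution_def]
    have : ‖∫ t, (ContinuousLinearMap.lsmul ℝ ℝ (ψ n t)) (g (x - t))‖ ≤ ∫ t, ψ n t * M := by
      refine norm_integral_le_of_norm_le ((b n).integrable_normed.mul_const M)
        (Eventually.of_forall fun t => ?_)
      simp only [ContinuousLinearMap.lsmul_apply, smul_eq_mul, norm_mul]
      rw [Real.norm_of_nonneg ((b n).nonneg_normed t)]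
      exact mul_le_mul_of_nonneg_left (hg _) ((b n).nonneg_normed t)
    rw [integral_mul_const, (b n).integral_normed, one_mul] at this
    exact this
  have hsm : ∀ n, IsTestFun (φn n) := fun n =>
    ⟨(b n).hasCompactSupport_normed.contDiff_convolution_left _ (b n).contDiff_normed
      hφ.continuous.locallyIntegrable,
     (b n).hasCompactSupport_normed.convolution _ hs⟩
  have hK : IsCompact (closedBall (0 : Ed d) 1 + tsupport φ) :=
    (isCompact_closedBall 0 1).add hs
  refine ⟨φn, closedBall (0 : Ed d) 1 + tsupport φ, M, hK, hsm, fun n => ?_, fun n x hx => ?_,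
    fun x => ?_, fun i x => ?_, fun i j x => ?_⟩
  · refine ⟨(hsm n).1.of_le (WithTop.coe_le_coe.2 (le_top : (2 : ℕ∞) ≤ ⊤)), hbd n φ hCb.bound,
      fun i x => ?_,
      fun i j x => ?_⟩
    · rw [h1]; exact hbd n _ (hCb.bound_pd i) x
    · rw [h2]; exact hbd n _ (hCb.bound_pd_pd i j) x
  · filter_upwards [hK.isClosed.isOpen_compl.mem_nhds hx] with y hy
    by_contra h
    have := support_convolution_subset (ContinuousLinearMap.lsmul ℝ ℝ) (μ := volume) h
    apply hy
    refine Set.add_subset_add ?_ (subset_tsupport φ) this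
    rw [(b n).support_normed_eq]
    refine ball_subset_closedBall.trans (closedBall_subset_closedBall ?_)
    change 1 / ((n : ℝ) + 1) ≤ 1
    rw [div_le_one (by positivity)]; linarith [Nat.cast_nonneg (α := ℝ) n]
  · exact ContDiffBump.convolution_tendsto_right_of_continuous hbr hφ.continuous x
  · simp_rw [h1]
    exact ContDiffBump.convolution_tendsto_right_of_continuous hbr (continuous_pd hφ1 i) x
  · simp_rw [h2]
    exact ContDiffBump.convolution_tendsto_right_of_continuous hbr (continuous_pd_pd hφ i j) x

/-- The resolvent equation `ν - h L^*ν = ν'`, tested with `C_c²` functions. -/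
def ResEq (A : Ed d → Matrix (Fin d) (Fin d) ℝ) (β : Ed d → Ed d) (h : ℝ)
    (ν ν' : Measure (Ed d)) : Prop :=
  ∀ φ : Ed d → ℝ, ContDiff ℝ 2 φ → HasCompactSupport φ →
    ∫ x, φ x ∂ν - h * ∫ x, Lop A β φ x ∂ν = ∫ x, φ x ∂ν'

/-- The resolvent inequality `τ - h L^*τ ≤ τ'`, tested with nonnegative `C_c²` functions. -/
def ResSub (A : Ed d → Matrix (Fin d) (Fin d) ℝ) (β : Ed d → Ed d) (h : ℝ)
    (ν ν' : Measure (Ed d)) : Prop :=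
  ∀ φ : Ed d → ℝ, ContDiff ℝ 2 φ → HasCompactSupport φ → (∀ x, 0 ≤ φ x) →
    ∫ x, φ x ∂ν - h * ∫ x, Lop A β φ x ∂ν ≤ ∫ x, φ x ∂ν'

variable {A : Ed d → Matrix (Fin d) (Fin d) ℝ} {β : Ed d → Ed d} {bb : Ed d → ℝ} {C : ℝ}

lemma Lop_eq_zero_of_eventuallyEq {φ : Ed d → ℝ} (hφ : ContDiff ℝ 2 φ) {x : Ed d}
    (h : φ =ᶠ[𝓝 x] fun _ => 0) : Lop A β φ x = 0 := by
  rw [Lop_eq A β hφ]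
  have h1 : ∀ j, pd φ j =ᶠ[𝓝 x] fun _ => 0 := fun j => by
    filter_upwards [h.eventually_nhds] with y hy
    rw [pd_congr hy]; simp
  have h2 : ∀ j, pd φ j x = 0 := fun j => (h1 j).eq_of_nhds
  have h3 : ∀ i j, pd (pd φ j) i x = 0 := fun i j => by rw [pd_congr (h1 j)]; simp
  simp [h2, h3]

lemma resEq_of_isTestFun (hc : Coef A β bb C) {h : ℝ} {ν ν' : Measure (Ed d)}
    [IsFiniteMeasure ν] [IsFiniteMeasure ν']
    (H : ∀ φ : Ed d → ℝ, IsTestFun φ →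
      ∫ x, φ x ∂ν - h * ∫ x, Lop A β φ x ∂ν = ∫ x, φ x ∂ν') : ResEq A β h ν ν' := by
  intro φ hφ hs
  obtain ⟨φn, K, M, hK, ht, hCb, hz, c0, c1, c2⟩ := exists_seq_test hφ hs
  have t0 : ∀ (m : Measure (Ed d)) [IsFiniteMeasure m],
      Tendsto (fun n => ∫ x, φn n x ∂m) atTop (𝓝 (∫ x, φ x ∂m)) := fun m _ =>
    tendsto_integral_of_dominated_convergence (fun _ => M)
      (fun n => (hCb n).contDiff.continuous.aestronglyMeasurable) (integrable_const _)
      (fun n => Eventually.of_forall fun x => (hCb n).bound x)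
      (Eventually.of_forall fun x => c0 x)
  have hint : Integrable (K.indicator fun x => (d * d * C + d) * |M| * bb x) ν := by
    rw [integrable_indicator_iff hK.measurableSet]
    exact (continuous_const.mul hc.cont).continuousOn.integrableOn_compact hK
  have t1 := tendsto_integral_Lop hc (ν := ν) (fun n => (hCb n).contDiff) hφ c1 c2 hint
    (fun n x => by
      by_cases hx : x ∈ K
      · rw [indicator_of_mem hx]
        exact hc.abs_Lop_le (hCb n).contDiff (fun i => (hCb n).bound_pd i x)
          (fun i j => (hCb n).bound_pd_pd i j x)
      · rw [indicator_of_notMem hx, Lop_eq_zero_of_eventuallyEq (hCb n).contDiff (hz n x hx)]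
        simp)
  refine tendsto_nhds_unique ((t0 ν).sub (t1.const_mul h)) ((t0 ν').congr fun n => ?_)
  exact (H _ (ht n)).symm

lemma ResEq.cb2 (hc : Coef A β bb C) {h : ℝ} {ν ν' : Measure (Ed d)}
    [IsFiniteMeasure ν] [IsFiniteMeasure ν'] (hb : Integrable bb ν) (H : ResEq A β h ν ν')
    {φ : Ed d → ℝ} {M : ℝ} (hφ : Cb2 φ M) :
    ∫ x, φ x ∂ν - h * ∫ x, Lop A β φ x ∂ν = ∫ x, φ x ∂ν' := by
  obtain ⟨φn, h1, -, h3⟩ := hφ.exists_seq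
  have t := h3 A β bb C hc ν inferInstance
  have t' := h3 A β bb C hc ν' inferInstance
  refine tendsto_nhds_unique (t.1.sub ((t.2 hb).const_mul h)) (t'.1.congr fun n => ?_)
  exact (H _ (h1 n).1 (h1 n).2).symm

lemma ResSub.cb2 (hc : Coef A β bb C) {h : ℝ} {ν ν' : Measure (Ed d)}
    [IsFiniteMeasure ν] [IsFiniteMeasure ν'] (hb : Integrable bb ν) (H : ResSub A β h ν ν')
    {φ : Ed d → ℝ} {M : ℝ} (hφ : Cb2 φ M) (h0 : ∀ x, 0 ≤ φ x) :
    ∫ x, φ x ∂ν - h * ∫ x, Lop A β φ x ∂ν ≤ ∫ x, φ x ∂ν' := by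
  obtain ⟨φn, h1, h2, h3⟩ := hφ.exists_seq
  have t := h3 A β bb C hc ν inferInstance
  have t' := h3 A β bb C hc ν' inferInstance
  exact le_of_tendsto_of_tendsto' (t.1.sub ((t.2 hb).const_mul h)) t'.1
    fun n => H _ (h1 n).1 (h1 n).2 (h2 h0 n)

end

/-- A positive normalised mollification kernel at scale `1 / N` whose derivatives are controlled by
the kernel itself. -/
structure IsKer (k : Ed d → ℝ) (c N : ℝ) : Prop where
  one_le_c : 1 ≤ c
  one_le : 1 ≤ N
  contDiff : ContDiff ℝ 2 k
  pos : ∀ z, 0 < k z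
  int : Integrable k
  integral : ∫ z, k z = 1
  pd_le : ∀ i z, |pd k i z| ≤ c * N * k z
  norm_mul_pd_le : ∀ i z, ‖z‖ * |pd k i z| ≤ c * k z
  pd_pd_le : ∀ i j z, |pd (pd k j) i z| ≤ c * N ^ 2 * k z
  int_norm_sq : Integrable fun z => ‖z‖ ^ 2 * k z
  integral_norm_sq : ∫ z, ‖z‖ ^ 2 * k z ≤ c / N ^ 2
  le : ∀ z, k z ≤ c * N ^ d
  tail : ∀ z, 1 ≤ ‖z‖ → k z ≤ c / N

/-- The unnormalised profile `(1 + |z|²)^{-(d+2)}`. -/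
def kerProfile (z : Ed d) : ℝ := ((1 + ‖z‖ ^ 2) ^ (d + 2))⁻¹

lemma kerProfile_pos (z : Ed d) : 0 < kerProfile z := by unfold kerProfile; positivity

lemma contDiff_kerProfile : ContDiff ℝ 2 (kerProfile (d := d)) := by
  unfold kerProfile
  exact ((contDiff_const.add (contDiff_norm_sq ℝ)).pow _).inv fun z => by positivity

lemma kerProfile_le_one (z : Ed d) : kerProfile z ≤ 1 := by
  unfold kerProfile
  exact inv_le_one_of_one_le₀ (one_le_pow₀ (by nlinarith [sq_nonneg ‖z‖]))

lemma pd_one_add_norm_sq_pow (p : ℕ) (i : Fin d) (z : Ed d) :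
    pd (fun z : Ed d => ((1 + ‖z‖ ^ 2) ^ p)⁻¹) i z
      = -(2 * p) * z i * ((1 + ‖z‖ ^ 2) ^ (p + 1))⁻¹ := by
  have hq : (1 + ‖z‖ ^ 2) ≠ 0 := by positivity
  have h1 : HasDerivAt (fun u : ℝ => (u ^ p)⁻¹) (-(p * (1 + ‖z‖ ^ 2) ^ (p - 1))
      / ((1 + ‖z‖ ^ 2) ^ p) ^ 2) (1 + ‖z‖ ^ 2) := by
    exact HasDerivAt.fun_inv (hasDerivAt_pow p (1 + ‖z‖ ^ 2)) (pow_ne_zero p hq)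
  have h2 : DifferentiableAt ℝ (fun z : Ed d => 1 + ‖z‖ ^ 2) z :=
    ((contDiff_const.add (contDiff_norm_sq ℝ)).differentiable (n := 1) one_ne_zero) z
  rw [pd_comp (f := fun z : Ed d => 1 + ‖z‖ ^ 2) h1 h2]
  have h3 : pd (fun z : Ed d => 1 + ‖z‖ ^ 2) i z = 2 * z i := by
    have := ((hasStrictFDerivAt_norm_sq z).hasFDerivAt.const_add 1).fderiv
    simp only [pd]
    rw [this]
    simp [EuclideanSpace.inner_single_right]
  rw [h3]
  rcases p with _ | p
  · simp
  · simp only [Nat.add_sub_cancel]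
    field_simp
    ring

lemma pd_kerProfile (i : Fin d) (z : Ed d) :
    pd kerProfile i z = -(2 * ((d : ℝ) + 2)) * z i * ((1 + ‖z‖ ^ 2) ^ (d + 3))⁻¹ := by
  have := pd_one_add_norm_sq_pow (d + 2) i z
  push_cast at this
  exact this

lemma pd_pd_kerProfile (i j : Fin d) (z : Ed d) :
    pd (pd kerProfile j) i z = -(2 * ((d : ℝ) + 2)) * (pd (fun z : Ed d => z j) i z
      * ((1 + ‖z‖ ^ 2) ^ (d + 3))⁻¹
      - z j * (2 * ((d : ℝ) + 3) * z i * ((1 + ‖z‖ ^ 2) ^ (d + 4))⁻¹)) := by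
  have h : pd kerProfile j = fun z : Ed d => -(2 * ((d : ℝ) + 2)) *
      (z j * ((1 + ‖z‖ ^ 2) ^ (d + 3))⁻¹) := by
    ext z; rw [pd_kerProfile]; ring
  have hd1 : DifferentiableAt ℝ (fun z : Ed d => z j) z :=
    (EuclideanSpace.proj j : Ed d →L[ℝ] ℝ).differentiableAt
  have hd2 : DifferentiableAt ℝ (fun z : Ed d => ((1 + ‖z‖ ^ 2) ^ (d + 3))⁻¹) z :=
    (((contDiff_const.add (contDiff_norm_sq ℝ)).pow _).inv
      (fun z => by positivity)).differentiable (n := 1) one_ne_zero z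
  rw [h, pd_mul (differentiableAt_const _) (hd1.fun_mul hd2), pd_mul hd1 hd2,
    pd_one_add_norm_sq_pow]
  push_cast
  simp only [pd_const]
  ring

lemma abs_pd_coord_le (i j : Fin d) (z : Ed d) : |pd (fun z : Ed d => z j) i z| ≤ 1 := by
  simp only [pd]
  have := (EuclideanSpace.proj j : Ed d →L[ℝ] ℝ).hasFDerivAt (x := z)
  have h2 : fderiv ℝ (fun z : Ed d => z j) z = (EuclideanSpace.proj j : Ed d →L[ℝ] ℝ) := this.fderiv
  rw [h2]
  by_cases h : j = i <;> simp [h]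

lemma kerProfile_bounds (i j : Fin d) (z : Ed d) :
    |pd kerProfile i z| ≤ 8 * ((d : ℝ) + 3) ^ 2 * kerProfile z ∧
    ‖z‖ * |pd kerProfile i z| ≤ 8 * ((d : ℝ) + 3) ^ 2 * kerProfile z ∧
    |pd (pd kerProfile j) i z| ≤ 8 * ((d : ℝ) + 3) ^ 2 * kerProfile z := by
  have hd : (0 : ℝ) ≤ d := Nat.cast_nonneg d
  set q : ℝ := 1 + ‖z‖ ^ 2 with hq
  have hq1 : 1 ≤ q := by nlinarith [sq_nonneg ‖z‖]
  have hq0 : 0 < q := by linarith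
  have hk : kerProfile z = (q ^ (d + 2))⁻¹ := rfl
  have hkp := kerProfile_pos z
  have hzi : |z i| ≤ ‖z‖ := PiLp.norm_apply_le z i
  have hzj : |z j| ≤ ‖z‖ := PiLp.norm_apply_le z j
  have hz0 := norm_nonneg z
  have e3 : (q ^ (d + 3))⁻¹ = kerProfile z * q⁻¹ := by rw [hk, pow_succ, mul_inv]
  have e4 : (q ^ (d + 4))⁻¹ = kerProfile z * (q⁻¹ * q⁻¹) := by
    rw [hk, pow_succ, pow_succ, mul_inv, mul_inv]; ring
  have b1 : ‖z‖ * q⁻¹ ≤ 1 := by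
    rw [← div_eq_mul_inv, div_le_one hq0]; nlinarith [sq_nonneg (‖z‖ - 1)]
  have b2 : ‖z‖ * ‖z‖ * q⁻¹ ≤ 1 := by
    rw [← div_eq_mul_inv, div_le_one hq0]; nlinarith
  have hqi : 0 < q⁻¹ := by positivity
  have hqi1 : q⁻¹ ≤ 1 := inv_le_one_of_one_le₀ hq1
  have a1 : |pd kerProfile i z| ≤ (2 * ((d : ℝ) + 2)) * (‖z‖ * q⁻¹) * kerProfile z := by
    rw [pd_kerProfile, ← hq, e3, abs_mul, abs_mul, abs_neg,
      abs_of_nonneg (by positivity : (0 : ℝ) ≤ 2 * ((d : ℝ) + 2)),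
      abs_of_nonneg (by positivity : 0 ≤ kerProfile z * q⁻¹)]
    calc _ ≤ 2 * ((d : ℝ) + 2) * ‖z‖ * (kerProfile z * q⁻¹) := by gcongr
      _ = _ := by ring
  have cc : 2 * ((d : ℝ) + 2) ≤ 8 * ((d : ℝ) + 3) ^ 2 := by nlinarith
  refine ⟨a1.trans ?_, ?_, ?_⟩
  · calc _ ≤ 2 * ((d : ℝ) + 2) * 1 * kerProfile z := by gcongr
      _ ≤ _ := by rw [mul_one]; exact mul_le_mul_of_nonneg_right cc hkp.le
  · calc _ ≤ ‖z‖ * ((2 * ((d : ℝ) + 2)) * (‖z‖ * q⁻¹) * kerProfile z) := by gcongr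
      _ = 2 * ((d : ℝ) + 2) * (‖z‖ * ‖z‖ * q⁻¹) * kerProfile z := by ring
      _ ≤ 2 * ((d : ℝ) + 2) * 1 * kerProfile z := by gcongr
      _ ≤ _ := by rw [mul_one]; exact mul_le_mul_of_nonneg_right cc hkp.le
  · rw [pd_pd_kerProfile, ← hq, e3, e4, abs_mul, abs_neg,
      abs_of_nonneg (by positivity : (0 : ℝ) ≤ 2 * ((d : ℝ) + 2))]
    have t1 : |pd (fun z : Ed d => z j) i z * (kerProfile z * q⁻¹)| ≤ kerProfile z := by
      rw [abs_mul, abs_of_nonneg (by positivity : 0 ≤ kerProfile z * q⁻¹)]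
      calc _ ≤ 1 * (kerProfile z * 1) := by
            gcongr
            exact abs_pd_coord_le i j z
        _ = _ := by ring
    have t2 : |z j * (2 * ((d : ℝ) + 3) * z i * (kerProfile z * (q⁻¹ * q⁻¹)))|
        ≤ 2 * ((d : ℝ) + 3) * kerProfile z := by
      rw [abs_mul, abs_mul, abs_mul, abs_of_nonneg (by positivity : (0 : ℝ) ≤ 2 * ((d : ℝ) + 3)),
        abs_of_nonneg (by positivity : 0 ≤ kerProfile z * (q⁻¹ * q⁻¹))]
      calc _ ≤ ‖z‖ * (2 * ((d : ℝ) + 3) * ‖z‖ * (kerProfile z * (q⁻¹ * q⁻¹))) := by gcongr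
        _ = 2 * ((d : ℝ) + 3) * kerProfile z * ((‖z‖ * q⁻¹) * (‖z‖ * q⁻¹)) := by ring
        _ ≤ 2 * ((d : ℝ) + 3) * kerProfile z * (1 * 1) := by gcongr
        _ = _ := by ring
    refine (mul_le_mul_of_nonneg_left ((abs_sub _ _).trans (add_le_add t1 t2))
      (by positivity)).trans ?_
    calc _ = (2 * ((d : ℝ) + 2) * (1 + 2 * ((d : ℝ) + 3))) * kerProfile z := by ring
      _ ≤ _ := mul_le_mul_of_nonneg_right (by nlinarith) hkp.le

lemma integrable_kerProfile : Integrable (kerProfile (d := d)) := by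
  have := integrable_rpow_neg_one_add_norm_sq (μ := (volume : Measure (Ed d)))
    (r := 2 * ((d : ℝ) + 2)) (by simp; linarith [Nat.cast_nonneg (α := ℝ) d])
  refine this.congr (Eventually.of_forall fun z => ?_)
  simp only [kerProfile]
  rw [show -(2 * ((d : ℝ) + 2)) / 2 = -((d + 2 : ℕ) : ℝ) by push_cast; ring,
    Real.rpow_neg (by positivity), Real.rpow_natCast]

lemma integrable_norm_sq_mul_kerProfile :
    Integrable fun z : Ed d => ‖z‖ ^ 2 * kerProfile z := by
  have := integrable_rpow_neg_one_add_norm_sq (μ := (volume : Measure (Ed d)))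
    (r := 2 * ((d : ℝ) + 1)) (by simp; linarith [Nat.cast_nonneg (α := ℝ) d])
  refine this.mono'
    (((continuous_norm.pow 2).mul contDiff_kerProfile.continuous).aestronglyMeasurable)
    (Eventually.of_forall fun z => ?_)
  rw [Real.norm_of_nonneg (mul_nonneg (sq_nonneg _) (kerProfile_pos z).le)]
  rw [show -(2 * ((d : ℝ) + 1)) / 2 = -((d + 1 : ℕ) : ℝ) by push_cast; ring,
    Real.rpow_neg (by positivity), Real.rpow_natCast]
  unfold kerProfile
  rw [pow_succ (1 + ‖z‖ ^ 2) (d + 1), mul_inv, mul_comm, mul_assoc]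
  refine mul_le_of_le_one_right (by positivity) ?_
  rw [inv_mul_le_iff₀ (by positivity)]
  linarith

lemma exists_ker (d : ℕ) : ∃ (c : ℝ) (k : ℕ → Ed d → ℝ), ∀ n : ℕ, IsKer (k n) c (n + 1) := by
  set I : ℝ := ∫ z : Ed d, kerProfile z with hI
  have hIpos : 0 < I := by
    rw [hI, integral_pos_iff_support_of_nonneg (fun z => (kerProfile_pos z).le)
      integrable_kerProfile]
    have : Function.support (kerProfile (d := d)) = univ := by
      ext z; simp [(kerProfile_pos z).ne']
    rw [this]
    exact isOpen_univ.measure_pos _ univ_nonempty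
  set J : ℝ := ∫ z : Ed d, ‖z‖ ^ 2 * kerProfile z with hJ
  have hJ0 : 0 ≤ J := integral_nonneg fun z => mul_nonneg (sq_nonneg _) (kerProfile_pos z).le
  set c : ℝ := 1 + 8 * ((d : ℝ) + 3) ^ 2 + I⁻¹ * J + I⁻¹ with hc
  have hIi : 0 < I⁻¹ := inv_pos.2 hIpos
  have hIJ : 0 ≤ I⁻¹ * J := by positivity
  have hd8 : 0 ≤ 8 * ((d : ℝ) + 3) ^ 2 := by positivity
  refine ⟨c, fun n z => ((n : ℝ) + 1) ^ d * I⁻¹ * kerProfile (((n : ℝ) + 1) • z), fun n => ?_⟩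
  set N : ℝ := (n : ℝ) + 1 with hN
  have hN1 : 1 ≤ N := by linarith [Nat.cast_nonneg (α := ℝ) n]
  have hN0 : 0 < N := by linarith
  have hNd : 0 < N ^ d * I⁻¹ := by positivity
  have hcd := contDiff_kerProfile (d := d)
  have hdiff := hcd.differentiable two_ne_zero
  have hcs : ContDiff ℝ 2 (fun z : Ed d => kerProfile (N • z)) := hcd.comp (contDiff_const_smul _)
  have hpd : ∀ i, pd (fun z : Ed d => N ^ d * I⁻¹ * kerProfile (N • z)) i
      = fun z => N ^ d * I⁻¹ * (N * pd kerProfile i (N • z)) := fun i => by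
    ext z
    rw [pd_mul (differentiableAt_const _) (hcs.differentiable two_ne_zero z), pd_comp_smul hdiff]
    simp
  have hpd2 : ∀ i j z, pd (pd (fun z : Ed d => N ^ d * I⁻¹ * kerProfile (N • z)) j) i z
      = N ^ d * I⁻¹ * (N * (N * pd (pd kerProfile j) i (N • z))) := fun i j z => by
    have h1 : pd (fun z : Ed d => kerProfile (N • z)) j
        = fun z => N * pd kerProfile j (N • z) := by
      ext z; exact pd_comp_smul hdiff N j z
    rw [hpd, pd_mul (differentiableAt_const _)
      (by rw [← h1]; exact (contDiff_one_pd hcs j).differentiable one_ne_zero z), ← h1,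
      pd_pd_comp_smul hcd]
    simp
  have hscale : ∀ f : Ed d → ℝ, ∫ z, N ^ d * I⁻¹ * f (N • z) = I⁻¹ * ∫ z, f z := fun f => by
    rw [integral_const_mul, Measure.integral_comp_smul]
    simp only [finrank_euclideanSpace, Fintype.card_fin, smul_eq_mul]
    rw [abs_of_pos (by positivity)]
    field_simp
  have hle8 : 8 * ((d : ℝ) + 3) ^ 2 ≤ c := by linarith
  have hint : Integrable (fun z : Ed d => N ^ d * I⁻¹ * kerProfile (N • z)) :=
    (integrable_kerProfile.comp_smul hN0.ne').const_mul _
  have hnorm : ∀ z : Ed d, ‖z‖ ^ 2 * (N ^ d * I⁻¹ * kerProfile (N • z))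
      = (N ^ 2)⁻¹ * (N ^ d * I⁻¹ * (‖N • z‖ ^ 2 * kerProfile (N • z))) := fun z => by
    rw [norm_smul, Real.norm_of_nonneg hN0.le]; field_simp
  refine ⟨by linarith, hN1, contDiff_const.mul hcs, fun z => mul_pos hNd (kerProfile_pos _), hint,
    ?_, fun i z => ?_, fun i z => ?_, fun i j z => ?_, ?_, ?_, fun z => ?_, fun z hz => ?_⟩
  · rw [hscale, ← hI, inv_mul_cancel₀ hIpos.ne']
  · beta_reduce
    rw [hpd, abs_mul (N ^ d * I⁻¹), abs_mul N, abs_of_pos hNd, abs_of_pos hN0]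
    calc _ ≤ N ^ d * I⁻¹ * (N * (c * kerProfile (N • z))) := by
          gcongr
          refine ((kerProfile_bounds i i (N • z)).1).trans ?_
          exact mul_le_mul_of_nonneg_right hle8 (kerProfile_pos _).le
      _ = _ := by ring
  · beta_reduce
    rw [hpd, abs_mul (N ^ d * I⁻¹), abs_mul N, abs_of_pos hNd, abs_of_pos hN0]
    have := (kerProfile_bounds i i (N • z)).2.1
    rw [norm_smul, Real.norm_of_nonneg hN0.le] at this
    calc _ = N ^ d * I⁻¹ * (N * ‖z‖ * |pd kerProfile i (N • z)|) := by ring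
      _ ≤ N ^ d * I⁻¹ * (c * kerProfile (N • z)) := by
          refine mul_le_mul_of_nonneg_left ?_ hNd.le
          exact this.trans (mul_le_mul_of_nonneg_right hle8 (kerProfile_pos _).le)
      _ = _ := by ring
  · beta_reduce
    rw [hpd2, abs_mul (N ^ d * I⁻¹), abs_mul N, abs_mul N, abs_of_pos hNd, abs_of_pos hN0]
    calc _ ≤ N ^ d * I⁻¹ * (N * (N * (c * kerProfile (N • z)))) := by
          gcongr
          refine ((kerProfile_bounds i j (N • z)).2.2).trans ?_
          exact mul_le_mul_of_nonneg_right hle8 (kerProfile_pos _).le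
      _ = _ := by ring
  · change Integrable fun z => ‖z‖ ^ 2 * (N ^ d * I⁻¹ * kerProfile (N • z))
    simp_rw [hnorm]
    exact ((integrable_norm_sq_mul_kerProfile.comp_smul hN0.ne').const_mul _).const_mul _
  · change ∫ z, ‖z‖ ^ 2 * (N ^ d * I⁻¹ * kerProfile (N • z)) ≤ _
    simp_rw [hnorm]
    rw [integral_const_mul, hscale (fun z => ‖z‖ ^ 2 * kerProfile z), ← hJ, div_eq_inv_mul]
    gcongr
    linarith
  · calc N ^ d * I⁻¹ * kerProfile (N • z) ≤ N ^ d * I⁻¹ * 1 := by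
          gcongr; exact kerProfile_le_one _
      _ = I⁻¹ * N ^ d := by ring
      _ ≤ c * N ^ d := by gcongr; linarith
  · have h1 : kerProfile (N • z) ≤ (N ^ (d + 1))⁻¹ := by
      unfold kerProfile
      rw [norm_smul, Real.norm_of_nonneg hN0.le]
      refine inv_anti₀ (by positivity) ?_
      have hz1 : N ≤ N * ‖z‖ := le_mul_of_one_le_right hN0.le hz
      have : N ≤ 1 + (N * ‖z‖) ^ 2 := by nlinarith
      calc N ^ (d + 1) ≤ N ^ (d + 2) := pow_le_pow_right₀ hN1 (by omega)
        _ ≤ _ := pow_le_pow_left₀ hN0.le this _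
    calc N ^ d * I⁻¹ * kerProfile (N • z) ≤ N ^ d * I⁻¹ * (N ^ (d + 1))⁻¹ := by gcongr
      _ = I⁻¹ / N := by rw [pow_succ]; field_simp
      _ ≤ c / N := by gcongr; linarith

section

/-- `C¹` functions bounded by `M` together with their partial derivatives. -/
structure Cb1 (K : Ed d → ℝ) (M : ℝ) : Prop where
  contDiff : ContDiff ℝ 1 K
  bound : ∀ x, |K x| ≤ M
  bound_pd : ∀ i x, |pd K i x| ≤ M

/-- The convolution `K * (w ν)`. -/
def cv (ν : Measure (Ed d)) (w K : Ed d → ℝ) (x : Ed d) : ℝ := ∫ y, w y * K (x - y) ∂ν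

variable {ν : Measure (Ed d)} {w K : Ed d → ℝ} {M : ℝ}

lemma integrable_cv (hw : Integrable w ν) (hK : Continuous K) (hM : ∀ x, |K x| ≤ M) (x : Ed d) :
    Integrable (fun y => w y * K (x - y)) ν :=
  hw.mul_bdd (c := M) (hK.comp (continuous_const.sub continuous_id)).aestronglyMeasurable
    (Eventually.of_forall fun _ => hM _)

lemma hasFDerivAt_cv (hw : Integrable w ν) (hK : Cb1 K M) (x : Ed d) :
    HasFDerivAt (cv ν w K) (∫ y, w y • fderiv ℝ K (x - y) ∂ν) x := by
  have hd := hK.contDiff.differentiable one_ne_zero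
  have hc := hK.contDiff.continuous_fderiv one_ne_zero
  refine hasFDerivAt_integral_of_dominated_of_fderiv_le (s := univ) (bound := fun y => |w y| * (d * M))
    (F' := fun x y => w y • fderiv ℝ K (x - y)) univ_mem
    (Eventually.of_forall fun x => (integrable_cv hw hK.contDiff.continuous hK.bound x).1)
    (integrable_cv hw hK.contDiff.continuous hK.bound x) ?_ ?_ ?_ ?_
  · exact hw.1.smul (hc.comp (continuous_const.sub continuous_id)).aestronglyMeasurable
  · refine Eventually.of_forall fun y x _ => ?_
    rw [norm_smul, Real.norm_eq_abs]
    refine mul_le_mul_of_nonneg_left ((norm_fderiv_le_sum_pd K _).trans ?_) (abs_nonneg _)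
    refine (Finset.sum_le_card_nsmul _ _ M fun i _ => hK.bound_pd i _).trans (by simp)
  · exact hw.abs.mul_const _
  · refine Eventually.of_forall fun y x _ => ?_
    have h1 : HasFDerivAt (fun x => K (x - y)) (fderiv ℝ K (x - y)) x := by
      have := (hd (x - y)).hasFDerivAt.comp x ((hasFDerivAt_id x).sub_const y)
      rw [ContinuousLinearMap.comp_id] at this
      exact this
    simpa using h1.const_mul (w y)

lemma contDiff_cv (hw : Integrable w ν) (hK : Cb1 K M) : ContDiff ℝ 1 (cv ν w K) := by
  rw [contDiff_one_iff_fderiv]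
  refine ⟨fun x => (hasFDerivAt_cv hw hK x).differentiableAt, ?_⟩
  have : fderiv ℝ (cv ν w K) = fun x => ∫ y, w y • fderiv ℝ K (x - y) ∂ν := by
    ext1 x; exact (hasFDerivAt_cv hw hK x).fderiv
  rw [this]
  have hc := hK.contDiff.continuous_fderiv one_ne_zero
  refine continuous_of_dominated (bound := fun y => |w y| * (d * M)) (fun x => ?_) (fun x => ?_)
    (hw.abs.mul_const _) (Eventually.of_forall fun y => ?_)
  · exact hw.1.smul (hc.comp (continuous_const.sub continuous_id)).aestronglyMeasurable
  · refine Eventually.of_forall fun y => ?_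
    rw [norm_smul, Real.norm_eq_abs]
    refine mul_le_mul_of_nonneg_left ((norm_fderiv_le_sum_pd K _).trans ?_) (abs_nonneg _)
    refine (Finset.sum_le_card_nsmul _ _ M fun i _ => hK.bound_pd i _).trans (by simp)
  · exact (hc.comp (continuous_id.sub continuous_const)).const_smul (w y)

lemma pd_cv (hw : Integrable w ν) (hK : Cb1 K M) (i : Fin d) (x : Ed d) :
    pd (cv ν w K) i x = cv ν w (pd K i) x := by
  have hc := hK.contDiff.continuous_fderiv one_ne_zero
  have hint : Integrable (fun y => w y • fderiv ℝ K (x - y)) ν := by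
    refine (hw.abs.mul_const (d * M)).mono'
      (hw.1.smul (hc.comp (continuous_const.sub continuous_id)).aestronglyMeasurable)
      (Eventually.of_forall fun y => ?_)
    rw [norm_smul, Real.norm_eq_abs]
    refine mul_le_mul_of_nonneg_left ((norm_fderiv_le_sum_pd K _).trans ?_) (abs_nonneg _)
    refine (Finset.sum_le_card_nsmul _ _ M fun i _ => hK.bound_pd i _).trans (by simp)
  simp only [pd, cv]
  rw [(hasFDerivAt_cv hw hK x).fderiv, ContinuousLinearMap.integral_apply hint]
  rfl

variable {k : Ed d → ℝ} {c N : ℝ}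

lemma IsKer.exists_bound (hk : IsKer k c N) : ∃ M, 0 ≤ M ∧ Cb2 k M := by
  have hc := hk.one_le_c
  have hN := hk.one_le
  have hN2 : N ≤ N ^ 2 := by nlinarith
  have hN2' : 1 ≤ N ^ 2 := by nlinarith
  refine ⟨c * N ^ 2 * (c * N ^ d), by positivity, hk.contDiff, fun x => ?_, fun i x => ?_,
    fun i j x => ?_⟩
  · rw [abs_of_pos (hk.pos x)]
    refine (hk.le x).trans (le_mul_of_one_le_left (by positivity) (by nlinarith))
  · refine (hk.pd_le i x).trans (mul_le_mul ?_ (hk.le x) (hk.pos x).le (by positivity))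
    gcongr
  · exact (hk.pd_pd_le i j x).trans (mul_le_mul_of_nonneg_left (hk.le x) (by positivity))

lemma Cb2.cb1 {f : Ed d → ℝ} (h : Cb2 f M) : Cb1 f M :=
  ⟨h.contDiff.of_le one_le_two, h.bound, h.bound_pd⟩

lemma Cb2.cb1_pd {f : Ed d → ℝ} (h : Cb2 f M) (i : Fin d) : Cb1 (pd f i) M :=
  ⟨contDiff_one_pd h.contDiff i, h.bound_pd i, fun j x => h.bound_pd_pd j i x⟩

lemma Cb2.comp_sub_left {f : Ed d → ℝ} (h : Cb2 f M) (x : Ed d) :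
    Cb2 (fun y => f (x - y)) M ∧ (∀ i y, pd (fun y => f (x - y)) i y = -pd f i (x - y)) ∧
      ∀ i j y, pd (pd (fun y => f (x - y)) j) i y = pd (pd f j) i (x - y) := by
  have h1 : ∀ i y, pd (fun y => f (x - y)) i y = -pd f i (x - y) := fun i y =>
    pd_comp_sub_left (h.contDiff.differentiable two_ne_zero) x i y
  have h2 : ∀ i j y, pd (pd (fun y => f (x - y)) j) i y = pd (pd f j) i (x - y) := fun i j y => by
    have e : pd (fun y => f (x - y)) j = fun y => (-1) * (fun y => pd f j (x - y)) y := by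
      ext y; rw [h1]; ring
    have hd := (contDiff_one_pd h.contDiff j).differentiable one_ne_zero
    have hd' : DifferentiableAt ℝ (fun y => pd f j (x - y)) y :=
      (hd.comp (differentiable_const x |>.sub differentiable_id)) y
    rw [e, pd_mul (differentiableAt_const _) hd', pd_comp_sub_left hd]
    simp
  refine ⟨⟨h.contDiff.comp (contDiff_const.sub contDiff_id), fun y => h.bound _, fun i y => ?_,
    fun i j y => ?_⟩, h1, h2⟩
  · rw [h1, abs_neg]; exact h.bound_pd _ _
  · rw [h2]; exact h.bound_pd_pd _ _ _

variable {A : Ed d → Matrix (Fin d) (Fin d) ℝ} {β : Ed d → Ed d} {bb : Ed d → ℝ} {C : ℝ}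

/-- The mollified flux `∑_j ∂_j (k * (a^{ij} r ν)) - k * (β^i r ν)`. -/
def flux (A : Ed d → Matrix (Fin d) (Fin d) ℝ) (β : Ed d → Ed d) (ν : Measure (Ed d))
    (r k : Ed d → ℝ) (i : Fin d) (x : Ed d) : ℝ :=
  (∑ j, cv ν (fun y => r y * A y i j) (pd k j) x) - cv ν (fun y => r y * β y i) k x

lemma Coef.integrable_A (hc : Coef A β bb C) (hr : Integrable w ν) (i j : Fin d) :
    Integrable (fun y => w y * A y i j) ν :=
  hr.mul_bdd (c := C) (hc.continuous_A i j).aestronglyMeasurable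
    (Eventually.of_forall fun y => hc.bdd y i j)

lemma Coef.integrable_β (hc : Coef A β bb C) (hr : Integrable (fun y => w y * bb y) ν)
    (hw : AEStronglyMeasurable w ν) (i : Fin d) : Integrable (fun y => w y * β y i) ν := by
  refine hr.abs.mono' (hw.mul (hc.measurable_β i).aestronglyMeasurable)
    (Eventually.of_forall fun y => ?_)
  rw [norm_mul, abs_mul, Real.norm_eq_abs, Real.norm_eq_abs]
  exact mul_le_mul_of_nonneg_left ((hc.le y i).trans (le_abs_self _)) (abs_nonneg _)

lemma Coef.integrable_of_bb (hc : Coef A β bb C) (hr : Integrable (fun y => w y * bb y) ν)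
    (hw : AEStronglyMeasurable w ν) : Integrable w ν := by
  refine hr.mono hw (Eventually.of_forall fun y => ?_)
  rw [norm_mul]
  refine le_mul_of_one_le_right (norm_nonneg _) ?_
  exact (hc.one_le_bb y).trans (le_abs_self _)

lemma contDiff_flux (hc : Coef A β bb C) (hk : Cb2 k M) (hr : Integrable (fun y => w y * bb y) ν)
    (hw : AEStronglyMeasurable w ν) (i : Fin d) : ContDiff ℝ 1 (flux A β ν w k i) := by
  refine ContDiff.sub (ContDiff.sum fun j _ => ?_) (contDiff_cv (hc.integrable_β hr hw i) hk.cb1)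
  exact contDiff_cv (hc.integrable_A (hc.integrable_of_bb hr hw) i j) (hk.cb1_pd j)

lemma div_flux (hc : Coef A β bb C) (hk : Cb2 k M) (hr : Integrable (fun y => w y * bb y) ν)
    (hw : AEStronglyMeasurable w ν) (x : Ed d) :
    ∑ i, pd (flux A β ν w k i) i x = ∫ y, w y * Lop A β (fun z => k (x - z)) y ∂ν := by
  have hiA := fun i j => hc.integrable_A (hc.integrable_of_bb hr hw) i j
  have hiβ := fun i => hc.integrable_β hr hw i
  obtain ⟨h1, h2, h3⟩ := hk.comp_sub_left x
  have e : ∀ i, pd (flux A β ν w k i) i x = (∑ j, cv ν (fun y => w y * A y i j) (pd (pd k j) i) x)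
      - cv ν (fun y => w y * β y i) (pd k i) x := fun i => by
    have d1 : ∀ j, DifferentiableAt ℝ (cv ν (fun y => w y * A y i j) (pd k j)) x := fun j =>
      (contDiff_cv (hiA i j) (hk.cb1_pd j)).differentiable one_ne_zero x
    have : flux A β ν w k i = fun x => (∑ j, cv ν (fun y => w y * A y i j) (pd k j) x)
      - cv ν (fun y => w y * β y i) k x := rfl
    rw [this, pd_sub (DifferentiableAt.fun_sum fun j _ => d1 j)
      ((contDiff_cv (hiβ i) hk.cb1).differentiable one_ne_zero x), pd_sum _ (fun j _ => d1 j),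
      pd_cv (hiβ i) hk.cb1]
    congr 1
    exact Finset.sum_congr rfl fun j _ => pd_cv (hiA i j) (hk.cb1_pd j) i x
  have e2 : ∀ y, w y * Lop A β (fun z => k (x - z)) y
      = ∑ i, ((∑ j, w y * A y i j * pd (pd k j) i (x - y)) - w y * β y i * pd k i (x - y)) :=
    fun y => by
      rw [Lop_eq A β h1.contDiff]
      simp only [h2, h3]
      simp only [mul_add, Finset.mul_sum, mul_neg, Finset.sum_neg_distrib, mul_assoc,
        sub_eq_add_neg, Finset.sum_add_distrib]
  have I1 : ∀ i j, Integrable (fun y => w y * A y i j * pd (pd k j) i (x - y)) ν := fun i j =>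
    integrable_cv (hiA i j) (continuous_pd_pd hk.contDiff i j) (hk.bound_pd_pd i j) x
  have I2 : ∀ i, Integrable (fun y => w y * β y i * pd k i (x - y)) ν := fun i =>
    integrable_cv (hiβ i) (continuous_pd hk.cb1.contDiff i) (hk.bound_pd i) x
  simp_rw [e2]
  have I3 : ∀ i, Integrable (fun y => (∑ j, w y * A y i j * pd (pd k j) i (x - y))
      - w y * β y i * pd k i (x - y)) ν := fun i =>
    (integrable_finsetSum _ fun j _ => I1 i j).sub (I2 i)
  rw [integral_finsetSum _ fun i _ => I3 i]
  refine Finset.sum_congr rfl fun i _ => ?_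
  rw [integral_sub (integrable_finsetSum _ fun j _ => I1 i j) (I2 i),
    integral_finsetSum _ fun j _ => I1 i j, e]
  rfl

lemma integral_mul_pd {f g : Ed d → ℝ} (hf : ContDiff ℝ 1 f) (hg : ContDiff ℝ 1 g)
    (hs : HasCompactSupport g) (i : Fin d) :
    ∫ x, g x * pd f i x = -∫ x, pd g i x * f x := by
  refine integral_mul_fderiv_eq_neg_fderiv_mul_of_integrable ?_ ?_ ?_
    (fun x _ => hg.differentiable one_ne_zero x) (fun x _ => hf.differentiable one_ne_zero x)
  · exact ((continuous_pd hg i).mul hf.continuous).integrable_of_hasCompactSupport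
      (hasCompactSupport_pd hs i).mul_right
  · exact (hg.continuous.mul (continuous_pd hf i)).integrable_of_hasCompactSupport hs.mul_right
  · exact (hg.continuous.mul hf.continuous).integrable_of_hasCompactSupport hs.mul_right

end

section

variable {m : Measure (Ed d)} [IsFiniteMeasure m] {k : Ed d → ℝ} {c N : ℝ}

lemma integrable_ker_snd (hk : IsKer k c N) {g : Ed d → ℝ} (hg : Integrable g m) :
    Integrable (fun p : Ed d × Ed d => k (p.1 - p.2) * g p.2) (volume.prod m) := by
  have := Integrable.convolution_integrand (ContinuousLinearMap.mul ℝ ℝ) hg hk.int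
    (μ := (volume : Measure (Ed d)))
  refine this.congr (Eventually.of_forall fun p => ?_)
  simp [mul_comm]

lemma integrable_ker_prod (hk : IsKer k c N) {f : Ed d × Ed d → ℝ} {g : Ed d → ℝ}
    (hg : Integrable g m) (hf : Measurable f) (h : ∀ x y, |f (x, y)| ≤ g y) :
    Integrable (fun p : Ed d × Ed d => k (p.1 - p.2) * f p) (volume.prod m) := by
  refine (integrable_ker_snd hk hg).mono' ?_ (Eventually.of_forall fun p => ?_)
  · exact ((hk.contDiff.continuous.measurable.comp (measurable_fst.sub measurable_snd)).mul
      hf).aestronglyMeasurable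
  · rw [norm_mul, Real.norm_of_nonneg (hk.pos _).le]
    exact mul_le_mul_of_nonneg_left (h p.1 p.2) (hk.pos _).le

lemma integral_ker_snd (hk : IsKer k c N) {g : Ed d → ℝ} (hg : Integrable g m) :
    ∫ p : Ed d × Ed d, k (p.1 - p.2) * g p.2 ∂(volume.prod m) = ∫ y, g y ∂m := by
  rw [integral_prod_symm _ (integrable_ker_snd hk hg)]
  refine integral_congr_ae (Eventually.of_forall fun y => ?_)
  simp only
  rw [integral_mul_const, integral_sub_right_eq_self (fun x => k x) y, hk.integral, one_mul]

lemma integrable_ker_norm_sq (hk : IsKer k c N) :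
    Integrable (fun p : Ed d × Ed d => k (p.1 - p.2) * ‖p.1 - p.2‖ ^ 2) (volume.prod m) := by
  have := Integrable.convolution_integrand (ContinuousLinearMap.mul ℝ ℝ)
    (integrable_const (1 : ℝ) : Integrable _ m) hk.int_norm_sq (μ := (volume : Measure (Ed d)))
  refine this.congr (Eventually.of_forall fun p => ?_)
  simp [mul_comm]

lemma integral_ker_norm_sq (hk : IsKer k c N) :
    ∫ p : Ed d × Ed d, k (p.1 - p.2) * ‖p.1 - p.2‖ ^ 2 ∂(volume.prod m)
      ≤ m.real univ * (c / N ^ 2) := by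
  rw [integral_prod_symm _ (integrable_ker_norm_sq hk)]
  have : ∀ y : Ed d, ∫ x, k (x - y) * ‖x - y‖ ^ 2 = ∫ z, ‖z‖ ^ 2 * k z := fun y => by
    rw [integral_sub_right_eq_self (fun x => k x * ‖x‖ ^ 2) y]
    simp_rw [mul_comm]
  simp only [this, integral_const, smul_eq_mul]
  exact mul_le_mul_of_nonneg_left hk.integral_norm_sq measureReal_nonneg

lemma exists_sq_sub_le {g : Ed d → ℝ} (hg : Continuous g) (hs : HasCompactSupport g) {η : ℝ}
    (hη : 0 < η) : ∃ K, 0 ≤ K ∧ ∀ x y, (g x - g y) ^ 2 ≤ η + K * ‖x - y‖ ^ 2 := by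
  obtain ⟨G, hG⟩ := hs.exists_bound_of_continuous hg
  have huc := hs.uniformContinuous_of_continuous hg
  obtain ⟨t, ht, h⟩ := Metric.uniformContinuous_iff.1 huc (√η) (Real.sqrt_pos.2 hη)
  have hG0 : 0 ≤ G := (norm_nonneg _).trans (hG 0)
  refine ⟨(2 * G) ^ 2 / t ^ 2, by positivity, fun x y => ?_⟩
  by_cases hxy : dist x y < t
  · have := h hxy
    rw [Real.dist_eq] at this
    have h2 : (g x - g y) ^ 2 ≤ η := by
      rw [← sq_abs, ← Real.sq_sqrt hη.le]
      exact pow_le_pow_left₀ (abs_nonneg _) this.le 2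
    have : 0 ≤ (2 * G) ^ 2 / t ^ 2 * ‖x - y‖ ^ 2 := by positivity
    linarith
  · rw [not_lt, dist_eq_norm] at hxy
    have h1 : |g x - g y| ≤ 2 * G := by
      have := abs_sub (g x) (g y)
      have h1 := hG x
      have h2 := hG y
      rw [Real.norm_eq_abs] at h1 h2
      linarith
    have h2 : (g x - g y) ^ 2 ≤ (2 * G) ^ 2 := by
      rw [← sq_abs]; exact pow_le_pow_left₀ (abs_nonneg _) h1 2
    have h3 : 1 ≤ ‖x - y‖ ^ 2 / t ^ 2 := by
      rw [one_le_div (by positivity)]; exact pow_le_pow_left₀ ht.le hxy 2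
    have h4 : (2 * G) ^ 2 ≤ (2 * G) ^ 2 * (‖x - y‖ ^ 2 / t ^ 2) :=
      le_mul_of_one_le_right (by positivity) h3
    calc _ ≤ _ := h2
      _ ≤ _ := h4
      _ = (2 * G) ^ 2 / t ^ 2 * ‖x - y‖ ^ 2 := by ring
      _ ≤ _ := by linarith

lemma tendsto_div_succ_sq (a : ℝ) : Tendsto (fun n : ℕ => a / ((n : ℝ) + 1) ^ 2) atTop (𝓝 0) := by
  have h := tendsto_one_div_add_atTop_nhds_zero_nat (𝕜 := ℝ)
  have := (h.mul h).const_mul a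
  simp only [mul_zero] at this
  refine this.congr fun n => ?_
  field_simp

lemma tendsto_zero_of_le {u : ℕ → ℝ} (h0 : ∀ n, 0 ≤ u n)
    (h : ∀ ε > 0, ∃ v : ℕ → ℝ, (∀ n, u n ≤ ε + v n) ∧ Tendsto v atTop (𝓝 0)) :
    Tendsto u atTop (𝓝 0) := by
  rw [tendsto_order]
  refine ⟨fun a ha => Eventually.of_forall fun n => ha.trans_le (h0 n), fun a ha => ?_⟩
  obtain ⟨v, hv, hv0⟩ := h (a / 2) (by linarith)
  filter_upwards [(tendsto_order.1 hv0).2 (a / 2) (by linarith)] with n hn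
  linarith [hv n]

variable {κ : ℕ → Ed d → ℝ}

lemma tendsto_integral_ker_sq_sub (hκ : ∀ n : ℕ, IsKer (κ n) c (n + 1)) {g : Ed d → ℝ}
    (hg : Continuous g) (hs : HasCompactSupport g) :
    Tendsto (fun n => ∫ p : Ed d × Ed d, κ n (p.1 - p.2) * (g p.1 - g p.2) ^ 2 ∂(volume.prod m))
      atTop (𝓝 0) := by
  refine tendsto_zero_of_le (fun n => integral_nonneg fun p =>
    mul_nonneg ((hκ n).pos _).le (sq_nonneg _)) fun ε hε => ?_
  have hm := measureReal_nonneg (μ := m) (s := univ)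
  obtain ⟨K, hK, h⟩ := exists_sq_sub_le hg hs (η := ε / (1 + m.real univ)) (by positivity)
  refine ⟨fun n => (K * (m.real univ * c)) / ((n : ℝ) + 1) ^ 2, fun n => ?_,
    tendsto_div_succ_sq _⟩
  have i1 := integrable_ker_snd (hκ n) (integrable_const (ε / (1 + m.real univ)) : Integrable _ m)
  have i2 := (integrable_ker_norm_sq (m := m) (hκ n)).const_mul K
  calc _ ≤ ∫ p : Ed d × Ed d, (κ n (p.1 - p.2) * (ε / (1 + m.real univ))
        + K * (κ n (p.1 - p.2) * ‖p.1 - p.2‖ ^ 2)) ∂(volume.prod m) := by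
        refine integral_mono_of_nonneg (Eventually.of_forall fun p =>
          mul_nonneg ((hκ n).pos _).le (sq_nonneg _)) (i1.add i2) (Eventually.of_forall fun p => ?_)
        have := mul_le_mul_of_nonneg_left (h p.1 p.2) ((hκ n).pos (p.1 - p.2)).le
        simp only; linarith
    _ ≤ _ := by
        rw [integral_add i1 i2, integral_ker_snd (hκ n) (integrable_const _), integral_const_mul]
        have h1 := mul_le_mul_of_nonneg_left (integral_ker_norm_sq (m := m) (hκ n)) hK
        have h2 : ∫ _ : Ed d, ε / (1 + m.real univ) ∂m ≤ ε := by
          rw [integral_const, smul_eq_mul, ← mul_div_assoc, div_le_iff₀ (by positivity)]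
          nlinarith
        calc _ ≤ ε + K * (m.real univ * (c / ((n : ℝ) + 1) ^ 2)) := add_le_add h2 h1
          _ = _ := by ring

/-- The averaged density `(k * (r m)) / (k * m)`. -/
def ravg (m : Measure (Ed d)) (r k : Ed d → ℝ) (x : Ed d) : ℝ :=
  cv m r k x / cv m (fun _ => 1) k x

lemma integrable_of_abs_le_one {r : Ed d → ℝ} (hr : Measurable r) (hr1 : ∀ y, |r y| ≤ 1) :
    Integrable r m :=
  (integrable_const (1 : ℝ)).mono' hr.aestronglyMeasurable (Eventually.of_forall hr1)

lemma IsKer.integrable_mul (hk : IsKer k c N) {w : Ed d → ℝ} (hw : Integrable w m) (x : Ed d) :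
    Integrable (fun y => w y * k (x - y)) m := by
  obtain ⟨M, -, hM⟩ := hk.exists_bound
  exact integrable_cv hw hk.contDiff.continuous hM.bound x

lemma IsKer.continuous_cv (hk : IsKer k c N) {w : Ed d → ℝ} (hw : Integrable w m) :
    Continuous (cv m w k) := by
  obtain ⟨M, -, hM⟩ := hk.exists_bound
  exact (contDiff_cv hw hM.cb1).continuous

lemma cv_nonneg (hk : IsKer k c N) {w : Ed d → ℝ} (hw : ∀ y, 0 ≤ w y) (x : Ed d) :
    0 ≤ cv m w k x := integral_nonneg fun _ => mul_nonneg (hw _) (hk.pos _).le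

lemma cv_one_pos (hk : IsKer k c N) (hm : m ≠ 0) (x : Ed d) : 0 < cv m (fun _ => 1) k x := by
  unfold cv
  rw [integral_pos_iff_support_of_nonneg (fun y => mul_nonneg zero_le_one (hk.pos _).le)
    (hk.integrable_mul (integrable_const _) x)]
  have : Function.support (fun y => 1 * k (x - y)) = univ := by
    ext y; simp [(hk.pos (x - y)).ne']
  rw [this]
  exact (Measure.measure_univ_pos).2 hm

lemma abs_cv_le (hk : IsKer k c N) {w v : Ed d → ℝ} (hv : Integrable v m)
    (h : ∀ y, |w y| ≤ v y) (x : Ed d) : |cv m w k x| ≤ cv m v k x := by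
  refine (abs_integral_le_integral_abs).trans ?_
  refine integral_mono_of_nonneg (Eventually.of_forall fun y => abs_nonneg _)
    (hk.integrable_mul hv x) (Eventually.of_forall fun y => ?_)
  simp only [abs_mul, abs_of_pos (hk.pos _)]
  exact mul_le_mul_of_nonneg_right (h y) (hk.pos _).le

lemma abs_ravg_le_one (hk : IsKer k c N) {r : Ed d → ℝ} (hr1 : ∀ y, |r y| ≤ 1) (x : Ed d) :
    |ravg m r k x| ≤ 1 := by
  have h := abs_cv_le (m := m) hk (integrable_const (1 : ℝ)) hr1 x
  have h0 := cv_nonneg (m := m) hk (fun _ => zero_le_one) x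
  rw [ravg, abs_div, abs_of_nonneg h0]
  exact div_le_one_of_le₀ h h0

lemma measurable_ravg (hk : IsKer k c N) {r : Ed d → ℝ} (hr : Integrable r m) :
    Measurable (ravg m r k) :=
  (hk.continuous_cv hr).measurable.div (hk.continuous_cv (integrable_const _)).measurable

lemma integral_sq_sub_ravg_le (hk : IsKer k c N) (hm : m ≠ 0) {r : Ed d → ℝ} (hr : Measurable r)
    (hr1 : ∀ y, |r y| ≤ 1) (x : Ed d) (a : ℝ) :
    ∫ y, k (x - y) * (r y - ravg m r k x) ^ 2 ∂m ≤ ∫ y, k (x - y) * (r y - a) ^ 2 ∂m := by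
  have hp := cv_one_pos hk hm x
  have i0 := hk.integrable_mul (integrable_const (1 : ℝ) : Integrable _ m) x
  have i1 := hk.integrable_mul (integrable_of_abs_le_one hr hr1 : Integrable r m) x
  have i2 : Integrable (fun y => r y ^ 2 * k (x - y)) m :=
    hk.integrable_mul (integrable_of_abs_le_one (hr.pow_const 2) fun y => by
      rw [abs_pow]; exact pow_le_one₀ (abs_nonneg _) (hr1 y)) x
  have e : ∀ b : ℝ, ∫ y, k (x - y) * (r y - b) ^ 2 ∂m = cv m (fun y => r y ^ 2) k x
      - 2 * b * cv m r k x + b ^ 2 * cv m (fun _ => 1) k x := fun b => by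
    have : ∀ y, k (x - y) * (r y - b) ^ 2 = r y ^ 2 * k (x - y) - 2 * b * (r y * k (x - y))
        + b ^ 2 * (1 * k (x - y)) := fun y => by ring
    simp_rw [this]
    have i3 : Integrable (fun y => r y ^ 2 * k (x - y) - 2 * b * (r y * k (x - y))) m :=
      i2.sub (i1.const_mul _)
    rw [integral_add i3 (i0.const_mul _), integral_sub i2 (i1.const_mul _),
      integral_const_mul, integral_const_mul]
    rfl
  rw [e, e]
  have hs : cv m r k x = ravg m r k x * cv m (fun _ => 1) k x := by
    rw [ravg, div_mul_cancel₀ _ hp.ne']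
  rw [hs]
  nlinarith [mul_nonneg hp.le (sq_nonneg (a - ravg m r k x))]

/-- The weighted variance of the density `r` at the scale of the kernel `k`. -/
def kvar (m : Measure (Ed d)) (r bb k : Ed d → ℝ) : ℝ :=
  ∫ p : Ed d × Ed d, k (p.1 - p.2) * (bb p.2 ^ 2 * (r p.2 - ravg m r k p.1) ^ 2) ∂(volume.prod m)

lemma measurable_sub_ravg (hk : IsKer k c N) {r : Ed d → ℝ} (hr : Measurable r)
    (hr1 : ∀ y, |r y| ≤ 1) : Measurable fun p : Ed d × Ed d => r p.2 - ravg m r k p.1 :=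
  (hr.comp measurable_snd).sub
    ((measurable_ravg hk (integrable_of_abs_le_one hr hr1)).comp measurable_fst)

lemma sq_sub_ravg_le (hk : IsKer k c N) {r : Ed d → ℝ} (hr1 : ∀ y, |r y| ≤ 1) (x y : Ed d) :
    (r y - ravg m r k x) ^ 2 ≤ 4 := by
  have h1 := abs_le.1 (hr1 y)
  have h2 := abs_le.1 (abs_ravg_le_one (m := m) hk hr1 x)
  nlinarith

lemma kvar_le (hk : IsKer k c N) (hm : m ≠ 0) {r bb : Ed d → ℝ} (hr : Measurable r)
    (hr1 : ∀ y, |r y| ≤ 1) (hb : Continuous bb) (hb2 : Integrable (fun y => bb y ^ 2) m)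
    {g : Ed d → ℝ} (hg : Continuous g) (hs : HasCompactSupport g) {B : ℝ} (hB : 0 ≤ B) :
    kvar m r bb k ≤ 4 * ∫ y in {y | B < bb y ^ 2}, bb y ^ 2 ∂m
      + B * (2 * ∫ y, (r y - g y) ^ 2 ∂m
        + 2 * ∫ p : Ed d × Ed d, k (p.1 - p.2) * (g p.1 - g p.2) ^ 2 ∂(volume.prod m)) := by
  have hms : MeasurableSet {y | B < bb y ^ 2} :=
    measurableSet_lt measurable_const (hb.pow 2).measurable
  obtain ⟨G, hG⟩ := hs.exists_bound_of_continuous hg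
  have hG' : ∀ x, |g x| ≤ G := hG
  have hG0 : 0 ≤ G := (abs_nonneg _).trans (hG' 0)
  have hsub := measurable_sub_ravg (m := m) hk hr hr1
  have hgm := hg.measurable
  have i1 := integrable_ker_snd hk ((hb2.indicator hms).const_mul 4)
  have i2 : Integrable (fun p : Ed d × Ed d => k (p.1 - p.2) * (r p.2 - ravg m r k p.1) ^ 2)
      (volume.prod m) := integrable_ker_prod hk (integrable_const (4 : ℝ)) (hsub.pow_const 2)
      fun x y => by
        rw [abs_of_nonneg (sq_nonneg _)]; exact sq_sub_ravg_le hk hr1 x y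
  have i3 : Integrable (fun p : Ed d × Ed d => k (p.1 - p.2) * (r p.2 - g p.1) ^ 2)
      (volume.prod m) := integrable_ker_prod hk (integrable_const ((1 + G) ^ 2))
      (((hr.comp measurable_snd).sub (hgm.comp measurable_fst)).pow_const 2) fun x y => by
        rw [abs_pow]
        refine pow_le_pow_left₀ (abs_nonneg _) ((abs_sub _ _).trans ?_) 2
        exact add_le_add (hr1 y) (hG' x)
  have i4' : Integrable (fun y => (r y - g y) ^ 2) m := by
    refine (integrable_const ((1 + G) ^ 2)).mono' ((hr.sub hgm).pow_const 2).aestronglyMeasurable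
      (Eventually.of_forall fun y => ?_)
    rw [norm_pow]
    refine pow_le_pow_left₀ (abs_nonneg _) ((abs_sub _ _).trans ?_) 2
    exact add_le_add (hr1 y) (hG' y)
  have i4 := integrable_ker_snd hk (i4'.const_mul 2)
  have i5 : Integrable (fun p : Ed d × Ed d => k (p.1 - p.2) * (g p.1 - g p.2) ^ 2)
      (volume.prod m) := integrable_ker_prod hk (integrable_const ((G + G) ^ 2))
      (((hgm.comp measurable_fst).sub (hgm.comp measurable_snd)).pow_const 2) fun x y => by
        rw [abs_pow]
        refine pow_le_pow_left₀ (abs_nonneg _) ((abs_sub _ _).trans ?_) 2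
        exact add_le_add (hG' x) (hG' y)
  have s1 : kvar m r bb k ≤ ∫ p : Ed d × Ed d, (k (p.1 - p.2) *
      (4 * ({y | B < bb y ^ 2}.indicator (fun y => bb y ^ 2) p.2))
      + B * (k (p.1 - p.2) * (r p.2 - ravg m r k p.1) ^ 2)) ∂(volume.prod m) := by
    refine integral_mono_of_nonneg (Eventually.of_forall fun p => mul_nonneg (hk.pos _).le
      (mul_nonneg (sq_nonneg _) (sq_nonneg _))) (i1.add (i2.const_mul B))
      (Eventually.of_forall fun p => ?_)
    simp only
    rw [mul_left_comm B, ← mul_add]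
    refine mul_le_mul_of_nonneg_left ?_ (hk.pos _).le
    have h4 := sq_sub_ravg_le (m := m) hk hr1 p.1 p.2
    by_cases hp : B < bb p.2 ^ 2
    · rw [indicator_of_mem (by exact hp)]
      nlinarith [mul_nonneg hB (sq_nonneg (r p.2 - ravg m r k p.1)), sq_nonneg (bb p.2)]
    · rw [indicator_of_notMem (by exact hp)]
      nlinarith [sq_nonneg (r p.2 - ravg m r k p.1)]
  have s2 : ∫ p : Ed d × Ed d, k (p.1 - p.2) * (r p.2 - ravg m r k p.1) ^ 2 ∂(volume.prod m)
      ≤ ∫ p : Ed d × Ed d, k (p.1 - p.2) * (r p.2 - g p.1) ^ 2 ∂(volume.prod m) := by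
    rw [integral_prod _ i2, integral_prod _ i3]
    exact integral_mono i2.integral_prod_left i3.integral_prod_left
      fun x => integral_sq_sub_ravg_le hk hm hr hr1 x (g x)
  have s3 : ∫ p : Ed d × Ed d, k (p.1 - p.2) * (r p.2 - g p.1) ^ 2 ∂(volume.prod m)
      ≤ ∫ p : Ed d × Ed d, (k (p.1 - p.2) * (2 * (r p.2 - g p.2) ^ 2)
        + 2 * (k (p.1 - p.2) * (g p.1 - g p.2) ^ 2)) ∂(volume.prod m) := by
    refine integral_mono i3 (i4.add (i5.const_mul 2)) fun p => ?_
    simp only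
    rw [mul_left_comm 2, ← mul_add]
    refine mul_le_mul_of_nonneg_left ?_ (hk.pos _).le
    nlinarith [sq_nonneg ((r p.2 - g p.2) + (g p.1 - g p.2))]
  rw [integral_add i4 (i5.const_mul 2), integral_ker_snd hk (i4'.const_mul 2), integral_const_mul,
    integral_const_mul] at s3
  rw [integral_add i1 (i2.const_mul B), integral_ker_snd hk ((hb2.indicator hms).const_mul 4),
    integral_const_mul, integral_const_mul, integral_indicator hms] at s1
  nlinarith [mul_le_mul_of_nonneg_left (s2.trans s3) hB]

lemma tendsto_setIntegral_lt {f : Ed d → ℝ} (hf : Measurable f) (hi : Integrable f m) :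
    Tendsto (fun n : ℕ => ∫ y in {y | (n : ℝ) < f y}, f y ∂m) atTop (𝓝 0) := by
  have hms : ∀ n : ℕ, MeasurableSet {y | (n : ℝ) < f y} := fun n =>
    measurableSet_lt measurable_const hf
  simp_rw [← fun n => integral_indicator (μ := m) (f := f) (hms n)]
  rw [← integral_zero (Ed d) ℝ (μ := m)]
  refine tendsto_integral_of_dominated_convergence (fun y => |f y|)
    (fun n => (hf.indicator (hms n)).aestronglyMeasurable) hi.abs
    (fun n => Eventually.of_forall fun y => ?_) (Eventually.of_forall fun y => ?_)
  · exact norm_indicator_le_norm_self f y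
  · obtain ⟨n0, hn0⟩ := exists_nat_ge (f y)
    refine tendsto_const_nhds.congr' ?_
    filter_upwards [eventually_ge_atTop n0] with n hn
    rw [indicator_of_notMem]
    have : (n0 : ℝ) ≤ n := by exact_mod_cast hn
    simp only [mem_ofPred_eq, not_lt]; linarith

lemma kvar_nonneg (hk : IsKer k c N) {r bb : Ed d → ℝ} : 0 ≤ kvar m r bb k :=
  integral_nonneg fun _ => mul_nonneg (hk.pos _).le (mul_nonneg (sq_nonneg _) (sq_nonneg _))

lemma tendsto_kvar (hκ : ∀ n : ℕ, IsKer (κ n) c (n + 1)) (hm : m ≠ 0) {r bb : Ed d → ℝ}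
    (hr : Measurable r) (hr1 : ∀ y, |r y| ≤ 1) (hb : Continuous bb)
    (hb2 : Integrable (fun y => bb y ^ 2) m) :
    Tendsto (fun n => kvar m r bb (κ n)) atTop (𝓝 0) := by
  refine tendsto_zero_of_le (fun n => kvar_nonneg (hκ n)) fun ε hε => ?_
  obtain ⟨B, hB⟩ := ((tendsto_order.1 (tendsto_setIntegral_lt (f := fun y => bb y ^ 2) (hb.pow 2).measurable hb2)).2
    (ε / 8) (by positivity)).exists
  have hL : MemLp r (ENNReal.ofReal 2) m := by
    refine MemLp.of_bound hr.aestronglyMeasurable 1 (Eventually.of_forall hr1)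
  obtain ⟨g, hgs, hgi, hgc, -⟩ := hL.exists_hasCompactSupport_integral_rpow_sub_le two_pos
    (ε := ε / (4 * (B + 1))) (by positivity)
  have t := (tendsto_integral_ker_sq_sub (m := m) hκ hgc hgs).const_mul ((B : ℝ) * 2)
  rw [mul_zero] at t
  refine ⟨_, fun n => ?_, t⟩
  have h := kvar_le (hκ n) hm hr hr1 hb hb2 hgc hgs (Nat.cast_nonneg B)
  have hgi' : ∫ y, (r y - g y) ^ 2 ∂m ≤ ε / (4 * (B + 1)) := by
    refine le_trans (le_of_eq ?_) hgi
    congr 1 with y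
    rw [Real.rpow_two, Real.norm_eq_abs, sq_abs]
  have h2 : (B : ℝ) * (2 * ∫ y, (r y - g y) ^ 2 ∂m) ≤ ε / 2 := by
    calc (B : ℝ) * (2 * ∫ y, (r y - g y) ^ 2 ∂m) ≤ B * (2 * (ε / (4 * (B + 1)))) := by gcongr
      _ ≤ (B + 1) * (2 * (ε / (4 * (B + 1)))) := by gcongr; linarith
      _ = _ := by field_simp; ring
  linarith

lemma tendsto_integral_ker_main (hκ : ∀ n : ℕ, IsKer (κ n) c (n + 1)) (hm : m ≠ 0)
    {r bb : Ed d → ℝ} (hr : Measurable r) (hr1 : ∀ y, |r y| ≤ 1) (hb : Continuous bb)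
    (hb2 : Integrable (fun y => bb y ^ 2) m) {g w : Ed d → ℝ} (hg : Continuous g)
    (hs : HasCompactSupport g) (hw : Measurable w) (hwb : ∀ y, |w y| ≤ bb y) {ξ : ℝ → ℝ}
    (hξ : Continuous ξ) (hξ1 : ∀ s t, |ξ s - ξ t| ≤ |s - t|) (hξ0 : ξ 0 = 0) :
    Tendsto (fun n => ∫ p : Ed d × Ed d, κ n (p.1 - p.2) *
      (g p.1 * w p.2 * ξ (ravg m r (κ n) p.1)) ∂(volume.prod m)) atTop
      (𝓝 (∫ y, g y * w y * ξ (r y) ∂m)) := by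
  obtain ⟨G, hG⟩ := hs.exists_bound_of_continuous hg
  have hG' : ∀ x, |g x| ≤ G := hG
  have hG0 : 0 ≤ G := (abs_nonneg _).trans (hG' 0)
  have hgm := hg.measurable
  have hm0 := measureReal_nonneg (μ := m) (s := univ)
  have hb20 : 0 ≤ ∫ y, bb y ^ 2 ∂m := integral_nonneg fun y => sq_nonneg _
  have hξle : ∀ s, |s| ≤ 1 → |ξ s| ≤ 1 := fun s hs => by
    have := hξ1 s 0
    rw [hξ0, sub_zero, sub_zero] at this
    exact this.trans hs
  have hb0 : ∀ y, 0 ≤ bb y := fun y => (abs_nonneg _).trans (hwb y)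
  have hb1 : Integrable (fun y => bb y) m := by
    refine ((integrable_const (1 : ℝ)).add hb2).mono' hb.aestronglyMeasurable
      (Eventually.of_forall fun y => ?_)
    rw [Real.norm_of_nonneg (hb0 y), Pi.add_apply]
    nlinarith [sq_nonneg (bb y - 1)]
  have iI : Integrable (fun y => g y * w y * ξ (r y)) m := by
    refine (hb1.const_mul G).mono' ((hgm.mul hw).mul
      (hξ.measurable.comp hr)).aestronglyMeasurable (Eventually.of_forall fun y => ?_)
    rw [Real.norm_eq_abs, abs_mul, abs_mul, ← mul_one (G * bb y)]
    exact mul_le_mul (mul_le_mul (hG' y) (hwb y) (abs_nonneg _) hG0) (hξle _ (hr1 y))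
      (abs_nonneg _) (mul_nonneg hG0 (hb0 y))
  rw [tendsto_iff_norm_sub_tendsto_zero]
  refine tendsto_zero_of_le (fun n => norm_nonneg _) fun ε hε => ?_
  set η : ℝ := ε / (1 + G * m.real univ + ∫ y, bb y ^ 2 ∂m) with hη
  have hden : 0 < 1 + G * m.real univ + ∫ y, bb y ^ 2 ∂m := by positivity
  have hη0 : 0 < η := by positivity
  have tv := (tendsto_kvar hκ hm hr hr1 hb hb2).const_mul (G / (4 * η))
  have tg := (tendsto_integral_ker_sq_sub (m := m) hκ hg hs).const_mul (1 / (4 * η))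
  have tt := tv.add tg
  simp only [mul_zero, add_zero] at tt
  refine ⟨_, fun n => ?_, tt⟩
  have hk := hκ n
  have hrm := (measurable_ravg hk (integrable_of_abs_le_one hr hr1 : Integrable r m))
  have hsub := measurable_sub_ravg (m := m) hk hr hr1
  have j1 : Integrable (fun p : Ed d × Ed d => κ n (p.1 - p.2) *
      (g p.1 * w p.2 * ξ (ravg m r (κ n) p.1))) (volume.prod m) :=
    integrable_ker_prod hk (hb1.const_mul G) (((hgm.comp measurable_fst).mul
      (hw.comp measurable_snd)).mul (hξ.measurable.comp (hrm.comp measurable_fst))) fun x y => by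
        rw [abs_mul, abs_mul, ← mul_one (G * bb y)]
        exact mul_le_mul (mul_le_mul (hG' x) (hwb y) (abs_nonneg _) hG0)
          (hξle _ (abs_ravg_le_one hk hr1 x)) (abs_nonneg _) (mul_nonneg hG0 (hb0 y))
  have j2 := integrable_ker_snd hk iI
  have k1 := integrable_ker_snd hk (integrable_const (G * η) : Integrable _ m)
  have k2 : Integrable (fun p : Ed d × Ed d => κ n (p.1 - p.2) *
      (bb p.2 ^ 2 * (r p.2 - ravg m r (κ n) p.1) ^ 2)) (volume.prod m) :=
    integrable_ker_prod hk (hb2.const_mul 4)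
      (((hb.measurable.comp measurable_snd).pow_const 2).mul (hsub.pow_const 2)) fun x y => by
        rw [abs_of_nonneg (by positivity)]
        nlinarith [sq_sub_ravg_le (m := m) hk hr1 x y, sq_nonneg (bb y)]
  have k3 : Integrable (fun p : Ed d × Ed d => κ n (p.1 - p.2) * (g p.1 - g p.2) ^ 2)
      (volume.prod m) := integrable_ker_prod hk (integrable_const ((G + G) ^ 2))
      (((hgm.comp measurable_fst).sub (hgm.comp measurable_snd)).pow_const 2) fun x y => by
        rw [abs_pow]
        refine pow_le_pow_left₀ (abs_nonneg _) ((abs_sub _ _).trans ?_) 2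
        exact add_le_add (hG' x) (hG' y)
  have k4 := integrable_ker_snd hk (hb2.const_mul η)
  rw [← integral_ker_snd hk iI, ← integral_sub j1 j2]
  have key : ∀ p : Ed d × Ed d, ‖κ n (p.1 - p.2) * (g p.1 * w p.2 * ξ (ravg m r (κ n) p.1))
      - κ n (p.1 - p.2) * (g p.2 * w p.2 * ξ (r p.2))‖ ≤
      (κ n (p.1 - p.2) * (G * η) + G / (4 * η) * (κ n (p.1 - p.2) *
      (bb p.2 ^ 2 * (r p.2 - ravg m r (κ n) p.1) ^ 2))) + (1 / (4 * η) *
      (κ n (p.1 - p.2) * (g p.1 - g p.2) ^ 2) + κ n (p.1 - p.2) * (η * bb p.2 ^ 2)) := fun p => by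
    rw [← mul_sub, norm_mul, Real.norm_of_nonneg (hk.pos _).le, Real.norm_eq_abs]
    have e : g p.1 * w p.2 * ξ (ravg m r (κ n) p.1) - g p.2 * w p.2 * ξ (r p.2)
        = g p.1 * (w p.2 * (ξ (ravg m r (κ n) p.1) - ξ (r p.2)))
          + (g p.1 - g p.2) * (w p.2 * ξ (r p.2)) := by ring
    have yng : ∀ a b : ℝ, a * b ≤ η * b ^ 2 + 1 / (4 * η) * a ^ 2 := fun a b => by
      have h1 : η * b ^ 2 + 1 / (4 * η) * a ^ 2 - a * b = η * (b - a / (2 * η)) ^ 2 := by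
        field_simp; ring
      nlinarith [mul_nonneg hη0.le (sq_nonneg (b - a / (2 * η)))]
    have b1 : |w p.2 * (ξ (ravg m r (κ n) p.1) - ξ (r p.2))|
        ≤ η + 1 / (4 * η) * (bb p.2 ^ 2 * (r p.2 - ravg m r (κ n) p.1) ^ 2) := by
      rw [abs_mul]
      calc _ ≤ bb p.2 * |r p.2 - ravg m r (κ n) p.1| := by
            refine mul_le_mul (hwb _) ((hξ1 _ _).trans (abs_sub_comm _ _).le) (abs_nonneg _)
              (hb0 _)
        _ ≤ _ := by
          have := yng (bb p.2 * |r p.2 - ravg m r (κ n) p.1|) 1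
          rw [mul_pow, sq_abs] at this
          linarith
    have b2 : |(g p.1 - g p.2) * (w p.2 * ξ (r p.2))|
        ≤ 1 / (4 * η) * (g p.1 - g p.2) ^ 2 + η * bb p.2 ^ 2 := by
      rw [abs_mul, abs_mul]
      calc _ ≤ |g p.1 - g p.2| * bb p.2 := by
            refine mul_le_mul_of_nonneg_left ?_ (abs_nonneg _)
            rw [← mul_one (bb p.2)]
            exact mul_le_mul (hwb _) (hξle _ (hr1 _)) (abs_nonneg _) (hb0 _)
        _ ≤ _ := by
          have := yng |g p.1 - g p.2| (bb p.2)
          rw [sq_abs] at this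
          linarith
    rw [e]
    have b3 : |g p.1 * (w p.2 * (ξ (ravg m r (κ n) p.1) - ξ (r p.2)))| ≤ G *
        (η + 1 / (4 * η) * (bb p.2 ^ 2 * (r p.2 - ravg m r (κ n) p.1) ^ 2)) := by
      rw [abs_mul]; exact mul_le_mul (hG' _) b1 (abs_nonneg _) hG0
    calc _ ≤ κ n (p.1 - p.2) * (G * (η + 1 / (4 * η) * (bb p.2 ^ 2 *
          (r p.2 - ravg m r (κ n) p.1) ^ 2)) + (1 / (4 * η) * (g p.1 - g p.2) ^ 2
          + η * bb p.2 ^ 2)) :=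
          mul_le_mul_of_nonneg_left ((abs_add_le _ _).trans (add_le_add b3 b2)) (hk.pos _).le
      _ = _ := by ring
  have k2' := k2.const_mul (G / (4 * η))
  have k3' := k3.const_mul (1 / (4 * η))
  have k12 : Integrable (fun p : Ed d × Ed d => κ n (p.1 - p.2) * (G * η) + G / (4 * η) *
      (κ n (p.1 - p.2) * (bb p.2 ^ 2 * (r p.2 - ravg m r (κ n) p.1) ^ 2))) (volume.prod m) :=
    k1.add k2'
  have k34 : Integrable (fun p : Ed d × Ed d => 1 / (4 * η) *
      (κ n (p.1 - p.2) * (g p.1 - g p.2) ^ 2) + κ n (p.1 - p.2) * (η * bb p.2 ^ 2))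
      (volume.prod m) := k3'.add k4
  refine (norm_integral_le_of_norm_le (k12.add k34) (Eventually.of_forall key)).trans ?_
  rw [integral_add' k12 k34, integral_add k1 k2', integral_add k3' k4,
    integral_ker_snd hk (integrable_const _), integral_ker_snd hk (hb2.const_mul η),
    integral_const_mul, integral_const_mul, integral_const_mul, integral_const_mul,
    integral_const, smul_eq_mul]
  have : ε = η * (1 + G * m.real univ + ∫ y, bb y ^ 2 ∂m) := by
    rw [hη]; field_simp
  rw [this]
  unfold kvar
  linarith

end

section

lemma pd_pd_comm {φ : Ed d → ℝ} (hφ : ContDiff ℝ 2 φ) (i j : Fin d) (x : Ed d) :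
    pd (pd φ j) i x = pd (pd φ i) j x := by
  have h : IsSymmSndFDerivAt ℝ φ x := hφ.contDiffAt.isSymmSndFDerivAt (by simp)
  have hd : DifferentiableAt ℝ (fderiv ℝ φ) x :=
    (hφ.fderiv_right (m := 1) (by norm_num)).differentiable one_ne_zero x
  have e : ∀ a b : Fin d, pd (pd φ b) a x = fderiv ℝ (fderiv ℝ φ) x
      (EuclideanSpace.single a 1) (EuclideanSpace.single b 1) := fun a b => by
    unfold pd
    rw [fderiv_clm_apply hd (differentiableAt_const _)]
    simp
  rw [e, e]
  exact h.eq _ _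

lemma integral_pd_eq_zero {g : Ed d → ℝ} (hg : ContDiff ℝ 1 g) (hs : HasCompactSupport g)
    (i : Fin d) : ∫ x, pd g i x = 0 := by
  have := integral_mul_pd (f := fun _ => (1 : ℝ)) contDiff_const hg hs i
  simpa using this

/-- A convex `C²` function vanishing at the origin which approximates the absolute value. -/
structure Entropy (Ξ Ξ1 Ξ2 : ℝ → ℝ) (B : ℝ) : Prop where
  deriv : ∀ t, HasDerivAt Ξ (Ξ1 t) t
  deriv' : ∀ t, HasDerivAt Ξ1 (Ξ2 t) t
  cont : Continuous Ξ2
  abs_le : ∀ t, |Ξ1 t| ≤ 1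
  nonneg : ∀ t, 0 ≤ Ξ2 t
  le : ∀ t, Ξ2 t ≤ B
  sub_le : ∀ t, Ξ t - t * Ξ1 t ≤ 0
  zero : Ξ 0 = 0

variable {Ξ Ξ1 Ξ2 : ℝ → ℝ} {B : ℝ}

lemma contDiff_one_of_hasDerivAt {f f' : ℝ → ℝ} (h : ∀ t, HasDerivAt f (f' t) t)
    (hc : Continuous f') : ContDiff ℝ 1 f := by
  rw [contDiff_one_iff_deriv]
  refine ⟨fun t => (h t).differentiableAt, ?_⟩
  rwa [show _root_.deriv f = f' from funext fun t => (h t).deriv]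

lemma Entropy.contDiff_deriv (h : Entropy Ξ Ξ1 Ξ2 B) : ContDiff ℝ 1 Ξ1 :=
  contDiff_one_of_hasDerivAt h.deriv' h.cont

lemma Entropy.contDiff (h : Entropy Ξ Ξ1 Ξ2 B) : ContDiff ℝ 1 Ξ :=
  contDiff_one_of_hasDerivAt h.deriv h.contDiff_deriv.continuous

lemma Entropy.lip (h : Entropy Ξ Ξ1 Ξ2 B) (s t : ℝ) : |Ξ s - Ξ t| ≤ |s - t| := by
  have := Convex.norm_image_sub_le_of_norm_hasDerivWithin_le (f := Ξ) (f' := Ξ1) (C := 1)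
    (fun t _ => (h.deriv t).hasDerivWithinAt) (fun t _ => h.abs_le t) convex_univ
    (mem_univ t) (mem_univ s)
  simpa using this

lemma entropy_sqrt {δ : ℝ} (hδ : 0 < δ) : Entropy (fun t => √(δ ^ 2 + t ^ 2) - δ)
    (fun t => t / √(δ ^ 2 + t ^ 2)) (fun t => δ ^ 2 / √(δ ^ 2 + t ^ 2) ^ 3) (1 / δ) := by
  have hp : ∀ t : ℝ, 0 < δ ^ 2 + t ^ 2 := fun t => by positivity
  have hs : ∀ t : ℝ, 0 < √(δ ^ 2 + t ^ 2) := fun t => Real.sqrt_pos.2 (hp t)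
  have hq : ∀ t : ℝ, √(δ ^ 2 + t ^ 2) ^ 2 = δ ^ 2 + t ^ 2 := fun t => Real.sq_sqrt (hp t).le
  have hδs : ∀ t : ℝ, δ ≤ √(δ ^ 2 + t ^ 2) := fun t => Real.le_sqrt_of_sq_le (by nlinarith)
  have hd : ∀ t : ℝ, HasDerivAt (fun t => √(δ ^ 2 + t ^ 2)) (t / √(δ ^ 2 + t ^ 2)) t := fun t => by
    refine HasDerivAt.congr_deriv (((hasDerivAt_pow 2 t).const_add (δ ^ 2)).sqrt (hp t).ne') ?_
    symm
    change t / √(δ ^ 2 + t ^ 2) = (2 : ℕ) * t ^ (2 - 1) / (2 * √(δ ^ 2 + t ^ 2))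
    have := (hs t).ne'
    push_cast
    field_simp
  refine ⟨fun t => (hd t).sub_const _, fun t => ?_, ?_, fun t => ?_, fun t => ?_, fun t => ?_,
    fun t => ?_, ?_⟩
  · refine HasDerivAt.congr_deriv ((hasDerivAt_id' t).fun_div (hd t) (hs t).ne') ?_
    have h3 := (hs t).ne'
    have h4 := hq t
    field_simp
    linarith
  · refine continuous_const.div (by fun_prop) fun t => (pow_pos (hs t) 3).ne'
  · rw [abs_div, abs_of_pos (hs t), div_le_one (hs t)]
    exact Real.abs_le_sqrt (by nlinarith)
  · have := hs t; positivity
  · rw [div_le_div_iff₀ (pow_pos (hs t) 3) hδ, one_mul, ← pow_succ]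
    exact pow_le_pow_left₀ hδ.le (hδs t) 3
  · have h1 := hs t
    have h2 := hδs t
    have h4 := hq t
    have : √(δ ^ 2 + t ^ 2) - δ - t * (t / √(δ ^ 2 + t ^ 2))
        = δ * (δ - √(δ ^ 2 + t ^ 2)) / √(δ ^ 2 + t ^ 2) := by
      field_simp
      linarith
    rw [this]
    exact div_nonpos_of_nonpos_of_nonneg (mul_nonpos_of_nonneg_of_nonpos hδ.le (by linarith)) h1.le
  · simp [Real.sqrt_sq hδ.le]

/-- Integration by parts behind Kato's inequality. -/
lemma Entropy.integral_by_parts (hE : Entropy Ξ Ξ1 Ξ2 B) {φ R : Ed d → ℝ} (hφ : ContDiff ℝ 2 φ)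
    (hs : HasCompactSupport φ) (hR : ContDiff ℝ 1 R) {Fs Fm b : Fin d → Ed d → ℝ}
    {q : Fin d → Fin d → Ed d → ℝ} (hFs : ∀ i, ContDiff ℝ 1 (Fs i))
    (hFm : ∀ i, ContDiff ℝ 1 (Fm i)) (hq : ∀ i j, ContDiff ℝ 1 (q i j))
    (hb : ∀ i x, Fm i x = (∑ j, pd (q i j) j x) - b i x) :
    ∫ x, φ x * (Ξ1 (R x) * ∑ i, pd (Fs i) i x + (Ξ (R x) - R x * Ξ1 (R x)) * ∑ i, pd (Fm i) i x)
      = ∫ x, (∑ i, ((∑ j, pd (pd φ i) j x * Ξ (R x) * q i j x) + pd φ i x * Ξ (R x) * b i x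
        - pd φ i x * (Ξ1 (R x) * (Fs i x - R x * Fm i x - ∑ j, q i j x * pd R j x))
        - φ x * Ξ2 (R x) * (pd R i x * (Fs i x - R x * Fm i x)))) := by
  have cφ := hφ.of_le one_le_two
  have cΞ : ContDiff ℝ 1 fun x => Ξ (R x) := hE.contDiff.comp hR
  have cΞ1 : ContDiff ℝ 1 fun x => Ξ1 (R x) := hE.contDiff_deriv.comp hR
  have dφ := cφ.differentiable one_ne_zero
  have eΞ := hE.contDiff
  have eΞ1 := hE.contDiff_deriv
  have fΞ := eΞ.differentiable one_ne_zero
  have fΞ1 := eΞ1.differentiable one_ne_zero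
  have dΞ := cΞ.differentiable one_ne_zero
  have dΞ1 := cΞ1.differentiable one_ne_zero
  have dR := hR.differentiable one_ne_zero
  have cP : ∀ i, ContDiff ℝ 1 (pd φ i) := contDiff_one_pd hφ
  have pΞ : ∀ i x, pd (fun x => Ξ (R x)) i x = Ξ1 (R x) * pd R i x := fun i x =>
    pd_comp (hE.deriv _) (dR x) i
  have pΞ1 : ∀ i x, pd (fun x => Ξ1 (R x)) i x = Ξ2 (R x) * pd R i x := fun i x =>
    pd_comp (hE.deriv' _) (dR x) i
  let G : Fin d → Ed d → ℝ := fun i x =>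
    φ x * (Ξ1 (R x) * Fs i x + (Ξ (R x) - R x * Ξ1 (R x)) * Fm i x)
  let H : Fin d → Fin d → Ed d → ℝ := fun i j x => pd φ i x * (Ξ (R x) * q i j x)
  have cG : ∀ i, ContDiff ℝ 1 (G i) := fun i => by
    have := hFs i; have := hFm i; simp only [G]; fun_prop
  have cH : ∀ i j, ContDiff ℝ 1 (H i j) := fun i j => by
    have := hq i j; have := cP i; simp only [H]; fun_prop
  have sG : ∀ i, HasCompactSupport (G i) := fun i => hs.mul_right
  have sH : ∀ i j, HasCompactSupport (H i j) := fun i j => (hasCompactSupport_pd hs i).mul_right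
  have pG : ∀ i x, pd (G i) i x = φ x * (Ξ1 (R x) * pd (Fs i) i x
      + (Ξ (R x) - R x * Ξ1 (R x)) * pd (Fm i) i x)
      + pd φ i x * (Ξ1 (R x) * (Fs i x - R x * Fm i x) + Ξ (R x) * Fm i x)
      + φ x * Ξ2 (R x) * (pd R i x * (Fs i x - R x * Fm i x)) := fun i x => by
    have d1 := (hFs i).differentiable one_ne_zero
    have d2 := (hFm i).differentiable one_ne_zero
    rw [show pd (G i) i x = _ from pd_mul (dφ x) (by fun_prop) i,
      pd_add (f := fun x => Ξ1 (R x) * Fs i x)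
        (g := fun x => (Ξ (R x) - R x * Ξ1 (R x)) * Fm i x) (by fun_prop) (by fun_prop),
      pd_mul (f := fun x => Ξ1 (R x)) (by fun_prop) (by fun_prop),
      pd_mul (f := fun x => Ξ (R x) - R x * Ξ1 (R x)) (by fun_prop) (by fun_prop),
      pd_sub (f := fun x => Ξ (R x)) (g := fun x => R x * Ξ1 (R x)) (by fun_prop) (by fun_prop),
      pd_mul (f := R) (g := fun x => Ξ1 (R x)) (by fun_prop) (by fun_prop), pΞ, pΞ1]
    ring
  have pH : ∀ i j x, pd (H i j) j x = pd (pd φ i) j x * Ξ (R x) * q i j x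
      + pd φ i x * (Ξ1 (R x) * (q i j x * pd R j x)) + pd φ i x * Ξ (R x) * pd (q i j) j x :=
    fun i j x => by
    have d1 := (hq i j).differentiable one_ne_zero
    have d2 := (cP i).differentiable one_ne_zero
    rw [show pd (H i j) j x = _ from pd_mul (d2 x) (by fun_prop) j,
      pd_mul (f := fun x => Ξ (R x)) (g := q i j) (by fun_prop) (by fun_prop), pΞ]
    ring
  have key : ∀ x, φ x * (Ξ1 (R x) * ∑ i, pd (Fs i) i x
      + (Ξ (R x) - R x * Ξ1 (R x)) * ∑ i, pd (Fm i) i x)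
      = (∑ i, ((∑ j, pd (pd φ i) j x * Ξ (R x) * q i j x) + pd φ i x * Ξ (R x) * b i x
        - pd φ i x * (Ξ1 (R x) * (Fs i x - R x * Fm i x - ∑ j, q i j x * pd R j x))
        - φ x * Ξ2 (R x) * (pd R i x * (Fs i x - R x * Fm i x))))
        + ((∑ i, pd (G i) i x) - ∑ i, ∑ j, pd (H i j) j x) := fun x => by
    rw [← Finset.sum_sub_distrib, ← Finset.sum_add_distrib, Finset.mul_sum, Finset.mul_sum,
      ← Finset.sum_add_distrib, Finset.mul_sum]
    refine Finset.sum_congr rfl fun i _ => ?_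
    simp only [pG, pH, Finset.sum_add_distrib, ← Finset.mul_sum]
    rw [hb i x]
    ring
  have iG : Integrable fun x => (∑ i, pd (G i) i x) - ∑ i, ∑ j, pd (H i j) j x := by
    refine Integrable.sub (integrable_finsetSum _ fun i _ => ?_)
      (integrable_finsetSum _ fun i _ => integrable_finsetSum _ fun j _ => ?_)
    · exact (continuous_pd (cG i) i).integrable_of_hasCompactSupport (hasCompactSupport_pd (sG i) i)
    · exact (continuous_pd (cH i j) j).integrable_of_hasCompactSupport
        (hasCompactSupport_pd (sH i j) j)
  have zG : ∫ x, ((∑ i, pd (G i) i x) - ∑ i, ∑ j, pd (H i j) j x) = 0 := by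
    have i1 : ∀ i, Integrable (pd (G i) i) := fun i =>
      (continuous_pd (cG i) i).integrable_of_hasCompactSupport (hasCompactSupport_pd (sG i) i)
    have i2 : ∀ i j, Integrable (pd (H i j) j) := fun i j =>
      (continuous_pd (cH i j) j).integrable_of_hasCompactSupport (hasCompactSupport_pd (sH i j) j)
    rw [integral_sub (integrable_finsetSum _ fun i _ => i1 i)
      (integrable_finsetSum _ fun i _ => integrable_finsetSum _ fun j _ => i2 i j),
      integral_finsetSum _ fun i _ => i1 i,
      integral_finsetSum _ fun i _ => integrable_finsetSum _ fun j _ => i2 i j]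
    simp_rw [fun i => integral_finsetSum Finset.univ (f := fun j => pd (H i j) j)
      fun j _ => i2 i j, integral_pd_eq_zero (cG _) (sG _), integral_pd_eq_zero (cH _ _) (sH _ _)]
    simp
  have iL : Integrable fun x => φ x * (Ξ1 (R x) * ∑ i, pd (Fs i) i x
      + (Ξ (R x) - R x * Ξ1 (R x)) * ∑ i, pd (Fm i) i x) := by
    have c1 : ∀ i, Continuous (pd (Fs i) i) := fun i => continuous_pd (hFs i) i
    have c2 : ∀ i, Continuous (pd (Fm i) i) := fun i => continuous_pd (hFm i) i
    have := eΞ.continuous; have := eΞ1.continuous; have := hR.continuous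
    exact (hφ.continuous.mul (by fun_prop)).integrable_of_hasCompactSupport hs.mul_right
  have := integral_sub iL iG
  rw [zG, sub_zero] at this
  rw [← this]
  refine integral_congr_ae (Eventually.of_forall fun x => ?_)
  simp only [key x]
  ring

end

section

variable {A : Ed d → Matrix (Fin d) (Fin d) ℝ} {β : Ed d → Ed d} {bb : Ed d → ℝ} {C : ℝ}
  {m : Measure (Ed d)} [IsFiniteMeasure m] {k r : Ed d → ℝ} {c N : ℝ}

lemma Coef.integrable_bb (hc : Coef A β bb C) (hb2 : Integrable (fun y => bb y ^ 2) m) :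
    Integrable bb m := by
  refine hb2.mono' hc.cont.aestronglyMeasurable (Eventually.of_forall fun y => ?_)
  have := hc.one_le_bb y
  rw [Real.norm_eq_abs, abs_of_nonneg (by linarith)]
  nlinarith

lemma mul_le_young {α : ℝ} (hα : 0 < α) (a b : ℝ) : a * b ≤ α * a ^ 2 + b ^ 2 / (4 * α) := by
  have h1 : α * a ^ 2 + b ^ 2 / (4 * α) - a * b = α * (a - b / (2 * α)) ^ 2 := by
    field_simp; ring
  nlinarith [mul_nonneg hα.le (sq_nonneg (a - b / (2 * α)))]

lemma contDiff_ravg (hk : IsKer k c N) (hm : m ≠ 0) (hr : Integrable r m) :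
    ContDiff ℝ 1 (ravg m r k) := by
  obtain ⟨M, -, hM⟩ := hk.exists_bound
  exact (contDiff_cv hr hM.cb1).div (contDiff_cv (integrable_const _) hM.cb1)
    fun x => (cv_one_pos hk hm x).ne'

lemma ravg_mul (hk : IsKer k c N) (hm : m ≠ 0) (x : Ed d) :
    ravg m r k x * cv m (fun _ => 1) k x = cv m r k x := by
  rw [ravg, div_mul_cancel₀ _ (cv_one_pos hk hm x).ne']

/-- `cv` with the centred weight `r - ravg`. -/
lemma cv_sub_ravg {w K : Ed d → ℝ} {x : Ed d}
    (h1 : Integrable (fun y => r y * w y * K (x - y)) m)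
    (h2 : Integrable (fun y => 1 * w y * K (x - y)) m) (ρ : ℝ) :
    ∫ y, (r y - ρ) * (w y * K (x - y)) ∂m
      = cv m (fun y => r y * w y) K x - ρ * cv m (fun y => 1 * w y) K x := by
  unfold cv
  rw [← integral_const_mul, ← integral_sub h1 (h2.const_mul ρ)]
  refine integral_congr_ae (Eventually.of_forall fun y => ?_)
  simp only; ring

lemma mul_pd_ravg (hk : IsKer k c N) (hm : m ≠ 0) (hr : Integrable r m) (j : Fin d) (x : Ed d) :
    cv m (fun _ => 1) k x * pd (ravg m r k) j x
      = ∫ y, (r y - ravg m r k x) * (1 * pd k j (x - y)) ∂m := by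
  obtain ⟨M, -, hM⟩ := hk.exists_bound
  have hR := contDiff_ravg hk hm hr
  have hM1 := contDiff_cv (ν := m) (w := fun _ => 1) (integrable_const _) hM.cb1
  have e := pd_mul (hR.differentiable one_ne_zero x) (hM1.differentiable one_ne_zero x) j
  rw [show (fun y => ravg m r k y * cv m (fun _ => 1) k y) = cv m r k from
    funext fun y => ravg_mul hk hm y, pd_cv hr hM.cb1, pd_cv (integrable_const _) hM.cb1] at e
  have cp : Continuous (pd k j) := (contDiff_one_pd hM.contDiff j).continuous
  have i1 := integrable_cv hr cp (hM.bound_pd j) x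
  have i2 := integrable_cv (ν := m) (integrable_const (1 : ℝ)) cp (hM.bound_pd j) x
  rw [cv_sub_ravg (w := fun _ => 1) (by simpa using i1) (by simpa using i2)]
  simp only [mul_one]
  linarith

lemma flux_sub (hc : Coef A β bb C) (hk : IsKer k c N) (hb : Integrable bb m) (hr : Measurable r)
    (hr1 : ∀ y, |r y| ≤ 1) (ρ : ℝ) (i : Fin d) (x : Ed d) :
    flux A β m r k i x - ρ * flux A β m (fun _ => 1) k i x
      = (∑ j, ∫ y, (r y - ρ) * (A y i j * pd k j (x - y)) ∂m)
        - ∫ y, (r y - ρ) * (β y i * k (x - y)) ∂m := by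
  obtain ⟨M, -, hM⟩ := hk.exists_bound
  have ir := integrable_of_abs_le_one (m := m) hr hr1
  have hb' : Integrable (fun y => r y * bb y) m :=
    hb.bdd_mul hr.aestronglyMeasurable (Eventually.of_forall hr1)
  have hb1 : Integrable (fun y => 1 * bb y) m := by simpa using hb
  have cp : ∀ j, Continuous (pd k j) := fun j => (contDiff_one_pd hM.contDiff j).continuous
  rw [cv_sub_ravg (integrable_cv (hc.integrable_β hb' hr.aestronglyMeasurable i)
    hk.contDiff.continuous hM.bound x) (integrable_cv (hc.integrable_β hb1
    aestronglyMeasurable_const i) hk.contDiff.continuous hM.bound x)]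
  simp_rw [fun j => cv_sub_ravg (r := r) (w := fun y => A y i j) (ρ := ρ)
    (integrable_cv (hc.integrable_A ir i j) (cp j) (hM.bound_pd j) x)
    (integrable_cv (ν := m) (hc.integrable_A (integrable_const (1 : ℝ)) i j) (cp j)
      (hM.bound_pd j) x)]
  rw [Finset.sum_sub_distrib, ← Finset.mul_sum]
  unfold flux
  ring

/-- The error in replacing the flux of the centred density by `m A ∇r`. -/
lemma abs_flux_error_le (hc : Coef A β bb C) (hk : IsKer k c N) (hm : m ≠ 0)
    (hb : Integrable bb m) (hr : Measurable r) (hr1 : ∀ y, |r y| ≤ 1) (i : Fin d) (x : Ed d) :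
    |flux A β m r k i x - ravg m r k x * flux A β m (fun _ => 1) k i x
      - cv m (fun _ => 1) k x * ∑ j, A x i j * pd (ravg m r k) j x|
      ≤ (d * C * c + 1) * cv m (fun y => bb y * |r y - ravg m r k x|) k x := by
  obtain ⟨M, -, hM⟩ := hk.exists_bound
  have ir := integrable_of_abs_le_one (m := m) hr hr1
  set ρ := ravg m r k x with hρ
  have hρ1 : |ρ| ≤ 1 := abs_ravg_le_one hk hr1 x
  have hu : ∀ y, |r y - ρ| ≤ 2 := fun y => (abs_sub _ _).trans (by linarith [hr1 y])
  have cp : ∀ j, Continuous (pd k j) := fun j => (contDiff_one_pd hM.contDiff j).continuous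
  have iu : Integrable (fun y => r y - ρ) m := ir.sub (integrable_const _)
  have ib : Integrable (fun y => (r y - ρ) * bb y) m :=
    hb.bdd_mul iu.1 (Eventually.of_forall hu)
  have i1 : ∀ j, Integrable (fun y => (r y - ρ) * (A y i j * pd k j (x - y))) m := fun j => by
    simpa [mul_assoc] using integrable_cv (hc.integrable_A iu i j) (cp j) (hM.bound_pd j) x
  have i2 : ∀ j, Integrable (fun y => (r y - ρ) * (1 * pd k j (x - y))) m := fun j => by
    simpa [mul_assoc] using integrable_cv iu (cp j) (hM.bound_pd j) x
  have i3 : Integrable (fun y => (r y - ρ) * (β y i * k (x - y))) m := by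
    simpa [mul_assoc] using integrable_cv (hc.integrable_β ib iu.1 i) hk.contDiff.continuous
      hM.bound x
  have e : flux A β m r k i x - ρ * flux A β m (fun _ => 1) k i x
      - cv m (fun _ => 1) k x * ∑ j, A x i j * pd (ravg m r k) j x
      = ∫ y, (r y - ρ) * ((∑ j, (A y i j - A x i j) * pd k j (x - y)) - β y i * k (x - y)) ∂m := by
    rw [flux_sub hc hk hb hr hr1, Finset.mul_sum]
    have e' : ∀ j, cv m (fun _ => 1) k x * (A x i j * pd (ravg m r k) j x)
        = ∫ y, A x i j * ((r y - ρ) * (1 * pd k j (x - y))) ∂m := fun j => by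
      rw [mul_left_comm, mul_pd_ravg hk hm ir, integral_const_mul]
    rw [Finset.sum_congr rfl fun j _ => e' j]
    rw [sub_right_comm, ← Finset.sum_sub_distrib]
    have i4 : ∀ j, Integrable (fun y => (r y - ρ) * (A y i j * pd k j (x - y))
        - A x i j * ((r y - ρ) * (1 * pd k j (x - y)))) m := fun j =>
      (i1 j).sub ((i2 j).const_mul _)
    rw [Finset.sum_congr rfl fun j _ => (integral_sub (i1 j) ((i2 j).const_mul (A x i j))).symm,
      ← integral_finsetSum _ fun j _ => i4 j,
      ← integral_sub (integrable_finsetSum _ fun j _ => i4 j) i3]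
    refine integral_congr_ae (Eventually.of_forall fun y => ?_)
    simp only [mul_sub, Finset.mul_sum, sub_mul]
    congr 1
    refine Finset.sum_congr rfl fun j _ => ?_
    ring
  rw [e, cv, ← integral_const_mul]
  have iub : Integrable (fun y => bb y * |r y - ρ|) m := by
    refine ib.abs.congr (Eventually.of_forall fun y => ?_)
    simp only [abs_mul]
    rw [abs_of_nonneg (zero_le_one.trans (hc.one_le_bb y)), mul_comm]
  refine (abs_integral_le_integral_abs).trans (integral_mono_of_nonneg
    (Eventually.of_forall fun y => abs_nonneg _) ((hk.integrable_mul iub x).const_mul _)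
    (Eventually.of_forall fun y => ?_))
  simp only
  rw [abs_mul]
  have hbb := hc.one_le_bb y
  have hkp := hk.pos (x - y)
  have hC := hc.one_le
  have hc1 := hk.one_le_c
  have hK : |(∑ j, (A y i j - A x i j) * pd k j (x - y)) - β y i * k (x - y)|
      ≤ (d * C * c + 1) * bb y * k (x - y) := by
    refine (abs_sub _ _).trans ?_
    have s1 : |∑ j, (A y i j - A x i j) * pd k j (x - y)| ≤ ∑ _j : Fin d, C * c * k (x - y) := by
      refine (Finset.abs_sum_le_sum_abs _ _).trans (Finset.sum_le_sum fun j _ => ?_)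
      rw [abs_mul]
      calc _ ≤ C * ‖y - x‖ * |pd k j (x - y)| :=
            mul_le_mul_of_nonneg_right (hc.lip y x i j) (abs_nonneg _)
        _ = C * (‖x - y‖ * |pd k j (x - y)|) := by rw [norm_sub_rev]; ring
        _ ≤ C * (c * k (x - y)) := by
            exact mul_le_mul_of_nonneg_left (hk.norm_mul_pd_le j _) (by linarith)
        _ = _ := by ring
    have s2 : |β y i * k (x - y)| ≤ bb y * k (x - y) := by
      rw [abs_mul, abs_of_pos hkp]
      exact mul_le_mul_of_nonneg_right (hc.le y i) hkp.le
    simp only [Finset.sum_const, Finset.card_univ, Fintype.card_fin, nsmul_eq_mul] at s1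
    have s3 : (d : ℝ) * (C * c * k (x - y)) ≤ d * C * c * bb y * k (x - y) := by
      have : 0 ≤ d * C * c * k (x - y) := by positivity
      nlinarith
    linarith
  calc |r y - ρ| * _ ≤ |r y - ρ| * ((d * C * c + 1) * bb y * k (x - y)) :=
        mul_le_mul_of_nonneg_left hK (abs_nonneg _)
    _ = _ := by ring

/-- The local weighted variance at scale of the kernel. -/
def lvar (m : Measure (Ed d)) (r bb k : Ed d → ℝ) (x : Ed d) : ℝ :=
  cv m (fun y => bb y ^ 2 * (r y - ravg m r k x) ^ 2) k x

lemma integrable_sq_mul (hk : IsKer k c N) (hb2 : Integrable (fun y => bb y ^ 2) m)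
    (hr : Measurable r) (hr1 : ∀ y, |r y| ≤ 1) (x : Ed d) :
    Integrable (fun y => bb y ^ 2 * (r y - ravg m r k x) ^ 2) m :=
  hb2.mul_bdd (c := 4) ((hr.sub_const _).pow_const 2).aestronglyMeasurable
    (Eventually.of_forall fun y => by
      rw [Real.norm_of_nonneg (sq_nonneg _)]; exact sq_sub_ravg_le hk hr1 x y)

lemma integrable_mul_abs (hk : IsKer k c N) (hb : Integrable bb m)
    (hr : Measurable r) (hr1 : ∀ y, |r y| ≤ 1) (x : Ed d) :
    Integrable (fun y => bb y * |r y - ravg m r k x|) m :=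
  hb.mul_bdd (c := 2) (hr.sub_const _).abs.aestronglyMeasurable
    (Eventually.of_forall fun y => by
      rw [Real.norm_of_nonneg (abs_nonneg _)]
      exact (abs_sub _ _).trans (by linarith [hr1 y, abs_ravg_le_one (m := m) hk hr1 x]))

lemma mul_cv_abs_le (hk : IsKer k c N) (hb : Integrable bb m)
    (hb2 : Integrable (fun y => bb y ^ 2) m) (hr : Measurable r) (hr1 : ∀ y, |r y| ≤ 1)
    (x : Ed d) {α : ℝ} (hα : 0 < α) (t : ℝ) :
    t * cv m (fun y => bb y * |r y - ravg m r k x|) k x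
      ≤ α * t ^ 2 * cv m (fun _ => 1) k x + lvar m r bb k x / (4 * α) := by
  unfold lvar cv
  have i1 := hk.integrable_mul (integrable_mul_abs hk hb hr hr1 x) x
  have i2 := hk.integrable_mul (integrable_const (1 : ℝ) : Integrable _ m) x
  have i3 := hk.integrable_mul (integrable_sq_mul hk hb2 hr hr1 x) x
  rw [← integral_const_mul, ← integral_const_mul, ← integral_div,
    ← integral_add (i2.const_mul _) (i3.div_const _)]
  refine integral_mono (i1.const_mul _) ((i2.const_mul _).add (i3.div_const _)) fun y => ?_
  simp only
  have h := mul_le_mul_of_nonneg_right (mul_le_young hα t (bb y * |r y - ravg m r k x|))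
    (hk.pos (x - y)).le
  rw [mul_pow, sq_abs] at h
  calc _ = t * (bb y * |r y - ravg m r k x|) * k (x - y) := by ring
    _ ≤ _ := h
    _ = _ := by ring

lemma mul_sq_pd_ravg_le (hc : Coef A β bb C) (hk : IsKer k c N) (hm : m ≠ 0)
    (hb2 : Integrable (fun y => bb y ^ 2) m) (hr : Measurable r) (hr1 : ∀ y, |r y| ≤ 1)
    (j : Fin d) (x : Ed d) :
    cv m (fun _ => 1) k x * pd (ravg m r k) j x ^ 2 ≤ (c * N) ^ 2 * lvar m r bb k x := by
  have hb := hc.integrable_bb hb2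
  have hcN : 0 < c * N := mul_pos (by linarith [hk.one_le_c]) (by linarith [hk.one_le])
  have h1 : |cv m (fun _ => 1) k x * pd (ravg m r k) j x|
      ≤ c * N * cv m (fun y => bb y * |r y - ravg m r k x|) k x := by
    rw [mul_pd_ravg hk hm (integrable_of_abs_le_one hr hr1), cv, ← integral_const_mul]
    refine (abs_integral_le_integral_abs).trans (integral_mono_of_nonneg
      (Eventually.of_forall fun y => abs_nonneg _)
      ((hk.integrable_mul (integrable_mul_abs hk hb hr hr1 x) x).const_mul _)
      (Eventually.of_forall fun y => ?_))
    simp only [one_mul]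
    rw [abs_mul]
    have := hc.one_le_bb y
    calc _ ≤ |r y - ravg m r k x| * (c * N * k (x - y)) :=
          mul_le_mul_of_nonneg_left (hk.pd_le j _) (abs_nonneg _)
      _ ≤ _ := by
        have h0 : 0 ≤ |r y - ravg m r k x| * (c * N * k (x - y)) :=
          mul_nonneg (abs_nonneg _) (mul_nonneg hcN.le (hk.pos _).le)
        nlinarith
  have hp := cv_one_pos hk hm x
  rw [abs_mul, abs_of_pos hp] at h1
  have h2 := mul_cv_abs_le hk hb hb2 hr hr1 x (α := 1 / (2 * (c * N))) (by positivity)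
    |pd (ravg m r k) j x|
  have h3 := mul_le_mul_of_nonneg_right h1 (abs_nonneg (pd (ravg m r k) j x))
  have h4 := mul_le_mul_of_nonneg_left h2 hcN.le
  rw [sq_abs] at h4
  have e1 : cv m (fun _ => 1) k x * |pd (ravg m r k) j x| * |pd (ravg m r k) j x|
      = cv m (fun _ => 1) k x * pd (ravg m r k) j x ^ 2 := by
    rw [mul_assoc, abs_mul_abs_self, sq]
  have e2 : c * N * (1 / (2 * (c * N)) * pd (ravg m r k) j x ^ 2 * cv m (fun _ => 1) k x
      + lvar m r bb k x / (4 * (1 / (2 * (c * N))))) =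
      1 / 2 * (cv m (fun _ => 1) k x * pd (ravg m r k) j x ^ 2)
        + (c * N) ^ 2 / 2 * lvar m r bb k x := by
    have : c ≠ 0 := (by linarith [hk.one_le_c] : 0 < c).ne'
    have : N ≠ 0 := (by linarith [hk.one_le] : 0 < N).ne'
    field_simp; ring
  linarith

lemma neg_sum_mul_flux_le (hc : Coef A β bb C) (hk : IsKer k c N) (hm : m ≠ 0)
    (hb2 : Integrable (fun y => bb y ^ 2) m) (hr : Measurable r) (hr1 : ∀ y, |r y| ≤ 1)
    (x : Ed d) :
    -∑ i, pd (ravg m r k) i x * (flux A β m r k i x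
        - ravg m r k x * flux A β m (fun _ => 1) k i x)
      ≤ d * (C * (d * C * c + 1) ^ 2) * lvar m r bb k x := by
  have hb := hc.integrable_bb hb2
  have hC := hc.one_le
  have hc1 := hk.one_le_c
  set D : ℝ := d * C * c + 1 with hD
  have hD0 : 0 < D := by positivity
  have hp := cv_one_pos hk hm x
  have h1 : ∀ i, -(pd (ravg m r k) i x * (flux A β m r k i x
      - ravg m r k x * flux A β m (fun _ => 1) k i x))
      ≤ -(cv m (fun _ => 1) k x * ∑ j, A x i j * pd (ravg m r k) i x * pd (ravg m r k) j x)
        + (cv m (fun _ => 1) k x / C * pd (ravg m r k) i x ^ 2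
          + C * D ^ 2 * lvar m r bb k x) := fun i => by
    have e := abs_flux_error_le hc hk hm hb hr hr1 i x
    have y := mul_cv_abs_le hk hb hb2 hr hr1 x (α := 1 / (C * D)) (by positivity)
      |pd (ravg m r k) i x|
    rw [sq_abs] at y
    set E := flux A β m r k i x - ravg m r k x * flux A β m (fun _ => 1) k i x
      - cv m (fun _ => 1) k x * ∑ j, A x i j * pd (ravg m r k) j x with hE
    have e1 : -(pd (ravg m r k) i x * (flux A β m r k i x
        - ravg m r k x * flux A β m (fun _ => 1) k i x))
        = -(cv m (fun _ => 1) k x * ∑ j, A x i j * pd (ravg m r k) i x * pd (ravg m r k) j x)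
          - pd (ravg m r k) i x * E := by
      rw [hE]
      have : ∑ j, A x i j * pd (ravg m r k) i x * pd (ravg m r k) j x
          = pd (ravg m r k) i x * ∑ j, A x i j * pd (ravg m r k) j x := by
        rw [Finset.mul_sum]; exact Finset.sum_congr rfl fun j _ => by ring
      rw [this]; ring
    have e2 : -(pd (ravg m r k) i x * E) ≤ |pd (ravg m r k) i x| * (D *
        cv m (fun y => bb y * |r y - ravg m r k x|) k x) := by
      refine (neg_le_abs _).trans ?_
      rw [abs_mul]
      exact mul_le_mul_of_nonneg_left e (abs_nonneg _)
    have e3 := mul_le_mul_of_nonneg_left y hD0.le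
    have e4 : D * (1 / (C * D) * pd (ravg m r k) i x ^ 2 * cv m (fun _ => 1) k x
        + lvar m r bb k x / (4 * (1 / (C * D)))) = cv m (fun _ => 1) k x / C *
        pd (ravg m r k) i x ^ 2 + C * D ^ 2 / 4 * lvar m r bb k x := by
      field_simp
    have e5 : 0 ≤ C * D ^ 2 * lvar m r bb k x := by
      have : 0 ≤ lvar m r bb k x := cv_nonneg hk (fun y => by positivity) x
      positivity
    rw [e1]
    nlinarith
  rw [← Finset.sum_neg_distrib]
  refine (Finset.sum_le_sum fun i _ => h1 i).trans ?_
  rw [Finset.sum_add_distrib, Finset.sum_add_distrib, Finset.sum_neg_distrib, ← Finset.mul_sum,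
    ← Finset.mul_sum]
  have hl := hc.low x fun i => pd (ravg m r k) i x
  have : cv m (fun _ => 1) k x / C * ∑ i, pd (ravg m r k) i x ^ 2 ≤ cv m (fun _ => 1) k x *
      ∑ i, ∑ j, A x i j * pd (ravg m r k) i x * pd (ravg m r k) j x := by
    rw [div_mul_eq_mul_div, div_le_iff₀ (by linarith)]
    calc _ ≤ cv m (fun _ => 1) k x * (C * ∑ i, ∑ j, A x i j * pd (ravg m r k) i x *
          pd (ravg m r k) j x) := mul_le_mul_of_nonneg_left hl hp.le
      _ = _ := by ring
  simp only [Finset.sum_const, Finset.card_univ, Fintype.card_fin, nsmul_eq_mul]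
  linarith

/-- The error term multiplying the gradient of the test function. -/
lemma abs_flux_error_le' (hc : Coef A β bb C) (hk : IsKer k c N) (hm : m ≠ 0)
    (hb2 : Integrable (fun y => bb y ^ 2) m) (hr : Measurable r) (hr1 : ∀ y, |r y| ≤ 1)
    (i : Fin d) {x : Ed d} (hx : Integrable (fun y => k (x - y) * ‖x - y‖ ^ 2) m) {η : ℝ}
    (hη : 0 < η) :
    |flux A β m r k i x - ravg m r k x * flux A β m (fun _ => 1) k i x
      - ∑ j, cv m (fun y => A y i j) k x * pd (ravg m r k) j x|
      ≤ (d * C * c + 1) * (η * cv m (fun _ => 1) k x + lvar m r bb k x / (4 * η))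
        + d * (C * (η * N ^ 2 * (∫ y, k (x - y) * ‖x - y‖ ^ 2 ∂m)
          + c ^ 2 * lvar m r bb k x / (4 * η))) := by
  have hb := hc.integrable_bb hb2
  have hC := hc.one_le
  have hc1 := hk.one_le_c
  have hN := hk.one_le
  have hp := cv_one_pos hk hm x
  have e := abs_flux_error_le hc hk hm hb hr hr1 i x
  have y1 := mul_cv_abs_le hk hb hb2 hr hr1 x hη 1
  have i0 := hk.integrable_mul (integrable_const (1 : ℝ) : Integrable _ m) x
  have hj : ∀ j, |(A x i j * cv m (fun _ => 1) k x - cv m (fun y => A y i j) k x)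
      * pd (ravg m r k) j x| ≤ C * (η * N ^ 2 * (∫ y, k (x - y) * ‖x - y‖ ^ 2 ∂m)
          + c ^ 2 * lvar m r bb k x / (4 * η)) := fun j => by
    have iA := hk.integrable_mul (by simpa using hc.integrable_A (integrable_const (1 : ℝ)) i j :
      Integrable (fun y => A y i j) m) x
    have e1 : (A x i j * cv m (fun _ => 1) k x - cv m (fun y => A y i j) k x)
        * pd (ravg m r k) j x = ∫ y, (A x i j - A y i j) * k (x - y) * pd (ravg m r k) j x ∂m := by
      unfold cv
      rw [← integral_const_mul, ← integral_sub (i0.const_mul _) iA, ← integral_mul_const]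
      refine integral_congr_ae (Eventually.of_forall fun y => ?_)
      simp only; ring
    have i1 : Integrable (fun y => C * (η * N ^ 2 * (k (x - y) * ‖x - y‖ ^ 2))) m :=
      (hx.const_mul _).const_mul _
    have i2 : Integrable (fun y => C * (pd (ravg m r k) j x ^ 2 / (4 * (η * N ^ 2))
      * (1 * k (x - y)))) m := (i0.const_mul _).const_mul _
    rw [e1]
    calc _ ≤ ∫ y, (C * (η * N ^ 2 * (k (x - y) * ‖x - y‖ ^ 2)) +
          C * (pd (ravg m r k) j x ^ 2 / (4 * (η * N ^ 2)) * (1 * k (x - y)))) ∂m := by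
          refine (abs_integral_le_integral_abs).trans (integral_mono_of_nonneg
            (Eventually.of_forall fun y => abs_nonneg _) (i1.add i2)
            (Eventually.of_forall fun y => ?_))
          simp only
          rw [abs_mul, abs_mul, abs_of_pos (hk.pos _)]
          have yy := mul_le_young (α := η * N ^ 2) (by positivity) ‖x - y‖ |pd (ravg m r k) j x|
          rw [sq_abs] at yy
          have hkp := hk.pos (x - y)
          calc _ ≤ C * ‖x - y‖ * k (x - y) * |pd (ravg m r k) j x| := by
                refine mul_le_mul_of_nonneg_right (mul_le_mul_of_nonneg_right (hc.lip x y i j)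
                  hkp.le) (abs_nonneg _)
            _ = C * k (x - y) * (‖x - y‖ * |pd (ravg m r k) j x|) := by ring
            _ ≤ C * k (x - y) * (η * N ^ 2 * ‖x - y‖ ^ 2
                + pd (ravg m r k) j x ^ 2 / (4 * (η * N ^ 2))) :=
                mul_le_mul_of_nonneg_left yy (by positivity)
            _ = _ := by ring
      _ = C * (η * N ^ 2 * (∫ y, k (x - y) * ‖x - y‖ ^ 2 ∂m)
          + (cv m (fun _ => 1) k x * pd (ravg m r k) j x ^ 2) / (4 * (η * N ^ 2))) := by
          rw [integral_add i1 i2]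
          simp_rw [integral_const_mul]
          unfold cv
          simp only [integral_const_mul]
          ring
      _ ≤ _ := by
          refine mul_le_mul_of_nonneg_left (add_le_add le_rfl ?_) (by linarith)
          rw [div_le_div_iff₀ (by positivity) (by positivity)]
          have := mul_sq_pd_ravg_le hc hk hm hb2 hr hr1 j x
          calc _ ≤ (c * N) ^ 2 * lvar m r bb k x * (4 * η) :=
                mul_le_mul_of_nonneg_right this (by positivity)
            _ = _ := by ring
  have e2 : flux A β m r k i x - ravg m r k x * flux A β m (fun _ => 1) k i x
      - ∑ j, cv m (fun y => A y i j) k x * pd (ravg m r k) j x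
      = (flux A β m r k i x - ravg m r k x * flux A β m (fun _ => 1) k i x
      - cv m (fun _ => 1) k x * ∑ j, A x i j * pd (ravg m r k) j x)
      + ∑ j, (A x i j * cv m (fun _ => 1) k x - cv m (fun y => A y i j) k x)
      * pd (ravg m r k) j x := by
    simp only [sub_mul, Finset.sum_sub_distrib, Finset.mul_sum]
    have : ∑ j, cv m (fun _ => 1) k x * (A x i j * pd (ravg m r k) j x)
        = ∑ j, A x i j * cv m (fun _ => 1) k x * pd (ravg m r k) j x :=
      Finset.sum_congr rfl fun j _ => by ring
    rw [this]; ring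
  rw [e2]
  refine (abs_add_le _ _).trans (add_le_add (e.trans (mul_le_mul_of_nonneg_left ?_
    (by positivity))) ?_)
  · linarith
  · refine (Finset.abs_sum_le_sum_abs _ _).trans ((Finset.sum_le_sum fun j _ => hj j).trans_eq ?_)
    simp

end

section

variable {A : Ed d → Matrix (Fin d) (Fin d) ℝ} {β : Ed d → Ed d} {bb : Ed d → ℝ} {C : ℝ}
  {m : Measure (Ed d)} [IsFiniteMeasure m] {k r : Ed d → ℝ} {c N : ℝ}

lemma integral_mul_cv (hk : IsKer k c N) {G w : Ed d → ℝ} {K : ℝ} (hG : Measurable G)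
    (hGb : ∀ x, |G x| ≤ K) (hw : Measurable w) (hwi : Integrable w m) :
    Integrable (fun x => G x * cv m w k x) ∧
    ∫ p : Ed d × Ed d, k (p.1 - p.2) * (G p.1 * w p.2) ∂(volume.prod m)
      = ∫ x, G x * cv m w k x := by
  have i := integrable_ker_prod (m := m) hk (f := fun p => G p.1 * w p.2)
    (g := fun y => K * |w y|) (hwi.abs.const_mul K)
    ((hG.comp measurable_fst).mul (hw.comp measurable_snd)) fun x y => by
      simp only [abs_mul]
      exact mul_le_mul_of_nonneg_right (hGb x) (abs_nonneg _)
  have e : ∀ x, ∫ y, k (x - y) * (G x * w y) ∂m = G x * cv m w k x := fun x => by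
    rw [cv, ← integral_const_mul]
    exact integral_congr_ae (Eventually.of_forall fun y => by simp only; ring)
  refine ⟨?_, ?_⟩
  · simpa only [e] using i.integral_prod_left
  · rw [integral_prod _ i]
    exact integral_congr_ae (Eventually.of_forall fun x => e x)

lemma integral_cv_one (hk : IsKer k c N) :
    Integrable (cv m (fun _ => 1) k) ∧ ∫ x, cv m (fun _ => 1) k x = m.real univ := by
  have h := integral_mul_cv (m := m) hk (G := fun _ => 1) (w := fun _ => 1) (K := 1)
    measurable_const (by simp) measurable_const (integrable_const _)
  have h2 := integral_ker_snd (m := m) hk (g := fun _ => 1) (integrable_const _)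
  simp only [one_mul, mul_one, integral_const, smul_eq_mul] at h h2
  exact ⟨h.1, by rw [← h.2, h2]⟩

lemma integral_lvar (hk : IsKer k c N) (hb : Continuous bb)
    (hb2 : Integrable (fun y => bb y ^ 2) m) (hr : Measurable r) (hr1 : ∀ y, |r y| ≤ 1) :
    Integrable (lvar m r bb k) ∧ ∫ x, lvar m r bb k x = kvar m r bb k := by
  have i := integrable_ker_prod (m := m) hk
    (f := fun p => bb p.2 ^ 2 * (r p.2 - ravg m r k p.1) ^ 2)
    (g := fun y => bb y ^ 2 * 4) (hb2.mul_const 4)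
    (((hb.pow 2).measurable.comp measurable_snd).mul ((measurable_sub_ravg hk hr hr1).pow_const 2))
    fun x y => by
      simp only
      rw [abs_of_nonneg (by positivity)]
      exact mul_le_mul_of_nonneg_left (sq_sub_ravg_le hk hr1 x y) (sq_nonneg _)
  have e : ∀ x, ∫ y, k (x - y) * (bb y ^ 2 * (r y - ravg m r k x) ^ 2) ∂m = lvar m r bb k x :=
    fun x => by
    rw [lvar, cv]
    exact integral_congr_ae (Eventually.of_forall fun y => by simp only; ring)
  refine ⟨?_, ?_⟩
  · simpa only [e] using i.integral_prod_left
  · rw [kvar, integral_prod _ i]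
    exact (integral_congr_ae (Eventually.of_forall fun x => e x)).symm

variable {Ξ Ξ1 Ξ2 : ℝ → ℝ} {B : ℝ}

lemma Entropy.kato_mollified (hE : Entropy Ξ Ξ1 Ξ2 B) (hc : Coef A β bb C) (hk : IsKer k c N)
    (hm : m ≠ 0) (hb2 : Integrable (fun y => bb y ^ 2) m) (hr : Measurable r)
    (hr1 : ∀ y, |r y| ≤ 1) {h : ℝ} (hh : 0 ≤ h) {m' : Measure (Ed d)} [IsFiniteMeasure m']
    {r' : Ed d → ℝ} (hr' : Measurable r') (hr1' : ∀ y, |r' y| ≤ 1)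
    (Hm : ∀ φ M, Cb2 φ M → ∫ x, φ x ∂m - h * ∫ x, Lop A β φ x ∂m = ∫ x, φ x ∂m')
    (Hs : ∀ φ M, Cb2 φ M → ∫ x, r x * φ x ∂m - h * ∫ x, r x * Lop A β φ x ∂m
      = ∫ x, r' x * φ x ∂m')
    {φ : Ed d → ℝ} {M : ℝ} (hφ : Cb2 φ M) (hs : HasCompactSupport φ) (h0 : ∀ x, 0 ≤ φ x)
    {η : ℝ} (hη : 0 < η) :
    ∫ p : Ed d × Ed d, k (p.1 - p.2) * (φ p.1 * 1 * Ξ (ravg m r k p.1)) ∂(volume.prod m)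
      ≤ ∫ p : Ed d × Ed d, k (p.1 - p.2) * (φ p.1 * |r' p.2|) ∂(volume.prod m')
        + h * ((∑ i, ((∑ j, ∫ p : Ed d × Ed d, k (p.1 - p.2) *
            (pd (pd φ i) j p.1 * A p.2 i j * Ξ (ravg m r k p.1)) ∂(volume.prod m))
          + ∫ p : Ed d × Ed d, k (p.1 - p.2) *
            (pd φ i p.1 * β p.2 i * Ξ (ravg m r k p.1)) ∂(volume.prod m)))
          + (d * (M * ((d * C * c + 1) * (η * m.real univ + kvar m r bb k / (4 * η))
            + d * (C * (η * (m.real univ * c) + c ^ 2 * kvar m r bb k / (4 * η)))))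
          + M * B * (d * (C * (d * C * c + 1) ^ 2) * kvar m r bb k))) := by
  obtain ⟨Mk, -, hMk⟩ := hk.exists_bound
  have hb := hc.integrable_bb hb2
  have ir := integrable_of_abs_le_one (m := m) hr hr1
  have hM := hφ.nonneg
  have hC := hc.one_le
  have hc1 := hk.one_le_c
  have hN := hk.one_le
  set R := ravg m r k with hR
  have cR : ContDiff ℝ 1 R := contDiff_ravg hk hm ir
  have hR1 : ∀ x, |R x| ≤ 1 := abs_ravg_le_one hk hr1
  have hΞR : ∀ x, |Ξ (R x)| ≤ 1 := fun x => by
    have := hE.lip (R x) 0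
    rw [hE.zero, sub_zero, sub_zero] at this
    exact this.trans (hR1 x)
  have cΞ : Continuous fun x => Ξ (R x) := hE.contDiff.continuous.comp cR.continuous
  have cΞ1 : Continuous fun x => Ξ1 (R x) := hE.contDiff_deriv.continuous.comp cR.continuous
  have cΞ2 : Continuous fun x => Ξ2 (R x) := hE.cont.comp cR.continuous
  have hb' : Integrable (fun y => r y * bb y) m :=
    hb.bdd_mul hr.aestronglyMeasurable (Eventually.of_forall hr1)
  have hb1 : Integrable (fun y => (fun _ => (1 : ℝ)) y * bb y) m := by simpa using hb
  have iA : ∀ i j, Integrable (fun y => A y i j) m := fun i j => by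
    simpa using hc.integrable_A (integrable_const (1 : ℝ)) i j
  have iβ : ∀ i, Integrable (fun y => β y i) m := fun i => by
    simpa using hc.integrable_β hb1 aestronglyMeasurable_const i
  have cs : ∀ i, ContDiff ℝ 1 (flux A β m r k i) :=
    contDiff_flux hc hMk hb' hr.aestronglyMeasurable
  have cm : ∀ i, ContDiff ℝ 1 (flux A β m (fun _ => 1) k i) :=
    contDiff_flux hc hMk hb1 aestronglyMeasurable_const
  have cq : ∀ i j, ContDiff ℝ 1 (cv m (fun y => A y i j) k) := fun i j =>
    contDiff_cv (iA i j) hMk.cb1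
  have hbq : ∀ i x, flux A β m (fun _ => 1) k i x
      = (∑ j, pd (cv m (fun y => A y i j) k) j x) - cv m (fun y => β y i) k x := fun i x => by
    simp_rw [pd_cv (iA i _) hMk.cb1]
    simp [flux]
  have ibp := hE.integral_by_parts hφ.contDiff hs cR cs cm cq hbq
  -- pointwise inequality
  have hpt : ∀ x, φ x * Ξ (R x) * cv m (fun _ => 1) k x ≤ φ x * cv m' (fun y => |r' y|) k x
      + h * (φ x * (Ξ1 (R x) * ∑ i, pd (flux A β m r k i) i x + (Ξ (R x) - R x * Ξ1 (R x)) *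
        ∑ i, pd (flux A β m (fun _ => 1) k i) i x)) := fun x => by
    have e1 := Hs _ _ (hMk.comp_sub_left x).1
    have e2 := Hm _ _ (hMk.comp_sub_left x).1
    rw [← div_flux hc hMk hb' hr.aestronglyMeasurable x] at e1
    have e3 := div_flux hc hMk hb1 aestronglyMeasurable_const x
    simp only [one_mul] at e3
    rw [← e3] at e2
    have e4 : ∫ y, k (x - y) ∂m = cv m (fun _ => 1) k x := by simp [cv]
    rw [e4] at e2
    have e5 := ravg_mul (m := m) (r := r) hk hm x
    have e6 : ∫ y, r y * k (x - y) ∂m = cv m r k x := rfl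
    rw [e6, ← e5] at e1
    have e7 : |∫ y, r' y * k (x - y) ∂m'| ≤ cv m' (fun y => |r' y|) k x :=
      abs_cv_le hk (integrable_of_abs_le_one hr' hr1').abs (fun y => le_rfl) x
    have e8 : 0 ≤ ∫ y, k (x - y) ∂m' := integral_nonneg fun y => (hk.pos _).le
    have e9 : Ξ1 (R x) * ∫ y, r' y * k (x - y) ∂m' ≤ cv m' (fun y => |r' y|) k x := by
      refine (le_abs_self _).trans ?_
      rw [abs_mul]
      calc _ ≤ 1 * |∫ y, r' y * k (x - y) ∂m'| :=
            mul_le_mul_of_nonneg_right (hE.abs_le _) (abs_nonneg _)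
        _ ≤ _ := by rw [one_mul]; exact e7
    have e10 := mul_nonpos_of_nonpos_of_nonneg (hE.sub_le (R x)) e8
    rw [← e1] at e9
    rw [← e2] at e10
    have := mul_le_mul_of_nonneg_left (add_le_add e9 e10) (h0 x)
    nlinarith
  -- error bounds
  have hae : ∀ᵐ x : Ed d, Integrable (fun y => k (x - y) * ‖x - y‖ ^ 2) m :=
    (integrable_ker_norm_sq (m := m) hk).prod_right_ae
  set J : Ed d → ℝ := fun x => ∑ i, ((∑ j, pd (pd φ i) j x * Ξ (R x) * cv m (fun y => A y i j) k x)
    + pd φ i x * Ξ (R x) * cv m (fun y => β y i) k x) with hJ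
  set D : ℝ := d * C * c + 1 with hD
  have hD0 : 0 < D := by positivity
  have hB0 : 0 ≤ B := (hE.nonneg 0).trans (hE.le 0)
  set E : Ed d → ℝ := fun x => d * (M * (D * (η * cv m (fun _ => 1) k x
      + lvar m r bb k x / (4 * η)) + d * (C * (η * N ^ 2 * (∫ y, k (x - y) * ‖x - y‖ ^ 2 ∂m)
          + c ^ 2 * lvar m r bb k x / (4 * η)))))
      + M * B * (d * (C * D ^ 2) * lvar m r bb k x) with hEd
  have herr : ∀ᵐ x : Ed d, (∑ i, ((∑ j, pd (pd φ i) j x * Ξ (R x) * cv m (fun y => A y i j) k x)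
        + pd φ i x * Ξ (R x) * cv m (fun y => β y i) k x
        - pd φ i x * (Ξ1 (R x) * (flux A β m r k i x - R x * flux A β m (fun _ => 1) k i x
          - ∑ j, cv m (fun y => A y i j) k x * pd R j x))
        - φ x * Ξ2 (R x) * (pd R i x * (flux A β m r k i x
          - R x * flux A β m (fun _ => 1) k i x)))) ≤ J x + E x := by
    filter_upwards [hae] with x hx
    have h1 : ∀ i, -(pd φ i x * (Ξ1 (R x) * (flux A β m r k i x
        - R x * flux A β m (fun _ => 1) k i x - ∑ j, cv m (fun y => A y i j) k x * pd R j x)))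
        ≤ M * (D * (η * cv m (fun _ => 1) k x
      + lvar m r bb k x / (4 * η)) + d * (C * (η * N ^ 2 * (∫ y, k (x - y) * ‖x - y‖ ^ 2 ∂m)
          + c ^ 2 * lvar m r bb k x / (4 * η)))) := fun i => by
      have e1 := abs_flux_error_le' hc hk hm hb2 hr hr1 i hx hη
      refine (neg_le_abs _).trans ?_
      rw [abs_mul, abs_mul]
      refine mul_le_mul (hφ.bound_pd i x) ?_ (by positivity) hM
      calc _ ≤ 1 * _ := mul_le_mul_of_nonneg_right (hE.abs_le _) (abs_nonneg _)
        _ ≤ _ := by rw [one_mul]; exact e1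
    have hl0 : 0 ≤ lvar m r bb k x := cv_nonneg hk (fun y => by positivity) x
    have h2 : φ x * Ξ2 (R x) * -∑ i, (pd R i x * (flux A β m r k i x
          - R x * flux A β m (fun _ => 1) k i x)) ≤ M * B * (d * (C * D ^ 2) * lvar m r bb k x) := by
      refine (mul_le_mul_of_nonneg_left (neg_sum_mul_flux_le hc hk hm hb2 hr hr1 x)
        (mul_nonneg (h0 x) (hE.nonneg _))).trans ?_
      refine mul_le_mul_of_nonneg_right ?_ (by positivity)
      exact mul_le_mul ((le_abs_self _).trans (hφ.bound x)) (hE.le _) (hE.nonneg _) hM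
    have h3 := Finset.sum_le_sum fun i (_ : i ∈ Finset.univ) => h1 i
    simp only [Finset.sum_const, Finset.card_univ, Fintype.card_fin, nsmul_eq_mul,
      Finset.sum_neg_distrib] at h3
    rw [Finset.sum_sub_distrib, Finset.sum_sub_distrib, ← Finset.mul_sum]
    simp only [hJ, hEd]
    linarith
  -- integrability
  have sP : ∀ i, HasCompactSupport (pd φ i) := hasCompactSupport_pd hs
  have sPP : ∀ i j, HasCompactSupport (pd (pd φ i) j) := fun i j => hasCompactSupport_pd (sP i) j
  have cP : ∀ i, ContDiff ℝ 1 (pd φ i) := contDiff_one_pd hφ.contDiff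
  have cPP : ∀ i j, Continuous (pd (pd φ i) j) := fun i j => continuous_pd (cP i) j
  have mA : ∀ i j, Measurable fun y => A y i j := fun i j => (hc.continuous_A i j).measurable
  have mβ : ∀ i, Measurable fun y => β y i := hc.measurable_β
  have prodb : ∀ {g : Ed d → ℝ}, (∀ x, |g x| ≤ M) → ∀ x, |g x * Ξ (R x)| ≤ M := fun hg x => by
    rw [abs_mul]
    calc _ ≤ M * 1 := mul_le_mul (hg x) (hΞR x) (abs_nonneg _) hM
      _ = M := mul_one M
  have t1 := integral_mul_cv (m := m) hk (G := fun x => φ x * Ξ (R x)) (w := fun _ => 1)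
    (hφ.contDiff.continuous.mul cΞ).measurable (prodb hφ.bound) measurable_const
    (integrable_const _)
  have t2 := integral_mul_cv (m := m') hk (G := φ) (w := fun y => |r' y|)
    hφ.contDiff.continuous.measurable hφ.bound hr'.abs (integrable_of_abs_le_one hr' hr1').abs
  have t3 := fun i j => integral_mul_cv (m := m) hk (G := fun x => pd (pd φ i) j x * Ξ (R x))
    (w := fun y => A y i j) ((cPP i j).mul cΞ).measurable (prodb (hφ.bound_pd_pd j i))
    (mA i j) (iA i j)
  have t4 := fun i => integral_mul_cv (m := m) hk (G := fun x => pd φ i x * Ξ (R x))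
    (w := fun y => β y i) ((cP i).continuous.mul cΞ).measurable (prodb (hφ.bound_pd i))
    (mβ i) (iβ i)
  have iJ1 : ∀ i, Integrable fun x => ∑ j, pd (pd φ i) j x * Ξ (R x) * cv m (fun y => A y i j) k x :=
    fun i => integrable_finsetSum _ fun j _ => (t3 i j).1
  have iJ2 : ∀ i, Integrable fun x => (∑ j, pd (pd φ i) j x * Ξ (R x) *
      cv m (fun y => A y i j) k x) + pd φ i x * Ξ (R x) * cv m (fun y => β y i) k x :=
    fun i => (iJ1 i).add (t4 i).1
  have iJ : Integrable J := integrable_finsetSum _ fun i _ => iJ2 i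
  have eJ : ∫ x, J x = ∑ i, ((∑ j, ∫ p : Ed d × Ed d, k (p.1 - p.2) *
            (pd (pd φ i) j p.1 * A p.2 i j * Ξ (R p.1)) ∂(volume.prod m))
          + ∫ p : Ed d × Ed d, k (p.1 - p.2) *
            (pd φ i p.1 * β p.2 i * Ξ (R p.1)) ∂(volume.prod m)) := by
    simp only [hJ]
    rw [integral_finsetSum _ fun i _ => iJ2 i]
    refine Finset.sum_congr rfl fun i _ => ?_
    rw [integral_add (iJ1 i) (t4 i).1, integral_finsetSum _ fun j _ => (t3 i j).1, ← (t4 i).2]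
    congr 1
    · refine Finset.sum_congr rfl fun j _ => ?_
      rw [← (t3 i j).2]
      exact integral_congr_ae (Eventually.of_forall fun p => by simp only; ring)
    · exact integral_congr_ae (Eventually.of_forall fun p => by simp only; ring)
  have l := integral_lvar hk hc.cont hb2 hr hr1
  have o := integral_cv_one (m := m) hk
  have w := (integrable_ker_norm_sq (m := m) hk).integral_prod_left
  have iE1 : Integrable fun x => η * cv m (fun _ => 1) k x + lvar m r bb k x / (4 * η) :=
    (o.1.const_mul _).add (l.1.div_const _)
  have iE2 : Integrable fun x => η * N ^ 2 * (∫ y, k (x - y) * ‖x - y‖ ^ 2 ∂m)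
          + c ^ 2 * lvar m r bb k x / (4 * η) := (w.const_mul _).add ((l.1.const_mul _).div_const _)
  have iE3 : Integrable fun x => D * (η * cv m (fun _ => 1) k x
      + lvar m r bb k x / (4 * η)) + d * (C * (η * N ^ 2 * (∫ y, k (x - y) * ‖x - y‖ ^ 2 ∂m)
          + c ^ 2 * lvar m r bb k x / (4 * η))) :=
    (iE1.const_mul _).add ((iE2.const_mul _).const_mul _)
  have iE4 : Integrable fun x => d * (M * (D * (η * cv m (fun _ => 1) k x
      + lvar m r bb k x / (4 * η)) + d * (C * (η * N ^ 2 * (∫ y, k (x - y) * ‖x - y‖ ^ 2 ∂m)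
          + c ^ 2 * lvar m r bb k x / (4 * η))))) := (iE3.const_mul _).const_mul _
  have iE5 : Integrable fun x => M * B * (d * (C * D ^ 2) * lvar m r bb k x) :=
    (l.1.const_mul _).const_mul _
  have iE : Integrable E := iE4.add iE5
  have eE : ∫ x, E x ≤ d * (M * (D * (η * m.real univ + kvar m r bb k / (4 * η))
            + d * (C * (η * (m.real univ * c) + c ^ 2 * kvar m r bb k / (4 * η)))))
          + M * B * (d * (C * D ^ 2) * kvar m r bb k) := by
    simp only [hEd]
    rw [integral_add iE4 iE5, integral_const_mul, integral_const_mul,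
      integral_add (iE1.const_mul _) ((iE2.const_mul _).const_mul _), integral_const_mul,
      integral_const_mul, integral_const_mul,
      integral_add (o.1.const_mul _) (l.1.div_const _),
      integral_add (w.const_mul _) ((l.1.const_mul _).div_const _), integral_const_mul,
      integral_const_mul, integral_const_mul, integral_div, integral_div, integral_const_mul,
      integral_const_mul, l.2, o.2]
    have := integral_ker_norm_sq (m := m) hk
    rw [integral_prod _ (integrable_ker_norm_sq hk)] at this
    have h5 : η * N ^ 2 * ∫ x, ∫ y, k (x - y) * ‖x - y‖ ^ 2 ∂m ≤ η * (m.real univ * c) := by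
      refine (mul_le_mul_of_nonneg_left this (by positivity)).trans_eq ?_
      have : N ≠ 0 := (by linarith : 0 < N).ne'
      field_simp
    gcongr
  -- conclusion
  have cflux : ∀ i, Continuous (flux A β m r k i) := fun i => (cs i).continuous
  have cflux' : ∀ i, Continuous (flux A β m (fun _ => 1) k i) := fun i => (cm i).continuous
  have iI : Integrable fun x => φ x * (Ξ1 (R x) * ∑ i, pd (flux A β m r k i) i x
      + (Ξ (R x) - R x * Ξ1 (R x)) * ∑ i, pd (flux A β m (fun _ => 1) k i) i x) := by
    have c1 : ∀ i, Continuous (pd (flux A β m r k i) i) := fun i => continuous_pd (cs i) i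
    have c2 : ∀ i, Continuous (pd (flux A β m (fun _ => 1) k i) i) :=
      fun i => continuous_pd (cm i) i
    have c3 := cR.continuous
    refine (hφ.contDiff.continuous.mul ?_).integrable_of_hasCompactSupport hs.mul_right
    exact (cΞ1.mul (continuous_finsetSum _ fun i _ => c1 i)).add
      ((cΞ.sub (c3.mul cΞ1)).mul (continuous_finsetSum _ fun i _ => c2 i))
  have iK : Integrable fun x => (∑ i, ((∑ j, pd (pd φ i) j x * Ξ (R x) *
        cv m (fun y => A y i j) k x) + pd φ i x * Ξ (R x) * cv m (fun y => β y i) k x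
        - pd φ i x * (Ξ1 (R x) * (flux A β m r k i x - R x * flux A β m (fun _ => 1) k i x
          - ∑ j, cv m (fun y => A y i j) k x * pd R j x))
        - φ x * Ξ2 (R x) * (pd R i x * (flux A β m r k i x
          - R x * flux A β m (fun _ => 1) k i x)))) := by
    have c3 := cR.continuous
    have c4 : ∀ i, Continuous (pd R i) := fun i => continuous_pd cR i
    refine integrable_finsetSum _ fun i _ => ((iJ2 i).sub ?_).sub ?_
    · refine ((cP i).continuous.mul (cΞ1.mul (((cflux i).sub (c3.mul (cflux' i))).sub
        (continuous_finsetSum _ fun j _ => (cq i j).continuous.mul (c4 j))))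
        ).integrable_of_hasCompactSupport (sP i).mul_right
    · refine ((hφ.contDiff.continuous.mul cΞ2).mul ((c4 i).mul ((cflux i).sub
        (c3.mul (cflux' i))))).integrable_of_hasCompactSupport hs.mul_right.mul_right
  have f1 := integral_mono t1.1 (t2.1.add (iI.const_mul h)) hpt
  rw [integral_add' t2.1 (iI.const_mul h), integral_const_mul, ibp, ← t2.2] at f1
  have f2 := integral_mono_ae iK (iJ.add iE) herr
  rw [integral_add' iJ iE, eJ] at f2
  have f3 : ∫ p : Ed d × Ed d, k (p.1 - p.2) * (φ p.1 * 1 * Ξ (R p.1)) ∂(volume.prod m)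
      = ∫ x, φ x * Ξ (R x) * cv m (fun _ => 1) k x := by
    rw [← t1.2]
    exact integral_congr_ae (Eventually.of_forall fun p => by simp only; ring)
  rw [f3]
  refine f1.trans (add_le_add le_rfl (mul_le_mul_of_nonneg_left ?_ hh))
  linarith

end

section

variable {A : Ed d → Matrix (Fin d) (Fin d) ℝ} {β : Ed d → Ed d} {bb : Ed d → ℝ} {C : ℝ}
  {m : Measure (Ed d)} [IsFiniteMeasure m] {r : Ed d → ℝ} {Ξ Ξ1 Ξ2 : ℝ → ℝ} {B : ℝ}

lemma le_of_forall_le_add_mul {a b K : ℝ} (h : ∀ η : ℝ, 0 < η → a ≤ b + η * K) : a ≤ b := by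
  have t : Tendsto (fun η : ℝ => b + η * K) (𝓝[>] 0) (𝓝 (b + 0 * K)) :=
    ((continuous_const.add (continuous_id.mul continuous_const)).tendsto 0).mono_left
      nhdsWithin_le_nhds
  rw [zero_mul, add_zero] at t
  exact ge_of_tendsto t (eventually_nhdsWithin_of_forall fun η hη => h η hη)

lemma Coef.integrable_Lop (hc : Coef A β bb C) (hb : Integrable bb m) {φ : Ed d → ℝ} {M : ℝ}
    (hφ : Cb2 φ M) : Integrable (Lop A β φ) m :=
  (hb.const_mul ((d * d * C + d) * |M|)).mono' (hc.measurable_Lop hφ.contDiff).aestronglyMeasurable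
    (Eventually.of_forall fun x =>
      hc.abs_Lop_le hφ.contDiff (fun i => hφ.bound_pd i x) (fun i j => hφ.bound_pd_pd i j x))

lemma Entropy.kato (hE : Entropy Ξ Ξ1 Ξ2 B) (hc : Coef A β bb C)
    (hm : m ≠ 0) (hb2 : Integrable (fun y => bb y ^ 2) m) (hr : Measurable r)
    (hr1 : ∀ y, |r y| ≤ 1) {h : ℝ} (hh : 0 ≤ h) {m' : Measure (Ed d)} [IsFiniteMeasure m']
    {r' : Ed d → ℝ} (hr' : Measurable r') (hr1' : ∀ y, |r' y| ≤ 1)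
    (Hm : ∀ φ M, Cb2 φ M → ∫ x, φ x ∂m - h * ∫ x, Lop A β φ x ∂m = ∫ x, φ x ∂m')
    (Hs : ∀ φ M, Cb2 φ M → ∫ x, r x * φ x ∂m - h * ∫ x, r x * Lop A β φ x ∂m
      = ∫ x, r' x * φ x ∂m')
    {φ : Ed d → ℝ} {M : ℝ} (hφ : Cb2 φ M) (hs : HasCompactSupport φ) (h0 : ∀ x, 0 ≤ φ x) :
    ∫ x, φ x * Ξ (r x) ∂m ≤ ∫ x, φ x * |r' x| ∂m' + h * ∫ x, Lop A β φ x * Ξ (r x) ∂m := by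
  obtain ⟨c, κ, hκ⟩ := exists_ker d
  have hb := hc.integrable_bb hb2
  have hC := hc.one_le
  have hb2' : Integrable (fun y => (C * bb y) ^ 2) m := by
    simpa only [mul_pow] using hb2.const_mul (C ^ 2)
  have hbC : Continuous fun y => C * bb y := continuous_const.mul hc.cont
  have hCb : ∀ y, bb y ≤ C * bb y := fun y => by nlinarith [hc.one_le_bb y]
  have cΞ := hE.contDiff.continuous
  have sP : ∀ i, HasCompactSupport (pd φ i) := hasCompactSupport_pd hs
  have sPP : ∀ i j, HasCompactSupport (pd (pd φ i) j) := fun i j => hasCompactSupport_pd (sP i) j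
  have cP : ∀ i, ContDiff ℝ 1 (pd φ i) := contDiff_one_pd hφ.contDiff
  have cPP : ∀ i j, Continuous (pd (pd φ i) j) := fun i j => continuous_pd (cP i) j
  have hm' : m' ≠ 0 := fun h' => by
    have e := Hm _ _ (Cb2.const (d := d) 1)
    have : ∀ x, Lop A β (fun _ => (1 : ℝ)) x = 0 := fun x => Lop_const A β 1 x
    simp only [this, integral_zero, mul_zero, sub_zero, integral_const, smul_eq_mul, mul_one, h',
      measureReal_zero_apply] at e
    rw [measureReal_eq_zero_iff] at e
    exact hm (Measure.measure_univ_eq_zero.1 e)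
  have T1 := tendsto_integral_ker_main hκ hm hr hr1 hbC hb2' hφ.contDiff.continuous hs
    (w := fun _ => 1) measurable_const (fun y => by
      rw [abs_one]; exact (hc.one_le_bb y).trans (hCb y)) cΞ hE.lip hE.zero
  have T2 : Tendsto (fun n => ∫ p : Ed d × Ed d, κ n (p.1 - p.2) * (φ p.1 * |r' p.2|)
      ∂(volume.prod m')) atTop (𝓝 (∫ x, φ x * |r' x| ∂m')) := by
    have := tendsto_integral_ker_main hκ hm' (r := fun _ => 1) (bb := fun _ => 1) measurable_const
      (fun y => abs_one.le) continuous_const (integrable_const _) hφ.contDiff.continuous hs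
      (w := fun y => |r' y|) hr'.abs (fun y => by rw [abs_abs]; exact hr1' y)
      (ξ := id) continuous_id (fun _ _ => le_rfl) rfl
    have e : ∀ n x, ravg m' (fun _ => 1) (κ n) x = 1 := fun n x =>
      div_self (cv_one_pos (hκ n) hm' x).ne'
    simpa only [e, id, mul_one] using this
  have T3 := fun i j => tendsto_integral_ker_main hκ hm hr hr1 hbC hb2' (cPP i j) (sPP i j)
    (w := fun y => A y i j) (hc.continuous_A i j).measurable (fun y => (hc.bdd y i j).trans (by
      nlinarith [hc.one_le_bb y])) cΞ hE.lip hE.zero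
  have T4 := fun i => tendsto_integral_ker_main hκ hm hr hr1 hbC hb2' (cP i).continuous (sP i)
    (w := fun y => β y i) (hc.measurable_β i) (fun y => (hc.le y i).trans (hCb y))
    cΞ hE.lip hE.zero
  have Tv := tendsto_kvar hκ hm hr hr1 hc.cont hb2
  have hΞ : ∀ y, |Ξ (r y)| ≤ 1 := fun y => by
    have := hE.lip (r y) 0
    rw [hE.zero, sub_zero, sub_zero] at this
    exact this.trans (hr1 y)
  have mΞ : Measurable fun y => Ξ (r y) := cΞ.measurable.comp hr
  have eL : ∫ x, Lop A β φ x * Ξ (r x) ∂m = ∑ i, ((∑ j, ∫ y, pd (pd φ i) j y * A y i j * Ξ (r y) ∂m)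
      + ∫ y, pd φ i y * β y i * Ξ (r y) ∂m) := by
    have iA : ∀ i j, Integrable (fun y => pd (pd φ i) j y * A y i j * Ξ (r y)) m := fun i j => by
      refine ((integrable_const (M * C)).mono' (((cPP i j).measurable.mul
        (hc.continuous_A i j).measurable).mul mΞ).aestronglyMeasurable
        (Eventually.of_forall fun y => ?_))
      rw [Real.norm_eq_abs, abs_mul, abs_mul]
      calc _ ≤ (M * C) * 1 := mul_le_mul (mul_le_mul (hφ.bound_pd_pd j i y) (hc.bdd y i j)
            (abs_nonneg _) hφ.nonneg) (hΞ y) (abs_nonneg _)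
            (mul_nonneg hφ.nonneg (by linarith))
        _ = _ := mul_one _
    have iβ : ∀ i, Integrable (fun y => pd φ i y * β y i * Ξ (r y)) m := fun i => by
      refine ((hb.const_mul M).mono' (((cP i).continuous.measurable.mul
        (hc.measurable_β i)).mul mΞ).aestronglyMeasurable (Eventually.of_forall fun y => ?_))
      rw [Real.norm_eq_abs, abs_mul, abs_mul]
      calc _ ≤ (M * bb y) * 1 := mul_le_mul (mul_le_mul (hφ.bound_pd i y) (hc.le y i)
            (abs_nonneg _) hφ.nonneg) (hΞ y) (abs_nonneg _)
            (mul_nonneg hφ.nonneg (by linarith [hc.one_le_bb y]))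
        _ = _ := mul_one _
    have iS : ∀ i, Integrable (fun y => ∑ j, pd (pd φ i) j y * A y i j * Ξ (r y)) m := fun i =>
      integrable_finsetSum _ fun j _ => iA i j
    have i5 : ∀ i, Integrable (fun y => (∑ j, pd (pd φ i) j y * A y i j * Ξ (r y))
        + pd φ i y * β y i * Ξ (r y)) m := fun i => (iS i).add (iβ i)
    have e1 : ∀ i, (∑ j, ∫ y, pd (pd φ i) j y * A y i j * Ξ (r y) ∂m)
        + ∫ y, pd φ i y * β y i * Ξ (r y) ∂m = ∫ y, ((∑ j, pd (pd φ i) j y * A y i j * Ξ (r y))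
        + pd φ i y * β y i * Ξ (r y)) ∂m := fun i => by
      rw [integral_add (iS i) (iβ i), integral_finsetSum _ fun j _ => iA i j]
    rw [Finset.sum_congr rfl fun i _ => e1 i, ← integral_finsetSum _ fun i _ => i5 i]
    refine integral_congr_ae (Eventually.of_forall fun x => ?_)
    simp only [Lop_eq A β hφ.contDiff]
    rw [Finset.sum_add_distrib, add_mul, Finset.sum_mul, Finset.sum_mul]
    congr 1
    · refine Finset.sum_congr rfl fun i _ => ?_
      rw [Finset.sum_mul]
      refine Finset.sum_congr rfl fun j _ => ?_
      rw [pd_pd_comm hφ.contDiff]; ring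
    · exact Finset.sum_congr rfl fun i _ => by ring
  refine le_of_forall_le_add_mul (K := h * (d * (M * ((d * C * c + 1) * m.real univ
    + d * (C * (m.real univ * c)))))) fun η hη => ?_
  have lim := T2.add (((tendsto_finsetSum Finset.univ fun i _ =>
    (tendsto_finsetSum Finset.univ fun j _ => T3 i j).add (T4 i)).add
      ((((((Tv.div_const (4 * η)).const_add (η * m.real univ)).const_mul (d * C * c + 1)).add
      ((((((Tv.const_mul (c ^ 2)).div_const (4 * η)).const_add (η * (m.real univ * c))).const_mul C
        ).const_mul (d : ℝ)))).const_mul M).const_mul (d : ℝ) |>.add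
        ((Tv.const_mul (d * (C * (d * C * c + 1) ^ 2))).const_mul (M * B)))).const_mul h)
  have := le_of_tendsto_of_tendsto' T1 lim fun n =>
    hE.kato_mollified hc (hκ n) hm hb2 hr hr1 hh hr' hr1' Hm Hs hφ hs h0 hη
  simp only [mul_one] at this
  refine this.trans_eq ?_
  rw [eL]
  simp only [zero_div, mul_zero, add_zero]
  ring

/-- **Kato's inequality** for the implicit Euler scheme. -/
lemma kato (hc : Coef A β bb C) (hb2 : Integrable (fun y => bb y ^ 2) m) (hr : Measurable r)
    (hr1 : ∀ y, |r y| ≤ 1) {h : ℝ} (hh : 0 ≤ h) {m' : Measure (Ed d)} [IsFiniteMeasure m']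
    {r' : Ed d → ℝ} (hr' : Measurable r') (hr1' : ∀ y, |r' y| ≤ 1)
    (Hm : ∀ φ M, Cb2 φ M → ∫ x, φ x ∂m - h * ∫ x, Lop A β φ x ∂m = ∫ x, φ x ∂m')
    (Hs : ∀ φ M, Cb2 φ M → ∫ x, r x * φ x ∂m - h * ∫ x, r x * Lop A β φ x ∂m
      = ∫ x, r' x * φ x ∂m')
    {φ : Ed d → ℝ} (hφ : ContDiff ℝ 2 φ) (hs : HasCompactSupport φ) (h0 : ∀ x, 0 ≤ φ x) :
    ∫ x, φ x * |r x| ∂m - h * ∫ x, Lop A β φ x * |r x| ∂m ≤ ∫ x, φ x * |r' x| ∂m' := by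
  rcases eq_or_ne m 0 with rfl | hm
  · simp only [integral_zero_measure, mul_zero, sub_zero]
    exact integral_nonneg fun x => mul_nonneg (h0 x) (abs_nonneg _)
  obtain ⟨M, -, hM⟩ := exists_Cb2_of_hasCompactSupport hφ hs
  have hb := hc.integrable_bb hb2
  have iφ : Integrable φ m := hφ.continuous.integrable_of_hasCompactSupport hs
  have iL : Integrable (Lop A β φ) m := hc.integrable_Lop hb hM
  refine le_of_forall_le_add_mul (K := ∫ x, φ x ∂m + h * ∫ x, |Lop A β φ x| ∂m) fun δ hδ => ?_
  have hE := entropy_sqrt hδ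
  have key := hE.kato hc hm hb2 hr hr1 hh hr' hr1' Hm Hs hM hs h0
  have hΞ : ∀ t : ℝ, |t| - δ ≤ √(δ ^ 2 + t ^ 2) - δ ∧ √(δ ^ 2 + t ^ 2) - δ ≤ |t| := fun t => by
    constructor
    · have : |t| ≤ √(δ ^ 2 + t ^ 2) := Real.abs_le_sqrt (by nlinarith)
      linarith
    · have : √(δ ^ 2 + t ^ 2) ≤ |t| + δ := by
        rw [Real.sqrt_le_left (by positivity)]
        nlinarith [sq_abs t, mul_nonneg (abs_nonneg t) hδ.le]
      linarith
  have mΞ : Measurable fun y => √(δ ^ 2 + r y ^ 2) - δ := by fun_prop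
  have hΞ1 : ∀ y, |√(δ ^ 2 + r y ^ 2) - δ| ≤ 1 := fun y => by
    have := hE.lip (r y) 0
    simp only [hE.zero, sub_zero] at this
    exact this.trans (hr1 y)
  have i1 : Integrable (fun x => φ x * |r x|) m :=
    iφ.mul_bdd (c := 1) hr.abs.aestronglyMeasurable (Eventually.of_forall fun y => by
      rw [Real.norm_eq_abs, abs_abs]; exact hr1 y)
  have i2 : Integrable (fun x => Lop A β φ x * |r x|) m :=
    iL.mul_bdd (c := 1) hr.abs.aestronglyMeasurable (Eventually.of_forall fun y => by
      rw [Real.norm_eq_abs, abs_abs]; exact hr1 y)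
  have i3 : Integrable (fun x => φ x * (√(δ ^ 2 + r x ^ 2) - δ)) m :=
    iφ.mul_bdd (c := 1) mΞ.aestronglyMeasurable (Eventually.of_forall hΞ1)
  have i4 : Integrable (fun x => Lop A β φ x * (√(δ ^ 2 + r x ^ 2) - δ)) m :=
    iL.mul_bdd (c := 1) mΞ.aestronglyMeasurable (Eventually.of_forall hΞ1)
  have s1 : ∫ x, φ x * |r x| ∂m ≤ ∫ x, φ x * (√(δ ^ 2 + r x ^ 2) - δ) ∂m + δ * ∫ x, φ x ∂m := by
    rw [← integral_const_mul, ← integral_add i3 (iφ.const_mul _)]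
    refine integral_mono i1 (i3.add (iφ.const_mul _)) fun x => ?_
    have := mul_le_mul_of_nonneg_left (hΞ (r x)).1 (h0 x)
    simp only
    linarith
  have s2 : ∫ x, Lop A β φ x * (√(δ ^ 2 + r x ^ 2) - δ) ∂m
      ≤ ∫ x, Lop A β φ x * |r x| ∂m + δ * ∫ x, |Lop A β φ x| ∂m := by
    rw [← integral_const_mul, ← integral_add i2 (iL.abs.const_mul _)]
    refine integral_mono i4 (i2.add (iL.abs.const_mul _)) fun x => ?_
    simp only
    have h1 : abs ((√(δ ^ 2 + r x ^ 2) - δ) - |r x|) ≤ δ := by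
      rw [abs_le]; constructor <;> linarith [(hΞ (r x)).1, (hΞ (r x)).2]
    have h2 : Lop A β φ x * ((√(δ ^ 2 + r x ^ 2) - δ) - |r x|) ≤ |Lop A β φ x| * δ := by
      refine (le_abs_self _).trans ?_
      rw [abs_mul]
      exact mul_le_mul_of_nonneg_left h1 (abs_nonneg _)
    linarith
  have s3 := mul_le_mul_of_nonneg_left s2 hh
  linarith

end

section

variable {A : Ed d → Matrix (Fin d) (Fin d) ℝ} {β : Ed d → Ed d} {bb : Ed d → ℝ} {C : ℝ}
  {m m' : Measure (Ed d)} [IsFiniteMeasure m] [IsFiniteMeasure m'] {k : Ed d → ℝ} {c N : ℝ}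

lemma IsKer.cv_le (hk : IsKer k c N) {v : Ed d → ℝ} {K : ℝ} {x : Ed d}
    (hv : Integrable v m) (h0 : ∀ y, 0 ≤ v y) (hK : ∀ y, ‖x - y‖ < 1 → v y ≤ K) (hK0 : 0 ≤ K) :
    cv m v k x ≤ K * cv m (fun _ => 1) k x + c / N * ∫ y, v y ∂m := by
  have hc0 : 0 ≤ c / N := div_nonneg (by linarith [hk.one_le_c]) (by linarith [hk.one_le])
  have i1 := (hk.integrable_mul (integrable_const (1 : ℝ) : Integrable _ m) x).const_mul K
  rw [cv, cv, ← integral_const_mul, ← integral_const_mul, ← integral_add i1 (hv.const_mul _)]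
  refine integral_mono (hk.integrable_mul hv x) (i1.add (hv.const_mul _)) fun y => ?_
  simp only
  have hp := (hk.pos (x - y)).le
  rcases lt_or_ge ‖x - y‖ 1 with h | h
  · have := mul_le_mul_of_nonneg_right (hK y h) hp
    have := mul_nonneg hc0 (h0 y)
    linarith
  · have := mul_le_mul_of_nonneg_left (hk.tail _ h) (h0 y)
    have := mul_nonneg hK0 hp
    linarith

lemma abs_flux_sub_le (hc : Coef A β bb C) (hk : IsKer k c N) (hb : Integrable bb m) {K : ℝ}
    {x : Ed d} (hK : ∀ y, ‖x - y‖ < 1 → bb y ≤ K) (hK0 : 0 ≤ K) (i : Fin d) :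
    |flux A β m (fun _ => 1) k i x - ∑ j, A x i j * pd (cv m (fun _ => 1) k) j x|
      ≤ (d * C * c + K) * cv m (fun _ => 1) k x + c / N * ∫ y, bb y ∂m := by
  obtain ⟨M, -, hM⟩ := hk.exists_bound
  have cp : ∀ j, Continuous (pd k j) := fun j => (contDiff_one_pd hM.contDiff j).continuous
  have hb1 : Integrable (fun y => 1 * bb y) m := by simpa using hb
  have i0 : Integrable (fun _ : Ed d => (1 : ℝ)) m := integrable_const _
  have i1 : ∀ j, Integrable (fun y => 1 * A y i j * pd k j (x - y)) m := fun j =>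
    integrable_cv (hc.integrable_A i0 i j) (cp j) (hM.bound_pd j) x
  have i2 : ∀ j, Integrable (fun y => 1 * pd k j (x - y)) m := fun j =>
    integrable_cv i0 (cp j) (hM.bound_pd j) x
  have s1 : ∀ j, |cv m (fun y => 1 * A y i j) (pd k j) x
      - A x i j * pd (cv m (fun _ => 1) k) j x| ≤ C * c * cv m (fun _ => 1) k x := fun j => by
    rw [pd_cv i0 hM.cb1]
    unfold cv
    rw [← integral_const_mul, ← integral_sub (i1 j) ((i2 j).const_mul _), ← integral_const_mul]
    refine (abs_integral_le_integral_abs).trans (integral_mono_of_nonneg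
      (Eventually.of_forall fun y => abs_nonneg _) ((hk.integrable_mul i0 x).const_mul _)
      (Eventually.of_forall fun y => ?_))
    simp only [one_mul]
    rw [← sub_mul, abs_mul]
    calc _ ≤ C * ‖y - x‖ * |pd k j (x - y)| :=
          mul_le_mul_of_nonneg_right (hc.lip y x i j) (abs_nonneg _)
      _ = C * (‖x - y‖ * |pd k j (x - y)|) := by rw [norm_sub_rev]; ring
      _ ≤ C * (c * k (x - y)) :=
          mul_le_mul_of_nonneg_left (hk.norm_mul_pd_le j _) (by linarith [hc.one_le])
      _ = _ := by ring
  have s2 : |cv m (fun y => 1 * β y i) k x| ≤ K * cv m (fun _ => 1) k x + c / N * ∫ y, bb y ∂m :=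
    (abs_cv_le hk hb (fun y => by rw [one_mul]; exact hc.le y i) x).trans
      (hk.cv_le hb (fun y => zero_le_one.trans (hc.one_le_bb y)) hK hK0)
  have e : flux A β m (fun _ => 1) k i x - ∑ j, A x i j * pd (cv m (fun _ => 1) k) j x
      = (∑ j, (cv m (fun y => 1 * A y i j) (pd k j) x - A x i j * pd (cv m (fun _ => 1) k) j x))
        - cv m (fun y => 1 * β y i) k x := by
    rw [Finset.sum_sub_distrib, flux]; ring
  rw [e]
  refine (abs_sub _ _).trans ?_
  have s3 := (Finset.abs_sum_le_sum_abs (fun j => cv m (fun y => 1 * A y i j) (pd k j) x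
    - A x i j * pd (cv m (fun _ => 1) k) j x) Finset.univ).trans (Finset.sum_le_sum fun j _ => s1 j)
  rw [Finset.sum_const, Finset.card_univ, Fintype.card_fin, nsmul_eq_mul] at s3
  linarith

/-- A convex function on `[0, ∞)` used to test the mollified resolvent inequality. -/
structure LocEnt (Ξ Ξ1 Ξ2 : ℝ → ℝ) (a B : ℝ) : Prop where
  deriv : ∀ t, 0 ≤ t → HasDerivAt Ξ (Ξ1 t) t
  deriv' : ∀ t, 0 ≤ t → HasDerivAt Ξ1 (Ξ2 t) t
  smooth : ∀ t, 0 ≤ t → ContDiffAt ℝ 1 Ξ1 t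
  cont : ContinuousOn Ξ2 (Ici 0)
  nonneg : 0 ≤ a
  neg_le : ∀ t, 0 ≤ t → -a ≤ Ξ1 t
  abs_le : ∀ t, 0 ≤ t → |Ξ1 t| ≤ B
  conv : ∀ t, 0 ≤ t → 0 ≤ Ξ2 t
  le : ∀ t, 0 ≤ t → Ξ2 t ≤ B
  mul_le : ∀ t, 0 ≤ t → t * |Ξ1 t| ≤ 1 + t
  sq_mul_le : ∀ t, 0 ≤ t → t ^ 2 * Ξ2 t ≤ 1 + t

variable {Ξ Ξ1 Ξ2 : ℝ → ℝ} {a B : ℝ}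

lemma LocEnt.sub_le (hE : LocEnt Ξ Ξ1 Ξ2 a B) {s t : ℝ} (hs : 0 ≤ s) (ht : 0 ≤ t) :
    Ξ t - Ξ s ≤ Ξ1 t * (t - s) := by
  have hm : MonotoneOn Ξ1 (Ici 0) := by
    refine monotoneOn_of_deriv_nonneg (convex_Ici 0) (fun t ht =>
      (hE.deriv' t ht).continuousAt.continuousWithinAt) (fun t ht => ?_) (fun t ht => ?_)
    · exact (hE.deriv' t (interior_subset ht)).differentiableAt.differentiableWithinAt
    · rw [(hE.deriv' t (interior_subset ht)).deriv]; exact hE.conv t (interior_subset ht)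
  have key : ∀ p q, 0 ≤ p → p < q → ∃ ξ, p ≤ ξ ∧ ξ ≤ q ∧ Ξ q - Ξ p = Ξ1 ξ * (q - p) := by
    intro p q hp hpq
    obtain ⟨ξ, hξ, e⟩ := exists_hasDerivAt_eq_slope Ξ Ξ1 hpq
      (fun t ht => (hE.deriv t (hp.trans ht.1)).continuousAt.continuousWithinAt)
      (fun t ht => hE.deriv t (hp.trans ht.1.le))
    refine ⟨ξ, hξ.1.le, hξ.2.le, ?_⟩
    rw [e, div_mul_cancel₀ _ (by linarith)]
  rcases lt_trichotomy s t with h | h | h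
  · obtain ⟨ξ, h1, h2, e⟩ := key s t hs h
    rw [e]
    exact mul_le_mul_of_nonneg_right (hm (hs.trans h1) ht h2) (by linarith)
  · simp [h]
  · obtain ⟨ξ, h1, h2, e⟩ := key t s ht h
    have := mul_le_mul_of_nonneg_right (hm ht (ht.trans h1) h1) (sub_nonneg.2 h.le)
    linarith

end

set_option maxHeartbeats 1000000 in
lemma sum_flux_le {d : ℕ} {a q z2 : Fin d → Fin d → ℝ} {g b F z1 : Fin d → ℝ}
    {z e1 e2 ρ ε C K K' M M' B : ℝ} (hC : 1 ≤ C)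
    (low : ∑ i, g i ^ 2 ≤ C * ∑ i, ∑ j, a i j * g i * g j) (hq : ∀ i j, |q i j| ≤ C * ρ)
    (hb : ∀ i, |b i| ≤ K * ρ + ε) (hF : ∀ i, |F i - ∑ j, a i j * g j| ≤ K' * ρ + ε)
    (hz : |z| ≤ M) (hz1 : ∀ i, |z1 i| ≤ 2 * M * |z|) (hz2 : ∀ i j, |z2 i j| ≤ M') (hM' : 0 ≤ M')
    (hρ : 0 ≤ ρ) (hε : 0 ≤ ε) (hε1 : ε ≤ 1) (hK : 0 ≤ K) (hK' : 0 ≤ K')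
    (h1 : ρ * |e1| ≤ 1 + ρ) (h2 : ρ ^ 2 * e2 ≤ 1 + ρ) (hB1 : |e1| ≤ B) (hB2 : e2 ≤ B)
    (h0 : 0 ≤ e2) :
    ∑ i, ((∑ j, (z2 i j * e1 + z1 i * e2 * g j) * q i j) + z1 i * e1 * b i - z ^ 2 * e2 * g i * F i)
      ≤ -(1 / (2 * C) * (z ^ 2 * e2 * ∑ i, g i ^ 2))
        + (d * C * ((2 * d * M * C + M * K') ^ 2 + M ^ 2) + d ^ 2 * M' * C + 2 * d * M ^ 2 * (K + 1))
          * (1 + ρ + B * ε) := by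
  have hM : 0 ≤ M := (abs_nonneg _).trans hz
  have hB : 0 ≤ B := h0.trans hB2
  set X1 := 2 * d * M * C + M * K' with hX1
  set X := X1 * ρ + M * ε with hX
  have hX0 : 0 ≤ X1 := by positivity
  have T1 : ∀ i j, z2 i j * e1 * q i j ≤ M' * C * (1 + ρ) := fun i j => by
    refine (le_abs_self _).trans ?_
    rw [abs_mul, abs_mul]
    calc _ ≤ M' * |e1| * (C * ρ) := mul_le_mul (mul_le_mul_of_nonneg_right (hz2 i j) (abs_nonneg _))
          (hq i j) (abs_nonneg _) (by positivity)
      _ = M' * C * (ρ * |e1|) := by ring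
      _ ≤ _ := by gcongr
  have T2 : ∀ i j, z1 i * e2 * g j * q i j ≤ e2 * (|z| * |g j| * (2 * M * C * ρ)) := fun i j => by
    refine (le_abs_self _).trans ?_
    rw [abs_mul, abs_mul, abs_mul, abs_of_nonneg h0]
    calc _ ≤ 2 * M * |z| * e2 * |g j| * (C * ρ) := by
          refine mul_le_mul ?_ (hq i j) (abs_nonneg _) (by positivity)
          have := hz1 i
          gcongr
      _ = _ := by ring
  have T3 : ∀ i, z1 i * e1 * b i ≤ 2 * M ^ 2 * (K * (1 + ρ) + B * ε) := fun i => by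
    refine (le_abs_self _).trans ?_
    rw [abs_mul, abs_mul]
    calc _ ≤ 2 * M * M * |e1| * (K * ρ + ε) := by
          refine mul_le_mul ?_ (hb i) (abs_nonneg _) (by positivity)
          have := hz1 i
          have : |z1 i| ≤ 2 * M * M := this.trans (by gcongr)
          gcongr
      _ = 2 * M ^ 2 * (K * (ρ * |e1|) + |e1| * ε) := by ring
      _ ≤ _ := by gcongr
  have T4 : ∀ i, -(z ^ 2 * e2 * g i * F i) ≤ -(z ^ 2 * e2 * ∑ j, a i j * g i * g j)
      + e2 * (|z| * |g i| * (M * (K' * ρ + ε))) := fun i => by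
    have e : z ^ 2 * e2 * ∑ j, a i j * g i * g j = z ^ 2 * e2 * g i * ∑ j, a i j * g j := by
      rw [Finset.mul_sum, Finset.mul_sum]
      exact Finset.sum_congr rfl fun j _ => by ring
    rw [e]
    have : -(z ^ 2 * e2 * g i * (F i - ∑ j, a i j * g j))
        ≤ e2 * (|z| * |g i| * (M * (K' * ρ + ε))) := by
      refine (neg_le_abs _).trans ?_
      rw [abs_mul, abs_mul, abs_mul, abs_of_nonneg h0, abs_of_nonneg (sq_nonneg z), ← sq_abs z]
      calc _ ≤ |z| ^ 2 * e2 * |g i| * (K' * ρ + ε) := by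
            have := hF i; gcongr
        _ = |z| * (|z| * e2 * |g i| * (K' * ρ + ε)) := by ring
        _ ≤ M * (|z| * e2 * |g i| * (K' * ρ + ε)) := by gcongr
        _ = _ := by ring
    linarith
  have Y : ∀ i, |z| * |g i| * X ≤ 1 / (2 * C) * (z ^ 2 * g i ^ 2) + C / 2 * X ^ 2 := fun i => by
    have := sq_nonneg (|z| * |g i| - C * X)
    have hz2 := sq_abs z
    have hg2 := sq_abs (g i)
    rw [← hz2, ← hg2]
    have h2C : 0 < 2 * C := by linarith
    rw [← sub_nonneg]
    have e : 1 / (2 * C) * (|z| ^ 2 * |g i| ^ 2) + C / 2 * X ^ 2 - |z| * |g i| * X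
        = 1 / (2 * C) * (|z| * |g i| - C * X) ^ 2 := by field_simp; ring
    rw [e]; positivity
  have hXX : e2 * X ^ 2 ≤ 2 * (X1 ^ 2 + M ^ 2) * (1 + ρ + B * ε) := by
    have s : X ^ 2 ≤ 2 * (X1 ^ 2 * ρ ^ 2) + 2 * (M ^ 2 * ε) := by
      have := sq_nonneg (X1 * ρ - M * ε)
      have : M ^ 2 * ε ^ 2 ≤ M ^ 2 * ε := by gcongr; nlinarith
      rw [hX]; nlinarith
    have s2 : e2 * ε ≤ B * ε := by gcongr
    have hBε : 0 ≤ B * ε := by positivity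
    calc _ ≤ e2 * (2 * (X1 ^ 2 * ρ ^ 2) + 2 * (M ^ 2 * ε)) := by gcongr
      _ = 2 * X1 ^ 2 * (ρ ^ 2 * e2) + 2 * M ^ 2 * (e2 * ε) := by ring
      _ ≤ 2 * X1 ^ 2 * (1 + ρ + B * ε) + 2 * M ^ 2 * (1 + ρ + B * ε) := by
          have : ρ ^ 2 * e2 ≤ 1 + ρ + B * ε := by linarith
          have : e2 * ε ≤ 1 + ρ + B * ε := by linarith
          gcongr
      _ = _ := by ring
  have step : ∀ i, (∑ j, (z2 i j * e1 + z1 i * e2 * g j) * q i j) + z1 i * e1 * b i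
      - z ^ 2 * e2 * g i * F i ≤ d * (M' * C * (1 + ρ)) + (∑ j, e2 * (|z| * |g j| * (2 * M * C * ρ)))
        + 2 * M ^ 2 * (K * (1 + ρ) + B * ε) - z ^ 2 * e2 * (∑ j, a i j * g i * g j)
        + e2 * (|z| * |g i| * (M * (K' * ρ + ε))) := fun i => by
    have s1 : ∑ j, (z2 i j * e1 + z1 i * e2 * g j) * q i j
        ≤ ∑ j, (M' * C * (1 + ρ) + e2 * (|z| * |g j| * (2 * M * C * ρ))) :=
      Finset.sum_le_sum fun j _ => by
        rw [add_mul]; exact add_le_add (T1 i j) (T2 i j)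
    rw [Finset.sum_add_distrib, Finset.sum_const, Finset.card_univ, Fintype.card_fin,
      nsmul_eq_mul] at s1
    linarith [T3 i, T4 i]
  refine (Finset.sum_le_sum fun i _ => step i).trans ?_
  rw [Finset.sum_add_distrib, Finset.sum_sub_distrib, Finset.sum_add_distrib,
    Finset.sum_add_distrib, Finset.sum_const, Finset.sum_const, Finset.sum_const, Finset.card_univ,
    Fintype.card_fin, nsmul_eq_mul, nsmul_eq_mul, nsmul_eq_mul, ← Finset.mul_sum (a := z ^ 2 * e2)]
  have hY : ∑ i, e2 * (|z| * |g i| * X)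
      ≤ ∑ i, e2 * (1 / (2 * C) * (z ^ 2 * g i ^ 2) + C / 2 * X ^ 2) :=
    Finset.sum_le_sum fun i _ => mul_le_mul_of_nonneg_left (Y i) h0
  have eY : d * ∑ j, e2 * (|z| * |g j| * (2 * M * C * ρ)) + ∑ i, e2 * (|z| * |g i| * (M * (K' * ρ + ε)))
      = ∑ i, e2 * (|z| * |g i| * X) := by
    rw [Finset.mul_sum, ← Finset.sum_add_distrib]
    exact Finset.sum_congr rfl fun j _ => by rw [hX, hX1]; ring
  have eZ : ∑ i, e2 * (1 / (2 * C) * (z ^ 2 * g i ^ 2) + C / 2 * X ^ 2)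
      = 1 / (2 * C) * (z ^ 2 * e2 * ∑ i, g i ^ 2) + d * C / 2 * (e2 * X ^ 2) := by
    rw [← Finset.mul_sum, Finset.sum_add_distrib, Finset.sum_const, Finset.card_univ,
      Fintype.card_fin, nsmul_eq_mul, ← Finset.mul_sum, ← Finset.mul_sum]
    ring
  have eA : 1 / C * (z ^ 2 * e2 * ∑ i, g i ^ 2) ≤ z ^ 2 * e2 * ∑ i, ∑ j, a i j * g i * g j := by
    rw [mul_left_comm]
    refine mul_le_mul_of_nonneg_left ?_ (by positivity)
    rw [one_div, inv_mul_le_iff₀ (by linarith)]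
    exact low
  have hh : 1 / C * (z ^ 2 * e2 * ∑ i, g i ^ 2) = 2 * (1 / (2 * C) * (z ^ 2 * e2 * ∑ i, g i ^ 2)) := by
    field_simp
  have e5 : d * C / 2 * (e2 * X ^ 2) ≤ d * C * (X1 ^ 2 + M ^ 2) * (1 + ρ + B * ε) := by
    calc _ ≤ d * C / 2 * (2 * (X1 ^ 2 + M ^ 2) * (1 + ρ + B * ε)) := by gcongr
      _ = _ := by ring
  have hBε : 0 ≤ B * ε := by positivity
  have e6 : d * (d * (M' * C * (1 + ρ))) ≤ d ^ 2 * M' * C * (1 + ρ + B * ε) := by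
    calc _ = d ^ 2 * M' * C * (1 + ρ) := by ring
      _ ≤ _ := mul_le_mul_of_nonneg_left (by linarith) (by positivity)
  have e7 : d * (2 * M ^ 2 * (K * (1 + ρ) + B * ε)) ≤ 2 * d * M ^ 2 * (K + 1) * (1 + ρ + B * ε) := by
    calc _ = 2 * d * M ^ 2 * (K * (1 + ρ) + B * ε) := by ring
      _ ≤ 2 * d * M ^ 2 * ((K + 1) * (1 + ρ + B * ε)) := by
        gcongr; nlinarith [mul_nonneg hK hBε]
      _ = _ := by ring
  have e8 : (d * C * (X1 ^ 2 + M ^ 2) + d ^ 2 * M' * C + 2 * d * M ^ 2 * (K + 1)) * (1 + ρ + B * ε)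
      = d * C * (X1 ^ 2 + M ^ 2) * (1 + ρ + B * ε) + d ^ 2 * M' * C * (1 + ρ + B * ε)
        + 2 * d * M ^ 2 * (K + 1) * (1 + ρ + B * ε) := by ring
  linarith

section

variable {A : Ed d → Matrix (Fin d) (Fin d) ℝ} {β : Ed d → Ed d} {bb : Ed d → ℝ} {C : ℝ}
  {m m' : Measure (Ed d)} [IsFiniteMeasure m] [IsFiniteMeasure m'] {k : Ed d → ℝ} {c N : ℝ}
  {Ξ Ξ1 Ξ2 : ℝ → ℝ} {a B : ℝ}

lemma LocEnt.contDiff_comp (hE : LocEnt Ξ Ξ1 Ξ2 a B) {ρ : Ed d → ℝ} (hρ : ContDiff ℝ 1 ρ)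
    (h0 : ∀ x, 0 ≤ ρ x) : ContDiff ℝ 1 fun x => Ξ1 (ρ x) :=
  contDiff_iff_contDiffAt.2 fun x => (hE.smooth _ (h0 x)).comp x hρ.contDiffAt

lemma LocEnt.continuous_comp (hE : LocEnt Ξ Ξ1 Ξ2 a B) {ρ : Ed d → ℝ} (hρ : Continuous ρ)
    (h0 : ∀ x, 0 ≤ ρ x) : Continuous fun x => Ξ (ρ x) :=
  continuous_iff_continuousAt.2 fun x =>
    ContinuousAt.comp (hE.deriv _ (h0 x)).continuousAt hρ.continuousAt

lemma pd_eq_zero_of_support_subset {f : Ed d → ℝ} {S : Set (Ed d)} (hS : IsClosed S)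
    (h : Function.support f ⊆ S) (i : Fin d) : Function.support (pd f i) ⊆ S := by
  intro x hx
  by_contra hxS
  refine hx ?_
  have : f =ᶠ[𝓝 x] fun _ => 0 := by
    filter_upwards [hS.isOpen_compl.mem_nhds hxS] with y hy
    by_contra hy0
    exact hy (h hy0)
  rw [pd_congr this, pd_const]

lemma LocEnt.integral_mul_div_le (hE : LocEnt Ξ Ξ1 Ξ2 a B) (hc : Coef A β bb C) (hk : IsKer k c N)
    (hb : Integrable bb m) {R K M : ℝ} (hK0 : 0 ≤ K) (hK : ∀ y, ‖y‖ ≤ R + 1 → bb y ≤ K)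
    {ζ : Ed d → ℝ} (hζ : Cb2 ζ M) (hS : Function.support ζ ⊆ closedBall 0 R) {ε : ℝ} (hε1 : ε ≤ 1)
    (hε : c / N * ∫ y, bb y ∂m ≤ ε) :
    ∫ x, ζ x ^ 2 * Ξ1 (cv m (fun _ => 1) k x) * ∑ i, pd (flux A β m (fun _ => 1) k i) i x
      ≤ -(1 / (2 * C)) * (∫ x, ζ x ^ 2 * Ξ2 (cv m (fun _ => 1) k x)
          * ∑ i, pd (cv m (fun _ => 1) k) i x ^ 2)
        + (d * C * ((2 * d * M * C + M * (d * C * c + K)) ^ 2 + M ^ 2) + d ^ 2 * (4 * (M * M)) * C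
          + 2 * d * M ^ 2 * (K + 1))
          * ((1 + B * ε) * volume.real (closedBall (0 : Ed d) R) + m.real univ) := by
  obtain ⟨Mk, -, hM⟩ := hk.exists_bound
  have hC := hc.one_le
  have hc1 := hk.one_le_c
  have hN := hk.one_le
  have i0 : Integrable (fun _ : Ed d => (1 : ℝ)) m := integrable_const _
  have hb1 : Integrable (fun y => 1 * bb y) m := by simpa using hb
  set ρ := cv m (fun _ => 1) k with hρ
  set F := flux A β m (fun _ => 1) k with hF
  set q : Fin d → Fin d → Ed d → ℝ := fun i j => cv m (fun y => 1 * A y i j) k with hq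
  set b : Fin d → Ed d → ℝ := fun i => cv m (fun y => 1 * β y i) k with hb'
  have iq : ∀ i j, Integrable (fun y => 1 * A y i j) m := fun i j => hc.integrable_A i0 i j
  have ib : ∀ i, Integrable (fun y => 1 * β y i) m := fun i =>
    hc.integrable_β hb1 aestronglyMeasurable_const i
  have cρ : ContDiff ℝ 1 ρ := contDiff_cv i0 hM.cb1
  have ρ0 : ∀ x, 0 ≤ ρ x := cv_nonneg hk fun _ => zero_le_one
  have cF : ∀ i, ContDiff ℝ 1 (F i) := contDiff_flux hc hM hb1 aestronglyMeasurable_const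
  have cq : ∀ i j, ContDiff ℝ 1 (q i j) := fun i j => contDiff_cv (iq i j) hM.cb1
  have cb : ∀ i, ContDiff ℝ 1 (b i) := fun i => contDiff_cv (ib i) hM.cb1
  have eF : ∀ i x, F i x = (∑ j, pd (q i j) j x) - b i x := fun i x => by
    rw [hF, flux]
    congr 1
    exact Finset.sum_congr rfl fun j _ => (pd_cv (iq i j) hM.cb1 j x).symm
  set φ : Ed d → ℝ := fun x => ζ x * ζ x with hφ
  have hCφ : Cb2 φ (4 * (M * M)) := hζ.mul hζ
  have hsφ : Function.support φ ⊆ closedBall 0 R := fun x hx => hS (left_ne_zero_of_mul hx)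
  have cs : ∀ {f : Ed d → ℝ}, Function.support f ⊆ closedBall 0 R → HasCompactSupport f :=
    fun h => HasCompactSupport.of_support_subset_isCompact (isCompact_closedBall _ _) h
  have hs1 : ∀ i, Function.support (pd φ i) ⊆ closedBall 0 R :=
    pd_eq_zero_of_support_subset isClosed_closedBall hsφ
  have hs2 : ∀ i j, Function.support (pd (pd φ i) j) ⊆ closedBall 0 R := fun i j =>
    pd_eq_zero_of_support_subset isClosed_closedBall (hs1 i) j
  have cφ1 : ∀ i, ContDiff ℝ 1 (pd φ i) := contDiff_one_pd hCφ.contDiff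
  have c1 : ContDiff ℝ 1 fun x => Ξ1 (ρ x) := hE.contDiff_comp cρ ρ0
  have c2 : Continuous fun x => Ξ2 (ρ x) := hE.cont.comp_continuous cρ.continuous ρ0
  have dρ := cρ.differentiable one_ne_zero
  have p1 : ∀ i x, pd (fun x => Ξ1 (ρ x)) i x = Ξ2 (ρ x) * pd ρ i x := fun i x =>
    pd_comp (hE.deriv' _ (ρ0 x)) (dρ x) i
  have p2 : ∀ i x, pd (fun x => φ x * Ξ1 (ρ x)) i x
      = pd φ i x * Ξ1 (ρ x) + φ x * Ξ2 (ρ x) * pd ρ i x := fun i x => by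
    rw [pd_mul (hCφ.contDiff.differentiable two_ne_zero x) (c1.differentiable one_ne_zero x), p1]
    ring
  have p3 : ∀ i j x, pd (fun x => pd φ i x * Ξ1 (ρ x)) j x
      = pd (pd φ i) j x * Ξ1 (ρ x) + pd φ i x * Ξ2 (ρ x) * pd ρ j x := fun i j x => by
    rw [pd_mul ((cφ1 i).differentiable one_ne_zero x) (c1.differentiable one_ne_zero x), p1]
    ring
  have cpρ : ∀ i, Continuous (pd ρ i) := fun i => continuous_pd cρ i
  have cP2 : ∀ i j, Continuous (pd (pd φ i) j) := fun i j => continuous_pd (cφ1 i) j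
  have s1 : ∀ i, Function.support (fun x => pd φ i x * Ξ1 (ρ x)) ⊆ closedBall 0 R := fun i x hx =>
    hs1 i (left_ne_zero_of_mul hx)
  have intg : ∀ {f : Ed d → ℝ}, Continuous f → (∀ x, x ∉ closedBall (0 : Ed d) R → f x = 0) →
      Integrable f := fun hf h0 => hf.integrable_of_hasCompactSupport
    (cs (fun x hx => by by_contra h; exact hx (h0 x h)))
  have zφ : ∀ x, x ∉ closedBall (0 : Ed d) R → φ x = 0 := fun x hx => by
    by_contra h; exact hx (hsφ h)
  have z1 : ∀ i x, x ∉ closedBall (0 : Ed d) R → pd φ i x = 0 := fun i x hx => by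
    by_contra h; exact hx (hs1 i h)
  have z2 : ∀ i j x, x ∉ closedBall (0 : Ed d) R → pd (pd φ i) j x = 0 := fun i j x hx => by
    by_contra h; exact hx (hs2 i j h)
  have J1 : ∀ i j, Integrable fun x => (pd (pd φ i) j x * Ξ1 (ρ x) + pd φ i x * Ξ2 (ρ x) * pd ρ j x)
      * q i j x := fun i j => by
    refine intg ?_ fun x hx => by rw [z1 i x hx, z2 i j x hx]; ring
    exact (((cP2 i j).mul c1.continuous).add (((cφ1 i).continuous.mul c2).mul (cpρ j))).mul
      (cq i j).continuous
  have J2 : ∀ i, Integrable fun x => pd φ i x * Ξ1 (ρ x) * b i x := fun i => by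
    refine intg ?_ fun x hx => by rw [z1 i x hx]; ring
    exact ((cφ1 i).continuous.mul c1.continuous).mul (cb i).continuous
  have J3 : ∀ i, Integrable fun x => φ x * Ξ2 (ρ x) * pd ρ i x * F i x := fun i => by
    refine intg ?_ fun x hx => by rw [zφ x hx]; ring
    exact ((hCφ.contDiff.continuous.mul c2).mul (cpρ i)).mul (cF i).continuous
  have J4 : ∀ i, Integrable fun x => φ x * Ξ1 (ρ x) * pd (F i) i x := fun i => by
    refine intg ?_ fun x hx => by rw [zφ x hx]; ring
    exact (hCφ.contDiff.continuous.mul c1.continuous).mul (continuous_pd (cF i) i)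
  have J5 : ∀ i j, Integrable fun x => pd φ i x * Ξ1 (ρ x) * pd (q i j) j x := fun i j => by
    refine intg ?_ fun x hx => by rw [z1 i x hx]; ring
    exact ((cφ1 i).continuous.mul c1.continuous).mul (continuous_pd (cq i j) j)
  have K1 : ∀ i, Integrable fun x => ∑ j, pd φ i x * Ξ1 (ρ x) * pd (q i j) j x := fun i =>
    integrable_finsetSum _ fun j _ => J5 i j
  have K2 : ∀ i, Integrable fun x => ∑ j, (pd (pd φ i) j x * Ξ1 (ρ x)
      + pd φ i x * Ξ2 (ρ x) * pd ρ j x) * q i j x := fun i =>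
    integrable_finsetSum _ fun j _ => J1 i j
  have K3 : ∀ i, Integrable fun x => (∑ j, (pd (pd φ i) j x * Ξ1 (ρ x)
      + pd φ i x * Ξ2 (ρ x) * pd ρ j x) * q i j x) + pd φ i x * Ξ1 (ρ x) * b i x := fun i =>
    (K2 i).add (J2 i)
  have K4 : ∀ i, Integrable fun x => (∑ j, (pd (pd φ i) j x * Ξ1 (ρ x)
      + pd φ i x * Ξ2 (ρ x) * pd ρ j x) * q i j x) + pd φ i x * Ξ1 (ρ x) * b i x
      - φ x * Ξ2 (ρ x) * pd ρ i x * F i x := fun i => (K3 i).sub (J3 i)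
  have hi : ∀ i, ∫ x, φ x * Ξ1 (ρ x) * pd (F i) i x
      = ∫ x, (∑ j, (pd (pd φ i) j x * Ξ1 (ρ x) + pd φ i x * Ξ2 (ρ x) * pd ρ j x) * q i j x)
        + pd φ i x * Ξ1 (ρ x) * b i x - φ x * Ξ2 (ρ x) * pd ρ i x * F i x := fun i => by
    rw [integral_mul_pd (cF i) ((hCφ.contDiff.of_le one_le_two).mul c1)
      (cs fun x hx => hsφ (left_ne_zero_of_mul hx)) i]
    have e1 : ∀ x, pd (fun x => φ x * Ξ1 (ρ x)) i x * F i x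
        = ((∑ j, pd φ i x * Ξ1 (ρ x) * pd (q i j) j x) - pd φ i x * Ξ1 (ρ x) * b i x)
          + φ x * Ξ2 (ρ x) * pd ρ i x * F i x := fun x => by
      rw [p2, add_mul]
      congr 1
      rw [eF, mul_sub, Finset.mul_sum]
    have e2 : ∀ j, ∫ x, pd φ i x * Ξ1 (ρ x) * pd (q i j) j x
        = -∫ x, (pd (pd φ i) j x * Ξ1 (ρ x) + pd φ i x * Ξ2 (ρ x) * pd ρ j x) * q i j x :=
      fun j => by
        rw [integral_mul_pd (cq i j) ((cφ1 i).mul c1) (cs (s1 i)) j]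
        simp only [p3]
    have K5 : Integrable fun x => (∑ j, pd φ i x * Ξ1 (ρ x) * pd (q i j) j x)
      - pd φ i x * Ξ1 (ρ x) * b i x := (K1 i).sub (J2 i)
    simp only [e1]
    rw [integral_add K5 (J3 i), integral_sub (K1 i) (J2 i), integral_finsetSum _ fun j _ => J5 i j,
      Finset.sum_congr rfl fun j _ => e2 j, integral_sub (K3 i) (J3 i), integral_add (K2 i) (J2 i),
      integral_finsetSum _ fun j _ => J1 i j, Finset.sum_neg_distrib]
    ring
  have eq : ∫ x, ζ x ^ 2 * Ξ1 (ρ x) * ∑ i, pd (F i) i x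
      = ∫ x, ∑ i, ((∑ j, (pd (pd φ i) j x * Ξ1 (ρ x) + pd φ i x * Ξ2 (ρ x) * pd ρ j x) * q i j x)
        + pd φ i x * Ξ1 (ρ x) * b i x - ζ x ^ 2 * Ξ2 (ρ x) * pd ρ i x * F i x) := by
    have e1 : ∀ x, ζ x ^ 2 * Ξ1 (ρ x) * ∑ i, pd (F i) i x
        = ∑ i, φ x * Ξ1 (ρ x) * pd (F i) i x := fun x => by
      rw [Finset.mul_sum, sq]
    simp only [e1]
    simp only [sq]
    rw [integral_finsetSum _ fun i _ => J4 i, integral_finsetSum _ fun i _ => K4 i]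
    exact Finset.sum_congr rfl fun i _ => hi i
  rw [eq]
  set C₁ := d * C * ((2 * d * M * C + M * (d * C * c + K)) ^ 2 + M ^ 2) + d ^ 2 * (4 * (M * M)) * C
          + 2 * d * M ^ 2 * (K + 1) with hC₁
  have hM0 := hζ.nonneg
  have hC₁0 : 0 ≤ C₁ := by positivity
  have hε0 : 0 ≤ c / N * ∫ y, bb y ∂m := mul_nonneg (by positivity)
    (integral_nonneg fun y => zero_le_one.trans (hc.one_le_bb y))
  have hB : 0 ≤ B := (abs_nonneg _).trans (hE.abs_le 0 le_rfl)
  have P : ∀ x, ∑ i, ((∑ j, (pd (pd φ i) j x * Ξ1 (ρ x) + pd φ i x * Ξ2 (ρ x) * pd ρ j x) * q i j x)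
        + pd φ i x * Ξ1 (ρ x) * b i x - ζ x ^ 2 * Ξ2 (ρ x) * pd ρ i x * F i x)
      ≤ -(1 / (2 * C)) * (ζ x ^ 2 * Ξ2 (ρ x) * ∑ i, pd ρ i x ^ 2)
        + (closedBall (0 : Ed d) R).indicator (fun x => C₁ * ((1 + B * ε) + ρ x)) x := fun x => by
    by_cases hx : x ∈ closedBall (0 : Ed d) R
    · rw [indicator_of_mem hx]
      have hloc : ∀ y, ‖x - y‖ < 1 → bb y ≤ K := fun y hy => hK y (by
        rw [mem_closedBall, dist_zero_right] at hx
        have := norm_sub_norm_le y x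
        rw [norm_sub_rev] at this
        linarith)
      refine (sum_flux_le (C := C) (K := K) (K' := d * C * c + K) (M := M) (M' := 4 * (M * M)) (B := B)
        (ε := ε) (a := fun i j => A x i j) hC (hc.low x _) (fun i j => ?_) (fun i => ?_)
        (fun i => ?_) (hζ.bound x) (fun i => ?_) (fun i j => hCφ.bound_pd_pd j i x)
        (by positivity) (ρ0 x) (hε0.trans hε) hε1 hK0 (by positivity) (hE.mul_le _ (ρ0 x))
        (hE.sq_mul_le _ (ρ0 x)) (hE.abs_le _ (ρ0 x)) (hE.le _ (ρ0 x)) (hE.conv _ (ρ0 x))).trans_eq ?_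
      · refine (abs_cv_le hk (integrable_const C) (fun y => by rw [one_mul]; exact hc.bdd y i j) x
          ).trans_eq ?_
        rw [hρ, cv, cv, ← integral_const_mul]
        simp only [one_mul]
      · refine (abs_cv_le hk hb (fun y => by rw [one_mul]; exact hc.le y i) x).trans ?_
        exact (hk.cv_le hb (fun y => zero_le_one.trans (hc.one_le_bb y)) hloc hK0).trans (by linarith)
      · exact (abs_flux_sub_le hc hk hb hloc hK0 i).trans (by linarith)
      · have dζ := hζ.contDiff.differentiable two_ne_zero x
        rw [hφ, pd_mul dζ dζ]
        have : |ζ x * pd ζ i x + ζ x * pd ζ i x| = 2 * |pd ζ i x| * |ζ x| := by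
          rw [← two_mul, abs_mul, abs_mul, abs_two]; ring
        rw [this]
        gcongr
        exact hζ.bound_pd i x
      · ring
    · rw [indicator_of_notMem hx, add_zero]
      have hζ0 : ζ x = 0 := by by_contra h; exact hx (hS h)
      simp [z1 _ x hx, z2 _ _ x hx, hζ0]
  have iI : Integrable ((closedBall (0 : Ed d) R).indicator fun x => C₁ * ((1 + B * ε) + ρ x)) := by
    rw [integrable_indicator_iff measurableSet_closedBall]
    exact (continuous_const.mul (continuous_const.add cρ.continuous)).continuousOn.integrableOn_compact
      (isCompact_closedBall _ _)
  have iP : Integrable fun x => ζ x ^ 2 * Ξ2 (ρ x) * ∑ i, pd ρ i x ^ 2 := by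
    refine intg ?_ fun x hx => ?_
    · exact ((hζ.contDiff.continuous.pow 2).mul c2).mul (continuous_finsetSum _ fun i _ => (cpρ i).pow 2)
    · have hζ0 : ζ x = 0 := by by_contra h; exact hx (hS h)
      rw [hζ0]; ring
  refine (integral_mono (integrable_finsetSum _ fun i _ => ?_) ((iP.const_mul _).add iI) P).trans ?_
  · simp only [sq]; exact K4 i
  rw [integral_add' (iP.const_mul _) iI, integral_const_mul, integral_indicator measurableSet_closedBall,
    integral_const_mul]
  have o := integral_cv_one (m := m) hk
  have ic : IntegrableOn (fun _ : Ed d => 1 + B * ε) (closedBall 0 R) :=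
    continuousOn_const.integrableOn_compact (isCompact_closedBall _ _)
  rw [integral_add ic o.1.integrableOn, setIntegral_const, smul_eq_mul]
  have : ∫ x in closedBall (0 : Ed d) R, ρ x ≤ m.real univ := by
    rw [← o.2]; exact setIntegral_le_integral o.1 (Eventually.of_forall ρ0)
  have : C₁ * (volume.real (closedBall (0 : Ed d) R) * (1 + B * ε) + ∫ x in closedBall (0 : Ed d) R, ρ x)
      ≤ C₁ * ((1 + B * ε) * volume.real (closedBall (0 : Ed d) R) + m.real univ) :=
    mul_le_mul_of_nonneg_left (by rw [mul_comm]; linarith) hC₁0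
  linarith

end

section

variable {A : Ed d → Matrix (Fin d) (Fin d) ℝ} {β : Ed d → Ed d} {bb : Ed d → ℝ} {C : ℝ}
  {m m' : Measure (Ed d)} [IsFiniteMeasure m] [IsFiniteMeasure m'] {k : Ed d → ℝ} {c N h : ℝ}
  {Ξ Ξ1 Ξ2 : ℝ → ℝ} {a B : ℝ}

lemma IsKer.integrable_cv (hk : IsKer k c N) {w : Ed d → ℝ} (hw : Measurable w)
    (hwi : Integrable w m) : Integrable (cv m w k) := by
  simpa using (integral_mul_cv (m := m) hk (G := fun _ => 1) (K := 1) measurable_const (by simp)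
    hw hwi).1

lemma IsKer.integrable_cv_pd (hk : IsKer k c N) {w : Ed d → ℝ} (hw : Measurable w)
    (hwi : Integrable w m) (j : Fin d) : Integrable (cv m w (pd k j)) := by
  obtain ⟨M, -, hM⟩ := hk.exists_bound
  refine ((hk.integrable_cv hw.abs hwi.abs).const_mul (c * N)).mono'
    (contDiff_cv hwi (hM.cb1_pd j)).continuous.aestronglyMeasurable
    (Eventually.of_forall fun x => ?_)
  rw [Real.norm_eq_abs, cv, cv, ← integral_const_mul]
  refine (abs_integral_le_integral_abs).trans (integral_mono_of_nonneg
    (Eventually.of_forall fun y => abs_nonneg _) ((hk.integrable_mul hwi.abs x).const_mul _)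
    (Eventually.of_forall fun y => ?_))
  simp only [abs_mul]
  calc _ ≤ |w y| * (c * N * k (x - y)) := mul_le_mul_of_nonneg_left (hk.pd_le j _) (abs_nonneg _)
    _ = _ := by ring

lemma integrable_flux (hc : Coef A β bb C) (hk : IsKer k c N) (hb : Integrable bb m) (i : Fin d) :
    Integrable (flux A β m (fun _ => 1) k i) := by
  have i0 : Integrable (fun _ : Ed d => (1 : ℝ)) m := integrable_const _
  have hb1 : Integrable (fun y => 1 * bb y) m := by simpa using hb
  exact (integrable_finsetSum _ fun j _ => hk.integrable_cv_pd
    (measurable_const.mul (hc.continuous_A i j).measurable) (hc.integrable_A i0 i j) j).sub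
    (hk.integrable_cv (measurable_const.mul (hc.measurable_β i))
      (hc.integrable_β hb1 aestronglyMeasurable_const i))

/-- The nonnegative defect in the mollified resolvent inequality. -/
def defect (A : Ed d → Matrix (Fin d) (Fin d) ℝ) (β : Ed d → Ed d) (h : ℝ) (m m' : Measure (Ed d))
    (k : Ed d → ℝ) (x : Ed d) : ℝ :=
  cv m' (fun _ => 1) k x + h * (∑ i, pd (flux A β m (fun _ => 1) k i) i x) - cv m (fun _ => 1) k x

lemma defect_nonneg (hc : Coef A β bb C) (hk : IsKer k c N) (hb : Integrable bb m)
    (H : ResSub A β h m m') (x : Ed d) : 0 ≤ defect A β h m m' k x := by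
  obtain ⟨M, -, hM⟩ := hk.exists_bound
  have hb1 : Integrable (fun y => 1 * bb y) m := by simpa using hb
  obtain ⟨h1, h2, h3⟩ := hM.comp_sub_left x
  have := H.cb2 hc hb h1 fun z => (hk.pos (x - z)).le
  rw [defect, div_flux hc hM hb1 aestronglyMeasurable_const]
  simp only [cv, one_mul]
  linarith

lemma continuous_defect (hc : Coef A β bb C) (hk : IsKer k c N) (hb : Integrable bb m) :
    Continuous (defect A β h m m' k) := by
  obtain ⟨M, -, hM⟩ := hk.exists_bound
  have hb1 : Integrable (fun y => 1 * bb y) m := by simpa using hb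
  exact ((hk.continuous_cv (integrable_const _)).add (continuous_const.mul
    (continuous_finsetSum _ fun i _ => continuous_pd
      (contDiff_flux hc hM hb1 aestronglyMeasurable_const i) i))).sub
    (hk.continuous_cv (integrable_const _))

lemma integral_mul_defect_le (hc : Coef A β bb C) (hk : IsKer k c N) (hb : Integrable bb m)
    (hh : 0 ≤ h) (H : ResSub A β h m m') {G : Ed d → ℝ} (hG : Continuous G) {R : ℝ}
    (hG1 : ∀ x, G x ≤ 1) (hS : Function.support G ⊆ closedBall 0 R) :
    ∫ x, G x * defect A β h m m' k x ≤ m'.real univ - m.real univ := by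
  obtain ⟨Mk, -, hMk⟩ := hk.exists_bound
  obtain ⟨M, χ, hM, hχ⟩ := exists_cutoff d
  have hb1 : Integrable (fun y => 1 * bb y) m := by simpa using hb
  have cF := fun i => contDiff_flux hc hMk hb1 aestronglyMeasurable_const i
  have iF := fun i => integrable_flux hc hk hb i
  have o := integral_cv_one (m := m) hk
  have o' := integral_cv_one (m := m') hk
  have cD := continuous_defect (h := h) (m' := m') hc hk hb
  set F := flux A β m (fun _ => 1) k with hF
  have iG : Integrable fun x => G x * defect A β h m m' k x :=
    (hG.mul cD).integrable_of_hasCompactSupport (HasCompactSupport.of_support_subset_isCompact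
      (isCompact_closedBall 0 R) hS).mul_right
  have t : ∀ (ν : Measure (Ed d)) [IsFiniteMeasure ν], Tendsto (fun n =>
      ∫ x, χ n x * cv ν (fun _ => 1) k x) atTop (𝓝 (ν.real univ)) := fun ν _ => by
    have o := integral_cv_one (m := ν) hk
    rw [← o.2]
    refine tendsto_integral_of_dominated_convergence (cv ν (fun _ => 1) k) (fun n =>
      ((hχ n).1.contDiff.continuous.mul (hk.continuous_cv (integrable_const _))).aestronglyMeasurable)
      o.1 (fun n => Eventually.of_forall fun x => ?_) (Eventually.of_forall fun x => ?_)
    · have h0 := cv_nonneg (m := ν) hk (fun _ => zero_le_one) x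
      rw [Real.norm_eq_abs, abs_mul, abs_of_nonneg ((hχ n).2.2.1 x).1, abs_of_nonneg h0]
      exact mul_le_of_le_one_left h0 ((hχ n).2.2.1 x).2
    · refine tendsto_const_nhds.congr' ?_
      filter_upwards [eventually_gt_atTop ⌈‖x‖⌉₊] with n hn
      have := Nat.le_ceil ‖x‖
      have h2 : ((⌈‖x‖⌉₊ : ℕ) : ℝ) < n := by exact_mod_cast hn
      rw [((hχ n).2.2.2.1 x (by linarith)).eq_of_nhds, one_mul]
  have t2 : Tendsto (fun n : ℕ => h * (M / ((n : ℝ) + 1) * ∑ i, ∫ x, |F i x|)) atTop (𝓝 0) := by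
    have h1 : Tendsto (fun n : ℕ => M / ((n : ℝ) + 1)) atTop (𝓝 0) :=
      tendsto_const_nhds.div_atTop (tendsto_atTop_add_const_right _ _ tendsto_natCast_atTop_atTop)
    simpa using (h1.mul_const (∑ i, ∫ x, |F i x|)).const_mul h
  have key := ((t m').sub (t m)).add t2
  rw [add_zero] at key
  refine ge_of_tendsto key ?_
  filter_upwards [eventually_gt_atTop ⌈R⌉₊] with n hn
  have hR : R < n := (Nat.le_ceil R).trans_lt (by exact_mod_cast hn)
  have cχ := (hχ n).1.contDiff
  have sχ := (hχ n).2.1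
  have iχ : ∀ {f : Ed d → ℝ}, Continuous f → Integrable fun x => χ n x * f x := fun hf =>
    (cχ.continuous.mul hf).integrable_of_hasCompactSupport sχ.mul_right
  have cdiv : ∀ i, Continuous (pd (F i) i) := fun i => continuous_pd (cF i) i
  have le1 : ∫ x, G x * defect A β h m m' k x ≤ ∫ x, χ n x * defect A β h m m' k x := by
    refine integral_mono iG (iχ cD) fun x => ?_
    refine mul_le_mul_of_nonneg_right ?_ (defect_nonneg hc hk hb H x)
    by_cases hx : x ∈ closedBall (0 : Ed d) R
    · rw [mem_closedBall, dist_zero_right] at hx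
      rw [((hχ n).2.2.2.1 x (by linarith)).eq_of_nhds]
      exact hG1 x
    · have : G x = 0 := by by_contra h; exact hx (hS h)
      rw [this]; exact ((hχ n).2.2.1 x).1
  refine le1.trans ?_
  have e : ∫ x, χ n x * defect A β h m m' k x = (∫ x, χ n x * cv m' (fun _ => 1) k x)
      - (∫ x, χ n x * cv m (fun _ => 1) k x) + h * ∑ i, ∫ x, χ n x * pd (F i) i x := by
    have e1 : ∀ x, χ n x * defect A β h m m' k x = (χ n x * cv m' (fun _ => 1) k x
      - χ n x * cv m (fun _ => 1) k x) + h * ∑ i, χ n x * pd (F i) i x := fun x => by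
      rw [defect, ← Finset.mul_sum]; ring
    have j1 := iχ (hk.continuous_cv (m := m') (integrable_const (1 : ℝ)))
    have j2 := iχ (hk.continuous_cv (m := m) (integrable_const (1 : ℝ)))
    have j3 : Integrable fun x => χ n x * cv m' (fun _ => 1) k x - χ n x * cv m (fun _ => 1) k x :=
      j1.sub j2
    have j4 : Integrable fun x => ∑ i, χ n x * pd (F i) i x :=
      integrable_finsetSum _ fun i _ => iχ (cdiv i)
    simp only [e1]
    rw [integral_add j3 (j4.const_mul h), integral_sub j1 j2, integral_const_mul,
      integral_finsetSum _ fun i _ => iχ (cdiv i)]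
  rw [e]
  refine add_le_add le_rfl (mul_le_mul_of_nonneg_left ?_ hh)
  rw [Finset.mul_sum]
  refine Finset.sum_le_sum fun i _ => ?_
  rw [integral_mul_pd (cF i) (cχ.of_le one_le_two) sχ i, ← integral_neg, ← integral_const_mul]
  have sp : HasCompactSupport (pd (χ n) i) := hasCompactSupport_pd sχ i
  refine integral_mono (((continuous_pd (cχ.of_le one_le_two) i).mul
    (cF i).continuous).integrable_of_hasCompactSupport sp.mul_right).neg
    ((iF i).abs.const_mul _) fun x => ?_
  refine (neg_le_abs _).trans ?_
  rw [abs_mul]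
  exact mul_le_mul_of_nonneg_right ((hχ n).2.2.2.2 i x) (abs_nonneg _)

end

section

variable {A : Ed d → Matrix (Fin d) (Fin d) ℝ} {β : Ed d → Ed d} {bb : Ed d → ℝ} {C : ℝ}
  {m m' : Measure (Ed d)} [IsFiniteMeasure m] [IsFiniteMeasure m'] {k : Ed d → ℝ} {c N h : ℝ}
  {Ξ Ξ1 Ξ2 : ℝ → ℝ} {a B : ℝ}

/-- The constant in the localised entropy inequality. -/
def locC (d : ℕ) (C c K M : ℝ) : ℝ :=
  d * C * ((2 * d * M * C + M * (d * C * c + K)) ^ 2 + M ^ 2) + d ^ 2 * (4 * (M * M)) * C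
    + 2 * d * M ^ 2 * (K + 1)

lemma locC_nonneg {K M : ℝ} (hC : 0 ≤ C) (hK : 0 ≤ K) : 0 ≤ locC d C c K M := by
  unfold locC
  have := mul_self_nonneg M
  positivity

lemma step_aux {I1 I2 I3 I4 J L m0 m1 h a C : ℝ} (h1 : I1 - I2 ≤ h * I3 + a * I4)
    (h2 : h * I3 ≤ h * (-(1 / (2 * C)) * J + L)) (h3 : a * I4 ≤ a * (m1 - m0)) :
    I1 + h / (2 * C) * J ≤ I2 + h * L + a * (m1 - m0) := by
  have e : h / (2 * C) * J = h * (1 / (2 * C) * J) := by ring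
  rw [e]
  linarith

lemma LocEnt.step (hE : LocEnt Ξ Ξ1 Ξ2 a B) (hc : Coef A β bb C) (hk : IsKer k c N)
    (hb : Integrable bb m) (hh : 0 ≤ h) (H : ResSub A β h m m')
    {R K M : ℝ} (hK0 : 0 ≤ K) (hK : ∀ y, ‖y‖ ≤ R + 1 → bb y ≤ K)
    {ζ : Ed d → ℝ} (hζ : Cb2 ζ M) (hS : Function.support ζ ⊆ closedBall 0 R) (hζ1 : ∀ x, |ζ x| ≤ 1)
    {ε : ℝ} (hε1 : ε ≤ 1) (hε : c / N * ∫ y, bb y ∂m ≤ ε) :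
    (∫ x, ζ x ^ 2 * Ξ (cv m (fun _ => 1) k x))
        + h / (2 * C) * (∫ x, ζ x ^ 2 * Ξ2 (cv m (fun _ => 1) k x)
          * ∑ i, pd (cv m (fun _ => 1) k) i x ^ 2)
      ≤ (∫ x, ζ x ^ 2 * Ξ (cv m' (fun _ => 1) k x))
        + h * (locC d C c K M * ((1 + B * ε) * volume.real (closedBall (0 : Ed d) R)
          + m.real univ)) + a * (m'.real univ - m.real univ) := by
  have key := mul_le_mul_of_nonneg_left (hE.integral_mul_div_le hc hk hb hK0 hK hζ hS hε1 hε) hh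
  have hD := integral_mul_defect_le hc hk hb hh H (G := fun x => ζ x ^ 2) (R := R)
    (hζ.contDiff.continuous.pow 2) (fun x => by
      rw [← sq_abs]; exact pow_le_one₀ (abs_nonneg _) (hζ1 x)) (by
      intro x hx; refine hS fun h0 => hx ?_; simp [h0])
  have hD := mul_le_mul_of_nonneg_left hD hE.nonneg
  obtain ⟨Mk, -, hMk⟩ := hk.exists_bound
  have hb1 : Integrable (fun y => 1 * bb y) m := by simpa using hb
  have cF := fun i => contDiff_flux hc hMk hb1 aestronglyMeasurable_const i
  have iζ : ∀ {f : Ed d → ℝ}, Continuous f → Integrable fun x => ζ x ^ 2 * f x := fun hf =>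
    ((hζ.contDiff.continuous.pow 2).mul hf).integrable_of_hasCompactSupport
      (HasCompactSupport.of_support_subset_isCompact (isCompact_closedBall 0 R) fun x hx =>
        hS fun h0 => hx (by simp [h0]))
  have nn : ∀ (ν : Measure (Ed d)) [IsFiniteMeasure ν] x, 0 ≤ cv ν (fun _ => 1) k x := fun ν _ x =>
    cv_nonneg hk (fun _ => zero_le_one) x
  have cρ := hk.continuous_cv (m := m) (integrable_const (1 : ℝ))
  have cρ' := hk.continuous_cv (m := m') (integrable_const (1 : ℝ))
  have cD := continuous_defect (h := h) (m' := m') hc hk hb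
  have cdiv : Continuous fun x => ∑ i, pd (flux A β m (fun _ => 1) k i) i x :=
    continuous_finsetSum _ fun i _ => continuous_pd (cF i) i
  have cρd : ContDiff ℝ 1 (cv m (fun _ => 1) k) :=
    contDiff_cv (integrable_const _) hMk.cb1
  have cΞ1 := (hE.contDiff_comp cρd (nn m)).continuous
  have i1 := iζ (hE.continuous_comp cρ (nn m))
  have i2 := iζ (hE.continuous_comp cρ' (nn m'))
  have i3 : Integrable fun x => ζ x ^ 2 * (Ξ1 (cv m (fun _ => 1) k x)
      * ∑ i, pd (flux A β m (fun _ => 1) k i) i x) := iζ (cΞ1.mul cdiv)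
  have i4 := iζ cD
  have := integral_mono (i1.sub i2) ((i3.const_mul h).add (i4.const_mul a)) fun x => by
    have h1 := hE.sub_le (nn m' x) (nn m x)
    have h2 := defect_nonneg hc hk hb H x
    have h3 := hE.neg_le _ (nn m x)
    have h4 : cv m (fun _ => 1) k x - cv m' (fun _ => 1) k x
      = h * (∑ i, pd (flux A β m (fun _ => 1) k i) i x) - defect A β h m m' k x := by
      rw [defect]; ring
    rw [h4] at h1
    have h5 := mul_le_mul_of_nonneg_right h3 h2
    have h6 := mul_le_mul_of_nonneg_left (show Ξ (cv m (fun _ => 1) k x)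
      - Ξ (cv m' (fun _ => 1) k x) ≤ h * (Ξ1 (cv m (fun _ => 1) k x)
        * ∑ i, pd (flux A β m (fun _ => 1) k i) i x) + a * defect A β h m m' k x by linarith)
        (sq_nonneg (ζ x))
    simp only [Pi.sub_apply, Pi.add_apply]
    linarith
  simp only [Pi.sub_apply, Pi.add_apply] at this
  rw [integral_sub i1 i2, integral_add (i3.const_mul h) (i4.const_mul a), integral_const_mul,
    integral_const_mul] at this
  have e3 : (∫ x, ζ x ^ 2 * (Ξ1 (cv m (fun _ => 1) k x)
      * ∑ i, pd (flux A β m (fun _ => 1) k i) i x)) = ∫ x, ζ x ^ 2 * Ξ1 (cv m (fun _ => 1) k x)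
      * ∑ i, pd (flux A β m (fun _ => 1) k i) i x :=
    integral_congr_ae (Eventually.of_forall fun x => (mul_assoc _ _ _).symm)
  rw [e3] at this
  exact step_aux this key hD

/-- Summed localised entropy inequality along an implicit Euler chain. -/
lemma LocEnt.sum_le (hE : LocEnt Ξ Ξ1 Ξ2 a B) (hc : Coef A β bb C) (hk : IsKer k c N)
    {τ : ℕ → Measure (Ed d)} [∀ n, IsFiniteMeasure (τ n)]
    (hb : ∀ n, Integrable bb (τ n)) (hh : 0 ≤ h) (H : ∀ n, ResSub A β h (τ (n + 1)) (τ n))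
    (h1 : ∀ n, (τ n).real univ ≤ 1)
    {R K M : ℝ} (hK0 : 0 ≤ K) (hK : ∀ y, ‖y‖ ≤ R + 1 → bb y ≤ K)
    {ζ : Ed d → ℝ} (hζ : Cb2 ζ M) (hS : Function.support ζ ⊆ closedBall 0 R) (hζ1 : ∀ x, |ζ x| ≤ 1)
    {ε : ℝ} (hε1 : ε ≤ 1) {n : ℕ} (hε : ∀ j ≤ n, c / N * ∫ y, bb y ∂(τ j) ≤ ε) :
    h / (2 * C) * ∑ j ∈ Finset.range n, (∫ x, ζ x ^ 2 * Ξ2 (cv (τ (j + 1)) (fun _ => 1) k x)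
          * ∑ i, pd (cv (τ (j + 1)) (fun _ => 1) k) i x ^ 2)
      ≤ (∫ x, ζ x ^ 2 * Ξ (cv (τ 0) (fun _ => 1) k x))
        - (∫ x, ζ x ^ 2 * Ξ (cv (τ n) (fun _ => 1) k x))
        + n * h * (locC d C c K M * ((1 + B * ε) * volume.real (closedBall (0 : Ed d) R) + 1))
        + a * ((τ 0).real univ - (τ n).real univ) := by
  induction n with
  | zero => simp
  | succ n ih =>
    have s := hE.step hc hk (hb (n + 1)) hh (H n) hK0 hK hζ hS hζ1 hε1 (hε (n + 1) le_rfl)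
    have ih := ih fun j hj => hε j (by omega)
    have hl : 0 ≤ locC d C c K M := locC_nonneg (by linarith [hc.one_le]) hK0
    have := mul_le_mul_of_nonneg_left (h1 (n + 1)) (mul_nonneg hh hl)
    rw [Finset.sum_range_succ, mul_add]
    push_cast
    linarith

end

lemma lintegral_enorm_eq_ofReal {E : Type*} [MeasurableSpace E] {ν : Measure E} {f : E → ℝ}
    (hf : Integrable f ν) : ∫⁻ x, ‖f x‖ₑ ∂ν = ENNReal.ofReal (∫ x, |f x| ∂ν) := by
  rw [ofReal_integral_eq_lintegral_ofReal hf.abs (Eventually.of_forall fun x => abs_nonneg _)]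
  simp_rw [Real.enorm_eq_ofReal_abs]

/-- A Gagliardo–Nirenberg inequality in every positive dimension, obtained from the sharp one on
`ℝ^d × ℝ`. -/
lemma exists_sobolev (hd : 0 < d) : ∃ S : ℝ, 0 ≤ S ∧ ∀ g : Ed d → ℝ, ContDiff ℝ 1 g →
    HasCompactSupport g → ∫ x, |g x| ^ (((d : ℝ) + 1) / d)
      ≤ S * ((∫ x, |g x|) + ∫ x, ∑ i, |pd g i x|) ^ (((d : ℝ) + 1) / d) := by
  have hd0 : (0 : ℝ) < d := by exact_mod_cast hd
  set p : ℝ := ((d : ℝ) + 1) / d with hp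
  have hp0 : 0 < p := by positivity
  let b : ContDiffBump (0 : ℝ) := ⟨1, 2, one_pos, one_lt_two⟩
  have hb : ContDiff ℝ 1 b := b.contDiff
  have sb : HasCompactSupport b := b.hasCompactSupport
  have cb : Continuous (deriv b) := hb.continuous_deriv le_rfl
  have ib : Integrable (b : ℝ → ℝ) := hb.continuous.integrable_of_hasCompactSupport sb
  have ib' : Integrable (deriv b) := cb.integrable_of_hasCompactSupport sb.deriv
  set a₁ := ∫ t, |b t| with ha₁
  set a₂ := ∫ t, |deriv b t| with ha₂
  have ha₁0 : 0 ≤ a₁ := integral_nonneg fun _ => abs_nonneg _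
  have ha₂0 : 0 ≤ a₂ := integral_nonneg fun _ => abs_nonneg _
  have cbp : Continuous fun t => |b t| ^ p := hb.continuous.abs.rpow_const fun _ => Or.inr hp0.le
  have sbp : HasCompactSupport fun t => |b t| ^ p :=
    sb.comp_left (g := fun y : ℝ => |y| ^ p) (by simp [hp0.ne'])
  have ibp := cbp.integrable_of_hasCompactSupport (μ := volume) sbp
  set a₃ := ∫ t, |b t| ^ p with ha₃
  have ha₃0 : 0 < a₃ := by
    rw [ha₃, integral_pos_iff_support_of_nonneg (fun t => by positivity) ibp]
    refine cbp.isOpen_support.measure_pos volume ⟨0, ?_⟩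
    have : b 0 = 1 := b.one_of_mem_closedBall (mem_closedBall_self zero_le_one)
    simp [this]
  have hfr : (Module.finrank ℝ (Ed d × ℝ) : ℝ).HolderConjugate p := by
    rw [Module.finrank_prod, finrank_euclideanSpace_fin, Module.finrank_self]
    push_cast
    rw [Real.holderConjugate_iff]
    refine ⟨by linarith, ?_⟩
    rw [hp]; field_simp; ring
  have : (volume : Measure (Ed d × ℝ)).IsAddHaarMeasure := inferInstanceAs
    (((volume : Measure (Ed d)).prod (volume : Measure ℝ)).IsAddHaarMeasure)
  set S₀ : ℝ≥0 := lintegralPowLePowLIntegralFDerivConst (volume : Measure (Ed d × ℝ)) p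
  refine ⟨(S₀ : ℝ) * (a₁ + a₂) ^ p / a₃, by positivity, fun g hg hs => ?_⟩
  have ig : Integrable g := hg.continuous.integrable_of_hasCompactSupport hs
  have ipd : ∀ i, Integrable (pd g i) := fun i =>
    (continuous_pd hg i).integrable_of_hasCompactSupport (hasCompactSupport_pd hs i)
  have isum : Integrable fun x => ∑ i, |pd g i x| := integrable_finsetSum _ fun i _ => (ipd i).abs
  set G := ∫ x, |g x| with hG
  set D := ∫ x, ∑ i, |pd g i x| with hD
  have hG0 : 0 ≤ G := integral_nonneg fun _ => abs_nonneg _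
  have hD0 : 0 ≤ D := integral_nonneg fun _ => Finset.sum_nonneg fun _ _ => abs_nonneg _
  let u : Ed d × ℝ → ℝ := fun z => g z.1 * b z.2
  have hu : ContDiff ℝ 1 u := (hg.comp contDiff_fst).mul (hb.comp contDiff_snd)
  have su : HasCompactSupport u := by
    refine HasCompactSupport.of_support_subset_isCompact (hs.isCompact.prod sb.isCompact) ?_
    intro z hz
    exact ⟨subset_tsupport _ (left_ne_zero_of_mul hz), subset_tsupport _ (right_ne_zero_of_mul hz)⟩
  have key := lintegral_pow_le_pow_lintegral_fderiv (volume : Measure (Ed d × ℝ)) hu su hfr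
  have cgp : Continuous fun t => |g t| ^ p := hg.continuous.abs.rpow_const fun _ => Or.inr hp0.le
  have igp : Integrable fun t => |g t| ^ p := cgp.integrable_of_hasCompactSupport
    (hs.comp_left (g := fun y : ℝ => |y| ^ p) (by simp [hp0.ne']))
  have e1 : ∫⁻ z, ‖u z‖ₑ ^ p = ENNReal.ofReal ((∫ x, |g x| ^ p) * a₃) := by
    have : ∀ z, ‖u z‖ₑ ^ p = ENNReal.ofReal (|g z.1| ^ p) * ENNReal.ofReal (|b z.2| ^ p) :=
      fun z => by
        rw [Real.enorm_eq_ofReal_abs, ENNReal.ofReal_rpow_of_nonneg (abs_nonneg _) hp0.le,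
          ← ENNReal.ofReal_mul (by positivity), abs_mul,
          Real.mul_rpow (abs_nonneg _) (abs_nonneg _)]
    simp_rw [this]
    rw [show (volume : Measure (Ed d × ℝ)) = volume.prod volume from rfl,
      lintegral_prod_mul cgp.measurable.ennreal_ofReal.aemeasurable
        cbp.measurable.ennreal_ofReal.aemeasurable,
      ← ofReal_integral_eq_lintegral_ofReal igp (Eventually.of_forall fun _ => by positivity),
      ← ofReal_integral_eq_lintegral_ofReal ibp (Eventually.of_forall fun _ => by positivity),
      ENNReal.ofReal_mul (by positivity)]
  have e2 : ∫⁻ z, ‖fderiv ℝ u z‖ₑ ≤ ENNReal.ofReal ((a₁ + a₂) * (G + D)) := by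
    have hle : ∀ z, ‖fderiv ℝ u z‖ₑ ≤ ‖g z.1‖ₑ * ‖deriv b z.2‖ₑ
        + ‖∑ i, |pd g i z.1|‖ₑ * ‖b z.2‖ₑ := fun z => by
      have h1 := ((hg.differentiable one_ne_zero).differentiableAt (x := z.1)).hasFDerivAt.comp z
        (hasFDerivAt_fst (𝕜 := ℝ) (E := Ed d) (F := ℝ))
      have h2 := ((hb.differentiable one_ne_zero).differentiableAt (x := z.2)).hasFDerivAt.comp z
        (hasFDerivAt_snd (𝕜 := ℝ) (E := Ed d) (F := ℝ))
      have h3 := (h1.mul h2).fderiv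
      have h4 : fderiv ℝ u z = _ := h3
      rw [h4]
      simp only [enorm_eq_nnnorm]
      norm_cast
      rw [← NNReal.coe_le_coe]
      push_cast
      refine (norm_add_le _ _).trans (add_le_add ?_ ?_)
      · rw [norm_smul]
        refine mul_le_mul_of_nonneg_left ((ContinuousLinearMap.opNorm_comp_le _ _).trans ?_)
          (norm_nonneg _)
        rw [norm_deriv_eq_norm_fderiv]
        exact mul_le_of_le_one_right (norm_nonneg _) (ContinuousLinearMap.norm_snd_le _ _ _)
      · rw [norm_smul, mul_comm]
        refine mul_le_mul_of_nonneg_right ((ContinuousLinearMap.opNorm_comp_le _ _).trans ?_)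
          (norm_nonneg _)
        rw [Real.norm_of_nonneg (Finset.sum_nonneg fun _ _ => abs_nonneg _)]
        exact (mul_le_of_le_one_right (norm_nonneg _) (ContinuousLinearMap.norm_fst_le _ _ _)).trans
          (norm_fderiv_le_sum_pd g _)
    refine (lintegral_mono hle).trans ?_
    rw [lintegral_add_left (by
      exact ((hg.continuous.measurable.comp measurable_fst).enorm.mul
        (cb.measurable.comp measurable_snd).enorm)),
      show (volume : Measure (Ed d × ℝ)) = volume.prod volume from rfl,
      lintegral_prod_mul (f := fun x => ‖g x‖ₑ) (g := fun t => ‖deriv b t‖ₑ)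
        hg.continuous.measurable.enorm.aemeasurable cb.measurable.enorm.aemeasurable,
      lintegral_prod_mul (f := fun x => ‖∑ i, |pd g i x|‖ₑ) (g := fun t => ‖b t‖ₑ)
        isum.aestronglyMeasurable.aemeasurable.enorm hb.continuous.measurable.enorm.aemeasurable,
      lintegral_enorm_eq_ofReal ig, lintegral_enorm_eq_ofReal ib', lintegral_enorm_eq_ofReal isum,
      lintegral_enorm_eq_ofReal ib]
    have : ∫ x, |(∑ i, |pd g i x|)| = D := by
      refine integral_congr_ae (Eventually.of_forall fun x => ?_)
      exact abs_of_nonneg (Finset.sum_nonneg fun _ _ => abs_nonneg _)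
    rw [this, ← ENNReal.ofReal_mul hG0, ← ENNReal.ofReal_mul hD0,
      ← ENNReal.ofReal_add (by positivity) (by positivity)]
    exact ENNReal.ofReal_le_ofReal (by nlinarith [mul_nonneg hG0 ha₁0, mul_nonneg hD0 ha₂0])
  rw [e1] at key
  have key := key.trans (mul_le_mul_right (ENNReal.rpow_le_rpow e2 hp0.le) _)
  rw [ENNReal.ofReal_rpow_of_nonneg (by positivity) hp0.le, ← ENNReal.ofReal_coe_nnreal,
    ← ENNReal.ofReal_mul (by positivity), ENNReal.ofReal_le_ofReal_iff (by positivity),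
    Real.mul_rpow (by positivity) (by positivity)] at key
  rw [div_mul_eq_mul_div, le_div_iff₀ ha₃0]
  linarith

lemma sq_sub_midpoint_le {v : Ed d → ℝ} (hv : ContDiff ℝ 1 v) (x y : Ed d) :
    (v x - v ((1 / 2 : ℝ) • x + (1 / 2 : ℝ) • y)) ^ 2
      ≤ ‖y - x‖ ^ 2 / 2 * ∫ t in (0 : ℝ)..(1 / 2), ∑ i, pd v i ((1 - t) • x + t • y) ^ 2 := by
  let γ : ℝ → Ed d := fun t => (1 - t) • x + t • y
  have hγ : ∀ t, HasDerivAt γ (y - x) t := fun t => by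
    have := (((hasDerivAt_id t).const_sub 1).smul_const x).add ((hasDerivAt_id t).smul_const y)
    refine this.congr_deriv ?_
    simp only [neg_smul, one_smul]; abel
  have cγ : Continuous γ := continuous_iff_continuousAt.2 fun t => (hγ t).continuousAt
  let f' : ℝ → ℝ := fun t => ∑ i, pd v i (γ t) * (y - x) i
  have hf : ∀ t, HasDerivAt (fun t => v (γ t)) (f' t) t := fun t => by
    have := ((hv.differentiable one_ne_zero).differentiableAt (x := γ t)).hasFDerivAt.comp_hasDerivAt
      t (hγ t)
    refine this.congr_deriv ?_
    rw [fderiv_apply_eq_sum_pd]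
    exact Finset.sum_congr rfl fun i _ => mul_comm _ _
  have cp : ∀ i, Continuous fun t => pd v i (γ t) := fun i => (continuous_pd hv i).comp cγ
  have cf' : Continuous f' := continuous_finsetSum _ fun i _ => (cp i).mul continuous_const
  have ftc := intervalIntegral.integral_eq_sub_of_hasDerivAt (a := 0) (b := 1 / 2)
    (fun t _ => hf t) (cf'.intervalIntegrable _ _)
  set Δ := v (γ (1 / 2)) - v (γ 0) with hΔ
  have h1 : 2 * Δ ^ 2 ≤ ∫ t in (0 : ℝ)..(1 / 2), f' t ^ 2 := by
    have h0 : 0 ≤ ∫ t in (0 : ℝ)..(1 / 2), (f' t - 2 * Δ) ^ 2 :=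
      intervalIntegral.integral_nonneg (by norm_num) fun t _ => sq_nonneg _
    have e : ∀ t, (f' t - 2 * Δ) ^ 2 = f' t ^ 2 - (4 * Δ) * f' t + 4 * Δ ^ 2 := fun t => by ring
    simp_rw [e] at h0
    have j1 : IntervalIntegrable (fun t => f' t ^ 2) volume 0 (1 / 2) :=
      (cf'.pow 2).intervalIntegrable _ _
    have j2 : IntervalIntegrable (fun t => 4 * Δ * f' t) volume 0 (1 / 2) :=
      (continuous_const.mul cf').intervalIntegrable _ _
    rw [intervalIntegral.integral_add (j1.sub j2) intervalIntegrable_const,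
      intervalIntegral.integral_sub j1 j2, intervalIntegral.integral_const_mul, ftc,
      intervalIntegral.integral_const] at h0
    simp only [smul_eq_mul] at h0
    nlinarith
  have h2 : ∫ t in (0 : ℝ)..(1 / 2), f' t ^ 2
      ≤ ‖y - x‖ ^ 2 * ∫ t in (0 : ℝ)..(1 / 2), ∑ i, pd v i (γ t) ^ 2 := by
    rw [← intervalIntegral.integral_const_mul]
    refine intervalIntegral.integral_mono (by norm_num) ((cf'.pow 2).intervalIntegrable _ _)
      ((continuous_const.mul (continuous_finsetSum _ fun i _ => (cp i).pow 2)).intervalIntegrable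
        _ _) fun t => ?_
    refine (Finset.sum_mul_sq_le_sq_mul_sq _ _ _).trans_eq ?_
    rw [EuclideanSpace.real_norm_sq_eq, mul_comm]
  have e3 : v x - v ((1 / 2 : ℝ) • x + (1 / 2 : ℝ) • y) = -Δ := by
    have e1 : γ 0 = x := by simp [γ]
    have e2 : γ (1 / 2) = (1 / 2 : ℝ) • x + (1 / 2 : ℝ) • y := by simp only [γ]; norm_num
    rw [hΔ, e1, e2]; ring
  rw [e3, neg_sq]
  linarith

lemma lintegral_comp_affine_le {H : Ed d → ℝ≥0∞} (hH : Measurable H) {t : ℝ} (h0 : 0 ≤ t)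
    (h1 : t ≤ 1 / 2) {B : Set (Ed d)} (hB : Convex ℝ B) (hBm : MeasurableSet B) {y : Ed d}
    (hy : y ∈ B) :
    ∫⁻ x in B, H ((1 - t) • x + t • y) ≤ ENNReal.ofReal (2 ^ d) * ∫⁻ z in B, H z := by
  have ht : (0 : ℝ) < 1 - t := by linarith
  have hm : Measurable (B.indicator H) := hH.indicator hBm
  calc ∫⁻ x in B, H ((1 - t) • x + t • y)
      ≤ ∫⁻ x, B.indicator H ((1 - t) • x + t • y) := by
        rw [← lintegral_indicator hBm]
        refine lintegral_mono fun x => ?_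
        by_cases hx : x ∈ B
        · rw [indicator_of_mem hx, indicator_of_mem (hB hx hy ht.le h0 (by ring))]
        · rw [indicator_of_notMem hx]; exact zero_le
    _ = ∫⁻ x, B.indicator H (x + t • y) ∂(volume.map ((1 - t) • · : Ed d → Ed d)) :=
        (lintegral_map (hm.comp (measurable_add_const _)) (measurable_const_smul _)).symm
    _ = ENNReal.ofReal |((1 - t) ^ Module.finrank ℝ (Ed d))⁻¹| * ∫⁻ z in B, H z := by
        rw [Measure.map_addHaar_smul _ ht.ne', lintegral_smul_measure,
          lintegral_add_right_eq_self (fun x => B.indicator H x), lintegral_indicator hBm, smul_eq_mul]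
    _ ≤ _ := by
        refine mul_le_mul_left (ENNReal.ofReal_le_ofReal ?_) _
        rw [finrank_euclideanSpace_fin, abs_of_pos (by positivity), ← inv_pow]
        refine pow_le_pow_left₀ (by positivity) ?_ _
        rw [inv_le_comm₀ ht two_pos]
        linarith

/-- A Poincaré inequality on balls in difference form. -/
lemma poincare_ball {v : Ed d → ℝ} (hv : ContDiff ℝ 1 v) {r : ℝ} :
    ∫⁻ y in closedBall (0 : Ed d) r, ∫⁻ x in closedBall (0 : Ed d) r,
        ENNReal.ofReal ((v x - v y) ^ 2)
      ≤ ENNReal.ofReal (4 * r ^ 2 * 2 ^ d) * volume (closedBall (0 : Ed d) r)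
        * ∫⁻ z in closedBall (0 : Ed d) r, ENNReal.ofReal (∑ i, pd v i z ^ 2) := by
  set B := closedBall (0 : Ed d) r with hB
  have hBm : MeasurableSet B := measurableSet_closedBall
  have hv0 := hv.continuous
  let H : Ed d → ℝ := fun z => ∑ i, pd v i z ^ 2
  have hH : Continuous H := continuous_finsetSum _ fun i _ => (continuous_pd hv i).pow 2
  have hH0 : ∀ z, 0 ≤ H z := fun z => Finset.sum_nonneg fun i _ => sq_nonneg _
  let F : Ed d → Ed d → ℝ≥0∞ := fun x y =>
    ENNReal.ofReal ((v x - v ((1 / 2 : ℝ) • x + (1 / 2 : ℝ) • y)) ^ 2)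
  have mF : Measurable (Function.uncurry F) := by
    refine Measurable.ennreal_ofReal (Continuous.measurable ?_)
    fun_prop
  have hF : ∀ x y, ENNReal.ofReal ((v x - v y) ^ 2) ≤ 2 * F x y + 2 * F y x := fun x y => by
    have e2 : (2 : ℝ≥0∞) = ENNReal.ofReal 2 := by simp
    simp only [F, e2]
    rw [← ENNReal.ofReal_mul zero_le_two, ← ENNReal.ofReal_mul zero_le_two,
      ← ENNReal.ofReal_add (by positivity) (by positivity), add_comm ((1 / 2 : ℝ) • y)]
    refine ENNReal.ofReal_le_ofReal ?_
    nlinarith [sq_nonneg (v x - v ((1 / 2 : ℝ) • x + (1 / 2 : ℝ) • y)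
      + (v y - v ((1 / 2 : ℝ) • x + (1 / 2 : ℝ) • y)))]
  have main : ∫⁻ y in B, ∫⁻ x in B, F x y
      ≤ ENNReal.ofReal (r ^ 2 * 2 ^ d) * volume B * ∫⁻ z in B, ENNReal.ofReal (H z) := by
    have pt : ∀ y ∈ B, ∀ x ∈ B, F x y ≤ ENNReal.ofReal (2 * r ^ 2)
        * ∫⁻ t in Ioc (0 : ℝ) (1 / 2), ENNReal.ofReal (H ((1 - t) • x + t • y)) := fun y hy x hx => by
      have ct : Continuous fun t : ℝ => H ((1 - t) • x + t • y) := by fun_prop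
      rw [← ofReal_integral_eq_lintegral_ofReal
        ((ct.intervalIntegrable 0 (1 / 2)).1) (Eventually.of_forall fun t => hH0 _),
        ← ENNReal.ofReal_mul (by positivity)]
      refine ENNReal.ofReal_le_ofReal ((sq_sub_midpoint_le hv x y).trans ?_)
      rw [intervalIntegral.integral_of_le (by norm_num)]
      refine mul_le_mul_of_nonneg_right ?_ (integral_nonneg fun t => hH0 _)
      rw [hB, mem_closedBall, dist_zero_right] at hx hy
      have : ‖y - x‖ ≤ 2 * r := (norm_sub_le _ _).trans (by linarith)
      have := pow_le_pow_left₀ (norm_nonneg _) this 2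
      linarith
    have iy : ∀ y ∈ B, ∫⁻ x in B, F x y
        ≤ ENNReal.ofReal (r ^ 2 * 2 ^ d) * ∫⁻ z in B, ENNReal.ofReal (H z) := fun y hy => by
      calc ∫⁻ x in B, F x y
          ≤ ∫⁻ x in B, ENNReal.ofReal (2 * r ^ 2)
            * ∫⁻ t in Ioc (0 : ℝ) (1 / 2), ENNReal.ofReal (H ((1 - t) • x + t • y)) :=
            setLIntegral_mono' hBm (pt y hy)
        _ = ENNReal.ofReal (2 * r ^ 2) * ∫⁻ t in Ioc (0 : ℝ) (1 / 2), ∫⁻ x in B,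
            ENNReal.ofReal (H ((1 - t) • x + t • y)) := by
            rw [lintegral_const_mul' _ _ ENNReal.ofReal_ne_top, lintegral_lintegral_swap]
            refine (Measurable.ennreal_ofReal (Continuous.measurable ?_)).aemeasurable
            exact hH.comp (by fun_prop : Continuous fun q : Ed d × ℝ => (1 - q.2) • q.1 + q.2 • y)
        _ ≤ ENNReal.ofReal (2 * r ^ 2) * ∫⁻ t in Ioc (0 : ℝ) (1 / 2),
            (ENNReal.ofReal (2 ^ d) * ∫⁻ z in B, ENNReal.ofReal (H z)) := by
            refine mul_le_mul_right (setLIntegral_mono' measurableSet_Ioc fun t ht => ?_) _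
            exact lintegral_comp_affine_le hH.measurable.ennreal_ofReal ht.1.le ht.2
              (convex_closedBall _ _) hBm hy
        _ = _ := by
            have e : ENNReal.ofReal (r ^ 2 * 2 ^ d) = ENNReal.ofReal (2 * r ^ 2)
                * ENNReal.ofReal (2 ^ d) * ENNReal.ofReal (1 / 2 - 0) := by
              rw [← ENNReal.ofReal_mul (by positivity), ← ENNReal.ofReal_mul (by positivity)]
              congr 1
              ring
            rw [setLIntegral_const, Real.volume_Ioc, e]
            ring
    refine (setLIntegral_mono' hBm iy).trans_eq ?_
    rw [setLIntegral_const]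
    ring
  have mF1 : ∀ y, Measurable fun x => F x y := fun y => mF.comp (measurable_id.prodMk measurable_const)
  have mI : Measurable fun y => ∫⁻ x in B, F x y :=
    Measurable.lintegral_prod_left (f := F) mF
  calc _ ≤ ∫⁻ y in B, ∫⁻ x in B, (2 * F x y + 2 * F y x) :=
        lintegral_mono fun y => lintegral_mono fun x => hF x y
    _ = 2 * (∫⁻ y in B, ∫⁻ x in B, F x y) + 2 * ∫⁻ y in B, ∫⁻ x in B, F y x := by
        simp_rw [lintegral_add_left ((mF1 _).const_mul 2), lintegral_const_mul' _ _ ENNReal.ofNat_ne_top]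
        rw [lintegral_add_left (mI.const_mul 2), lintegral_const_mul' _ _ ENNReal.ofNat_ne_top,
          lintegral_const_mul' _ _ ENNReal.ofNat_ne_top]
    _ = 4 * ∫⁻ y in B, ∫⁻ x in B, F x y := by
        rw [lintegral_lintegral_swap (f := fun y x => F y x) mF.aemeasurable]
        ring
    _ ≤ 4 * (ENNReal.ofReal (r ^ 2 * 2 ^ d) * volume B * ∫⁻ z in B, ENNReal.ofReal (H z)) :=
        mul_le_mul_right main _
    _ = _ := by
        rw [← ENNReal.ofReal_ofNat, ← mul_assoc, ← mul_assoc, ← ENNReal.ofReal_mul (by norm_num),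
          ← mul_assoc]

/-- If `v` separates two subsets of a ball, then its Dirichlet energy is bounded below. -/
lemma sq_mul_volume_le_dirichlet {v : Ed d → ℝ} (hv : ContDiff ℝ 1 v) {r : ℝ} (hr : 0 ≤ r)
    {S S' : Set (Ed d)} (hS : MeasurableSet S) (hS' : MeasurableSet S')
    (hSB : S ⊆ closedBall 0 r) (hSB' : S' ⊆ closedBall 0 r) {ℓ : ℝ} (hℓ : 0 ≤ ℓ)
    (h : ∀ x ∈ S, ∀ y ∈ S', ℓ ≤ v x - v y) :
    ℓ ^ 2 * volume.real S * volume.real S'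
      ≤ 4 * r ^ 2 * 2 ^ d * volume.real (closedBall (0 : Ed d) r)
        * ∫ z in closedBall (0 : Ed d) r, ∑ i, pd v i z ^ 2 := by
  have hH : Continuous fun z => ∑ i, pd v i z ^ 2 :=
    continuous_finsetSum _ fun i _ => (continuous_pd hv i).pow 2
  have fin : ∀ {s}, s ⊆ closedBall (0 : Ed d) r → volume s ≠ ⊤ := fun hs =>
    ((measure_mono hs).trans_lt measure_closedBall_lt_top).ne
  have key : ENNReal.ofReal (ℓ ^ 2) * volume S * volume S' ≤ _ :=
    le_trans ?_ (poincare_ball (r := r) hv)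
  · rw [← ofReal_integral_eq_lintegral_ofReal
      (hH.continuousOn.integrableOn_compact (isCompact_closedBall _ _))
      (Eventually.of_forall fun z => Finset.sum_nonneg fun i _ => sq_nonneg _)] at key
    have := ENNReal.toReal_mono (by finiteness [fin subset_rfl]) key
    simpa [ENNReal.toReal_mul, Measure.real, hr, sq_nonneg, ENNReal.toReal_ofReal,
      ENNReal.toReal_ofReal (integral_nonneg fun z : Ed d =>
        Finset.sum_nonneg fun i (_ : i ∈ Finset.univ) => sq_nonneg (pd v i z))] using this
  · calc ENNReal.ofReal (ℓ ^ 2) * volume S * volume S'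
        = ∫⁻ y in S', ∫⁻ x in S, ENNReal.ofReal (ℓ ^ 2) := by
          rw [setLIntegral_const, setLIntegral_const]
      _ ≤ ∫⁻ y in S', ∫⁻ x in S, ENNReal.ofReal ((v x - v y) ^ 2) :=
          setLIntegral_mono' hS' fun y hy => setLIntegral_mono' hS fun x hx =>
            ENNReal.ofReal_le_ofReal (pow_le_pow_left₀ hℓ (h x hx y hy) 2)
      _ ≤ _ := (lintegral_mono fun y => lintegral_mono_set hSB).trans (lintegral_mono_set hSB')

lemma locEnt_rpow {θ : ℝ} (h0 : 0 < θ) (h1 : θ < 1) :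
    LocEnt (fun t => (1 + t) - (1 + t) ^ θ) (fun t => 1 - θ * (1 + t) ^ (θ - 1))
      (fun t => θ * (1 - θ) * (1 + t) ^ (θ - 2)) 0 1 := by
  have pos : ∀ t : ℝ, 0 ≤ t → 0 < 1 + t := fun t ht => by linarith
  have hid : ∀ t : ℝ, HasDerivAt (fun t : ℝ => 1 + t) 1 t := fun t => (hasDerivAt_id t).const_add 1
  have h2 : ∀ t : ℝ, 0 ≤ t → (1 + t) ^ (θ - 1) ≤ 1 := fun t ht =>
    Real.rpow_le_one_of_one_le_of_nonpos (by linarith) (by linarith)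
  have h3 : ∀ t : ℝ, 0 ≤ t → (1 + t) ^ (θ - 2) ≤ (1 + t)⁻¹ := fun t ht => by
    rw [← Real.rpow_neg_one]
    exact Real.rpow_le_rpow_of_exponent_le (by linarith) (by linarith)
  have h4 : ∀ t : ℝ, 0 ≤ t → (1 + t)⁻¹ ≤ 1 := fun t ht => inv_le_one_of_one_le₀ (by linarith)
  have p1 : ∀ t : ℝ, 0 ≤ t → 0 < (1 + t) ^ (θ - 1) := fun t ht => Real.rpow_pos_of_pos (pos t ht) _
  have p2 : ∀ t : ℝ, 0 ≤ t → 0 < (1 + t) ^ (θ - 2) := fun t ht => Real.rpow_pos_of_pos (pos t ht) _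
  have hθ : θ * (1 - θ) ≤ 1 := by nlinarith
  have hθ0 : 0 ≤ θ * (1 - θ) := mul_nonneg h0.le (by linarith)
  have b1 : ∀ t : ℝ, 0 ≤ t → 0 ≤ 1 - θ * (1 + t) ^ (θ - 1) := fun t ht => by
    nlinarith [h2 t ht, p1 t ht]
  have b2 : ∀ t : ℝ, 0 ≤ t → |1 - θ * (1 + t) ^ (θ - 1)| ≤ 1 := fun t ht => by
    rw [abs_of_nonneg (b1 t ht)]
    nlinarith [mul_pos h0 (p1 t ht)]
  have b3 : ∀ t : ℝ, 0 ≤ t → θ * (1 - θ) * (1 + t) ^ (θ - 2) ≤ (1 + t)⁻¹ := fun t ht =>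
    (mul_le_of_le_one_left (p2 t ht).le hθ).trans (h3 t ht)
  refine ⟨fun t ht => ?_, fun t ht => ?_, fun t ht => ?_, ?_, le_rfl, fun t ht => ?_, b2,
    fun t ht => mul_nonneg hθ0 (p2 t ht).le, fun t ht => (b3 t ht).trans (h4 t ht), fun t ht => ?_,
    fun t ht => ?_⟩
  · refine ((hid t).sub ((hid t).rpow_const (p := θ) (Or.inl (pos t ht).ne'))).congr_deriv (by ring)
  · refine ((((hid t).rpow_const (p := θ - 1) (Or.inl (pos t ht).ne')).const_mul θ).const_sub
      1).congr_deriv ?_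
    rw [show θ - 1 - 1 = θ - 2 by ring]; ring
  · exact contDiffAt_const.sub (contDiffAt_const.mul
      ((contDiffAt_const.add contDiffAt_id).rpow_const_of_ne (pos t ht).ne'))
  · exact continuousOn_const.mul (ContinuousOn.rpow_const (by fun_prop)
      fun t ht => Or.inl (pos t ht).ne')
  · simpa using b1 t ht
  · nlinarith [b2 t ht]
  · calc t ^ 2 * (θ * (1 - θ) * (1 + t) ^ (θ - 2)) ≤ (1 + t) ^ 2 * (1 + t)⁻¹ :=
          mul_le_mul (by nlinarith) (b3 t ht) (mul_nonneg hθ0 (p2 t ht).le) (sq_nonneg _)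
      _ = 1 + t := by rw [sq, mul_assoc, mul_inv_cancel₀ (pos t ht).ne', mul_one]

lemma locEnt_log {δ : ℝ} (h0 : 0 < δ) (h1 : δ ≤ 1) :
    LocEnt (fun t => -log (δ + t)) (fun t => -(δ + t)⁻¹) (fun t => (δ + t)⁻¹ ^ 2) δ⁻¹ (δ⁻¹ ^ 2) := by
  have pos : ∀ t : ℝ, 0 ≤ t → 0 < δ + t := fun t ht => by linarith
  have hid : ∀ t : ℝ, HasDerivAt (fun t : ℝ => δ + t) 1 t := fun t => (hasDerivAt_id t).const_add δ
  have hi : ∀ t : ℝ, 0 ≤ t → (δ + t)⁻¹ ≤ δ⁻¹ := fun t ht => inv_anti₀ h0 (by linarith)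
  have hi0 : ∀ t : ℝ, 0 ≤ t → 0 < (δ + t)⁻¹ := fun t ht => inv_pos.2 (pos t ht)
  have ht1 : ∀ t : ℝ, 0 ≤ t → t * (δ + t)⁻¹ ≤ 1 := fun t ht => by
    rw [mul_inv_le_iff₀ (pos t ht)]; linarith
  have hd1 : 1 ≤ δ⁻¹ := (one_le_inv₀ h0).2 h1
  refine ⟨fun t ht => ?_, fun t ht => ?_, fun t ht => ?_, ?_, (inv_pos.2 h0).le, fun t ht => ?_,
    fun t ht => ?_, fun t ht => sq_nonneg _, fun t ht => pow_le_pow_left₀ (hi0 t ht).le (hi t ht) 2,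
    fun t ht => ?_, fun t ht => ?_⟩
  · refine ((hid t).log (pos t ht).ne').neg.congr_deriv ?_
    rw [one_div]
  · refine ((hid t).inv (pos t ht).ne').neg.congr_deriv ?_
    rw [inv_pow]; ring
  · exact ((contDiffAt_const.add contDiffAt_id).inv (pos t ht).ne').neg
  · exact (ContinuousOn.inv₀ (by fun_prop) fun t ht => (pos t ht).ne').pow 2
  · exact neg_le_neg (hi t ht)
  · rw [abs_neg, abs_of_pos (hi0 t ht)]
    nlinarith [hi t ht]
  · rw [abs_neg, abs_of_pos (hi0 t ht)]
    linarith [ht1 t ht]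
  · rw [← mul_pow]
    have := pow_le_one₀ (n := 2) (mul_nonneg ht (hi0 t ht).le) (ht1 t ht)
    linarith

set_option maxHeartbeats 1000000 in
/-- Higher integrability, in the form of a lower bound for superlevel sets. -/
lemma exists_level (hd : 0 < d) (R M X : ℝ) (hX : 0 ≤ X) (hM : 0 ≤ M) :
    ∃ κ > (0 : ℝ), ∃ κ' > (0 : ℝ), ∀ (ρ ζ : Ed d → ℝ) (r θ : ℝ), θ = (2 * d + 1) / (2 * d + 2) →
      ContDiff ℝ 1 ρ → (∀ x, 0 ≤ ρ x) → Cb2 ζ M → Function.support ζ ⊆ closedBall 0 R →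
      (∀ x, |ζ x| ≤ 1) → r ≤ R → (∀ x ∈ closedBall (0 : Ed d) r, ζ x = 1) →
      ∫ x in closedBall (0 : Ed d) R, ρ x ≤ 1 →
      ∫ x, ζ x ^ 2 * (θ * (1 - θ) * (1 + ρ x) ^ (θ - 2)) * ∑ i, pd ρ i x ^ 2 ≤ X →
      1 / 8 ≤ ∫ x in closedBall (0 : Ed d) r, ρ x →
      κ' ≤ volume.real {x ∈ closedBall (0 : Ed d) r | κ ≤ ρ x} := by
  obtain ⟨S, hS0, hS⟩ := exists_sobolev hd
  have hd0 : (0 : ℝ) < d := by exact_mod_cast hd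
  set θ : ℝ := (2 * d + 1) / (2 * d + 2) with hθ
  set p : ℝ := ((d : ℝ) + 1) / d with hp
  set q : ℝ := θ * p with hq
  have hp0 : 0 < p := by positivity
  have hθ0 : 0 < θ := by positivity
  have hθ1 : θ < 1 := by rw [hθ, div_lt_one (by positivity)]; linarith
  have hq1 : 1 < q := by
    have : q = (2 * d + 1) / (2 * d) := by rw [hq, hθ, hp]; field_simp
    rw [this, one_lt_div (by positivity)]; linarith
  set vol := volume.real (closedBall (0 : Ed d) R) with hvol
  have hvol0 : 0 ≤ vol := measureReal_nonneg
  set Z : ℝ := (vol + 1) + d * (2 * M * (vol + 1)) + (1 / 2 : ℝ) * (X / (θ * (1 - θ)) + d * (vol + 1))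
    with hZ
  have hθ2 : 0 < θ * (1 - θ) := mul_pos hθ0 (by linarith)
  have hZ0 : 0 ≤ Z := by positivity
  set Q : ℝ := S * Z ^ p with hQ
  have hQ0 : 0 ≤ Q := by positivity
  obtain ⟨L, hL, hL1⟩ : ∃ L : ℝ, L ^ (1 - q) * Q < 1 / 32 ∧ 1 ≤ L := by
    have := (tendsto_rpow_neg_atTop (y := q - 1) (by linarith)).mul_const Q
    rw [zero_mul] at this
    have h2 := (this.eventually (gt_mem_nhds (show (0 : ℝ) < 1 / 32 by norm_num))).and
      (eventually_ge_atTop (1 : ℝ))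
    simpa [neg_sub] using h2.exists
  refine ⟨1 / (32 * (vol + 1)), by positivity, 1 / (16 * L), by positivity,
    fun ρ ζ r θ' hθ' hρ h0 hζ hs hζ1 hrR hζr hint hE hlow => ?_⟩
  subst hθ'
  set κ : ℝ := 1 / (32 * (vol + 1)) with hκ
  set B := closedBall (0 : Ed d) R with hB
  set Br := closedBall (0 : Ed d) r with hBr
  have pos : ∀ x, 0 < 1 + ρ x := fun x => by linarith [h0 x]
  have cρ := hρ.continuous
  have cζ := hζ.contDiff.continuous
  have hB1 : IntegrableOn (fun x => 1 + ρ x) B :=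
    (continuous_const.add cρ).continuousOn.integrableOn_compact (isCompact_closedBall _ _)
  have hBi : ∫ x in B, (1 + ρ x) ≤ vol + 1 := by
    rw [integral_add (continuousOn_const.integrableOn_compact (isCompact_closedBall _ _))
      (cρ.continuousOn.integrableOn_compact
      (isCompact_closedBall _ _)), setIntegral_const, smul_eq_mul, mul_one]
    linarith
  let f : Ed d → ℝ := fun x => (1 + ρ x) ^ θ
  let g : Ed d → ℝ := fun x => ζ x ^ 2 * f x
  have hf : ContDiff ℝ 1 f := (contDiff_const.add hρ).rpow_const_of_ne fun x => (pos x).ne'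
  have hζ' : ContDiff ℝ 1 fun x => ζ x ^ 2 := (hζ.contDiff.of_le one_le_two).pow 2
  have hg : ContDiff ℝ 1 g := hζ'.mul hf
  have sg : HasCompactSupport g := HasCompactSupport.of_support_subset_isCompact
    (isCompact_closedBall 0 R) fun x hx => hs fun h => hx (by simp [g, h])
  have key := hS g hg sg
  have dρ := hρ.differentiable one_ne_zero
  have dζ := hζ.contDiff.differentiable two_ne_zero
  have epd : ∀ i x, pd g i x = ζ x ^ 2 * (θ * (1 + ρ x) ^ (θ - 1) * pd ρ i x)
      + f x * (2 * ζ x * pd ζ i x) := fun i x => by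
    have e1 : pd f i x = θ * (1 + ρ x) ^ (θ - 1) * pd ρ i x := pd_comp
      (g := fun t => (1 + t) ^ θ) ((((hasDerivAt_id _).const_add 1).rpow_const (p := θ)
        (Or.inl (pos x).ne')).congr_deriv (by simp)) (dρ x) i
    have e2 : pd (fun x => ζ x ^ 2) i x = 2 * ζ x * pd ζ i x := pd_comp
      (g := fun t => t ^ 2) ((hasDerivAt_pow 2 (ζ x)).congr_deriv (by simp)) (dζ x) i
    have := pd_mul ((hζ'.differentiable one_ne_zero) x) ((hf.differentiable one_ne_zero) x) i
    simp only [g]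
    rw [this, e1, e2]
  have fle : ∀ x, f x ≤ 1 + ρ x := fun x => by
    simpa using Real.rpow_le_rpow_of_exponent_le (by linarith [h0 x] : 1 ≤ 1 + ρ x) hθ1.le
  have f0 : ∀ x, 0 ≤ f x := fun x => Real.rpow_nonneg (pos x).le _
  have ζ2 : ∀ x, ζ x ^ 2 ≤ 1 := fun x => by
    rw [← sq_abs]; exact pow_le_one₀ (abs_nonneg _) (hζ1 x)
  have out : ∀ x, x ∉ B → ζ x = 0 := fun x hx => by by_contra h; exact hx (hs h)
  have hE' : Integrable fun x => ζ x ^ 2 * (θ * (1 - θ) * (1 + ρ x) ^ (θ - 2)) * ∑ i, pd ρ i x ^ 2 := by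
    refine Continuous.integrable_of_hasCompactSupport ?_
      (HasCompactSupport.of_support_subset_isCompact
      (isCompact_closedBall 0 R) fun x hx => hs fun h => hx (by simp [h]))
    exact ((cζ.pow 2).mul (continuous_const.mul ((continuous_const.add cρ).rpow_const
      fun x => Or.inl (pos x).ne'))).mul
      (continuous_finsetSum _ fun i _ => (continuous_pd hρ i).pow 2)
  have hBind : Integrable (B.indicator fun x => 1 + ρ x) :=
    (integrable_indicator_iff measurableSet_closedBall).2 hB1
  have i1 : ∫ x, |g x| ≤ vol + 1 := by
    refine le_trans ?_ hBi
    rw [← integral_indicator measurableSet_closedBall]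
    refine integral_mono (hg.continuous.integrable_of_hasCompactSupport sg).abs hBind fun x => ?_
    by_cases hx : x ∈ B
    · rw [indicator_of_mem hx]
      simp only [g]
      rw [abs_of_nonneg (mul_nonneg (sq_nonneg _) (f0 x))]
      exact (mul_le_of_le_one_left (f0 x) (ζ2 x)).trans (fle x)
    · rw [indicator_of_notMem hx]; simp [g, out x hx]
  have i2 : ∫ x, ∑ i, |pd g i x| ≤ d * (2 * M * (vol + 1))
      + (1 / 2 : ℝ) * (X / (θ * (1 - θ)) + d * (vol + 1)) := by
    have pt : ∀ x, ∑ i, |pd g i x| ≤ (d * (2 * M) + 1 / 2 * d) * B.indicator (fun x => 1 + ρ x) x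
        + 1 / (2 * (θ * (1 - θ)))
          * (ζ x ^ 2 * (θ * (1 - θ) * (1 + ρ x) ^ (θ - 2)) * ∑ i, pd ρ i x ^ 2) := fun x => by
      by_cases hx : x ∈ B
      · rw [indicator_of_mem hx]
        set a := (1 + ρ x) ^ (θ - 2) with ha
        have ha0 : 0 < a := Real.rpow_pos_of_pos (pos x) _
        have ea : (1 + ρ x) ^ (θ - 1) = a * (1 + ρ x) := by
          rw [ha, ← Real.rpow_add_one (pos x).ne']; ring_nf
        have eb : f x = a * (1 + ρ x) ^ 2 := by
          simp only [f]
          rw [ha, ← Real.rpow_natCast, ← Real.rpow_add (pos x)]; norm_num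
        have ti : ∀ i, |pd g i x| ≤ (2 * M + 1 / 2) * (1 + ρ x)
            + 1 / 2 * (ζ x ^ 2 * a * pd ρ i x ^ 2) := fun i => by
          rw [epd, ea]
          have h1 : |f x * (2 * ζ x * pd ζ i x)| ≤ 2 * M * (1 + ρ x) := by
            rw [abs_mul, abs_of_nonneg (f0 x), abs_mul, abs_mul, abs_two, mul_comm]
            refine mul_le_mul ?_ (fle x) (f0 x) (by positivity)
            have := mul_le_mul (hζ1 x) (hζ.bound_pd i x) (abs_nonneg _) zero_le_one
            linarith
          have h2 : |ζ x ^ 2 * (θ * (a * (1 + ρ x)) * pd ρ i x)|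
              ≤ 1 / 2 * (1 + ρ x) + 1 / 2 * (ζ x ^ 2 * a * pd ρ i x ^ 2) := by
            have h3 : a * (1 + ρ x) * |pd ρ i x| ≤ 1 / 2 * f x + 1 / 2 * (a * pd ρ i x ^ 2) := by
              rw [eb, ← sq_abs (pd ρ i x)]
              nlinarith [mul_nonneg ha0.le (sq_nonneg ((1 + ρ x) - |pd ρ i x|))]
            have h4 : 0 ≤ a * (1 + ρ x) * |pd ρ i x| := by have := pos x; positivity
            calc _ = ζ x ^ 2 * (θ * (a * (1 + ρ x) * |pd ρ i x|)) := by
                  rw [abs_mul, abs_of_nonneg (sq_nonneg (ζ x)), abs_mul,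
                    abs_of_nonneg (by have := pos x; positivity : 0 ≤ θ * (a * (1 + ρ x)))]
                  ring
              _ ≤ ζ x ^ 2 * (1 / 2 * f x + 1 / 2 * (a * pd ρ i x ^ 2)) :=
                  mul_le_mul_of_nonneg_left ((mul_le_of_le_one_left h4 hθ1.le).trans h3)
                    (sq_nonneg _)
              _ ≤ _ := by
                  have := (mul_le_of_le_one_left (f0 x) (ζ2 x)).trans (fle x)
                  linarith
          exact (abs_add_le _ _).trans (by linarith)
        refine (Finset.sum_le_sum fun i _ => ti i).trans_eq ?_
        rw [Finset.sum_add_distrib, Finset.sum_const, ← Finset.mul_sum, ← Finset.mul_sum,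
          Finset.card_univ, Fintype.card_fin, nsmul_eq_mul]
        have h1θ : 1 - θ ≠ 0 := (by linarith : 0 < 1 - θ).ne'
        field_simp
      · rw [indicator_of_notMem hx]; simp [epd, out x hx]
    have := integral_mono (integrable_finsetSum _ fun i _ => ((continuous_pd hg
      i).integrable_of_hasCompactSupport (hasCompactSupport_pd sg i)).abs)
      ((hBind.const_mul _).add (hE'.const_mul _)) pt
    refine this.trans ?_
    simp only [Pi.add_apply]
    rw [integral_add (hBind.const_mul _) (hE'.const_mul _), integral_const_mul, integral_const_mul,
      integral_indicator measurableSet_closedBall]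
    have h1 := mul_le_mul_of_nonneg_left hBi (show 0 ≤ d * (2 * M) + 1 / 2 * (d : ℝ) by positivity)
    have h2 := mul_le_mul_of_nonneg_left hE (show 0 ≤ 1 / (2 * (θ * (1 - θ))) by positivity)
    refine (add_le_add h1 h2).trans_eq ?_
    have h1θ : 1 - θ ≠ 0 := (by linarith : 0 < 1 - θ).ne'
    field_simp
    ring
  have hgp : ∫ x, |g x| ^ p ≤ Q := key.trans (mul_le_mul_of_nonneg_left (Real.rpow_le_rpow
    (add_nonneg (integral_nonneg fun _ => abs_nonneg _)
      (integral_nonneg fun _ => Finset.sum_nonneg fun _ _ => abs_nonneg _))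
    (by rw [hZ]; linarith) hp0.le) hS0)
  set T := {x ∈ Br | κ ≤ ρ x} with hT
  have hTm : MeasurableSet T :=
    measurableSet_closedBall.inter (measurableSet_le measurable_const cρ.measurable)
  have igp : Integrable fun x => |g x| ^ p :=
    (hg.continuous.abs.rpow_const fun _ => Or.inr hp0.le).integrable_of_hasCompactSupport
      (sg.comp_left (g := fun y : ℝ => |y| ^ p) (by simp [hp0.ne']))
  have fT : volume T ≠ ⊤ :=
    ((measure_mono (sep_subset _ _)).trans_lt (measure_closedBall_lt_top (x := (0 : Ed d)) (r := r))).ne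
  have iT : Integrable (T.indicator fun _ => L) :=
    (integrable_indicator_iff hTm).2 (by simp [integrableOn_const_iff, fT.lt_top])
  have iκ : Integrable (fun _ : Ed d => κ) (volume.restrict Br) :=
    continuousOn_const.integrableOn_compact (isCompact_closedBall _ _)
  have pt : ∀ x ∈ Br, ρ x ≤ (κ + T.indicator (fun _ => L) x) + L ^ (1 - q) * |g x| ^ p :=
    fun x hx => by
    have hn : 0 ≤ L ^ (1 - q) * |g x| ^ p := by positivity
    by_cases h1 : κ ≤ ρ x
    · rw [indicator_of_mem (show x ∈ T from ⟨hx, h1⟩)]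
      have hκ0 : 0 ≤ κ := by positivity
      rcases le_or_gt (ρ x) L with h2 | h2
      · linarith
      · have e : |g x| ^ p = (1 + ρ x) ^ q := by
          simp only [g, f]
          rw [hζr x hx, one_pow, one_mul, abs_of_nonneg (f0 x), ← Real.rpow_mul (pos x).le]
        have h3 : L ^ (q - 1) ≤ (1 + ρ x) ^ (q - 1) :=
          Real.rpow_le_rpow (by linarith) (by linarith) (by linarith)
        have h4 : (1 + ρ x) ^ q = (1 + ρ x) ^ (q - 1) * (1 + ρ x) := by
          rw [← Real.rpow_add_one (pos x).ne']; ring_nf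
        have h5 : L ^ (1 - q) * L ^ (q - 1) = 1 := by
          rw [← Real.rpow_add (by linarith)]; simp
        have h6 : 1 ≤ L ^ (1 - q) * (1 + ρ x) ^ (q - 1) := by
          exact h5.symm.le.trans (mul_le_mul_of_nonneg_left h3 (by positivity))
        have h7 := mul_le_mul_of_nonneg_right h6 (pos x).le
        rw [e, h4, ← mul_assoc]
        linarith
    · rw [indicator_of_notMem (fun h => h1 h.2)]; linarith
  have iκT : Integrable (fun x => κ + T.indicator (fun _ => L) x) (volume.restrict Br) :=
    iκ.add iT.restrict
  have igp' : Integrable (fun x => L ^ (1 - q) * |g x| ^ p) (volume.restrict Br) :=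
    igp.restrict.const_mul _
  have h : ∫ x in Br, ρ x ≤ ∫ x in Br, ((κ + T.indicator (fun _ => L) x) + L ^ (1 - q) * |g x| ^ p) :=
    setIntegral_mono_on (cρ.continuousOn.integrableOn_compact (isCompact_closedBall _ _))
      (iκT.add igp') measurableSet_closedBall pt
  rw [integral_add iκT igp', integral_add iκ iT.restrict, integral_const_mul, setIntegral_const] at h
  have a1 : ∫ x in Br, T.indicator (fun _ => L) x ≤ L * volume.real T := by
    refine (setIntegral_le_integral iT (Eventually.of_forall fun x =>
      indicator_nonneg (fun _ _ => by linarith) x)).trans_eq ?_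
    rw [integral_indicator hTm, setIntegral_const, smul_eq_mul, mul_comm]
  have a2 : ∫ x in Br, |g x| ^ p ≤ Q :=
    (setIntegral_le_integral igp (Eventually.of_forall fun x => by positivity)).trans hgp
  have a3 : volume.real Br * κ ≤ 1 / 32 := by
    have : volume.real Br ≤ vol + 1 := (measureReal_mono (closedBall_subset_closedBall hrR)
      measure_closedBall_lt_top.ne).trans (by linarith)
    calc _ ≤ (vol + 1) * κ := mul_le_mul_of_nonneg_right this (by positivity)
      _ = 1 / 32 := by rw [hκ]; field_simp
  have a4 := mul_le_mul_of_nonneg_left a2 (show 0 ≤ L ^ (1 - q) by positivity)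
  rw [smul_eq_mul] at h
  rw [div_le_iff₀ (by positivity)]
  nlinarith

section

variable {c N : ℝ} {k : Ed d → ℝ} {m P Q : Measure (Ed d)} [IsFiniteMeasure m]
  [IsFiniteMeasure P] [IsFiniteMeasure Q] {κ : ℕ → Ed d → ℝ}

lemma IsKer.le_setIntegral_cv (hk : IsKer k c N) (r : ℝ) :
    m.real (closedBall 0 r) - m.real univ * (c / N ^ 2)
      ≤ ∫ x in closedBall (0 : Ed d) (r + 1), cv m (fun _ => 1) k x := by
  let g : Ed d → ℝ := (closedBall 0 r).indicator fun _ => 1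
  let G : Ed d → ℝ := (closedBall 0 (r + 1)).indicator fun _ => 1
  have hg : Integrable g m := (integrable_const _).indicator measurableSet_closedBall
  have hG : Measurable G := measurable_const.indicator measurableSet_closedBall
  have hG1 : ∀ x, |G x| ≤ 1 := fun x => by
    simp only [G, indicator]; split_ifs <;> simp
  have e1 : ∫ y, g y ∂m = m.real (closedBall 0 r) := by
    simp [g, integral_indicator measurableSet_closedBall]
  have e2 := (integral_mul_cv (m := m) hk hG hG1 measurable_const (integrable_const (1 : ℝ))).2
  have e3 : ∫ x, G x * cv m (fun _ => 1) k x
      = ∫ x in closedBall (0 : Ed d) (r + 1), cv m (fun _ => 1) k x := by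
    rw [← integral_indicator measurableSet_closedBall]
    refine integral_congr_ae (Eventually.of_forall fun x => ?_)
    simp only [G, indicator]; split_ifs <;> simp
  have i2 := integrable_ker_prod (m := m) hk (f := fun p => G p.1 * 1) (integrable_const (1 : ℝ))
    ((hG.comp measurable_fst).mul_const 1) fun x y => by simpa using hG1 x
  have i3 := integrable_ker_norm_sq (m := m) hk
  have h3 := integral_ker_norm_sq (m := m) hk
  have := integral_mono (integrable_ker_snd (m := m) hk hg) (i2.add i3) fun p => by
    simp only [Pi.add_apply]
    rw [← mul_add]
    refine mul_le_mul_of_nonneg_left ?_ (hk.pos _).le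
    by_cases h1 : p.2 ∈ closedBall (0 : Ed d) r
    · simp only [g]
      rw [indicator_of_mem h1]
      by_cases h2 : p.1 ∈ closedBall (0 : Ed d) (r + 1)
      · simp only [G]; rw [indicator_of_mem h2]; nlinarith [sq_nonneg ‖p.1 - p.2‖]
      · simp only [G]
        rw [indicator_of_notMem h2, zero_mul, zero_add]
        rw [mem_closedBall_zero_iff] at h1 h2
        have := norm_sub_norm_le p.1 p.2
        nlinarith
    · simp only [g]
      rw [indicator_of_notMem h1]
      exact add_nonneg (by simp only [G, indicator]; split_ifs <;> simp) (sq_nonneg _)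
  rw [integral_ker_snd hk hg, e1] at this
  simp only [Pi.add_apply] at this
  rw [integral_add i2 i3, e2, e3] at this
  linarith

/-- Mollifications of mutually singular measures do not overlap asymptotically. -/
lemma tendsto_integral_min (hκ : ∀ n : ℕ, IsKer (κ n) c (n + 1)) (hP : P ≠ 0) (h : P ⟂ₘ Q) :
    Tendsto (fun n => ∫ x, min (cv P (fun _ => 1) (κ n) x) (cv Q (fun _ => 1) (κ n) x)) atTop
      (𝓝 0) := by
  obtain ⟨S, hS, hPS, hQS⟩ := h
  have hm : P + Q ≠ 0 := fun h => hP (Measure.ext fun s _ => by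
    have := congrArg (fun ν => ν s) h
    simp only [Measure.coe_add, Pi.add_apply, Measure.coe_zero, Pi.zero_apply, add_eq_zero] at this
    simpa using this.1)
  let r : Ed d → ℝ := S.indicator fun _ => 1
  have hr : Measurable r := measurable_const.indicator hS
  have hr1 : ∀ y, |r y| ≤ 1 := fun y => by
    simp only [r, indicator]; split_ifs <;> simp
  have T := (tendsto_kvar hκ hm hr hr1 (bb := fun _ => 1) continuous_const
    (integrable_const _)).const_mul 2
  rw [mul_zero] at T
  refine squeeze_zero (fun n => integral_nonneg fun x => le_min (cv_nonneg (hκ n)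
    (fun _ => zero_le_one) x) (cv_nonneg (hκ n) (fun _ => zero_le_one) x)) (fun n => ?_) T
  have hk := hκ n
  have ip : Integrable (fun p : Ed d × Ed d => κ n (p.1 - p.2) *
      ((1 : ℝ) ^ 2 * (r p.2 - ravg (P + Q) r (κ n) p.1) ^ 2)) (volume.prod (P + Q)) := by
    refine integrable_ker_prod (g := fun _ => 4) hk (integrable_const _)
      (f := fun p => (1 : ℝ) ^ 2 * (r p.2 - ravg (P + Q) r (κ n) p.1) ^ 2)
      (((measurable_sub_ravg hk hr hr1).pow_const 2).const_mul _) fun x y => ?_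
    rw [one_pow, one_mul, abs_of_nonneg (sq_nonneg _)]
    exact sq_sub_ravg_le hk hr1 x y
  unfold kvar
  rw [integral_prod _ ip, ← integral_const_mul]
  refine integral_mono_of_nonneg (Eventually.of_forall fun x => le_min (cv_nonneg hk
    (fun _ => zero_le_one) x) (cv_nonneg hk (fun _ => zero_le_one) x))
    (ip.integral_prod_left.const_mul 2) ?_
  filter_upwards [ip.prod_right_ae] with x hx
  rw [integral_add_measure hx.left_of_add_measure hx.right_of_add_measure]
  set a := ravg (P + Q) r (κ n) x
  have e1 : ∫ y, κ n (x - y) * ((1 : ℝ) ^ 2 * (r y - a) ^ 2) ∂P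
      = a ^ 2 * cv P (fun _ => 1) (κ n) x := by
    unfold cv
    rw [← integral_const_mul]
    refine integral_congr_ae ?_
    have : ∀ᵐ y ∂P, y ∉ S := measure_eq_zero_iff_ae_notMem.1 hPS
    filter_upwards [this] with y hy
    simp only [r]
    rw [indicator_of_notMem hy]; ring
  have e2 : ∫ y, κ n (x - y) * ((1 : ℝ) ^ 2 * (r y - a) ^ 2) ∂Q
      = (1 - a) ^ 2 * cv Q (fun _ => 1) (κ n) x := by
    unfold cv
    rw [← integral_const_mul]
    refine integral_congr_ae ?_
    have : ∀ᵐ y ∂Q, y ∉ Sᶜ := measure_eq_zero_iff_ae_notMem.1 hQS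
    filter_upwards [this] with y hy
    simp only [r]
    rw [indicator_of_mem (not_not.1 hy)]; ring
  rw [e1, e2]
  have h0 : 0 ≤ min (cv P (fun _ => 1) (κ n) x) (cv Q (fun _ => 1) (κ n) x) :=
    le_min (cv_nonneg hk (fun _ => zero_le_one) x) (cv_nonneg hk (fun _ => zero_le_one) x)
  have h1 := mul_le_mul_of_nonneg_left (min_le_left (cv P (fun _ => 1) (κ n) x)
    (cv Q (fun _ => 1) (κ n) x)) (sq_nonneg a)
  have h2 := mul_le_mul_of_nonneg_left (min_le_right (cv P (fun _ => 1) (κ n) x)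
    (cv Q (fun _ => 1) (κ n) x)) (sq_nonneg (1 - a))
  nlinarith [mul_nonneg h0 (sq_nonneg (2 * a - 1))]

end

section

variable {A : Ed d → Matrix (Fin d) (Fin d) ℝ} {β : Ed d → Ed d} {bb : Ed d → ℝ} {C : ℝ}
  {k : Ed d → ℝ} {c N h : ℝ}

/-- Bounds on the weighted integral of an entropy that grows at most linearly. -/
lemma integral_sq_mul_le {ζ ρ : Ed d → ℝ} {R : ℝ} (cζ : Continuous ζ)
    (hS : Function.support ζ ⊆ closedBall 0 R) (hζ1 : ∀ x, |ζ x| ≤ 1) (cρ : Continuous ρ)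
    (h1 : ∫ x in closedBall (0 : Ed d) R, ρ x ≤ 1) {Ξ : ℝ → ℝ} (hΞ : ContinuousOn Ξ (Ici 0))
    (h0 : ∀ x, 0 ≤ ρ x) {b e : ℝ} (he : 0 ≤ e) (hb : 0 ≤ b) (h : ∀ t, 0 ≤ t → Ξ t ≤ b + e * t) :
    ∫ x, ζ x ^ 2 * Ξ (ρ x) ≤ b * volume.real (closedBall (0 : Ed d) R) + e := by
  have iρ : IntegrableOn ρ (closedBall 0 R) :=
    cρ.continuousOn.integrableOn_compact (isCompact_closedBall _ _)
  have ib : IntegrableOn (fun _ : Ed d => b) (closedBall 0 R) :=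
    continuousOn_const.integrableOn_compact (isCompact_closedBall _ _)
  have out : ∀ x ∉ closedBall (0 : Ed d) R, ζ x = 0 := fun x hx => by
    by_contra h; exact hx (hS h)
  have hc : Continuous fun x => Ξ (ρ x) := hΞ.comp_continuous cρ h0
  have e1 : ∫ x, ζ x ^ 2 * Ξ (ρ x) = ∫ x in closedBall (0 : Ed d) R, ζ x ^ 2 * Ξ (ρ x) :=
    (setIntegral_eq_integral_of_forall_compl_eq_zero fun x hx => by simp [out x hx]).symm
  have : ∫ x in closedBall (0 : Ed d) R, ζ x ^ 2 * Ξ (ρ x)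
      ≤ ∫ x in closedBall (0 : Ed d) R, (b + e * ρ x) := by
    refine integral_mono (((cζ.pow 2).mul hc).continuousOn.integrableOn_compact
      (isCompact_closedBall _ _)) (ib.add (iρ.const_mul e)) fun x => ?_
    have h2 : ζ x ^ 2 ≤ 1 := by rw [← sq_abs]; exact pow_le_one₀ (abs_nonneg _) (hζ1 x)
    have h3 := mul_le_mul_of_nonneg_left (h _ (h0 x)) (sq_nonneg (ζ x))
    have h4 : 0 ≤ b + e * ρ x := add_nonneg hb (mul_nonneg he (h0 x))
    exact h3.trans (mul_le_of_le_one_left h4 h2)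
  rw [integral_add ib (iρ.const_mul e), integral_const_mul, setIntegral_const, smul_eq_mul] at this
  rw [e1]
  have := mul_le_mul_of_nonneg_left h1 he
  linarith

lemma setIntegral_cv_le_one (hk : IsKer k c N) {m : Measure (Ed d)} [IsFiniteMeasure m]
    (hm : m.real univ ≤ 1) (R : ℝ) :
    ∫ x in closedBall (0 : Ed d) R, cv m (fun _ => 1) k x ≤ 1 := by
  obtain ⟨i, e⟩ := integral_cv_one (m := m) hk
  exact (setIntegral_le_integral i (Eventually.of_forall fun x =>
    cv_nonneg hk (fun _ => zero_le_one) x)).trans (e.le.trans hm)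

lemma energy_rpow (hc : Coef A β bb C) (hk : IsKer k c N)
    {τ : ℕ → Measure (Ed d)} [∀ n, IsFiniteMeasure (τ n)]
    (hb : ∀ n, Integrable bb (τ n)) (hh : 0 ≤ h) (H : ∀ n, ResSub A β h (τ (n + 1)) (τ n))
    (h1 : ∀ n, (τ n).real univ ≤ 1)
    {R K M : ℝ} (hK0 : 0 ≤ K) (hK : ∀ y, ‖y‖ ≤ R + 1 → bb y ≤ K)
    {ζ : Ed d → ℝ} (hζ : Cb2 ζ M) (hS : Function.support ζ ⊆ closedBall 0 R) (hζ1 : ∀ x, |ζ x| ≤ 1)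
    {n : ℕ} {δ : ℝ} (hδ : 0 < δ) (hδ1 : δ ≤ 1) (hε : ∀ j ≤ n, c / N * ∫ y, bb y ∂(τ j) ≤ δ ^ 2)
    {θ : ℝ} (hθ0 : 0 < θ) (hθ1 : θ < 1) :
    h / (2 * C) * ∑ j ∈ Finset.range n,
        (∫ x, ζ x ^ 2 * (θ * (1 - θ) * (1 + cv (τ (j + 1)) (fun _ => 1) k x) ^ (θ - 2))
          * ∑ i, pd (cv (τ (j + 1)) (fun _ => 1) k) i x ^ 2)
      ≤ volume.real (closedBall (0 : Ed d) R) + 1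
        + n * h * (locC d C c K M * (2 * volume.real (closedBall (0 : Ed d) R) + 1)) := by
  have hE := locEnt_rpow hθ0 hθ1
  have hδ2 : δ ^ 2 ≤ 1 := pow_le_one₀ hδ.le hδ1
  have s := hE.sum_le hc hk hb hh H h1 hK0 hK hζ hS hζ1 hδ2 hε
  have hl : 0 ≤ n * h * locC d C c K M :=
    mul_nonneg (by positivity) (locC_nonneg (by linarith [hc.one_le]) hK0)
  have hv : 0 ≤ volume.real (closedBall (0 : Ed d) R) := measureReal_nonneg
  have a1 : ∫ x, ζ x ^ 2 * ((1 + cv (τ 0) (fun _ => 1) k x) - (1 + cv (τ 0) (fun _ => 1) k x) ^ θ)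
      ≤ 1 * volume.real (closedBall (0 : Ed d) R) + 1 :=
    integral_sq_mul_le hζ.contDiff.continuous hS hζ1 (hk.continuous_cv (integrable_const _))
      (setIntegral_cv_le_one hk (h1 0) R) (Ξ := fun t => (1 + t) - (1 + t) ^ θ)
      (fun t ht => (hE.deriv t ht).continuousAt.continuousWithinAt)
      (cv_nonneg hk fun _ => zero_le_one) zero_le_one zero_le_one fun t ht => by
        have := Real.rpow_nonneg (by linarith : 0 ≤ 1 + t) θ
        linarith
  have a2 : 0 ≤ ∫ x, ζ x ^ 2 * ((1 + cv (τ n) (fun _ => 1) k x)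
      - (1 + cv (τ n) (fun _ => 1) k x) ^ θ) := by
    refine integral_nonneg fun x => mul_nonneg (sq_nonneg _) ?_
    have := cv_nonneg (m := τ n) hk (fun _ => zero_le_one) x
    have := Real.rpow_le_rpow_of_exponent_le
      (by linarith : 1 ≤ 1 + cv (τ n) (fun _ => 1) k x) hθ1.le
    rw [Real.rpow_one] at this
    linarith
  have a3 : n * h * locC d C c K M * ((1 + 1 * δ ^ 2) * volume.real (closedBall (0 : Ed d) R) + 1)
      ≤ n * h * locC d C c K M * (2 * volume.real (closedBall (0 : Ed d) R) + 1) :=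
    mul_le_mul_of_nonneg_left (by nlinarith) hl
  linarith

lemma energy_log (hc : Coef A β bb C) (hk : IsKer k c N)
    {τ : ℕ → Measure (Ed d)} [∀ n, IsFiniteMeasure (τ n)]
    (hb : ∀ n, Integrable bb (τ n)) (hh : 0 ≤ h) (H : ∀ n, ResSub A β h (τ (n + 1)) (τ n))
    (h1 : ∀ n, (τ n).real univ ≤ 1)
    {R K M : ℝ} (hK0 : 0 ≤ K) (hK : ∀ y, ‖y‖ ≤ R + 1 → bb y ≤ K)
    {ζ : Ed d → ℝ} (hζ : Cb2 ζ M) (hS : Function.support ζ ⊆ closedBall 0 R) (hζ1 : ∀ x, |ζ x| ≤ 1)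
    {n : ℕ} {δ : ℝ} (hδ : 0 < δ) (hδ1 : δ ≤ 1) (hε : ∀ j ≤ n, c / N * ∫ y, bb y ∂(τ j) ≤ δ ^ 2)
    (hm : (τ 0).real univ - (τ n).real univ ≤ δ) :
    h / (2 * C) * ∑ j ∈ Finset.range n,
        (∫ x, ζ x ^ 2 * (δ + cv (τ (j + 1)) (fun _ => 1) k x)⁻¹ ^ 2
          * ∑ i, pd (cv (τ (j + 1)) (fun _ => 1) k) i x ^ 2)
      ≤ volume.real (closedBall (0 : Ed d) R) * -log δ + 2
        + n * h * (locC d C c K M * (2 * volume.real (closedBall (0 : Ed d) R) + 1)) := by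
  have hE := locEnt_log hδ hδ1
  have hδ2 : δ ^ 2 ≤ 1 := pow_le_one₀ hδ.le hδ1
  have s := hE.sum_le hc hk hb hh H h1 hK0 hK hζ hS hζ1 hδ2 hε
  have hlog : 0 ≤ -log δ := by linarith [Real.log_nonpos hδ.le hδ1]
  have a1 : ∫ x, ζ x ^ 2 * (-log (δ + cv (τ 0) (fun _ => 1) k x))
      ≤ -log δ * volume.real (closedBall (0 : Ed d) R) + 0 :=
    integral_sq_mul_le hζ.contDiff.continuous hS hζ1 (hk.continuous_cv (integrable_const _))
      (setIntegral_cv_le_one hk (h1 0) R) (Ξ := fun t => -log (δ + t))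
      (fun t ht => (hE.deriv t ht).continuousAt.continuousWithinAt)
      (cv_nonneg hk fun _ => zero_le_one) le_rfl hlog fun t ht => by
        have := Real.log_le_log hδ (by linarith : δ ≤ δ + t)
        linarith
  have a2 : ∫ x, ζ x ^ 2 * log (δ + cv (τ n) (fun _ => 1) k x)
      ≤ 0 * volume.real (closedBall (0 : Ed d) R) + 1 :=
    integral_sq_mul_le hζ.contDiff.continuous hS hζ1 (hk.continuous_cv (integrable_const _))
      (setIntegral_cv_le_one hk (h1 n) R) (Ξ := fun t => log (δ + t))
      (fun t ht => ((continuousAt_const.add continuousAt_id).log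
        (by have : 0 ≤ t := ht; exact (show 0 < δ + t by linarith).ne')).continuousWithinAt)
      (cv_nonneg hk fun _ => zero_le_one) zero_le_one le_rfl fun t ht => by
        have := Real.log_le_sub_one_of_pos (by linarith : 0 < δ + t)
        linarith
  have a2' : ∫ x, ζ x ^ 2 * (-log (δ + cv (τ n) (fun _ => 1) k x))
      = -∫ x, ζ x ^ 2 * log (δ + cv (τ n) (fun _ => 1) k x) := by
    rw [← integral_neg]; simp only [mul_neg]
  have a3 : δ⁻¹ * ((τ 0).real univ - (τ n).real univ) ≤ 1 := by
    rw [inv_mul_le_iff₀ hδ]; linarith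
  have a4 : δ⁻¹ ^ 2 * δ ^ 2 = 1 := by field_simp
  rw [a2', a4] at s
  have a5 : (1 : ℝ) + 1 = 2 := by norm_num
  rw [a5] at s
  linarith

end

lemma exists_forall_lt_sq {a : ℝ} (ha : 0 < a) (b p q : ℝ) :
    ∃ L₀, ∀ L ≥ L₀, p * L + q < (L + b) ^ 2 * a := by
  refine ⟨1 + (|p| + |q - p * b|) / a - b, fun L hL => ?_⟩
  have h0 : 0 ≤ (|p| + |q - p * b|) / a := by positivity
  have h1 : 1 + (|p| + |q - p * b|) / a ≤ L + b := by linarith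
  have h2 : a + (|p| + |q - p * b|) ≤ a * (L + b) := by
    have := mul_le_mul_of_nonneg_left h1 ha.le
    rwa [mul_add, mul_one, mul_div_cancel₀ _ ha.ne'] at this
  have h3 : 1 ≤ L + b := by linarith
  have h4 := mul_le_mul_of_nonneg_right h2 (by linarith : 0 ≤ L + b)
  nlinarith [le_abs_self p, le_abs_self (q - p * b), abs_nonneg (q - p * b), abs_nonneg p]

lemma sub_div_le_real_closedBall {P : Measure (Ed d)} [IsFiniteMeasure P] {W : Ed d → ℝ}
    (hW0 : ∀ x, 0 ≤ W x) (hi : Integrable W P) {I s r : ℝ} (hI : ∫ x, W x ∂P ≤ I) (hs : 0 < s)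
    (h : ∀ x, r < ‖x‖ → s ≤ W x) : P.real univ - I / s ≤ P.real (closedBall 0 r) := by
  have h1 := mul_meas_ge_le_integral_of_nonneg (Eventually.of_forall hW0) hi s
  have h2 : P.real (closedBall 0 r)ᶜ ≤ P.real {x | s ≤ W x} := measureReal_mono fun x hx => by
    rw [mem_compl_iff, mem_closedBall_zero_iff, not_le] at hx
    exact h x hx
  have h3 := measureReal_compl (μ := P) (s := closedBall (0 : Ed d) r) measurableSet_closedBall
  have h4 : P.real {x | s ≤ W x} ≤ I / s := by rw [le_div_iff₀ hs]; linarith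
  linarith

lemma exists_le_of_sum_bounds {n : ℕ} {f g e : ℕ → ℝ} {h T C C₁ C₂ : ℝ} (hT : 0 < T) (hC : 0 < C)
    (h₁ : 0 < C₁) (h₂ : 0 < C₂) (hn : T ≤ n * h) (hh : 0 ≤ h) (f0 : ∀ j, 0 ≤ f j) (g0 : ∀ j, 0 ≤ g j)
    (e0 : ∀ j, 0 ≤ e j) (hf : h / (2 * C) * ∑ j ∈ Finset.range n, f j ≤ C₁)
    (hg : h / (2 * C) * ∑ j ∈ Finset.range n, g j ≤ C₁)
    (he : h / (2 * C) * ∑ j ∈ Finset.range n, e j ≤ C₂) :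
    ∃ j < n, f j ≤ 8 * C * C₁ / T ∧ g j ≤ 8 * C * C₁ / T ∧ e j ≤ 8 * C * C₂ / T := by
  have key : ∃ j ∈ Finset.range n, f j / (8 * C * C₁ / T) + g j / (8 * C * C₁ / T)
      + e j / (8 * C * C₂ / T) ≤ 1 := by
    by_contra! hcon
    have := Finset.sum_le_sum fun j hj => (hcon j hj).le
    rw [Finset.sum_const, Finset.card_range, nsmul_eq_mul, mul_one, Finset.sum_add_distrib,
      Finset.sum_add_distrib, ← Finset.sum_div, ← Finset.sum_div, ← Finset.sum_div] at this
    have aux : ∀ {S D : ℝ}, 0 < D → h / (2 * C) * S ≤ D → h * (S / (8 * C * D / T)) ≤ T / 4 :=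
      fun {S D} hD h1 => by
        have e : h * (S / (8 * C * D / T)) = h / (2 * C) * S * (T / (4 * D)) := by field_simp; ring
        rw [e]
        refine (mul_le_mul_of_nonneg_right h1 (by positivity)).trans_eq ?_
        field_simp
    have a1 := aux h₁ hf
    have a2 := aux h₁ hg
    have a3 := aux h₂ he
    have := mul_le_mul_of_nonneg_left this hh
    linarith
  obtain ⟨j, hj, h1⟩ := key
  have p1 : 0 < 8 * C * C₁ / T := by positivity
  have p2 : 0 < 8 * C * C₂ / T := by positivity
  have b1 := div_nonneg (f0 j) p1.le
  have b2 := div_nonneg (g0 j) p1.le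
  have b3 := div_nonneg (e0 j) p2.le
  exact ⟨j, Finset.mem_range.1 hj, (div_le_one p1).1 (by linarith), (div_le_one p1).1 (by linarith),
    (div_le_one p2).1 (by linarith)⟩

/-- The Dirichlet energy of `log (δ + u)` controls the sizes of the sets `{u ≥ κ}`, `{u ≤ δ}`. -/
lemma sq_log_mul_volume_le {u ζ : Ed d → ℝ} (hu : ContDiff ℝ 1 u) (h0 : ∀ x, 0 ≤ u x)
    (cζ : Continuous ζ) {R r : ℝ} (hS : Function.support ζ ⊆ closedBall 0 R)
    (hζr : ∀ x ∈ closedBall (0 : Ed d) r, ζ x = 1) (hr : 0 ≤ r) {δ κ : ℝ} (hδ : 0 < δ)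
    (hκ : 2 * δ ≤ κ) :
    (log κ - log (2 * δ)) ^ 2 * volume.real {x ∈ closedBall (0 : Ed d) r | κ ≤ u x}
        * volume.real {x ∈ closedBall (0 : Ed d) r | u x ≤ δ}
      ≤ 4 * r ^ 2 * 2 ^ d * volume.real (closedBall (0 : Ed d) r)
        * ∫ x, ζ x ^ 2 * (δ + u x)⁻¹ ^ 2 * ∑ i, pd u i x ^ 2 := by
  have pos : ∀ x, 0 < δ + u x := fun x => by linarith [h0 x]
  have hv : ContDiff ℝ 1 fun x => log (δ + u x) :=
    (contDiff_const.add hu).log fun x => (pos x).ne'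
  have epd : ∀ i x, pd (fun x => log (δ + u x)) i x = (δ + u x)⁻¹ * pd u i x := fun i x =>
    pd_comp (g := fun t => log (δ + t)) ((((hasDerivAt_id _).const_add δ).log
      (pos x).ne').congr_deriv (by simp)) (hu.differentiable one_ne_zero x) i
  have := sq_mul_volume_le_dirichlet hv hr (S := {x ∈ closedBall (0 : Ed d) r | κ ≤ u x})
    (S' := {x ∈ closedBall (0 : Ed d) r | u x ≤ δ}) (ℓ := log κ - log (2 * δ))
    (measurableSet_closedBall.inter (measurableSet_le measurable_const hu.continuous.measurable))
    (measurableSet_closedBall.inter (measurableSet_le hu.continuous.measurable measurable_const))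
    (sep_subset _ _) (sep_subset _ _)
    (by linarith [Real.log_le_log (by positivity) hκ]) fun x hx y hy => by
      have h1 := Real.log_le_log (by linarith : 0 < κ) (by linarith [hx.2] : κ ≤ δ + u x)
      have h2 := Real.log_le_log (pos y) (by linarith [hy.2] : δ + u y ≤ 2 * δ)
      linarith
  refine this.trans (mul_le_mul_of_nonneg_left ?_ (by positivity))
  have hint : Integrable fun x => ζ x ^ 2 * (δ + u x)⁻¹ ^ 2 * ∑ i, pd u i x ^ 2 := by
    refine Continuous.integrable_of_hasCompactSupport ?_
      (HasCompactSupport.of_support_subset_isCompact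
      (isCompact_closedBall 0 R) fun x hx => hS fun h => hx (by simp [h]))
    exact ((cζ.pow 2).mul (((continuous_const.add hu.continuous).inv₀
      fun x => (pos x).ne').pow 2)).mul (continuous_finsetSum _ fun i _ => (continuous_pd hu i).pow 2)
  refine (setIntegral_congr_fun measurableSet_closedBall fun x hx => ?_).trans_le
    (setIntegral_le_integral (s := closedBall (0 : Ed d) r) hint (Eventually.of_forall fun x =>
      mul_nonneg (by positivity) (Finset.sum_nonneg fun _ _ => sq_nonneg _)))
  simp only [epd, mul_pow, hζr x hx, one_pow, one_mul, Finset.mul_sum]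

/-- Mutually singular subsolutions of the resolvent scheme lose mass at a uniform rate. -/
lemma mass_loss (hd : 0 < d) {A : Ed d → Matrix (Fin d) (Fin d) ℝ} {bb W : Ed d → ℝ} {C : ℝ}
    (hbb : Continuous bb) (hW0 : ∀ x, 0 ≤ W x) (hWinf : Tendsto W (cocompact (Ed d)) atTop)
    (hC : 1 ≤ C) (I T : ℝ) (hI : 0 ≤ I) (hT : 0 < T) :
    ∃ α > 0, α ≤ 1 / 8 ∧ ∀ (β : Ed d → Ed d) (h : ℝ) (n : ℕ) (P Q : ℕ → Measure (Ed d))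
      [∀ j, IsFiniteMeasure (P j)] [∀ j, IsFiniteMeasure (Q j)], Coef A β bb C → 0 ≤ h →
      T ≤ n * h → n * h ≤ 2 * T → (∀ j, Integrable bb (P j)) → (∀ j, Integrable bb (Q j)) →
      (∀ j, ResSub A β h (P (j + 1)) (P j)) → (∀ j, ResSub A β h (Q (j + 1)) (Q j)) →
      (∀ j, P j ⟂ₘ Q j) → (∀ j, (P j).real univ = (Q j).real univ) →
      Antitone (fun j => (P j).real univ) → (P 0).real univ ≤ 1 / 2 →
      (∀ j ≤ n, Integrable W (P j) ∧ ∫ x, W x ∂(P j) ≤ I) →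
      (∀ j ≤ n, Integrable W (Q j) ∧ ∫ x, W x ∂(Q j) ≤ I) → (P n).real univ ≤ 1 / 2 - α := by
  obtain ⟨c, k, hk⟩ := exists_ker d
  obtain ⟨r₀, hr₀, hr₀W⟩ : ∃ r₀ : ℝ, 0 ≤ r₀ ∧ ∀ x : Ed d, r₀ < ‖x‖ → 8 * (I + 1) ≤ W x := by
    have := hWinf.eventually (eventually_ge_atTop (8 * (I + 1)))
    rw [← Metric.cobounded_eq_cocompact] at this
    obtain ⟨r, -, hr⟩ := (hasBasis_cobounded_norm.eventually_iff).1 this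
    exact ⟨max r 0, le_max_right _ _, fun x hx => hr (by
      simpa using (le_max_left r 0).trans hx.le)⟩
  obtain ⟨M, χ, hM, hχ⟩ := exists_cutoff d
  obtain ⟨n₀, hn₀⟩ := exists_nat_ge (r₀ + 1)
  obtain ⟨hζ, hζs, hζ1, hζe, -⟩ := hχ n₀
  set ζ := χ n₀ with hζdef
  have hζ1' : ∀ x, |ζ x| ≤ 1 := fun x => abs_le.2 ⟨by linarith [(hζ1 x).1], (hζ1 x).2⟩
  have hζr : ∀ x ∈ closedBall (0 : Ed d) (r₀ + 1), ζ x = 1 := fun x hx => by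
    rw [mem_closedBall_zero_iff] at hx
    exact (hζe x (by linarith)).eq_of_nhds
  obtain ⟨R, hR, hrR⟩ : ∃ R, Function.support ζ ⊆ closedBall 0 R ∧ r₀ + 1 ≤ R := by
    obtain ⟨R, hR⟩ := hζs.isCompact.isBounded.subset_closedBall 0
    exact ⟨max R (r₀ + 1), (subset_tsupport _).trans (hR.trans
      (closedBall_subset_closedBall (le_max_left _ _))), le_max_right _ _⟩
  obtain ⟨K, hK0, hK⟩ : ∃ K, 0 ≤ K ∧ ∀ y : Ed d, ‖y‖ ≤ R + 1 → bb y ≤ K := by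
    obtain ⟨K, hK⟩ := (isCompact_closedBall (0 : Ed d) (R + 1)).exists_bound_of_continuousOn
      hbb.continuousOn
    exact ⟨max K 0, le_max_right _ _, fun y hy => (le_abs_self _).trans
      ((hK y (by simpa using hy)).trans (le_max_left _ _))⟩
  set V₀ := volume.real (closedBall (0 : Ed d) R) with hV₀
  have hV0 : 0 ≤ V₀ := measureReal_nonneg
  set D := locC d C c K M * (2 * V₀ + 1) with hD
  have hD0 : 0 ≤ D := mul_nonneg (locC_nonneg (by linarith) hK0) (by linarith)
  set C₁ := V₀ + 1 + 2 * T * D with hC₁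
  have hC₁0 : 0 < C₁ := by positivity
  have hC0 : 0 < C := by linarith
  obtain ⟨κ, hκ, κ', hκ', hlev⟩ := exists_level hd R M (8 * C * C₁ / T) (by positivity) hM
  set G := 4 * (r₀ + 1) ^ 2 * 2 ^ d * volume.real (closedBall (0 : Ed d) (r₀ + 1)) with hG
  have hG0 : 0 ≤ G := by positivity
  obtain ⟨L₀, hL₀⟩ := exists_forall_lt_sq (show 0 < κ' * (κ' / 2) by positivity) (log κ - log 2)
    (G * (8 * C / T) * V₀) (G * (8 * C / T) * (2 + 2 * T * D))
  set L := max L₀ (max (log 8) (log 2 - log κ)) with hL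
  set δ := Real.exp (-L) with hδ
  have hδ0 : 0 < δ := Real.exp_pos _
  have hlog : log δ = -L := Real.log_exp _
  have hδ8 : δ ≤ 1 / 8 := by
    have : log 8 ≤ L := (le_max_left _ _).trans (le_max_right _ _)
    calc δ ≤ Real.exp (-log 8) := Real.exp_le_exp.2 (by linarith)
      _ = 1 / 8 := by rw [Real.exp_neg, Real.exp_log (by norm_num)]; norm_num
  have hδκ : 2 * δ ≤ κ := by
    have : log 2 - log κ ≤ L := (le_max_right _ _).trans (le_max_right _ _)
    rw [← Real.log_le_log_iff (by positivity) hκ, Real.log_mul two_ne_zero hδ0.ne', hlog]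
    linarith
  have hfin := hL₀ L (le_max_left _ _)
  refine ⟨δ, hδ0, hδ8, fun β h n P Q _ _ hc hh hn1 hn2 hbP hbQ HP HQ hPQ heq hanti hP0 hWP hWQ => ?_⟩
  by_contra! hcon
  have mP : ∀ j, (P j).real univ ≤ 1 / 2 := fun j => (hanti (Nat.zero_le j)).trans hP0
  have mP' : ∀ j ≤ n, 3 / 8 ≤ (P j).real univ := fun j hj => by
    have := hanti hj
    simp only at this
    linarith
  have ev : ∀ᶠ N : ℕ in atTop, (∀ j ∈ Finset.range (n + 1),
      c / ((N : ℝ) + 1) * ∫ y, bb y ∂(P j) ≤ δ ^ 2 ∧ c / ((N : ℝ) + 1) * ∫ y, bb y ∂(Q j) ≤ δ ^ 2 ∧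
      ∫ x, min (cv (P j) (fun _ => 1) (k N) x) (cv (Q j) (fun _ => 1) (k N) x) ≤ κ' / 2 * δ) ∧
      c / ((N : ℝ) + 1) ^ 2 ≤ 1 / 8 := by
    have t0 : ∀ a : ℝ, Tendsto (fun N : ℕ => c / ((N : ℝ) + 1) * a) atTop (𝓝 0) := fun a => by
      have := (tendsto_one_div_add_atTop_nhds_zero_nat (𝕜 := ℝ)).mul_const (c * a)
      rw [zero_mul] at this
      exact this.congr fun N => by ring
    have e0 : ∀ {f : ℕ → ℝ} {b : ℝ}, Tendsto f atTop (𝓝 0) → 0 < b → ∀ᶠ N in atTop, f N ≤ b :=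
      fun hf hb => (hf.eventually (gt_mem_nhds hb)).mono fun _ h => h.le
    refine ((Finset.eventually_all _).2 fun j hj => ?_).and (e0 (tendsto_div_succ_sq c) (by norm_num))
    refine (e0 (t0 _) (by positivity)).and ((e0 (t0 _) (by positivity)).and
      (e0 (tendsto_integral_min hk ?_ (hPQ j)) (by positivity)))
    intro h0
    have := mP' j (by have := Finset.mem_range.1 hj; omega)
    rw [h0] at this
    norm_num at this
  obtain ⟨N, hN, hNc⟩ := ev.exists
  have hkN := hk N
  have hNj : ∀ j ≤ n, _ := fun j hj => hN j (Finset.mem_range.2 (by omega))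
  have mP1 : ∀ j, (P j).real univ ≤ 1 := fun j => (mP j).trans (by norm_num)
  have mQ1 : ∀ j, (Q j).real univ ≤ 1 := fun j => (heq j) ▸ mP1 j
  have hd0 : (0 : ℝ) < d := by exact_mod_cast hd
  set θ : ℝ := (2 * d + 1) / (2 * d + 2) with hθ
  have hθ0 : 0 < θ := by positivity
  have hθ1 : θ < 1 := by rw [hθ, div_lt_one (by positivity)]; linarith
  have hδ1 : δ ≤ 1 := by linarith
  have sP := energy_rpow hc hkN hbP hh HP mP1 hK0 hK hζ hR hζ1' hδ0 hδ1
    (fun j hj => (hNj j hj).1) hθ0 hθ1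
  have sQ := energy_rpow hc hkN hbQ hh HQ mQ1 hK0 hK hζ hR hζ1' hδ0 hδ1
    (fun j hj => (hNj j hj).2.1) hθ0 hθ1
  have sL := energy_log hc hkN hbP hh HP mP1 hK0 hK hζ hR hζ1' hδ0 hδ1
    (fun j hj => (hNj j hj).1) (by linarith)
  have hnD : n * h * D ≤ 2 * T * D := mul_le_mul_of_nonneg_right hn2 hD0
  have hL0 : 0 ≤ L := (Real.log_nonneg (by norm_num)).trans
    ((le_max_left (log 8) (log 2 - log κ)).trans (le_max_right _ _))
  rw [hlog, neg_neg] at sL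
  have u0 : ∀ (m : Measure (Ed d)) [IsFiniteMeasure m] x, 0 ≤ cv m (fun _ => 1) (k N) x := fun m _ x =>
    cv_nonneg hkN (fun _ => zero_le_one) x
  have en : ∀ (m : Measure (Ed d)) [IsFiniteMeasure m], 0 ≤ ∫ x, ζ x ^ 2 * (θ * (1 - θ)
      * (1 + cv m (fun _ => 1) (k N) x) ^ (θ - 2)) * ∑ i, pd (cv m (fun _ => 1) (k N)) i x ^ 2 :=
    fun m _ => integral_nonneg fun x => mul_nonneg (mul_nonneg (sq_nonneg _) (mul_nonneg
      (mul_nonneg hθ0.le (by linarith)) (Real.rpow_nonneg (by linarith [u0 m x]) _)))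
      (Finset.sum_nonneg fun _ _ => sq_nonneg _)
  obtain ⟨j, hj, e1, e2, e3⟩ := exists_le_of_sum_bounds hT hC0 hC₁0
    (show 0 < V₀ * L + 2 + 2 * T * D by positivity) hn1 hh (fun j => en _) (fun j => en _)
    (fun j => integral_nonneg fun x => mul_nonneg (by positivity)
      (Finset.sum_nonneg fun _ _ => sq_nonneg _))
    (sP.trans (by linarith)) (sQ.trans (by linarith)) (sL.trans (by linarith))
  obtain ⟨Mk, -, hMk⟩ := hkN.exists_bound
  have cd : ∀ (m : Measure (Ed d)) [IsFiniteMeasure m], ContDiff ℝ 1 (cv m (fun _ => 1) (k N)) :=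
    fun m _ => contDiff_cv (integrable_const _) hMk.cb1
  have low : ∀ (m : Measure (Ed d)) [IsFiniteMeasure m], m.real univ ≤ 1 / 2 → 3 / 8 ≤ m.real univ →
      Integrable W m ∧ ∫ x, W x ∂m ≤ I →
      1 / 8 ≤ ∫ x in closedBall (0 : Ed d) (r₀ + 1), cv m (fun _ => 1) (k N) x :=
    fun m _ h1 h2 h3 => by
      have a1 := hkN.le_setIntegral_cv (m := m) r₀
      have a2 := sub_div_le_real_closedBall hW0 h3.1 h3.2 (by positivity) hr₀W
      have a3 : I / (8 * (I + 1)) ≤ 1 / 8 := by rw [div_le_div_iff₀ (by positivity) (by norm_num)]; linarith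
      have a4 := mul_le_mul h1 hNc (by have := hkN.one_le_c; positivity) (by norm_num)
      linarith
  have l1 := hlev _ ζ (r₀ + 1) θ hθ (cd (P (j + 1))) (u0 _) hζ hR hζ1' hrR hζr
    (setIntegral_cv_le_one hkN (mP1 _) R) e1 (low _ (mP _) (mP' _ hj) (hWP _ hj))
  have l2 := hlev _ ζ (r₀ + 1) θ hθ (cd (Q (j + 1))) (u0 _) hζ hR hζ1' hrR hζr
    (setIntegral_cv_le_one hkN (mQ1 _) R) e2 (low _ (heq (j + 1) ▸ mP _) (heq (j + 1) ▸ mP' _ hj)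
      (hWQ _ hj))
  set u := cv (P (j + 1)) (fun _ => 1) (k N) with hu
  set w := cv (Q (j + 1)) (fun _ => 1) (k N) with hw
  have fin : ∀ s ⊆ closedBall (0 : Ed d) (r₀ + 1), volume s ≠ ⊤ := fun s hs =>
    ((measure_mono hs).trans_lt measure_closedBall_lt_top).ne
  have iu : Integrable u := (integral_cv_one (m := P (j + 1)) hkN).1
  have iw : Integrable w := (integral_cv_one (m := Q (j + 1)) hkN).1
  have l3 : κ' / 2 ≤ volume.real {x ∈ closedBall (0 : Ed d) (r₀ + 1) | u x ≤ δ} := by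
    have s1 : {x ∈ closedBall (0 : Ed d) (r₀ + 1) | κ ≤ w x}
        ⊆ {x ∈ closedBall (0 : Ed d) (r₀ + 1) | u x ≤ δ} ∪
          {x ∈ closedBall (0 : Ed d) (r₀ + 1) | δ ≤ min (u x) (w x)} := fun x hx => by
      rcases le_total (u x) δ with h1 | h1
      · exact Or.inl ⟨hx.1, h1⟩
      · exact Or.inr ⟨hx.1, le_min h1 (by linarith [hx.2])⟩
    have s2 := measureReal_mono s1 (fin _ (union_subset (sep_subset _ _) (sep_subset _ _)))
    have s3 := measureReal_union_le (μ := volume) {x ∈ closedBall (0 : Ed d) (r₀ + 1) | u x ≤ δ}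
      {x ∈ closedBall (0 : Ed d) (r₀ + 1) | δ ≤ min (u x) (w x)}
    have s4 := mul_meas_ge_le_integral_of_nonneg (Eventually.of_forall fun x => le_min (u0 _ x)
      (u0 _ x)) (iu.inf iw) δ
    have s5 : volume.real {x ∈ closedBall (0 : Ed d) (r₀ + 1) | δ ≤ min (u x) (w x)}
        ≤ volume.real {x | δ ≤ (u ⊓ w) x} := measureReal_mono (fun x hx => hx.2)
          ((iu.inf iw).measure_ge_lt_top hδ0).ne
    have s6 : δ * volume.real {x | δ ≤ (u ⊓ w) x} ≤ δ * (κ' / 2) :=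
      s4.trans (((hNj _ hj).2.2).trans_eq (mul_comm _ _))
    have s7 := le_of_mul_le_mul_left s6 hδ0
    linarith
  have l4 := sq_log_mul_volume_le (cd (P (j + 1))) (u0 _) hζ.contDiff.continuous hR hζr
    (by linarith) hδ0 hδκ
  have l5 : κ' * (κ' / 2) ≤ volume.real {x ∈ closedBall (0 : Ed d) (r₀ + 1) | κ ≤ u x}
        * volume.real {x ∈ closedBall (0 : Ed d) (r₀ + 1) | u x ≤ δ} :=
    mul_le_mul l1 l3 (by positivity) (hκ'.le.trans l1)
  have l6 := mul_le_mul_of_nonneg_left l5 (sq_nonneg (log κ - log (2 * δ)))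
  have l7 := mul_le_mul_of_nonneg_left e3 hG0
  rw [← mul_assoc ((log κ - log (2 * δ)) ^ 2) (volume.real _)] at l6
  have l8 := (l6.trans l4).trans l7
  rw [Real.log_mul two_ne_zero hδ0.ne', hlog] at l8
  have e4 : log κ - (log 2 + -L) = L + (log κ - log 2) := by ring
  have e5 : G * (8 * C * (V₀ * L + 2 + 2 * T * D) / T)
      = G * (8 * C / T) * V₀ * L + G * (8 * C / T) * (2 + 2 * T * D) := by field_simp; ring
  rw [e4, e5] at l8
  linarith

section

variable {A : Ed d → Matrix (Fin d) (Fin d) ℝ} {β : Ed d → Ed d} {bb : Ed d → ℝ} {C : ℝ}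

/-- A smooth concave truncation of the identity at level `R`. -/
structure IsTrunc (T T' T'' : ℝ → ℝ) (R : ℝ) : Prop where
  contDiff : ContDiff ℝ 2 T
  deriv1 : ∀ u, HasDerivAt T (T' u) u
  deriv2 : ∀ u, HasDerivAt T' (T'' u) u
  nonneg : ∀ u, 0 ≤ T' u
  le_one : ∀ u, T' u ≤ 1
  concave : ∀ u, T'' u ≤ 0
  eq_one : ∀ u ≤ R, T' u = 1
  eq_self : ∀ u ≤ R, T u = u
  eventually_const : ∃ S c, ∀ u, S ≤ u → T u = c

lemma exists_isTrunc {R : ℝ} (hR : 0 < R) : ∃ T T' T'', IsTrunc T T' T'' R := by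
  set g : ℝ → ℝ := fun v => smoothTransition (R + 1 - v) with hg
  have hgs : ContDiff ℝ 2 g :=
    (smoothTransition.contDiff (n := 2)).comp (contDiff_const.sub contDiff_id)
  have hd : ∀ u, HasDerivAt (fun u => ∫ v in (0:ℝ)..u, g v) (g u) u := fun u =>
    intervalIntegral.integral_hasDerivAt_right (hgs.continuous.intervalIntegrable _ _)
      hgs.continuous.stronglyMeasurable.stronglyMeasurableAtFilter hgs.continuous.continuousAt
  have g1 : ∀ u ≤ R, g u = 1 := fun u hu => smoothTransition.one_of_one_le (by linarith)
  have g0 : ∀ u, R + 1 ≤ u → g u = 0 := fun u hu => smoothTransition.zero_of_nonpos (by linarith)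
  have hanti : Antitone g := fun a b hab => smoothTransition.monotone (by linarith)
  refine ⟨_, g, deriv g, ?_, hd, fun u => (hgs.differentiable two_ne_zero u).hasDerivAt,
    fun u => smoothTransition.nonneg _, fun u => smoothTransition.le_one _,
    fun u => hanti.deriv_nonpos, g1, fun u hu => ?_, R + 1, ∫ v in (0:ℝ)..(R + 1), g v,
    fun u hu => ?_⟩
  · rw [show (2 : WithTop ℕ∞) = 1 + 1 by norm_num, contDiff_succ_iff_deriv]
    refine ⟨fun u => (hd u).differentiableAt, by simp, ?_⟩
    rw [show deriv (fun u => ∫ v in (0:ℝ)..u, g v) = g from funext fun u => (hd u).deriv]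
    exact hgs.of_le one_le_two
  · rw [intervalIntegral.integral_congr (g := fun _ => 1) fun v hv => g1 v ?_]
    · simp
    · exact hv.2.trans (sup_le hR.le hu)
  · rw [← intervalIntegral.integral_add_adjacent_intervals (b := R + 1)
      (hgs.continuous.intervalIntegrable _ _) (hgs.continuous.intervalIntegrable _ _),
      intervalIntegral.integral_congr (a := R + 1) (g := fun _ => 0) fun v hv => g0 v ?_]
    · simp
    · rw [uIcc_of_le hu] at hv; exact hv.1

section
variable {T T' T'' : ℝ → ℝ} {R : ℝ} {U : Ed d → ℝ}

lemma IsTrunc.nonneg_of_nonneg (hT : IsTrunc T T' T'' R) (hR : 0 ≤ R) {u : ℝ} (hu : 0 ≤ u) :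
    0 ≤ T u := by
  have : Monotone T := monotone_of_hasDerivAt_nonneg (fun u => hT.deriv1 u) fun u => hT.nonneg u
  rw [← hT.eq_self 0 hR]
  exact this hu

lemma IsTrunc.le_self (hT : IsTrunc T T' T'' R) (hR : 0 ≤ R) {u : ℝ} (hu : 0 ≤ u) :
    T u ≤ u := by
  have : Monotone fun u => u - T u :=
    monotone_of_hasDerivAt_nonneg (fun u => (hasDerivAt_id u).sub (hT.deriv1 u))
      fun u => by simpa using hT.le_one u
  have := this hu
  simp only [hT.eq_self 0 hR] at this
  linarith

lemma IsTrunc.exists_const (hT : IsTrunc T T' T'' R)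
    (hUinf : Tendsto U (cocompact (Ed d)) atTop) :
    ∃ c, HasCompactSupport fun x => T (U x) + c := by
  obtain ⟨S, c, hc⟩ := hT.eventually_const
  have := hUinf.eventually (eventually_ge_atTop S)
  rw [← Metric.cobounded_eq_cocompact] at this
  obtain ⟨r, -, hr⟩ := (hasBasis_cobounded_norm.eventually_iff).1 this
  refine ⟨-c, HasCompactSupport.of_support_subset_isCompact (isCompact_closedBall 0 r)
    fun x hx => ?_⟩
  rw [mem_closedBall_zero_iff]
  by_contra! hlt
  exact hx (by simp [hc _ (hr hlt.le)])

lemma IsTrunc.exists_Cb2 (hT : IsTrunc T T' T'' R) (hU : ContDiff ℝ 2 U)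
    (hUinf : Tendsto U (cocompact (Ed d)) atTop) : ∃ M, Cb2 (fun x => T (U x)) M := by
  obtain ⟨c, hs⟩ := hT.exists_const hUinf
  obtain ⟨M, -, hM⟩ :=
    exists_Cb2_of_hasCompactSupport ((hT.contDiff.comp hU).add contDiff_const) hs
  exact ⟨M + |-c|, by simpa using hM.add (Cb2.const (-c))⟩

lemma IsTrunc.Lop_le (hT : IsTrunc T T' T'' R) (hc : Coef A β bb C) (hU : ContDiff ℝ 2 U)
    {c₁ c₂ : ℝ} (hL : ∀ x, Lop A β U x ≤ c₁ - c₂ * U x) (x : Ed d) :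
    Lop A β (fun x => T (U x)) x ≤ T' (U x) * (c₁ - c₂ * U x) := by
  rw [Lop_comp A β hU (hT.contDiff.comp hU) (fun y => hT.deriv1 _) (fun y => hT.deriv2 _)]
  have h1 := hc.low x fun i => pd U i x
  have h2 : 0 ≤ C * ∑ i, ∑ j, A x i j * pd U i x * pd U j x :=
    (Finset.sum_nonneg fun _ _ => sq_nonneg _).trans h1
  have h3 := nonneg_of_mul_nonneg_right h2 (by linarith [hc.one_le])
  have h4 := mul_le_mul_of_nonneg_left (hL x) (hT.nonneg (U x))
  nlinarith [hT.concave (U x)]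

end

/-- The Lyapunov function stays integrable along the resolvent scheme. -/
lemma ResEq.integrable_lyapunov (hc : Coef A β bb C) {h : ℝ} (hh : 0 ≤ h)
    {ν ν' : Measure (Ed d)} [IsProbabilityMeasure ν] [IsProbabilityMeasure ν']
    (H : ResEq A β h ν ν') {U : Ed d → ℝ} (hU : ContDiff ℝ 2 U) (hU0 : ∀ x, 0 ≤ U x)
    (hUinf : Tendsto U (cocompact (Ed d)) atTop) {c₁ c₂ : ℝ} (h₁ : 0 ≤ c₁) (h₂ : 0 ≤ c₂)
    (hL : ∀ x, Lop A β U x ≤ c₁ - c₂ * U x) (hi : Integrable U ν') : Integrable U ν := by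
  choose T T' T'' hT using fun n : ℕ => exists_isTrunc (n.cast_add_one_pos (α := ℝ))
  have p : ∀ n : ℕ, (0:ℝ) ≤ n + 1 := fun n => by positivity
  have key : ∀ n, ∫ x, T n (U x) ∂ν ≤ ∫ x, U x ∂ν' + h * c₁ := fun n => by
    obtain ⟨c, hs⟩ := (hT n).exists_const hUinf
    obtain ⟨M, hM⟩ := (hT n).exists_Cb2 hU hUinf
    have ib : ∀ (m : Measure (Ed d)) [IsFiniteMeasure m], Integrable (fun x => T n (U x)) m :=
      fun m _ => Integrable.of_bound hM.contDiff.continuous.aestronglyMeasurable M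
        (Eventually.of_forall hM.bound)
    have e := H _ (hM.contDiff.add contDiff_const) hs
    simp only [Lop_add A β hM.contDiff contDiff_const, Lop_const, add_zero] at e
    rw [integral_add (ib ν) (integrable_const _), integral_add (ib ν') (integrable_const _)] at e
    simp only [integral_const, probReal_univ, one_smul] at e
    have l1 : ∫ x, Lop A β (fun x => T n (U x)) x ∂ν ≤ c₁ := by
      by_cases hil : Integrable (Lop A β (fun x => T n (U x))) ν
      · have := integral_mono hil (integrable_const c₁) fun x => by
          refine ((hT n).Lop_le hc hU hL x).trans ?_
          have := mul_nonneg h₂ (hU0 x)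
          have a := (hT n).le_one (U x)
          have b := (hT n).nonneg (U x)
          nlinarith
        simpa using this
      · rw [integral_undef hil]; exact h₁
    have l2 : ∫ x, T n (U x) ∂ν' ≤ ∫ x, U x ∂ν' :=
      integral_mono (ib ν') hi fun x => (hT n).le_self (p n) (hU0 x)
    nlinarith
  refine ⟨hU.continuous.aestronglyMeasurable, ?_⟩
  rw [hasFiniteIntegral_iff_ofReal (Eventually.of_forall hU0)]
  have lim : ∀ x, Tendsto (fun n => ENNReal.ofReal (T n (U x))) atTop (𝓝 (ENNReal.ofReal (U x))) :=
    fun x => by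
      refine tendsto_const_nhds.congr' ?_
      filter_upwards [eventually_ge_atTop ⌈U x⌉₊] with n hn
      rw [(hT n).eq_self _ ?_]
      have h1 := Nat.le_ceil (U x)
      have h2 : ((⌈U x⌉₊ : ℕ) : ℝ) ≤ n := by exact_mod_cast hn
      linarith
  have fatou := lintegral_liminf_le (μ := ν) (u := atTop) (f := fun n x => ENNReal.ofReal (T n (U x)))
    fun n => ((hT n).contDiff.continuous.comp hU.continuous).measurable.ennreal_ofReal
  simp_rw [fun x => (lim x).liminf_eq] at fatou
  refine fatou.trans_lt (lt_of_le_of_lt (b := ENNReal.ofReal (∫ x, U x ∂ν' + h * c₁)) ?_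
    ENNReal.ofReal_lt_top)
  refine liminf_le_of_le (by isBoundedDefault) fun b hb => ?_
  obtain ⟨n, hn⟩ := hb.exists
  refine hn.trans ?_
  obtain ⟨M, hM⟩ := (hT n).exists_Cb2 hU hUinf
  rw [← ofReal_integral_eq_lintegral_ofReal
    (Integrable.of_bound hM.contDiff.continuous.aestronglyMeasurable M
        (Eventually.of_forall hM.bound))
    (Eventually.of_forall fun x => (hT n).nonneg_of_nonneg (p n) (hU0 x))]
  exact ENNReal.ofReal_le_ofReal (key n)

/-- Evolution of the Lyapunov moment of a subsolution. -/
lemma ResSub.integral_lyapunov_le (hc : Coef A β bb C) {h : ℝ} (hh : 0 ≤ h)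
    {ν ν' : Measure (Ed d)} [IsFiniteMeasure ν] [IsFiniteMeasure ν'] (hb : Integrable bb ν)
    (H : ResSub A β h ν ν') {U : Ed d → ℝ} (hU : ContDiff ℝ 2 U) (hU0 : ∀ x, 0 ≤ U x)
    (hUinf : Tendsto U (cocompact (Ed d)) atTop) {c₁ c₂ : ℝ}
    (hL : ∀ x, Lop A β U x ≤ c₁ - c₂ * U x) (hi : Integrable U ν) (hi' : Integrable U ν') :
    (1 + h * c₂) * ∫ x, U x ∂ν ≤ ∫ x, U x ∂ν' + h * c₁ * ν.real univ := by
  choose T T' T'' hT using fun n : ℕ => exists_isTrunc (n.cast_add_one_pos (α := ℝ))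
  have p : ∀ n : ℕ, (0:ℝ) ≤ n + 1 := fun n => by positivity
  have ev : ∀ x, ∀ᶠ n : ℕ in atTop, U x ≤ n + 1 := fun x => by
    filter_upwards [eventually_ge_atTop ⌈U x⌉₊] with n hn
    have h1 := Nat.le_ceil (U x)
    have h2 : ((⌈U x⌉₊ : ℕ) : ℝ) ≤ n := by exact_mod_cast hn
    linarith
  have cT : ∀ n, Continuous fun x => T n (U x) := fun n =>
    (hT n).contDiff.continuous.comp hU.continuous
  have cT' : ∀ n, Continuous (T' n) := fun n =>
    continuous_iff_continuousAt.2 fun u => ((hT n).deriv2 u).continuousAt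
  have t0 : ∀ m : Measure (Ed d), Integrable U m →
      Tendsto (fun n => ∫ x, T n (U x) ∂m) atTop (𝓝 (∫ x, U x ∂m)) := fun m hm => by
    refine tendsto_integral_of_dominated_convergence U (fun n => (cT n).aestronglyMeasurable) hm
      (fun n => Eventually.of_forall fun x => ?_) (Eventually.of_forall fun x => ?_)
    · rw [Real.norm_of_nonneg ((hT n).nonneg_of_nonneg (p n) (hU0 x))]
      exact (hT n).le_self (p n) (hU0 x)
    · refine tendsto_const_nhds.congr' ?_
      filter_upwards [ev x] with n hn using ((hT n).eq_self _ hn).symm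
  have iG : Integrable (fun x => c₁ - c₂ * U x) ν := (integrable_const _).sub (hi.const_mul _)
  have t1 : Tendsto (fun n => ∫ x, T' n (U x) * (c₁ - c₂ * U x) ∂ν) atTop
      (𝓝 (∫ x, (c₁ - c₂ * U x) ∂ν)) := by
    refine tendsto_integral_of_dominated_convergence (fun x => |c₁ - c₂ * U x|)
      (fun n => (((cT' n).comp hU.continuous).mul
        (continuous_const.sub (continuous_const.mul hU.continuous))).aestronglyMeasurable) iG.abs
      (fun n => Eventually.of_forall fun x => ?_) (Eventually.of_forall fun x => ?_)
    · rw [norm_mul, Real.norm_of_nonneg ((hT n).nonneg _)]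
      exact mul_le_of_le_one_left (abs_nonneg _) ((hT n).le_one _)
    · refine tendsto_const_nhds.congr' ?_
      filter_upwards [ev x] with n hn
      rw [(hT n).eq_one _ hn, one_mul]
  have key : ∀ n, ∫ x, T n (U x) ∂ν ≤ ∫ x, T n (U x) ∂ν'
      + h * ∫ x, T' n (U x) * (c₁ - c₂ * U x) ∂ν := fun n => by
    obtain ⟨M, hM⟩ := (hT n).exists_Cb2 hU hUinf
    have e := H.cb2 hc hb hM fun x => (hT n).nonneg_of_nonneg (p n) (hU0 x)
    have l := integral_mono (hc.integrable_Lop hb hM) (iG.bdd_mul (c := 1)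
      ((cT' n).comp hU.continuous).aestronglyMeasurable (Eventually.of_forall fun x => by
        simpa only [Function.comp, Real.norm_of_nonneg ((hT n).nonneg _)] using (hT n).le_one _))
        fun x => (hT n).Lop_le hc hU hL x
    have := mul_le_mul_of_nonneg_left l hh
    simp only [Function.comp] at this
    linarith
  have fin := le_of_tendsto_of_tendsto' (t0 ν hi) ((t0 ν' hi').add (t1.const_mul h)) key
  rw [integral_sub (integrable_const _) (hi.const_mul _), integral_const, integral_const_mul,
    smul_eq_mul] at fin
  linarith

lemma lyapunov_rpow (hc : Coef A β bb C) {V : Ed d → ℝ} (hV : ContDiff ℝ 2 V)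
    (hV1 : ∀ x, 1 ≤ V x) {γ : ℝ} (h0 : 0 < γ) (h1 : γ ≤ 1) {c₁ c₂ : ℝ} (hc₁ : 0 ≤ c₁)
    (hL : ∀ x, Lop A β V x ≤ c₁ - c₂ * V x) (x : Ed d) :
    Lop A β (fun x => V x ^ γ) x ≤ γ * c₁ - γ * c₂ * V x ^ γ := by
  have hne : ∀ x, V x ≠ 0 := fun x => by linarith [hV1 x]
  rw [Lop_comp A β (g := fun u => u ^ γ) (g' := fun u => γ * u ^ (γ - 1))
    (g'' := fun u => γ * ((γ - 1) * u ^ (γ - 1 - 1))) hV (hV.rpow_const_of_ne hne)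
    (fun y => hasDerivAt_rpow_const (Or.inl (hne y)))
    (fun y => (hasDerivAt_rpow_const (Or.inl (hne y))).const_mul γ)]
  have a1 := hc.low x fun i => pd V i x
  have a2 : 0 ≤ C * ∑ i, ∑ j, A x i j * pd V i x * pd V j x :=
    (Finset.sum_nonneg fun _ _ => sq_nonneg _).trans a1
  have a3 := nonneg_of_mul_nonneg_right a2 (by linarith [hc.one_le])
  have hp : 0 < V x := by linarith [hV1 x]
  have b1 : 0 < V x ^ (γ - 1) := rpow_pos_of_pos hp _
  have b2 : V x ^ (γ - 1) ≤ 1 := rpow_le_one_of_one_le_of_nonpos (hV1 x) (by linarith)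
  have b3 : V x ^ (γ - 1) * V x = V x ^ γ := by
    rw [← rpow_add_one (hne x)]; ring_nf
  have b4 : 0 < V x ^ (γ - 1 - 1) := rpow_pos_of_pos hp _
  have e1 : γ * ((γ - 1) * V x ^ (γ - 1 - 1)) * ∑ i, ∑ j, A x i j * pd V i x * pd V j x ≤ 0 :=
    mul_nonpos_of_nonpos_of_nonneg (mul_nonpos_of_nonneg_of_nonpos h0.le
      (mul_nonpos_of_nonpos_of_nonneg (by linarith) b4.le)) a3
  have e2 := mul_le_mul_of_nonneg_left (hL x) (mul_nonneg h0.le b1.le)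
  have e3 := mul_le_mul_of_nonneg_left b2 (mul_nonneg h0.le hc₁)
  have e4 : γ * V x ^ (γ - 1) * (c₁ - c₂ * V x) = γ * c₁ * V x ^ (γ - 1)
      - γ * c₂ * (V x ^ (γ - 1) * V x) := by ring
  rw [e4, b3] at e2
  linarith

end

section

variable {A : Ed d → Matrix (Fin d) (Fin d) ℝ} {β : Ed d → Ed d} {bb : Ed d → ℝ} {C : ℝ}
  {m m' ν μ : Measure (Ed d)} {r r' : Ed d → ℝ}

/-- `r` is a density of the signed measure `ν - μ` with respect to `ν + μ`. -/
structure IsDiff (ν μ : Measure (Ed d)) (r : Ed d → ℝ) : Prop where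
  meas : Measurable r
  abs_le : ∀ x, |r x| ≤ 1
  integral_eq : ∀ g : Ed d → ℝ, Integrable g ν → Integrable g μ →
    ∫ x, r x * g x ∂(ν + μ) = ∫ x, g x ∂ν - ∫ x, g x ∂μ

lemma exists_isDiff (ν μ : Measure (Ed d)) [IsFiniteMeasure ν] [IsFiniteMeasure μ] :
    ∃ r, IsDiff ν μ r := by
  set ρ : Ed d → ℝ := fun x => (ν.rnDeriv (ν + μ) x).toReal with hρ
  have hρm : Measurable ρ := (Measure.measurable_rnDeriv _ _).ennreal_toReal
  have hle : ν ≤ ν + μ := Measure.le_add_right le_rfl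
  have h1 : ∀ᵐ x ∂(ν + μ), ρ x ≤ 1 := by
    filter_upwards [Measure.rnDeriv_le_one_of_le hle] with x hx
    exact ENNReal.toReal_le_of_le_ofReal zero_le_one (by simpa using hx)
  refine ⟨fun x => max (-1) (min 1 (2 * ρ x - 1)),
    measurable_const.max (measurable_const.min ((hρm.const_mul 2).sub_const 1)), fun x => ?_,
    fun g hg hg' => ?_⟩
  · exact abs_le.2 ⟨le_max_left _ _, max_le (by norm_num) (min_le_left _ _)⟩
  have ae : (fun x => max (-1) (min 1 (2 * ρ x - 1)) * g x)
      =ᵐ[ν + μ] fun x => 2 * (ρ x • g x) - g x := by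
    filter_upwards [h1] with x hx
    rw [min_eq_right (by linarith), max_eq_right (by
      have : 0 ≤ ρ x := ENNReal.toReal_nonneg
      linarith), smul_eq_mul]
    ring
  have := Measure.haveLebesgueDecomposition_of_sigmaFinite ν (ν + μ)
  have ac := Measure.absolutelyContinuous_of_le hle
  rw [integral_congr_ae ae, integral_sub (((integrable_rnDeriv_smul_iff ac).2 hg).const_mul 2)
    (hg.add_measure hg'), integral_const_mul, integral_rnDeriv_smul ac,
    integral_add_measure hg hg']
  ring

/-- The measure with density `max r 0` with respect to `m`. -/
def posM (r : Ed d → ℝ) (m : Measure (Ed d)) : Measure (Ed d) :=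
  m.withDensity fun x => ((r x).toNNReal : ℝ≥0∞)

lemma posM_le (h1 : ∀ x, |r x| ≤ 1) : posM r m ≤ m := by
  conv_rhs => rw [← withDensity_one (μ := m)]
  refine withDensity_mono (Eventually.of_forall fun x => ?_)
  have : (r x).toNNReal ≤ 1 := Real.toNNReal_le_one.2 ((le_abs_self _).trans (h1 x))
  simpa using this

lemma isFiniteMeasure_posM [IsFiniteMeasure m] (h1 : ∀ x, |r x| ≤ 1) :
    IsFiniteMeasure (posM r m) :=
  isFiniteMeasure_of_le m (posM_le h1)

lemma integral_posM (hr : Measurable r) (g : Ed d → ℝ) :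
    ∫ x, g x ∂(posM r m) = ∫ x, max (r x) 0 * g x ∂m := by
  unfold posM
  rw [integral_withDensity_eq_integral_smul hr.real_toNNReal]
  rfl

lemma posM_mutuallySingular (hr : Measurable r) : posM r m ⟂ₘ posM (fun x => -r x) m := by
  have hs : MeasurableSet {x | r x ≤ 0} := measurableSet_le hr measurable_const
  refine ⟨{x | r x ≤ 0}, hs, ?_, ?_⟩
  · rw [posM, withDensity_apply _ hs, setLIntegral_congr_fun hs (g := fun _ => 0) fun x hx => by
      simpa using hx]
    simp
  · rw [posM, withDensity_apply _ hs.compl,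
      setLIntegral_congr_fun hs.compl (g := fun _ => 0) fun x hx => by
        simpa using (not_le.1 (by exact hx : ¬ r x ≤ 0)).le]
    simp

section
variable [IsFiniteMeasure m] [IsFiniteMeasure m'] {g : Ed d → ℝ}

lemma two_mul_integral_posM (hr : Measurable r) (h1 : ∀ x, |r x| ≤ 1) (hg : Integrable g m) :
    2 * ∫ x, g x ∂(posM r m) = ∫ x, g x * |r x| ∂m + ∫ x, r x * g x ∂m := by
  have i1 : Integrable (fun x => g x * |r x|) m := hg.mul_bdd (c := 1)
    (continuous_abs.measurable.comp hr).aestronglyMeasurable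
    (Eventually.of_forall fun x => by simpa using h1 x)
  have i2 : Integrable (fun x => r x * g x) m := hg.bdd_mul (c := 1) hr.aestronglyMeasurable
    (Eventually.of_forall fun x => by simpa using h1 x)
  rw [integral_posM hr, ← integral_add i1 i2, ← integral_const_mul]
  congr 1 with x
  rcases le_total 0 (r x) with h | h
  · rw [max_eq_left h, abs_of_nonneg h]; ring
  · rw [max_eq_right h, abs_of_nonpos h]; ring

lemma resSub_posM (hc : Coef A β bb C) (hb2 : Integrable (fun y => bb y ^ 2) m)
    (hr : Measurable r) (hr1 : ∀ y, |r y| ≤ 1) {h : ℝ} (hh : 0 ≤ h)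
    (hr' : Measurable r') (hr1' : ∀ y, |r' y| ≤ 1)
    (Hm : ∀ φ M, Cb2 φ M → ∫ x, φ x ∂m - h * ∫ x, Lop A β φ x ∂m = ∫ x, φ x ∂m')
    (Hs : ∀ φ M, Cb2 φ M → ∫ x, r x * φ x ∂m - h * ∫ x, r x * Lop A β φ x ∂m
      = ∫ x, r' x * φ x ∂m') : ResSub A β h (posM r m) (posM r' m') := by
  intro φ hφ hs h0
  obtain ⟨M, -, hM⟩ := exists_Cb2_of_hasCompactSupport hφ hs
  have k := kato hc hb2 hr hr1 hh hr' hr1' Hm Hs hφ hs h0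
  have e := Hs φ M hM
  have a1 := two_mul_integral_posM (m := m) hr hr1 (hφ.continuous.integrable_of_hasCompactSupport hs)
  have a2 := two_mul_integral_posM hr hr1 (hc.integrable_Lop (hc.integrable_bb hb2) hM)
  have a3 := two_mul_integral_posM (m := m') hr' hr1'
    (hφ.continuous.integrable_of_hasCompactSupport hs)
  linear_combination (k + e + a1 - a3 - h * a2) / 2

end

/-- The Jordan decomposition of the difference of two solutions of the resolvent scheme. -/
lemma exists_jordan (hc : Coef A β bb C) {h : ℝ} (hh : 0 ≤ h) {R : ℕ → Measure (Ed d)}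
    [∀ k, IsProbabilityMeasure (R k)] [IsProbabilityMeasure μ]
    (hR2 : ∀ k, Integrable (fun y => bb y ^ 2) (R k)) (hμ2 : Integrable (fun y => bb y ^ 2) μ)
    (hR : ∀ k, ResEq A β h (R (k + 1)) (R k)) (hμ : ResEq A β h μ μ) :
    ∃ r : ℕ → Ed d → ℝ, (∀ k, IsDiff (R k) μ (r k)) ∧
      (∀ k, ResSub A β h (posM (r (k + 1)) (R (k + 1) + μ)) (posM (r k) (R k + μ))) ∧
      (∀ k, ResSub A β h (posM (fun x => -r (k + 1) x) (R (k + 1) + μ))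
        (posM (fun x => -r k x) (R k + μ))) := by
  choose r hr using fun k => exists_isDiff (R k) μ
  have hb : ∀ k, Integrable bb (R k) := fun k => hc.integrable_bb (hR2 k)
  have hbμ := hc.integrable_bb hμ2
  have ib : ∀ {φ : Ed d → ℝ} {M : ℝ}, Cb2 φ M → ∀ (m : Measure (Ed d)) [IsFiniteMeasure m],
      Integrable φ m := fun hφ m _ =>
    Integrable.of_bound hφ.contDiff.continuous.aestronglyMeasurable _ (Eventually.of_forall hφ.bound)
  have Hm : ∀ k φ M, Cb2 φ M → ∫ x, φ x ∂(R (k + 1) + μ)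
      - h * ∫ x, Lop A β φ x ∂(R (k + 1) + μ) = ∫ x, φ x ∂(R k + μ) := fun k φ M hφ => by
    rw [integral_add_measure (ib hφ _) (ib hφ _), integral_add_measure (ib hφ _) (ib hφ _),
      integral_add_measure (hc.integrable_Lop (hb _) hφ) (hc.integrable_Lop hbμ hφ)]
    have e1 := (hR k).cb2 hc (hb _) hφ
    have e2 := hμ.cb2 hc hbμ hφ
    linear_combination e1 + e2
  have Hs : ∀ k φ M, Cb2 φ M → ∫ x, r (k + 1) x * φ x ∂(R (k + 1) + μ)
      - h * ∫ x, r (k + 1) x * Lop A β φ x ∂(R (k + 1) + μ)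
      = ∫ x, r k x * φ x ∂(R k + μ) := fun k φ M hφ => by
    rw [(hr _).integral_eq _ (ib hφ _) (ib hφ _), (hr _).integral_eq _ (ib hφ _) (ib hφ _),
      (hr _).integral_eq _ (hc.integrable_Lop (hb _) hφ) (hc.integrable_Lop hbμ hφ)]
    have e1 := (hR k).cb2 hc (hb _) hφ
    have e2 := hμ.cb2 hc hbμ hφ
    linear_combination e1 - e2
  refine ⟨r, hr, fun k => resSub_posM hc ((hR2 _).add_measure hμ2) (hr _).meas (hr _).abs_le hh
    (hr _).meas (hr _).abs_le (Hm k) (Hs k), fun k => resSub_posM hc ((hR2 _).add_measure hμ2)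
    (hr _).meas.neg (fun y => (abs_neg _).trans_le ((hr _).abs_le y)) hh (hr _).meas.neg
    (fun y => (abs_neg _).trans_le ((hr _).abs_le y)) (Hm k) fun φ M hφ => ?_⟩
  simp only [Pi.neg_apply, neg_mul, integral_neg]
  linear_combination -(Hs k φ M hφ)

end

section

variable {A : Ed d → Matrix (Fin d) (Fin d) ℝ} {β : Ed d → Ed d} {bb W : Ed d → ℝ} {C : ℝ}
  {P Q : ℕ → Measure (Ed d)} {h c₁ c₂ : ℝ}

/-- The positive and negative parts of the difference of two solutions of the resolvent scheme. -/
structure Scheme (A : Ed d → Matrix (Fin d) (Fin d) ℝ) (β : Ed d → Ed d) (bb W : Ed d → ℝ)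
    (h : ℝ) (P Q : ℕ → Measure (Ed d)) : Prop where
  fin_left : ∀ j, IsFiniteMeasure (P j)
  fin_right : ∀ j, IsFiniteMeasure (Q j)
  bb_left : ∀ j, Integrable bb (P j)
  bb_right : ∀ j, Integrable bb (Q j)
  W_left : ∀ j, Integrable W (P j)
  W_right : ∀ j, Integrable W (Q j)
  sub_left : ∀ j, ResSub A β h (P (j + 1)) (P j)
  sub_right : ∀ j, ResSub A β h (Q (j + 1)) (Q j)
  sing : ∀ j, P j ⟂ₘ Q j
  mass_eq : ∀ j, (P j).real univ = (Q j).real univ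

lemma Scheme.shift (S : Scheme A β bb W h P Q) (n : ℕ) :
    Scheme A β bb W h (fun j => P (n + j)) (fun j => Q (n + j)) where
  fin_left _ := S.fin_left _
  fin_right _ := S.fin_right _
  bb_left _ := S.bb_left _
  bb_right _ := S.bb_right _
  W_left _ := S.W_left _
  W_right _ := S.W_right _
  sub_left j := S.sub_left (n + j)
  sub_right j := S.sub_right (n + j)
  sing _ := S.sing _
  mass_eq _ := S.mass_eq _

lemma ResSub.smul {ν ν' : Measure (Ed d)} (H : ResSub A β h ν ν') (s : ℝ≥0) :
    ResSub A β h (s • ν) (s • ν') := by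
  intro φ hφ hs h0
  simp only [integral_smul_nnreal_measure, NNReal.smul_def, smul_eq_mul]
  have := mul_le_mul_of_nonneg_left (H φ hφ hs h0) s.coe_nonneg
  linear_combination this

lemma Scheme.smul (S : Scheme A β bb W h P Q) (s : ℝ≥0) :
    Scheme A β bb W h (fun j => s • P j) (fun j => s • Q j) where
  fin_left j := by have := S.fin_left j; infer_instance
  fin_right j := by have := S.fin_right j; infer_instance
  bb_left j := (S.bb_left j).smul_measure_nnreal
  bb_right j := (S.bb_right j).smul_measure_nnreal
  W_left j := (S.W_left j).smul_measure_nnreal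
  W_right j := (S.W_right j).smul_measure_nnreal
  sub_left j := (S.sub_left j).smul s
  sub_right j := (S.sub_right j).smul s
  sing j := ((S.sing j).smul_nnreal s).symm.smul_nnreal s |>.symm
  mass_eq j := by simp [S.mass_eq j]

lemma ResSub.mass_le (hc : Coef A β bb C) {ν ν' : Measure (Ed d)} [IsFiniteMeasure ν]
    [IsFiniteMeasure ν'] (hb : Integrable bb ν) (H : ResSub A β h ν ν') :
    ν.real univ ≤ ν'.real univ := by
  simpa [Lop_const] using H.cb2 hc hb (Cb2.const 1) fun _ => zero_le_one

lemma Scheme.antitone (hc : Coef A β bb C) (S : Scheme A β bb W h P Q) :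
    Antitone fun j => (P j).real univ :=
  antitone_nat_of_succ_le fun j => by
    have := S.fin_left
    exact (S.sub_left j).mass_le hc (S.bb_left _)

/-- The weight of a scheme. -/
def wt (W : Ed d → ℝ) (P Q : ℕ → Measure (Ed d)) (j : ℕ) : ℝ :=
  ∫ x, W x ∂(P j) + ∫ x, W x ∂(Q j)

lemma wt_nonneg (hW0 : ∀ x, 0 ≤ W x) (j : ℕ) : 0 ≤ wt W P Q j :=
  add_nonneg (integral_nonneg hW0) (integral_nonneg hW0)

/-- A Lyapunov function with its constants. -/
structure IsLyap (A : Ed d → Matrix (Fin d) (Fin d) ℝ) (β : Ed d → Ed d) (W : Ed d → ℝ)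
    (c₁ c₂ : ℝ) : Prop where
  contDiff : ContDiff ℝ 2 W
  nonneg : ∀ x, 0 ≤ W x
  tendsto : Tendsto W (cocompact (Ed d)) atTop
  Lop_le : ∀ x, Lop A β W x ≤ c₁ - c₂ * W x

lemma Scheme.wt_le (hc : Coef A β bb C) (hW : IsLyap A β W c₁ c₂) (hc₁ : 0 ≤ c₁) (hc₂ : 0 < c₂)
    (hh : 0 ≤ h) (S : Scheme A β bb W h P Q) (n : ℕ) :
    (1 + h * c₂) ^ n * (wt W P Q n - 2 * c₁ / c₂ * (P 0).real univ) ≤ wt W P Q 0 := by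
  induction n with
  | zero =>
    have : 0 ≤ 2 * c₁ / c₂ * (P 0).real univ := by positivity
    simp; linarith
  | succ n ih =>
    have := S.fin_left; have := S.fin_right
    have l1 := (S.sub_left n).integral_lyapunov_le hc hh (S.bb_left _) hW.contDiff hW.nonneg
      hW.tendsto hW.Lop_le (S.W_left _) (S.W_left _)
    have l2 := (S.sub_right n).integral_lyapunov_le hc hh (S.bb_right _) hW.contDiff hW.nonneg
      hW.tendsto hW.Lop_le (S.W_right _) (S.W_right _)
    rw [← S.mass_eq] at l2
    have l3 := mul_le_mul_of_nonneg_left (S.antitone hc (Nat.zero_le (n + 1)))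
      (mul_nonneg hh hc₁)
    have key : (1 + h * c₂) * (wt W P Q (n + 1) - 2 * c₁ / c₂ * (P 0).real univ)
        ≤ wt W P Q n - 2 * c₁ / c₂ * (P 0).real univ := by
      have : h * c₂ * (2 * c₁ / c₂ * (P 0).real univ) = 2 * (h * c₁ * (P 0).real univ) := by
        field_simp
      unfold wt
      simp only at l3
      linear_combination l1 + l2 + 2 * l3 - this
    refine le_trans ?_ ih
    rw [pow_succ, mul_assoc]
    exact mul_le_mul_of_nonneg_left key (by positivity)

lemma Scheme.wt_le_add (hc : Coef A β bb C) (hW : IsLyap A β W c₁ c₂) (hc₁ : 0 ≤ c₁)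
    (hc₂ : 0 < c₂) (hh : 0 ≤ h) (S : Scheme A β bb W h P Q) {T : ℝ} (hT : 0 ≤ T) {n : ℕ}
    (hn : T ≤ n * h) :
    wt W P Q n ≤ 2 * c₁ / c₂ * (P 0).real univ + (1 + T * c₂)⁻¹ * wt W P Q 0 := by
  have h1 := S.wt_le hc hW hc₁ hc₂ hh n
  have h2 := one_add_mul_le_pow (a := h * c₂) (by nlinarith [mul_nonneg hh hc₂.le]) n
  have h3 : 0 ≤ (1 + T * c₂)⁻¹ * wt W P Q 0 :=
    mul_nonneg (by positivity) (wt_nonneg hW.nonneg 0)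
  have h4 : 0 < 1 + T * c₂ := by positivity
  by_contra! hlt
  have h5 : (1 + T * c₂)⁻¹ * wt W P Q 0 < wt W P Q n - 2 * c₁ / c₂ * (P 0).real univ := by linarith
  have h6 : 1 + T * c₂ ≤ (1 + h * c₂) ^ n := by nlinarith
  have h7 := mul_lt_mul_of_pos_left h5 h4
  rw [mul_inv_cancel_left₀ h4.ne'] at h7
  have h8 := mul_le_mul_of_nonneg_right h6 (h3.trans h5.le)
  linarith

lemma contraction_of_le {M₀ M w₀ w a ρ C₀ R ε δ : ℝ} (hM₀ : 0 ≤ M₀) (hw₀ : 0 ≤ w₀) (hC₀ : 0 ≤ C₀)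
    (hε : 0 < ε) (hw : w ≤ C₀ * M₀ + ρ * w₀) (hM : M ≤ M₀) (hR : R * (1 - ρ) = 2 * (C₀ + 1))
    (hεa : ε * (C₀ + 1) = a) (hδa : δ ≤ a) (hδρ : δ ≤ 1 - ρ) (hδε : δ * (1 + ε * R) ≤ ε)
    (hloss : w₀ ≤ R * M₀ → M ≤ (1 - 2 * a) * M₀) : M + ε * w ≤ (1 - δ) * (M₀ + ε * w₀) := by
  have e1 := mul_le_mul_of_nonneg_left hw hε.le
  rcases le_total w₀ (R * M₀) with hc | hc
  · have e2 := hloss hc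
    have e3 := mul_le_mul_of_nonneg_right hδa hM₀
    have e4 := mul_le_mul_of_nonneg_right hδρ (mul_nonneg hε.le hw₀)
    have e5 := mul_nonneg hε.le hM₀
    subst hεa
    nlinarith
  · have e2 := mul_le_mul_of_nonneg_left hc (mul_nonneg hε.le (sub_nonneg.2 hδρ))
    have e3 := mul_le_mul_of_nonneg_right hδε hM₀
    have e5 := mul_nonneg hε.le hM₀
    have e6 := mul_nonneg e5 hC₀
    have e7 : ε * (1 - ρ - δ) * (R * M₀) = ε * M₀ * (R * (1 - ρ)) - δ * (ε * R) * M₀ := by ring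
    rw [e7, hR] at e2
    nlinarith

/-- Harris-type contraction over one block of the resolvent scheme. -/
lemma exists_contraction (hd : 0 < d) {A : Ed d → Matrix (Fin d) (Fin d) ℝ} {bb W : Ed d → ℝ}
    {C c₁ c₂ : ℝ} (hbb : Continuous bb) (hW0 : ∀ x, 0 ≤ W x)
    (hWinf : Tendsto W (cocompact (Ed d)) atTop) (hC : 1 ≤ C) (hc₁ : 0 ≤ c₁) (hc₂ : 0 < c₂) :
    ∃ ε > 0, ε * (2 * c₁ / c₂) ≤ 1 ∧ ∃ q > 0, q < 1 ∧ ∀ (β : Ed d → Ed d) (h : ℝ) (n : ℕ)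
      (P Q : ℕ → Measure (Ed d)), Coef A β bb C → IsLyap A β W c₁ c₂ → 0 ≤ h →
      1 ≤ n * h → n * h ≤ 2 → Scheme A β bb W h P Q →
      (P n).real univ + ε * wt W P Q n ≤ q * ((P 0).real univ + ε * wt W P Q 0) := by
  set C₀ := 2 * c₁ / c₂ with hC₀
  have C₀0 : 0 ≤ C₀ := by positivity
  set ρ := (1 + 1 * c₂)⁻¹ with hρ
  have hρ0 : 0 < ρ := by positivity
  have hρ1 : ρ < 1 := inv_lt_one_of_one_lt₀ (by linarith)
  set R := 2 * (C₀ + 1) / (1 - ρ) with hR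
  have hρ1' : 0 < 1 - ρ := by linarith
  have hR0 : 0 < R := by positivity
  obtain ⟨α, hα, hα8, H⟩ := mass_loss (A := A) hd hbb hW0 hWinf hC ((C₀ + R) / 2) 1 (by positivity) one_pos
  set ε := α / (C₀ + 1) with hε
  have hε0 : 0 < ε := by positivity
  have hεa : ε * (C₀ + 1) = α := by rw [hε]; field_simp
  set δ := min α (min (1 - ρ) (ε / (1 + ε * R))) with hδ
  have hδ0 : 0 < δ := lt_min hα (lt_min hρ1' (by positivity))
  have hδa : δ ≤ α := min_le_left _ _
  refine ⟨ε, hε0, by nlinarith, 1 - δ, by linarith, by linarith,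
    fun β h n P Q hc hW hh hn1 hn2 S => ?_⟩
  have := S.fin_left; have := S.fin_right
  have hw := S.wt_le_add hc hW hc₁ hc₂ hh zero_le_one hn1
  have hM := S.antitone hc (Nat.zero_le n)
  refine contraction_of_le (R := R) measureReal_nonneg (wt_nonneg hW0 0) C₀0 hε0 hw hM
    (div_mul_cancel₀ _ hρ1'.ne') hεa hδa ((min_le_right _ _).trans (min_le_left _ _)) ?_ fun hwR => ?_
  · rw [← le_div_iff₀ (by positivity)]
    exact (min_le_right _ _).trans (min_le_right _ _)
  rcases (measureReal_nonneg (μ := P 0) (s := univ)).eq_or_lt with h0 | h0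
  · have : (P n).real univ ≤ (P 0).real univ := hM
    rw [← h0] at this ⊢
    simpa using this
  set s : ℝ≥0 := ⟨(2 * (P 0).real univ)⁻¹, by positivity⟩ with hs
  have hsv : (s : ℝ) = (2 * (P 0).real univ)⁻¹ := rfl
  have hwj : ∀ j, wt W P Q j ≤ (C₀ + R) * (P 0).real univ := fun j => by
    have := S.wt_le_add hc hW hc₁ hc₂ hh (T := 0) le_rfl (n := j) (by positivity)
    simp only [zero_mul, add_zero, inv_one, one_mul] at this
    linarith
  have hs1 : ∀ u, u ≤ (C₀ + R) * (P 0).real univ → s * u ≤ (C₀ + R) / 2 := fun u hu => by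
    refine (mul_le_mul_of_nonneg_left hu s.coe_nonneg).trans_eq ?_
    rw [hsv]; field_simp
  have S' := S.smul s
  have := S'.fin_left; have := S'.fin_right
  have i1 : ∀ j, ∫ x, W x ∂(P j) ≤ (C₀ + R) * (P 0).real univ := fun j =>
    (le_add_of_nonneg_right (integral_nonneg hW0)).trans (hwj j)
  have i2 : ∀ j, ∫ x, W x ∂(Q j) ≤ (C₀ + R) * (P 0).real univ := fun j =>
    (le_add_of_nonneg_left (integral_nonneg hW0)).trans (hwj j)
  have key := H β h n _ _ hc hh hn1 (by linarith) S'.bb_left S'.bb_right S'.sub_left S'.sub_right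
    S'.sing S'.mass_eq (S'.antitone hc) (by
      rw [measureReal_nnreal_smul_apply, hsv]
      exact le_of_eq (by field_simp))
    (fun j _ => ⟨S'.W_left j, by
      rw [integral_smul_nnreal_measure, NNReal.smul_def, smul_eq_mul]; exact hs1 _ (i1 j)⟩)
    (fun j _ => ⟨S'.W_right j, by
      rw [integral_smul_nnreal_measure, NNReal.smul_def, smul_eq_mul]; exact hs1 _ (i2 j)⟩)
  rw [measureReal_nnreal_smul_apply, hsv, inv_mul_le_iff₀ (by positivity)] at key
  linarith

/-- Exponential decay along the resolvent scheme. -/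
lemma exists_exp_decay (hd : 0 < d) {A : Ed d → Matrix (Fin d) (Fin d) ℝ} {bb W : Ed d → ℝ}
    {C c₁ c₂ : ℝ} (hbb : Continuous bb) (hW0 : ∀ x, 0 ≤ W x)
    (hWinf : Tendsto W (cocompact (Ed d)) atTop) (hC : 1 ≤ C) (hc₁ : 0 ≤ c₁) (hc₂ : 0 < c₂) :
    ∃ ε > 0, ∃ K > 0, ∃ lam > 0, ∀ (β : Ed d → Ed d) (t : ℝ) (N : ℕ)
      (P Q : ℕ → Measure (Ed d)), Coef A β bb C → IsLyap A β W c₁ c₂ → 0 < t → t ≤ N →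
      Scheme A β bb W (t / N) P Q →
      (P N).real univ + ε * wt W P Q N
        ≤ K * exp (-lam * t) * ((P 0).real univ + ε * wt W P Q 0) := by
  obtain ⟨ε, hε, hεC, q, hq0, hq1, H⟩ := exists_contraction (A := A) hd hbb hW0 hWinf hC hc₁ hc₂
  refine ⟨ε, hε, 2 / q, by positivity, -log q / 2, by have := log_neg hq0 hq1; linarith,
    fun β t N P Q hc hW ht htN S => ?_⟩
  have hN : (0:ℝ) < N := ht.trans_le htN
  set h := t / N with hh
  have hh0 : 0 < h := by positivity
  have hh1 : h ≤ 1 := (div_le_one hN).2 htN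
  set n := ⌈h⁻¹⌉₊ with hn
  have hn1 : 1 ≤ n * h := by
    have := mul_le_mul_of_nonneg_right (Nat.le_ceil h⁻¹) hh0.le
    rwa [inv_mul_cancel₀ hh0.ne'] at this
  have hn2 : n * h ≤ 2 := by
    have := mul_le_mul_of_nonneg_right (Nat.ceil_lt_add_one (a := h⁻¹) (by positivity)).le hh0.le
    rw [add_mul, inv_mul_cancel₀ hh0.ne'] at this
    linarith
  set F : ℕ → ℝ := fun j => (P j).real univ + ε * wt W P Q j with hF
  have hF0 : ∀ j, 0 ≤ F j := fun j =>
    add_nonneg measureReal_nonneg (mul_nonneg hε.le (wt_nonneg hW0 j))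
  have step : ∀ k, F (n * k) ≤ q ^ k * F 0 := fun k => by
    induction k with
    | zero => simp
    | succ k ih =>
      have := H β h n _ _ hc hW hh0.le hn1 hn2 (S.shift (n * k))
      have e : F (n * (k + 1)) ≤ q * F (n * k) := this
      rw [pow_succ']
      nlinarith
  have grow : ∀ i j, F (i + j) ≤ 2 * F i := fun i j => by
    have S' := S.shift i
    have l1 := S'.wt_le_add hc hW hc₁ hc₂ hh0.le (T := 0) le_rfl (n := j) (by positivity)
    have l2 := S'.antitone hc (Nat.zero_le j)
    simp only [zero_mul, add_zero, inv_one, one_mul] at l1 l2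
    have l3 : wt W P Q (i + j) ≤ 2 * c₁ / c₂ * (P i).real univ + wt W P Q i := l1
    have l4 : 0 ≤ wt W P Q i := wt_nonneg hW0 i
    have l5 : 0 ≤ (P i).real univ := measureReal_nonneg
    have l6 := mul_le_mul_of_nonneg_left l3 hε.le
    have l7 := mul_le_mul_of_nonneg_right hεC l5
    have l8 := mul_nonneg hε.le l4
    simp only [hF]
    nlinarith
  have hdm := Nat.div_add_mod N n
  have f1 : F N ≤ 2 * (q ^ (N / n) * F 0) := by
    rw [← hdm]
    refine (grow _ _).trans ?_
    rw [hdm]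
    exact mul_le_mul_of_nonneg_left (step _) zero_le_two
  have hn0 : 0 < n := Nat.ceil_pos.2 (by positivity)
  have f2 : t / 2 - 1 ≤ (N / n : ℕ) := by
    have h1 : N < n * (N / n + 1) := Nat.lt_mul_div_succ N hn0
    have h2 : (N : ℝ) ≤ n * ((N / n : ℕ) + 1) := by exact_mod_cast h1.le
    have h3 : t ≤ n * h * ((N / n : ℕ) + 1) := by
      have := mul_le_mul_of_nonneg_right h2 hh0.le
      rw [hh, mul_div_cancel₀ _ hN.ne'] at this
      linarith
    nlinarith [Nat.cast_nonneg (α := ℝ) (N / n)]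
  have f3 : q ^ (N / n) ≤ q⁻¹ * exp (-(-log q / 2) * t) := by
    rw [← rpow_natCast]
    refine (rpow_le_rpow_of_exponent_ge hq0 hq1.le f2).trans_eq ?_
    rw [rpow_sub hq0, rpow_one, rpow_def_of_pos hq0, div_eq_inv_mul]
    congr 2; ring
  have f4 := mul_le_mul_of_nonneg_right f3 (hF0 0)
  calc F N ≤ 2 * (q ^ (N / n) * F 0) := f1
    _ ≤ 2 * (q⁻¹ * exp (-(-log q / 2) * t) * F 0) := by linarith
    _ = _ := by simp only [hF]; ring

end

section

variable {ν μ : Measure (Ed d)} {r W : Ed d → ℝ}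

/-- The pairing with a signed measure, given by its Jordan decomposition. -/
lemma IsDiff.integral_abs_mul [IsFiniteMeasure ν] [IsFiniteMeasure μ] (H : IsDiff ν μ r)
    (h1 : Integrable W ν) (h2 : Integrable W μ) :
    ∫ x, W x ∂(posM r (ν + μ)) + ∫ x, W x ∂(posM (fun x => -r x) (ν + μ)) =
      ∫ x, W x * |r x| ∂(ν + μ) := by
  have a := two_mul_integral_posM H.meas H.abs_le (h1.add_measure h2)
  have b := two_mul_integral_posM (r := fun x => -r x) H.meas.neg
    (fun x => by simpa using H.abs_le x) (h1.add_measure h2)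
  simp only [abs_neg, neg_mul, integral_neg] at b
  linarith

lemma IsDiff.real_univ_eq [IsProbabilityMeasure ν] [IsProbabilityMeasure μ] (H : IsDiff ν μ r) :
    (posM r (ν + μ)).real univ = (posM (fun x => -r x) (ν + μ)).real univ := by
  have i : Integrable (fun _ : Ed d => (1 : ℝ)) (ν + μ) := integrable_const _
  have a := two_mul_integral_posM H.meas H.abs_le i
  have b := two_mul_integral_posM (r := fun x => -r x) H.meas.neg
    (fun x => by simpa using H.abs_le x) i
  have c := H.integral_eq (fun _ => 1) (integrable_const _) (integrable_const _)
  simp only [abs_neg, integral_neg, integral_const, smul_eq_mul, mul_one, probReal_univ,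
    sub_self] at a b c
  linarith

lemma bddAbove_wDist (h1 : Integrable W ν) (h2 : Integrable W μ) :
    BddAbove (range fun f : {f : Ed d → ℝ // Measurable f ∧ ∀ x, |f x| ≤ W x} =>
      (∫ x, f.1 x ∂ν - ∫ x, f.1 x ∂μ)) := by
  refine ⟨∫ x, W x ∂ν + ∫ x, W x ∂μ, ?_⟩
  rintro _ ⟨f, rfl⟩
  have k1 := norm_integral_le_of_norm_le (f := f.1) h1 (Eventually.of_forall f.2.2)
  have k2 := norm_integral_le_of_norm_le (f := f.1) h2 (Eventually.of_forall f.2.2)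
  rw [Real.norm_eq_abs] at k1 k2
  have := abs_le.1 k1
  have := abs_le.1 k2
  dsimp only
  linarith

lemma IsDiff.le_wDist [IsFiniteMeasure ν] [IsFiniteMeasure μ] (H : IsDiff ν μ r)
    (hW : Measurable W) (hW0 : ∀ x, 0 ≤ W x) (h1 : Integrable W ν) (h2 : Integrable W μ) :
    ∫ x, W x ∂(posM r (ν + μ)) + ∫ x, W x ∂(posM (fun x => -r x) (ν + μ)) ≤ wDist W ν μ := by
  set f : Ed d → ℝ := fun x => if 0 ≤ r x then W x else -W x with hf
  have hfm : Measurable f := hW.ite (measurableSet_le measurable_const H.meas) hW.neg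
  have hfW : ∀ x, |f x| ≤ W x := fun x => by
    rw [hf]; dsimp only; split_ifs <;> simp [abs_of_nonneg (hW0 x)]
  rw [H.integral_abs_mul h1 h2]
  refine le_trans (le_of_eq ?_) (le_ciSup (bddAbove_wDist h1 h2) ⟨f, hfm, hfW⟩)
  dsimp only
  rw [← H.integral_eq f (h1.mono' hfm.aestronglyMeasurable (Eventually.of_forall hfW))
    (h2.mono' hfm.aestronglyMeasurable (Eventually.of_forall hfW))]
  congr 1 with x
  rw [hf]; dsimp only
  split_ifs with h
  · rw [abs_of_nonneg h]; ring
  · rw [abs_of_neg (not_le.1 h)]; ring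

lemma IsDiff.integral_sub_le [IsFiniteMeasure ν] [IsFiniteMeasure μ] (H : IsDiff ν μ r)
    (h1 : Integrable W ν) (h2 : Integrable W μ) {φ : Ed d → ℝ} (hφ : Measurable φ) {c : ℝ}
    (hφW : ∀ x, |φ x| ≤ c * W x) :
    ∫ x, φ x ∂ν - ∫ x, φ x ∂μ ≤ c * (∫ x, W x ∂(posM r (ν + μ)) +
      ∫ x, W x ∂(posM (fun x => -r x) (ν + μ))) := by
  have i1 := (h1.const_mul c).mono' hφ.aestronglyMeasurable (Eventually.of_forall hφW)
  have i2 := (h2.const_mul c).mono' hφ.aestronglyMeasurable (Eventually.of_forall hφW)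
  rw [H.integral_abs_mul h1 h2, ← H.integral_eq φ i1 i2, ← integral_const_mul]
  refine integral_mono ((i1.add_measure i2).bdd_mul (c := 1) H.meas.aestronglyMeasurable
    (Eventually.of_forall H.abs_le)) ((((h1.add_measure h2)).mul_bdd (c := 1)
    (continuous_abs.measurable.comp H.meas).aestronglyMeasurable
    (Eventually.of_forall fun x => by simpa using H.abs_le x)).const_mul c) fun x => ?_
  calc r x * φ x ≤ |r x| * |φ x| := by rw [← abs_mul]; exact le_abs_self _
    _ ≤ |r x| * (c * W x) := mul_le_mul_of_nonneg_left (hφW x) (abs_nonneg _)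
    _ = c * (W x * |r x|) := by ring

/-- It suffices to estimate the weighted distance on test functions. -/
lemma wDist_le_of_isTestFun [IsFiniteMeasure ν] [IsFiniteMeasure μ] (hW : Continuous W)
    (hW1 : ∀ x, 1 ≤ W x) (h1 : Integrable W ν) (h2 : Integrable W μ) {B : ℝ}
    (H : ∀ δ > 0, ∀ φ : Ed d → ℝ, IsTestFun φ → (∀ x, |φ x| ≤ (1 + δ) * W x) →
      ∫ x, φ x ∂ν - ∫ x, φ x ∂μ ≤ (1 + δ) * B) : wDist W ν μ ≤ B := by
  have : Nonempty {f : Ed d → ℝ // Measurable f ∧ ∀ x, |f x| ≤ W x} :=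
    ⟨⟨fun _ => 0, measurable_const, fun x => by simpa using zero_le_one.trans (hW1 x)⟩⟩
  refine ciSup_le fun ⟨f, hfm, hfW⟩ => ?_
  have f1 : Integrable f ν := h1.mono' hfm.aestronglyMeasurable (Eventually.of_forall hfW)
  have f2 : Integrable f μ := h2.mono' hfm.aestronglyMeasurable (Eventually.of_forall hfW)
  set K : ℝ := |B| + (1 + (ν + μ).real univ) with hK
  have hK0 : 0 < K := by positivity
  refine le_of_forall_pos_le_add fun ε hε => ?_
  set δ : ℝ := ε / K with hδ
  have hδ0 : 0 < δ := div_pos hε hK0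
  obtain ⟨g, hgs, hgf, hgc, hgi⟩ :=
    (f1.add_measure f2).exists_hasCompactSupport_integral_sub_le hδ0
  set g' : Ed d → ℝ := fun x => max (-W x) (min (g x) (W x)) with hg'
  have hg'c : Continuous g' := hW.neg.max (hgc.min hW)
  have hsup : Function.support g' ⊆ Function.support g := fun x hx h0 => hx <| by
    have := hW1 x
    simp only [hg', h0]
    rw [min_eq_left (by linarith), max_eq_right (by linarith)]
  obtain ⟨φ, hφ, hφg, hφs⟩ := hg'c.exists_contDiff_approx (⊤ : ℕ∞) (ε := fun _ => δ)
    continuous_const fun _ => hδ0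
  have hφT : IsTestFun φ := ⟨by exact_mod_cast hφ, hgs.mono (hφs.trans hsup)⟩
  have hd : ∀ x, |f x - φ x| ≤ |f x - g x| + δ := fun x => by
    have a := abs_le.1 (hfW x)
    have b : |f x - g' x| ≤ |f x - g x| := by
      simp only [hg']
      rcases le_total (g x) (W x) with h | h
      · rw [min_eq_left h]
        rcases le_total (-W x) (g x) with h' | h'
        · rw [max_eq_right h']
        · rw [max_eq_left h', abs_of_nonneg (by linarith), abs_of_nonneg (by linarith)]; linarith
      · rw [min_eq_right h, max_eq_right (by linarith [hW1 x]), abs_of_nonpos (by linarith),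
          abs_of_nonpos (by linarith)]; linarith
    have c := hφg x
    rw [Real.dist_eq, abs_sub_comm] at c
    linarith [abs_sub_le (f x) (g' x) (φ x)]
  have hφW : ∀ x, |φ x| ≤ (1 + δ) * W x := fun x => by
    have c := hφg x
    rw [Real.dist_eq] at c
    have b : |g' x| ≤ W x := abs_le.2 ⟨le_max_left _ _, max_le (by linarith [hW1 x])
      (min_le_right _ _)⟩
    have := abs_sub_abs_le_abs_sub (φ x) (g' x)
    nlinarith [hW1 x]
  have p1 : Integrable φ ν := hφT.1.continuous.integrable_of_hasCompactSupport hφT.2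
  have p2 : Integrable φ μ := hφT.1.continuous.integrable_of_hasCompactSupport hφT.2
  have key : ∫ x, |f x - φ x| ∂(ν + μ) ≤ δ + δ * (ν + μ).real univ := by
    have i : Integrable (fun x => |f x - g x|) (ν + μ) := ((f1.add_measure f2).sub hgi).abs
    calc ∫ x, |f x - φ x| ∂(ν + μ) ≤ ∫ x, (|f x - g x| + δ) ∂(ν + μ) :=
          integral_mono ((f1.add_measure f2).sub (p1.add_measure p2)).abs
            (i.add (integrable_const _)) hd
      _ = ∫ x, |f x - g x| ∂(ν + μ) + δ * (ν + μ).real univ := by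
          rw [integral_add i (integrable_const _), integral_const, smul_eq_mul, mul_comm δ]
      _ ≤ _ := by
          simp only [Real.norm_eq_abs] at hgf
          linarith
  have q1 : Integrable (fun x => |f x - φ x|) ν := (f1.sub p1).abs
  have q2 : Integrable (fun x => |f x - φ x|) μ := (f2.sub p2).abs
  rw [integral_add_measure q1 q2] at key
  have e1 : ∫ x, f x ∂ν - ∫ x, φ x ∂ν ≤ ∫ x, |f x - φ x| ∂ν := by
    rw [← integral_sub f1 p1]
    exact integral_mono (f1.sub p1) q1 fun x => le_abs_self _
  have e2 : ∫ x, φ x ∂μ - ∫ x, f x ∂μ ≤ ∫ x, |f x - φ x| ∂μ := by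
    rw [← integral_sub p2 f2]
    exact integral_mono (p2.sub f2) q2 fun x => by
      rw [abs_sub_comm]; exact le_abs_self (φ x - f x)
  have e3 := H δ hδ0 φ hφT hφW
  have e4 : δ * K = ε := by rw [hδ]; field_simp
  have e5 : δ * B ≤ δ * |B| := mul_le_mul_of_nonneg_left (le_abs_self _) hδ0.le
  dsimp only
  rw [hK] at e4
  linarith

end

section

variable {h : ℝ}

/-- The exponential law with mean `h`, on the nonnegative reals. -/
def expLaw (h : ℝ) : Measure ℝ≥0 :=
  ((volume.restrict (Ioi (0 : ℝ))).withDensity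
    fun u => ENNReal.ofReal (h⁻¹ * exp (-h⁻¹ * u))).map Real.toNNReal

lemma integrable_expDensity (hh : 0 < h) :
    IntegrableOn (fun u : ℝ => h⁻¹ * exp (-h⁻¹ * u)) (Ioi 0) :=
  (integrableOn_exp_mul_Ioi (by simpa using hh) 0).const_mul _

lemma integral_expLaw (hh : 0 < h) {F : ℝ≥0 → ℝ} (hF : Measurable F) :
    ∫ u, F u ∂(expLaw h) = ∫ u in Ioi (0 : ℝ), h⁻¹ * exp (-h⁻¹ * u) * F u.toNNReal := by
  rw [expLaw, integral_map measurable_real_toNNReal.aemeasurable hF.aestronglyMeasurable,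
    integral_withDensity_eq_integral_toReal_smul (by fun_prop) (by simp)]
  refine integral_congr_ae (Eventually.of_forall fun u => ?_)
  have : 0 ≤ h⁻¹ * exp (-h⁻¹ * u) := by positivity
  dsimp only
  rw [ENNReal.toReal_ofReal this, smul_eq_mul]

lemma isProbabilityMeasure_expLaw (hh : 0 < h) : IsProbabilityMeasure (expLaw h) := by
  constructor
  rw [expLaw, Measure.map_apply measurable_real_toNNReal .univ, preimage_univ,
    withDensity_apply _ .univ, Measure.restrict_univ,
    ← ofReal_integral_eq_lintegral_ofReal (integrable_expDensity hh)
    (Eventually.of_forall fun u => by positivity), integral_const_mul,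
    integral_exp_mul_Ioi (by simpa using hh)]
  simp [hh.ne']

lemma integral_exp_expLaw (hh : 0 < h) {a : ℝ} (ha : 0 ≤ a) :
    ∫ u, exp (-a * u) ∂(expLaw h) = (1 + a * h)⁻¹ := by
  have hp : 0 < h⁻¹ := inv_pos.2 hh
  rw [integral_expLaw hh (by fun_prop)]
  have : ∀ u ∈ Ioi (0 : ℝ), h⁻¹ * exp (-h⁻¹ * u) * exp (-a * u.toNNReal) =
      h⁻¹ * exp (-(h⁻¹ + a) * u) := fun u hu => by
    rw [Real.coe_toNNReal u (le_of_lt hu), mul_assoc, ← exp_add]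
    ring_nf
  rw [setIntegral_congr_fun measurableSet_Ioi this, integral_const_mul,
    integral_exp_mul_Ioi (by linarith)]
  have : h⁻¹ + a ≠ 0 := by positivity
  have : 1 + a * h ≠ 0 := by positivity
  simp only [mul_zero, exp_zero]
  field_simp

/-- The resolvent identity for the primitive of a bounded function. -/
lemma integral_primitive_expLaw (hh : 0 < h) {g : ℝ → ℝ} (hg : Measurable g) {M : ℝ}
    (hM : ∀ v, |g v| ≤ M) (c : ℝ) :
    ∫ u : ℝ≥0, (c + ∫ v in (0 : ℝ)..u, g v) ∂(expLaw h) =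
      c + h * ∫ u : ℝ≥0, g u ∂(expLaw h) := by
  have hp : 0 < h⁻¹ := inv_pos.2 hh
  have := isProbabilityMeasure_expLaw hh
  have hgi : ∀ a b, IntervalIntegrable g volume a b := fun a b =>
    (intervalIntegrable_const (c := M)).mono_fun' hg.aestronglyMeasurable
      (Eventually.of_forall hM)
  have hcont : Continuous fun u : ℝ => ∫ v in (0 : ℝ)..u, g v :=
    intervalIntegral.continuous_primitive hgi 0
  set ν := (volume : Measure ℝ).restrict (Ioi 0) with hν
  set k : ℝ × ℝ → ℝ := fun p => h⁻¹ * exp (-h⁻¹ * p.1) * (Iio p.1).indicator g p.2 with hk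
  have hkm : Measurable k := by
    have : Measurable fun p : ℝ × ℝ => (Iio p.1).indicator g p.2 := by
      have e : (fun p : ℝ × ℝ => (Iio p.1).indicator g p.2) =
        {p : ℝ × ℝ | p.2 < p.1}.indicator fun p => g p.2 := by ext p; simp [indicator]
      rw [e]
      exact (hg.comp measurable_snd).indicator (measurableSet_lt measurable_snd measurable_fst)
    exact (by fun_prop : Measurable fun p : ℝ × ℝ => h⁻¹ * exp (-h⁻¹ * p.1)).mul this
  have hki : Integrable k (ν.prod ν) := by
    have hi : Integrable (fun u : ℝ => exp (-(h⁻¹ / 2) * u)) ν :=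
      integrableOn_exp_mul_Ioi (by linarith) 0
    refine ((hi.const_mul (h⁻¹ * M)).mul_prod hi).mono' hkm.aestronglyMeasurable
      (Eventually.of_forall fun p => ?_)
    have hM0 : 0 ≤ M := (abs_nonneg _).trans (hM 0)
    rw [hk, norm_mul, Real.norm_of_nonneg (by positivity), Real.norm_eq_abs]
    by_cases hx : p.2 < p.1
    · rw [indicator_of_mem (by exact hx)]
      have : exp (-h⁻¹ * p.1) ≤ exp (-(h⁻¹ / 2) * p.1) * exp (-(h⁻¹ / 2) * p.2) := by
        rw [← exp_add]
        exact exp_le_exp.2 (by nlinarith)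
      calc h⁻¹ * exp (-h⁻¹ * p.1) * |g p.2| ≤
          h⁻¹ * (exp (-(h⁻¹ / 2) * p.1) * exp (-(h⁻¹ / 2) * p.2)) * M :=
            mul_le_mul (mul_le_mul_of_nonneg_left this hp.le) (hM _) (abs_nonneg _) (by positivity)
        _ = _ := by ring
    · rw [indicator_of_notMem (by exact hx)]
      simp only [abs_zero, mul_zero]
      positivity
  have e1 : ∫ u : ℝ≥0, (∫ v in (0 : ℝ)..u, g v) ∂(expLaw h) = ∫ u, ∫ v, k (u, v) ∂ν ∂ν := by
    rw [integral_expLaw (F := fun u : ℝ≥0 => ∫ v in (0 : ℝ)..u, g v) hh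
      (hcont.measurable.comp measurable_coe_nnreal_real)]
    refine setIntegral_congr_fun measurableSet_Ioi fun u hu => ?_
    have hu' : (0 : ℝ) < u := hu
    dsimp only [k]
    rw [Real.coe_toNNReal u hu'.le, integral_const_mul, integral_indicator measurableSet_Iio,
      Measure.restrict_restrict measurableSet_Iio, intervalIntegral.integral_of_le hu'.le,
      integral_Ioc_eq_integral_Ioo, inter_comm, Ioi_inter_Iio]
  have e2 : ∫ v, ∫ u, k (u, v) ∂ν ∂ν = h * ∫ u : ℝ≥0, g u ∂(expLaw h) := by
    rw [integral_expLaw (F := fun u : ℝ≥0 => g u) hh (hg.comp measurable_coe_nnreal_real), ← integral_const_mul]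
    refine setIntegral_congr_fun measurableSet_Ioi fun v hv => ?_
    have hv' : (0 : ℝ) < v := hv
    dsimp only [k]
    have : ∀ u : ℝ, h⁻¹ * exp (-h⁻¹ * u) * (Iio u).indicator g v =
        (Ioi v).indicator (fun u => h⁻¹ * exp (-h⁻¹ * u) * g v) u := fun u => by
      by_cases hx : v < u
      · rw [indicator_of_mem (by exact hx), indicator_of_mem (by exact hx)]
      · rw [indicator_of_notMem (by exact hx), indicator_of_notMem (by exact hx), mul_zero]
    simp_rw [this]
    rw [integral_indicator measurableSet_Ioi, Measure.restrict_restrict measurableSet_Ioi,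
      Ioi_inter_Ioi, max_eq_left hv'.le, integral_mul_const, integral_const_mul,
      integral_exp_mul_Ioi (by linarith), Real.coe_toNNReal v hv'.le]
    field_simp
  have hb : Integrable (fun u : ℝ≥0 => ∫ v in (0 : ℝ)..u, g v) (expLaw h) := by
    have hm := hcont.measurable.comp measurable_coe_nnreal_real
    rw [Function.comp_def] at hm
    rw [expLaw, integrable_map_measure hm.aestronglyMeasurable
      measurable_real_toNNReal.aemeasurable,
      integrable_withDensity_iff_integrable_smul' (by fun_prop) (by simp)]
    refine hki.integral_prod_left.congr ?_
    filter_upwards [ae_restrict_mem measurableSet_Ioi] with u hu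
    have hu' : (0 : ℝ) < u := hu
    dsimp only [k, Function.comp_apply]
    rw [ENNReal.toReal_ofReal (by positivity), Real.coe_toNNReal u hu'.le, integral_const_mul,
      integral_indicator measurableSet_Iio, smul_eq_mul,
      Measure.restrict_restrict measurableSet_Iio, intervalIntegral.integral_of_le hu'.le,
      integral_Ioc_eq_integral_Ioo, inter_comm, Ioi_inter_Iio]
  rw [integral_add (integrable_const _) hb, integral_const, probReal_univ, one_smul, e1,
    integral_integral_swap hki, e2]

/-- The law of a sum of `k` independent exponential variables with mean `h`. -/
def gamLaw (h : ℝ) : ℕ → Measure ℝ≥0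
  | 0 => Measure.dirac 0
  | k + 1 => (gamLaw h k).conv (expLaw h)

lemma isProbabilityMeasure_gamLaw (hh : 0 < h) (k : ℕ) : IsProbabilityMeasure (gamLaw h k) := by
  have := isProbabilityMeasure_expLaw hh
  induction k with
  | zero => exact Measure.dirac.isProbabilityMeasure
  | succ k ih => rw [gamLaw]; infer_instance

lemma integrable_of_abs_le {α : Type*} [MeasurableSpace α] {m : Measure α} [IsFiniteMeasure m]
    {f : α → ℝ} (hf : Measurable f) {M : ℝ} (hM : ∀ s, |f s| ≤ M) : Integrable f m :=
  (integrable_const M).mono' hf.aestronglyMeasurable (Eventually.of_forall hM)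

lemma integral_gamLaw_succ (hh : 0 < h) (k : ℕ) {f : ℝ≥0 → ℝ} (hf : Measurable f) {M : ℝ}
    (hM : ∀ s, |f s| ≤ M) :
    ∫ s, f s ∂(gamLaw h (k + 1)) = ∫ s, ∫ u, f (s + u) ∂(expLaw h) ∂(gamLaw h k) := by
  have := isProbabilityMeasure_expLaw hh
  have := isProbabilityMeasure_gamLaw hh k
  have := isProbabilityMeasure_gamLaw hh (k + 1)
  exact integral_conv (integrable_of_abs_le (m := gamLaw h (k + 1)) hf hM)

lemma abs_exp_neg_mul_le {a : ℝ} (ha : 0 ≤ a) (s : ℝ≥0) : |exp (-a * s)| ≤ 1 := by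
  rw [abs_exp]
  exact exp_le_one_iff.2 (by have := s.coe_nonneg; nlinarith)

lemma integral_exp_gamLaw (hh : 0 < h) {a : ℝ} (ha : 0 ≤ a) (k : ℕ) :
    ∫ s, exp (-a * s) ∂(gamLaw h k) = (1 + a * h)⁻¹ ^ k := by
  induction k with
  | zero => simp [gamLaw]
  | succ k ih =>
    rw [integral_gamLaw_succ hh k (by fun_prop) (abs_exp_neg_mul_le ha)]
    have : ∀ s u : ℝ≥0, exp (-a * (s + u : ℝ≥0)) = exp (-a * s) * exp (-a * u) := fun s u => by
      rw [← exp_add]; push_cast; ring_nf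
    simp_rw [this, integral_const_mul, integral_exp_expLaw hh ha, integral_mul_const, ih, pow_succ]

lemma tendsto_integral_gamLaw {t : ℝ≥0} (ht : 0 < t) {f : ℝ≥0 → ℝ} (hf : Continuous f) {M : ℝ}
    (hM : ∀ s, |f s| ≤ M) :
    Tendsto (fun n : ℕ => ∫ s, f s ∂(gamLaw (t / n) n)) atTop (𝓝 (f t)) := by
  have hM0 : 0 ≤ M := (abs_nonneg _).trans (hM 0)
  have hexp : ∀ a : ℝ, 0 ≤ a →
      Tendsto (fun n : ℕ => ∫ s, exp (-a * s) ∂(gamLaw (t / n) n)) atTop (𝓝 (exp (-a * t))) := by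
    intro a ha
    have := (Real.tendsto_one_add_div_pow_exp (a * t)).inv₀ (exp_ne_zero _)
    rw [← exp_neg, ← neg_mul] at this
    refine this.congr' ?_
    filter_upwards [eventually_gt_atTop 0] with n hn
    have : (0 : ℝ) < n := by exact_mod_cast hn
    rw [integral_exp_gamLaw (div_pos (by exact_mod_cast ht) this) ha, inv_pow, mul_div_assoc]
  have hsq : Tendsto (fun n : ℕ => ∫ s : ℝ≥0, (exp (-1 * s) - exp (-1 * t)) ^ 2
      ∂(gamLaw (t / n) n)) atTop (𝓝 0) := by
    have := ((hexp 2 (by norm_num)).sub ((hexp 1 (by norm_num)).const_mul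
      (2 * exp (-1 * t)))).add_const (exp (-1 * t) ^ 2)
    have e0 : exp (-2 * t) - 2 * exp (-1 * t) * exp (-1 * t) + exp (-1 * t) ^ 2 = 0 := by
      have : exp (-2 * (t : ℝ)) = exp (-1 * t) ^ 2 := by rw [← exp_nat_mul]; ring_nf
      rw [this]; ring
    rw [e0] at this
    refine this.congr' ?_
    filter_upwards [eventually_gt_atTop 0] with n hn
    have hn : (0 : ℝ) < n := by exact_mod_cast hn
    have := isProbabilityMeasure_gamLaw (div_pos (by exact_mod_cast ht) hn : 0 < (t : ℝ) / n) n
    have i : ∀ a : ℝ, 0 ≤ a → Integrable (fun s : ℝ≥0 => exp (-a * s)) (gamLaw (t / n) n) :=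
      fun a ha => integrable_of_abs_le (by fun_prop) (abs_exp_neg_mul_le ha)
    have e : ∀ s : ℝ≥0, (exp (-1 * (s : ℝ)) - exp (-1 * t)) ^ 2 =
        (exp (-2 * s) - 2 * exp (-1 * t) * exp (-1 * s)) + exp (-1 * t) ^ 2 := fun s => by
      have : exp (-2 * (s : ℝ)) = exp (-1 * s) ^ 2 := by rw [← exp_nat_mul]; ring_nf
      rw [this]; ring
    simp_rw [e]
    have i2 : Integrable (fun s : ℝ≥0 => exp (-2 * s) - 2 * exp (-1 * t) * exp (-1 * s))
        (gamLaw (t / n) n) := (i 2 (by norm_num)).sub ((i 1 (by norm_num)).const_mul _)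
    rw [integral_add i2 (integrable_const _), integral_sub (i 2 (by norm_num)) ((i 1 (by norm_num)).const_mul _),
      integral_const_mul, integral_const, probReal_univ, one_smul]
  rw [Metric.tendsto_atTop]
  intro ε hε
  obtain ⟨δ, hδ, hfδ⟩ := Metric.continuous_iff.1 hf t (ε / 2) (half_pos hε)
  set c : ℝ := exp (-t) * (1 - exp (-δ)) with hc
  have hc0 : 0 < c := mul_pos (exp_pos _) (sub_pos.2 (exp_lt_one_iff.2 (by linarith)))
  have hbd : ∀ s : ℝ≥0, |f s - f t| ≤ ε / 2 + 2 * M / c ^ 2 * (exp (-1 * s) - exp (-1 * t)) ^ 2 := by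
    intro s
    by_cases hs : dist s t < δ
    · have := hfδ s hs
      rw [Real.dist_eq] at this
      have : 0 ≤ 2 * M / c ^ 2 * (exp (-1 * s) - exp (-1 * t)) ^ 2 := by positivity
      linarith
    · have h1 : c ≤ |exp (-1 * (s : ℝ)) - exp (-1 * t)| := by
        rw [NNReal.dist_eq, not_lt] at hs
        rw [hc, mul_sub, mul_one, ← exp_add]
        rcases le_total (s : ℝ) t with h | h
        · rw [abs_of_nonpos (by linarith)] at hs
          have a : exp (-(t : ℝ) + δ) ≤ exp (-1 * s) := exp_le_exp.2 (by linarith)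
          have b : exp (-(t : ℝ)) - exp (-t + -δ) ≤ exp (-t + δ) - exp (-t) := by
            rw [exp_add, exp_add]
            have := exp_pos (-(t : ℝ))
            have := add_one_le_exp δ
            have := add_one_le_exp (-δ)
            nlinarith
          rw [neg_one_mul (t : ℝ)]
          exact le_trans (by linarith) (le_abs_self _)
        · rw [abs_of_nonneg (by linarith)] at hs
          have a : exp (-1 * (s : ℝ)) ≤ exp (-(t : ℝ) + -δ) := exp_le_exp.2 (by linarith)
          rw [neg_one_mul (t : ℝ), abs_sub_comm]
          exact le_trans (by linarith) (le_abs_self _)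
      have h2 : 1 ≤ (exp (-1 * (s : ℝ)) - exp (-1 * t)) ^ 2 / c ^ 2 := by
        rw [one_le_div (by positivity), ← sq_abs (exp (-1 * (s : ℝ)) - _)]
        exact pow_le_pow_left₀ hc0.le h1 2
      have h3 : |f s - f t| ≤ 2 * M := (abs_sub _ _).trans (by linarith [hM s, hM t])
      calc |f s - f t| ≤ 2 * M * 1 := by linarith
        _ ≤ 2 * M * ((exp (-1 * (s : ℝ)) - exp (-1 * t)) ^ 2 / c ^ 2) :=
          mul_le_mul_of_nonneg_left h2 (by linarith)
        _ ≤ _ := by rw [mul_div_assoc', div_mul_eq_mul_div]; linarith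
  have hev := (hsq.const_mul (2 * M / c ^ 2)).eventually_lt_const (u := ε / 2) (by linarith)
  obtain ⟨n₀, hn₀⟩ := eventually_atTop.1 hev
  refine ⟨max n₀ 1, fun n hn => ?_⟩
  have hn1 : (0 : ℝ) < n := by exact_mod_cast (le_max_right _ _).trans hn
  have := isProbabilityMeasure_gamLaw (div_pos (by exact_mod_cast ht) hn1 : 0 < (t : ℝ) / n) n
  have fi : Integrable f (gamLaw (t / n) n) := integrable_of_abs_le hf.measurable hM
  have qi : Integrable (fun s : ℝ≥0 => (exp (-1 * (s : ℝ)) - exp (-1 * t)) ^ 2)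
      (gamLaw (t / n) n) := by
    refine integrable_of_abs_le (M := 4) (by fun_prop) fun s => ?_
    have a := abs_le.1 (abs_exp_neg_mul_le zero_le_one s)
    have b := abs_le.1 (abs_exp_neg_mul_le zero_le_one t)
    rw [abs_of_nonneg (sq_nonneg _)]
    nlinarith
  rw [Real.dist_eq]
  calc |∫ s, f s ∂(gamLaw (t / n) n) - f t| = |∫ s, (f s - f t) ∂(gamLaw (t / n) n)| := by
        rw [integral_sub fi (integrable_const _), integral_const, probReal_univ, one_smul]
    _ ≤ ∫ s, |f s - f t| ∂(gamLaw (t / n) n) := abs_integral_le_integral_abs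
    _ ≤ ∫ s : ℝ≥0, (ε / 2 + 2 * M / c ^ 2 * (exp (-1 * (s : ℝ)) - exp (-1 * t)) ^ 2)
        ∂(gamLaw (t / n) n) := integral_mono (fi.sub (integrable_const _)).abs
          ((integrable_const _).add (qi.const_mul _)) hbd
    _ = ε / 2 + 2 * M / c ^ 2 * ∫ s : ℝ≥0, (exp (-1 * (s : ℝ)) - exp (-1 * t)) ^ 2
        ∂(gamLaw (t / n) n) := by
        rw [integral_add (integrable_const _) (qi.const_mul _), integral_const, probReal_univ,
          one_smul, integral_const_mul]
    _ < ε := by linarith [hn₀ n ((le_max_left _ _).trans hn)]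

end

section

variable {A : Ed d → Matrix (Fin d) (Fin d) ℝ} {β : Ed d → Ed d} {bb : Ed d → ℝ} {C : ℝ}
  {μ₀ : Measure (Ed d)} {η : ℝ → Measure (Ed d)} {φ : Ed d → ℝ}

lemma IsTestFun.contDiff_two (hφ : IsTestFun φ) : ContDiff ℝ 2 φ :=
  contDiff_infty.1 hφ.1 2

lemma IsTestFun.exists_bound (hφ : IsTestFun φ) : ∃ M, ∀ x, |φ x| ≤ M :=
  hφ.2.exists_bound_of_continuous hφ.1.continuous

lemma Coef.exists_abs_Lop_le (hc : Coef A β bb C) (hφ : IsTestFun φ) :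
    ∃ M, 0 ≤ M ∧ ∀ x, |Lop A β φ x| ≤ M := by
  obtain ⟨M, -, hM⟩ := exists_Cb2_of_hasCompactSupport hφ.contDiff_two hφ.2
  obtain ⟨b, hb⟩ := hφ.2.isCompact.exists_bound_of_continuousOn hc.cont.continuousOn
  have hC := hc.one_le
  refine ⟨(d * d * C + d) * |M| * |b|, by positivity, fun x => ?_⟩
  by_cases hx : x ∈ tsupport φ
  · refine (hc.abs_Lop_le hφ.contDiff_two (fun i => hM.bound_pd i x)
      (fun i j => hM.bound_pd_pd i j x)).trans ?_
    exact mul_le_mul_of_nonneg_left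
      (((le_abs_self _).trans (hb x hx)).trans (le_abs_self b)) (by positivity)
  · rw [Lop_eq_zero_of_eventuallyEq hφ.contDiff_two (notMem_tsupport_iff_eventuallyEq.1 hx), abs_zero]
    positivity

lemma abs_integral_le_of_abs_le {α : Type*} [MeasurableSpace α] {m : Measure α}
    [IsProbabilityMeasure m] {f : α → ℝ}
    {M : ℝ} (hM : ∀ x, |f x| ≤ M) : |∫ x, f x ∂m| ≤ M := by
  simpa using norm_integral_le_of_norm_le_const (μ := m) (f := f) (Eventually.of_forall hM)

lemma measurable_integral_test (hc : Coef A β bb C) (H : IsLinCauchySol A β μ₀ η)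
    (hp : ∀ t, 0 ≤ t → IsProbabilityMeasure (η t)) (hφ : IsTestFun φ) :
    Measurable fun t : ℝ≥0 => ∫ x, φ x ∂(η t) := by
  classical
  obtain ⟨M, hM0, hM⟩ := hc.exists_abs_Lop_le hφ
  set G : ℝ → ℝ := fun s => ∫ x, Lop A β φ x ∂(η s) with hG
  have hGM : ∀ s, 0 ≤ s → |G s| ≤ M := fun s hs => by
    have := hp s hs
    exact abs_integral_le_of_abs_le hM
  set f : ℝ≥0 → ℝ := fun t => ∫ x, φ x ∂(η t) with hf
  have hfG : ∀ t : ℝ≥0, f t = ∫ x, φ x ∂μ₀ + ∫ s in (0 : ℝ)..t, G s := fun t => by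
    have := H.2 φ hφ t t.coe_nonneg
    simp only [hf]
    linarith
  set D : Set ℝ≥0 := {t | IntervalIntegrable G volume 0 t} with hD
  have hDl : IsLowerSet D := fun a b hab ha =>
    IntervalIntegrable.mono_set ha (by
      rw [uIcc_of_le b.coe_nonneg, uIcc_of_le a.coe_nonneg]
      exact Icc_subset_Icc_right (by exact_mod_cast hab))
  have key : ∀ s ∈ D, ∀ t ∈ D, s ≤ t → |f t - f s| ≤ M * dist t s := fun s hs t ht hst => by
    have hst' : (s : ℝ) ≤ t := by exact_mod_cast hst
    have e : f t - f s = ∫ v in (s : ℝ)..t, G v := by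
      rw [hfG, hfG, ← intervalIntegral.integral_interval_sub_left ht hs]; ring
    rw [e, NNReal.dist_eq]
    refine intervalIntegral.norm_integral_le_of_norm_le_const (f := G) fun v hv => hGM v ?_
    rw [uIoc_of_le hst'] at hv
    exact s.coe_nonneg.trans hv.1.le
  have hlip : LipschitzOnWith ⟨M, hM0⟩ f D := LipschitzOnWith.of_dist_le_mul fun s hs t ht => by
    rcases le_total s t with h | h
    · rw [dist_comm, dist_comm s t]; exact key s hs t ht h
    · exact key t ht s hs h
  have hm := hlip.continuousOn.measurable_piecewise
    (continuousOn_const (c := ∫ x, φ x ∂μ₀)) hDl.ordConnected.measurableSet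
  have e : D.piecewise f (fun _ => ∫ x, φ x ∂μ₀) = f := by
    ext t
    by_cases ht : t ∈ D
    · rw [piecewise_eq_of_mem _ _ _ ht]
    · rw [piecewise_eq_of_notMem _ _ _ ht, hfG, intervalIntegral.integral_undef ht, add_zero]
  rwa [e] at hm

lemma measurable_of_measurable_integral_test {η : ℝ≥0 → Measure (Ed d)}
    [∀ t, IsProbabilityMeasure (η t)]
    (H : ∀ φ : Ed d → ℝ, IsTestFun φ → Measurable fun t => ∫ x, φ x ∂(η t)) :
    Measurable η := by
  have hb : ∀ U : Set (Ed d), IsOpen U → Bornology.IsBounded U → Measurable fun t => η t U := by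
    intro U hU hUb
    obtain ⟨f, hfU, hf, hf01⟩ := hU.exists_contDiff_support_eq (n := ⊤)
    have h01 : ∀ x, 0 ≤ 1 - f x ∧ 1 - f x ≤ 1 := fun x => by
      have := hf01 (mem_range_self x)
      exact ⟨by linarith [this.2], by linarith [this.1]⟩
    have hT : ∀ n : ℕ, IsTestFun fun x => 1 - (1 - f x) ^ n := fun n =>
      ⟨contDiff_const.sub ((contDiff_const.sub hf).pow n), by
        refine HasCompactSupport.intro hUb.isCompact_closure fun x hx => ?_
        have : f x = 0 := by
          by_contra h
          exact hx (subset_closure (hfU ▸ h))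
        simp [this]⟩
    have hlim : ∀ t, Tendsto (fun n : ℕ => ∫ x, (1 - (1 - f x) ^ n) ∂(η t)) atTop
        (𝓝 ((η t).real U)) := fun t => by
      rw [← integral_indicator_one hU.measurableSet]
      refine tendsto_integral_of_dominated_convergence (fun _ => 1)
        (fun n => (hT n).1.continuous.aestronglyMeasurable) (integrable_const _)
        (fun n => Eventually.of_forall fun x => ?_) (Eventually.of_forall fun x => ?_)
      · have a := pow_nonneg (h01 x).1 n
        have b := pow_le_one₀ (n := n) (h01 x).1 (h01 x).2
        rw [Real.norm_eq_abs, abs_of_nonneg (by linarith)]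
        linarith
      · by_cases hx : x ∈ U
        · rw [indicator_of_mem hx, Pi.one_apply]
          have h0 : f x ≠ 0 := by rw [← hfU] at hx; exact hx
          have := (tendsto_pow_atTop_nhds_zero_of_lt_one (h01 x).1
            (lt_of_le_of_ne (h01 x).2 fun h => h0 (by linarith))).const_sub 1
          simpa using this
        · have h0 : f x = 0 := by
            by_contra h
            exact hx (hfU ▸ h)
          simp [indicator_of_notMem hx, h0]
    have := measurable_of_tendsto_metrizable (fun n => H _ (hT n)) (tendsto_pi_nhds.2 hlim)
    simpa [measureReal_def] using this.ennreal_ofReal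
  refine Measurable.measure_of_isPiSystem_of_isProbabilityMeasure (S := {U | IsOpen U})
    (BorelSpace.measurable_eq) isPiSystem_isOpen fun U hU => ?_
  refine measurable_of_tendsto_metrizable (f := fun n t => η t (U ∩ ball 0 (n : ℕ)))
    (fun n => hb _ (IsOpen.inter hU isOpen_ball) (isBounded_ball.subset inter_subset_right))
    (tendsto_pi_nhds.2 fun t => ?_)
  have e : U = ⋃ n : ℕ, U ∩ ball 0 (n : ℝ) := by rw [← inter_iUnion, iUnion_ball_nat, inter_univ]
  conv_rhs => rw [e]
  exact tendsto_measure_iUnion_atTop fun m n hmn =>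
    inter_subset_inter_right _ (ball_subset_ball (by exact_mod_cast hmn))

/-- The flow of a solution of the Cauchy problem, as a Markov kernel from time to space. -/
lemma exists_kernel (hc : Coef A β bb C) (H : IsLinCauchySol A β μ₀ η)
    (hp : ∀ t, 0 ≤ t → IsProbabilityMeasure (η t)) :
    ∃ κ : ProbabilityTheory.Kernel ℝ≥0 (Ed d), ProbabilityTheory.IsMarkovKernel κ ∧
      ∀ t, κ t = η t := by
  have : ∀ t : ℝ≥0, IsProbabilityMeasure (η t) := fun t => hp t t.coe_nonneg
  exact ⟨⟨fun t => η t, measurable_of_measurable_integral_test (η := fun t : ℝ≥0 => η t)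
    fun φ hφ => measurable_integral_test hc H hp hφ⟩, ⟨this⟩, fun t => rfl⟩

/-- A solution of the Cauchy problem is approximated by solutions of the implicit Euler scheme. -/
lemma exists_resolvent_scheme (hc : Coef A β bb C) (H : IsLinCauchySol A β μ₀ η)
    (hp : ∀ t, 0 ≤ t → IsProbabilityMeasure (η t)) :
    ∃ R : ℝ → ℕ → Measure (Ed d), (∀ h > 0, ∀ k, IsProbabilityMeasure (R h k)) ∧
      (∀ h > 0, R h 0 = μ₀) ∧ (∀ h > 0, ∀ k, ResEq A β h (R h (k + 1)) (R h k)) ∧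
      ∀ t > 0, ∀ φ : Ed d → ℝ, IsTestFun φ →
        Tendsto (fun n : ℕ => ∫ x, φ x ∂(R (t / n) n)) atTop (𝓝 (∫ x, φ x ∂(η t))) := by
  obtain ⟨κ, hκM, hκ⟩ := exists_kernel hc H hp
  have hint : ∀ h > 0, ∀ k, ∀ f : Ed d → ℝ, Measurable f → ∀ M, (∀ x, |f x| ≤ M) →
      ∫ x, f x ∂((gamLaw h k).bind κ) = ∫ s, ∫ x, f x ∂(κ s) ∂(gamLaw h k) := by
    intro h hh k f hf M hM
    have := isProbabilityMeasure_gamLaw hh k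
    have := integrable_of_abs_le (m := (gamLaw h k).bind κ) hf hM
    rw [Measure.comp_eq_comp_const_apply] at this ⊢
    rw [ProbabilityTheory.Kernel.integral_comp this, ProbabilityTheory.Kernel.const_apply]
  -- the value along the flow, as a primitive
  have hprim : ∀ φ : Ed d → ℝ, IsTestFun φ → ∃ g : ℝ → ℝ, ∃ M, Measurable g ∧ (∀ v, |g v| ≤ M) ∧
      (∀ s : ℝ≥0, g s = ∫ x, Lop A β φ x ∂(κ s)) ∧
      ∀ s : ℝ≥0, ∫ x, φ x ∂(κ s) = ∫ x, φ x ∂μ₀ + ∫ v in (0 : ℝ)..s, g v := by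
    intro φ hφ
    obtain ⟨M, hM0, hM⟩ := hc.exists_abs_Lop_le hφ
    refine ⟨fun v => ∫ x, Lop A β φ x ∂(κ v.toNNReal), M,
      ((hc.measurable_Lop hφ.contDiff_two).stronglyMeasurable.integral_kernel
        (κ := κ)).measurable.comp measurable_real_toNNReal,
      fun v => abs_integral_le_of_abs_le hM, fun s => by simp, fun s => ?_⟩
    have := H.2 φ hφ s s.coe_nonneg
    rw [hκ, sub_eq_iff_eq_add'.1 this]
    congr 1
    refine intervalIntegral.integral_congr fun v hv => ?_
    rw [uIcc_of_le s.coe_nonneg] at hv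
    simp only [hκ, Real.coe_toNNReal v hv.1]
  refine ⟨fun h k => (gamLaw h k).bind κ, fun h hh k => ?_, fun h hh => ?_, fun h hh k => ?_,
    fun t ht φ hφ => ?_⟩
  · have := isProbabilityMeasure_gamLaw hh k
    infer_instance
  · have := Measure.dirac_bind κ.measurable (0 : ℝ≥0)
    change (Measure.dirac (0 : ℝ≥0)).bind κ = μ₀
    rw [this, hκ, NNReal.coe_zero, H.1]
  · have := isProbabilityMeasure_gamLaw hh k
    have := isProbabilityMeasure_gamLaw hh (k + 1)
    have := isProbabilityMeasure_expLaw hh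
    refine resEq_of_isTestFun hc fun φ hφ => ?_
    obtain ⟨M, hM⟩ := hφ.exists_bound
    obtain ⟨M', -, hM'⟩ := hc.exists_abs_Lop_le hφ
    obtain ⟨g, Mg, hg, hgM, hgL, hgφ⟩ := hprim φ hφ
    rw [hint h hh _ _ hφ.1.continuous.measurable M hM, hint h hh _ _ hφ.1.continuous.measurable M hM,
      hint h hh _ _ (hc.measurable_Lop hφ.contDiff_two) M' hM']
    simp_rw [← hgL]
    have hFm : Measurable fun s : ℝ≥0 => ∫ x, φ x ∂(κ s) :=
      (hφ.1.continuous.stronglyMeasurable.integral_kernel (κ := κ)).measurable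
    have hFM : ∀ s : ℝ≥0, |∫ x, φ x ∂(κ s)| ≤ M := fun s => abs_integral_le_of_abs_le hM
    have hgi : ∀ a b, IntervalIntegrable g volume a b := fun a b =>
      (intervalIntegrable_const (c := Mg)).mono_fun' hg.aestronglyMeasurable
        (Eventually.of_forall hgM)
    have hgm : Measurable fun s : ℝ≥0 => g s := hg.comp measurable_coe_nnreal_real
    have hgim : Measurable fun s : ℝ≥0 => ∫ u : ℝ≥0, g (s + u) ∂(expLaw h) :=
      (StronglyMeasurable.integral_prod_right (f := fun s u : ℝ≥0 => g (s + u))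
        (hg.comp (by fun_prop)).stronglyMeasurable).measurable
    rw [integral_gamLaw_succ hh k hFm hFM, integral_gamLaw_succ hh k hgm fun s => hgM s]
    have step : ∀ s : ℝ≥0, ∫ u : ℝ≥0, ∫ x, φ x ∂(κ (s + u)) ∂(expLaw h) =
        ∫ x, φ x ∂(κ s) + h * ∫ u : ℝ≥0, g (s + u) ∂(expLaw h) := fun s => by
      rw [← integral_primitive_expLaw hh (g := fun v => g (s + v)) (hg.comp (by fun_prop))
        fun v => hgM _]
      refine integral_congr_ae (Eventually.of_forall fun u => ?_)
      dsimp only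
      rw [hgφ, hgφ s, intervalIntegral.integral_comp_add_left (fun v => g v) (s : ℝ), add_zero,
        add_assoc, intervalIntegral.integral_add_adjacent_intervals (hgi _ _) (hgi _ _),
        NNReal.coe_add]
    simp_rw [step, NNReal.coe_add]
    rw [integral_add (integrable_of_abs_le hFm hFM) ((integrable_of_abs_le hgim fun s =>
      abs_integral_le_of_abs_le fun u : ℝ≥0 => hgM (s + u)).const_mul h), integral_const_mul]
    ring
  · lift t to ℝ≥0 using ht.le
    obtain ⟨M, hM⟩ := hφ.exists_bound
    obtain ⟨g, Mg, hg, hgM, -, hgφ⟩ := hprim φ hφ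
    have hgi : ∀ a b, IntervalIntegrable g volume a b := fun a b =>
      (intervalIntegrable_const (c := Mg)).mono_fun' hg.aestronglyMeasurable
        (Eventually.of_forall hgM)
    have hcont : Continuous fun s : ℝ≥0 => ∫ x, φ x ∂(κ s) := by
      simp_rw [hgφ]
      exact continuous_const.add
        ((intervalIntegral.continuous_primitive hgi 0).comp NNReal.continuous_coe)
    have := tendsto_integral_gamLaw (by exact_mod_cast ht) hcont (M := M)
      fun s => abs_integral_le_of_abs_le hM
    rw [hκ] at this
    refine this.congr' ?_
    filter_upwards [eventually_gt_atTop 0] with n hn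
    have hn : (0 : ℝ) < n := by exact_mod_cast hn
    rw [hint _ (div_pos ht hn) _ _ hφ.1.continuous.measurable M hM]

end

section

variable {A : Ed d → Matrix (Fin d) (Fin d) ℝ} {β : Ed d → Ed d} {bb V W : Ed d → ℝ}
  {C c₁ c₂ : ℝ} {μ μ₀ : Measure (Ed d)}

lemma IsStationarySol.resEq (hc : Coef A β bb C) [IsFiniteMeasure μ] (H : IsStationarySol A β μ)
    (h : ℝ) : ResEq A β h μ μ :=
  resEq_of_isTestFun hc fun φ hφ => by rw [H φ hφ, mul_zero, sub_zero]

lemma integrable_posM {r : Ed d → ℝ} {m : Measure (Ed d)} (hr : ∀ x, |r x| ≤ 1) {g : Ed d → ℝ}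
    (hg : Integrable g m) : Integrable g (posM r m) := hg.mono_measure (posM_le hr)

/-- The Jordan decompositions of the differences of two solutions form a scheme. -/
lemma scheme_of_isDiff (hc : Coef A β bb C) {h : ℝ} {R : ℕ → Measure (Ed d)} {r : ℕ → Ed d → ℝ}
    [∀ k, IsProbabilityMeasure (R k)] [IsProbabilityMeasure μ]
    (hR2 : ∀ k, Integrable (fun y => bb y ^ 2) (R k)) (hμ2 : Integrable (fun y => bb y ^ 2) μ)
    (hRW : ∀ k, Integrable W (R k)) (hμW : Integrable W μ) (hr : ∀ k, IsDiff (R k) μ (r k))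
    (h1 : ∀ k, ResSub A β h (posM (r (k + 1)) (R (k + 1) + μ)) (posM (r k) (R k + μ)))
    (h2 : ∀ k, ResSub A β h (posM (fun x => -r (k + 1) x) (R (k + 1) + μ))
      (posM (fun x => -r k x) (R k + μ))) :
    Scheme A β bb W h (fun k => posM (r k) (R k + μ))
      (fun k => posM (fun x => -r k x) (R k + μ)) := by
  have a1 := fun k => (hr k).abs_le
  have a2 : ∀ k x, |-r k x| ≤ 1 := fun k x => by simpa using a1 k x
  have b : ∀ k, Integrable bb (R k + μ) := fun k =>
    (hc.integrable_bb (hR2 k)).add_measure (hc.integrable_bb hμ2)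
  exact ⟨fun k => isFiniteMeasure_posM (a1 k), fun k => isFiniteMeasure_posM (a2 k),
    fun k => integrable_posM (a1 k) (b k), fun k => integrable_posM (a2 k) (b k),
    fun k => integrable_posM (a1 k) ((hRW k).add_measure hμW),
    fun k => integrable_posM (a2 k) ((hRW k).add_measure hμW), h1, h2,
    fun k => posM_mutuallySingular (hr k).meas, fun k => (hr k).real_univ_eq⟩

/-- Decay of the discrete schemes gives decay of the weighted distance along the flow. -/
lemma wDist_le_of_decay (hc : Coef A β bb C) {c₀ : ℝ} (hbb : ∀ x, bb x ^ 2 ≤ c₀ * V x)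
    (hV : IsLyap A β V c₁ c₂) (hc₁ : 0 ≤ c₁) (hc₂ : 0 ≤ c₂) (hW : Continuous W)
    (hW1 : ∀ x, 1 ≤ W x) (hWV : ∀ x, W x ≤ V x) {ε K lam : ℝ} (hε : 0 < ε) (hK : 0 < K)
    (hdec : ∀ (t : ℝ) (N : ℕ) (P Q : ℕ → Measure (Ed d)), 0 < t → t ≤ N →
      Scheme A β bb W (t / N) P Q → (P N).real univ + ε * wt W P Q N
        ≤ K * exp (-lam * t) * ((P 0).real univ + ε * wt W P Q 0))
    (hμ : memPV V μ) (hst : IsStationarySol A β μ) (hμ₀ : memPV V μ₀) {η : ℝ → Measure (Ed d)}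
    (hη : ∀ t, 0 ≤ t → memPV V (η t)) (H : IsLinCauchySol A β μ₀ η) {t : ℝ} (ht : 0 < t) :
    wDist W (η t) μ ≤ K * (1 / 2 + ε) / ε * exp (-lam * t) * wDist W μ₀ μ := by
  obtain ⟨R, hRp, hR0, hR, hRt⟩ := exists_resolvent_scheme hc H fun s hs => (hη s hs).1
  have := hμ.1
  have := hμ₀.1
  have := (hη t ht.le).1
  have hW0 : ∀ x, 0 ≤ W x := fun x => zero_le_one.trans (hW1 x)
  have toW : ∀ {m : Measure (Ed d)}, Integrable V m → Integrable W m := fun h =>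
    h.mono' hW.aestronglyMeasurable (Eventually.of_forall fun x => by
      rw [Real.norm_of_nonneg (hW0 x)]; exact hWV x)
  have tobb : ∀ {m : Measure (Ed d)}, Integrable V m → Integrable (fun y => bb y ^ 2) m :=
    fun h => (h.const_mul c₀).mono' (hc.cont.pow 2).aestronglyMeasurable
      (Eventually.of_forall fun x => by
        rw [Real.norm_of_nonneg (sq_nonneg _)]; exact hbb x)
  set B : ℝ := K * (1 / 2 + ε) / ε * exp (-lam * t) * wDist W μ₀ μ with hB
  refine wDist_le_of_isTestFun hW hW1 (toW (hη t ht.le).2) (toW hμ.2) fun δ hδ φ hφ hφW => ?_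
  refine le_of_tendsto ((hRt t ht φ hφ).sub_const _) ?_
  filter_upwards [eventually_ge_atTop (⌈t⌉₊), eventually_gt_atTop 0] with n hn hn0
  have hn0 : (0 : ℝ) < n := by exact_mod_cast hn0
  have hh : 0 < t / n := div_pos ht hn0
  have hRp' := hRp _ hh
  have hRV : ∀ k, Integrable V (R (t / n) k) := by
    intro k
    induction k with
    | zero => rw [hR0 _ hh]; exact hμ₀.2
    | succ k ih =>
      exact (hR _ hh k).integrable_lyapunov hc hh.le hV.contDiff hV.nonneg hV.tendsto
        hc₁ hc₂ hV.Lop_le ih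
  obtain ⟨r, hr, h1, h2⟩ := exists_jordan hc hh.le (fun k => tobb (hRV k)) (tobb hμ.2) (hR _ hh)
    (hst.resEq hc _)
  have S := scheme_of_isDiff (W := W) hc (fun k => tobb (hRV k)) (tobb hμ.2)
    (fun k => toW (hRV k)) (toW hμ.2) hr h1 h2
  have D := hdec t n _ _ ht (Nat.ceil_le.1 hn) S
  have E := (hr 0).le_wDist hW.measurable hW0 (toW (hRV 0)) (toW hμ.2)
  have F := (hr n).integral_sub_le (toW (hRV n)) (toW hμ.2) hφ.1.continuous.measurable hφW
  refine F.trans (mul_le_mul_of_nonneg_left ?_ (by linarith))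
  rw [hR0 _ hh] at E
  have fin1 := S.fin_left 0
  have fin2 := S.fin_right 0
  have mW : ∀ (m : Measure (Ed d)) [IsFiniteMeasure m], Integrable W m →
      m.real univ ≤ ∫ x, W x ∂m := fun m _ hi => by
    have := integral_mono (μ := m) (integrable_const (1 : ℝ)) hi hW1
    simpa using this
  have m1 := mW _ (S.W_left 0)
  have m2 := mW _ (S.W_right 0)
  rw [← S.mass_eq 0] at m2
  simp only [wt, hR0 _ hh] at D m1 m2
  have hm : 0 ≤ (posM (r n) (R (t / n) n + μ)).real univ := measureReal_nonneg
  set e := exp (-lam * t)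
  have he : 0 < e := exp_pos _
  set p := (posM (r 0) (μ₀ + μ)).real univ
  set w := ∫ x, W x ∂(posM (r n) (R (t / n) n + μ)) +
    ∫ x, W x ∂(posM (fun x => -r n x) (R (t / n) n + μ))
  set w0 := ∫ x, W x ∂(posM (r 0) (μ₀ + μ)) + ∫ x, W x ∂(posM (fun x => -r 0 x) (μ₀ + μ))
  have q : p + ε * w0 ≤ (1 / 2 + ε) * wDist W μ₀ μ := by
    have : 2 * p ≤ w0 := by linarith
    nlinarith
  have q2 : ε * w ≤ K * e * ((1 / 2 + ε) * wDist W μ₀ μ) := by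
    have := mul_le_mul_of_nonneg_left q (mul_pos hK he).le
    linarith
  rw [hB, div_mul_eq_mul_div, div_mul_eq_mul_div, le_div_iff₀ hε]
  linarith

lemma coef_of_elliptic {K₁ K₂ : ℝ} (hK₁ : 0 < K₁) (hK₂ : 0 < K₂) (hAsymm : ∀ x, (A x).IsSymm)
    (hAlow : ∀ x (v : Ed d), K₁⁻¹ * ‖v‖ ^ 2 ≤ ∑ i, ∑ j, A x i j * v i * v j)
    (hAup : ∀ x (v : Ed d), ∑ i, ∑ j, A x i j * v i * v j ≤ K₁ * ‖v‖ ^ 2)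
    (hALip : ∀ x y i j, |A x i j - A y i j| ≤ K₂ * ‖x - y‖) (hβ : Measurable β)
    (hbb : Continuous bb) (hbb1 : ∀ x, 1 ≤ bb x) (hle : ∀ x, ‖β x‖ ≤ bb x) :
    Coef A β bb (1 + K₁ + K₂) := by
  have low : ∀ x (w : Fin d → ℝ), K₁⁻¹ * ∑ i, w i ^ 2 ≤ ∑ i, ∑ j, A x i j * w i * w j :=
    fun x w => by simpa [EuclideanSpace.real_norm_sq_eq] using hAlow x (WithLp.toLp 2 w)
  have up : ∀ x (w : Fin d → ℝ), ∑ i, ∑ j, A x i j * w i * w j ≤ K₁ * ∑ i, w i ^ 2 :=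
    fun x w => by simpa [EuclideanSpace.real_norm_sq_eq] using hAup x (WithLp.toLp 2 w)
  have nn : ∀ x (w : Fin d → ℝ), 0 ≤ ∑ i, ∑ j, A x i j * w i * w j := fun x w =>
    le_trans (by positivity) (low x w)
  refine ⟨by linarith, fun x w => ?_, fun x i j => ?_, fun x y i j => ?_, hβ, hbb, hbb1,
    fun x i => ?_⟩
  · have h := low x w
    rw [inv_mul_le_iff₀ hK₁] at h
    nlinarith [nn x w]
  · have diag : ∀ i, 0 ≤ A x i i ∧ A x i i ≤ K₁ := fun i => by
      have a := nn x (Pi.single i 1)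
      have b := up x (Pi.single i 1)
      simp [Pi.single_apply] at a b
      exact ⟨a, b⟩
    have hij : |A x i j| ≤ K₁ := by
      rcases eq_or_ne i j with rfl | hne
      · exact abs_le.2 ⟨by linarith [(diag i).1], (diag i).2⟩
      have hs : A x j i = A x i j := (hAsymm x).apply i j
      have key : ∀ s : ℝ, ∑ k, ∑ l, A x k l * (Pi.single i 1 + Pi.single j s : Fin d → ℝ) k *
          (Pi.single i 1 + Pi.single j s : Fin d → ℝ) l =
          A x i i + 2 * s * A x i j + s ^ 2 * A x j j := fun s => by
        simp [mul_add, add_mul, Finset.sum_add_distrib, Pi.single_apply]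
        rw [hs]; ring
      have nrm : ∀ s : ℝ, ∑ k, (Pi.single i 1 + Pi.single j s : Fin d → ℝ) k ^ 2 = 1 + s ^ 2 :=
        fun s => by
          simp [add_sq, Finset.sum_add_distrib, Pi.single_apply, ite_pow]
          exact fun h => absurd h.symm hne
      have a := up x (Pi.single i 1 + Pi.single j 1)
      have b := up x (Pi.single i 1 + Pi.single j (-1))
      rw [key, nrm] at a b
      exact abs_le.2 ⟨by linarith [(diag i).1, (diag j).1], by linarith [(diag i).1, (diag j).1]⟩
    linarith
  · refine (hALip x y i j).trans (mul_le_mul_of_nonneg_right (by linarith) (norm_nonneg _))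
  · exact (PiLp.norm_apply_le (β x) i).trans (hle x)

end

/-- **Lemma 1** (linear ergodicity): for a linear Fokker–Planck–Kolmogorov
operator with Lyapunov function `V` and drift bounded by `N₁ V^{1/2-γ}`,
solutions of the Cauchy problem converge exponentially in `‖·‖_W` to the
stationary solution, with constants `N, λ` depending only on
`d, K₁, K₂, Λ₁, Λ, N₁, γ, V` (in particular, uniform in `β`, `μ` and `μ₀`). -/
theorem stmt2_linear_exponential_convergence
    (A : Ed d → Matrix (Fin d) (Fin d) ℝ) (K₁ K₂ : ℝ)
    (hK₁ : 0 < K₁) (hK₂ : 0 < K₂)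
    (hAsymm : ∀ x, (A x).IsSymm)
    (hAlow : ∀ x (v : Ed d), K₁⁻¹ * ‖v‖ ^ 2 ≤ ∑ i, ∑ j, A x i j * v i * v j)
    (hAup : ∀ x (v : Ed d), ∑ i, ∑ j, A x i j * v i * v j ≤ K₁ * ‖v‖ ^ 2)
    (hALip : ∀ x y i j, |A x i j - A y i j| ≤ K₂ * ‖x - y‖)
    (V : Ed d → ℝ) (hV : ContDiff ℝ 2 V) (hV1 : ∀ x, 1 ≤ V x)
    (hVinf : Tendsto V (cocompact (Ed d)) atTop)
    (γ : ℝ) (hγ : γ ∈ Set.Ioc (0:ℝ) (1/2))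
    (W : Ed d → ℝ) (hW : W = fun x => V x ^ γ)
    (Λ₁ Λ N₁ : ℝ) (hΛ₁ : 0 < Λ₁) (hΛ : 0 < Λ) (hN₁ : 0 < N₁) :
    ∃ N > (0:ℝ), ∃ lam > (0:ℝ),
      ∀ β : Ed d → Ed d, Measurable β →
        (∀ x, Lop A β V x ≤ Λ₁ - Λ * V x) →
        (∀ x, ‖β x‖ ≤ N₁ * V x ^ ((1:ℝ)/2 - γ)) →
      ∀ μ : Measure (Ed d), memPV V μ → IsStationarySol A β μ →
      ∀ μ₀ : Measure (Ed d), memPV V μ₀ →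
      ∀ η : ℝ → Measure (Ed d),
        (∀ t, 0 ≤ t → memPV V (η t)) →
        IsLinCauchySol A β μ₀ η →
      ∀ t : ℝ, 0 < t →
        wDist W (η t) μ ≤ N * Real.exp (-lam * t) * wDist W μ₀ μ := by
  obtain ⟨hγ0, hγ1⟩ := hγ
  have hVpos : ∀ x, 0 < V x := fun x => one_pos.trans_le (hV1 x)
  rcases Nat.eq_zero_or_pos d with rfl | hd
  · refine ⟨1, one_pos, 1, one_pos, fun β _ _ _ μ hμ _ μ₀ hμ₀ η hη _ t ht => ?_⟩
    have eqd : ∀ ν ν' : Measure (Ed 0), IsProbabilityMeasure ν → IsProbabilityMeasure ν' →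
        ν = ν' := fun ν ν' _ _ => by
      refine Measure.ext fun s _ => ?_
      rcases Subsingleton.eq_empty_or_singleton (s := s) (Set.subsingleton_of_subsingleton)
        with rfl | ⟨x, rfl⟩
      · simp
      · rw [show ({x} : Set (Ed 0)) = univ from Set.eq_univ_of_forall fun y =>
          Subsingleton.elim y x]
        simp
    rw [eqd _ _ (hη t ht.le).1 hμ.1, eqd _ _ hμ₀.1 hμ.1]
    simp [wDist]
  set bb : Ed d → ℝ := fun x => 1 + N₁ * V x ^ ((1:ℝ)/2 - γ) with hbbd
  have hbb : Continuous bb := continuous_const.add (continuous_const.mul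
    (hV.continuous.rpow_const fun x => Or.inl (hVpos x).ne'))
  have hpos : ∀ x, 0 ≤ N₁ * V x ^ ((1:ℝ)/2 - γ) := fun x =>
    mul_nonneg hN₁.le (rpow_nonneg (hVpos x).le _)
  have hbb1 : ∀ x, 1 ≤ bb x := fun x => by simp only [hbbd]; linarith [hpos x]
  have hbbV : ∀ x, bb x ^ 2 ≤ (1 + N₁) ^ 2 * V x := fun x => by
    have h1 : V x ^ ((1:ℝ)/2 - γ) ≤ √(V x) := by
      rw [sqrt_eq_rpow]
      exact rpow_le_rpow_of_exponent_le (hV1 x) (by linarith)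
    have h2 : 1 ≤ √(V x) := one_le_sqrt.2 (hV1 x)
    have h3 : bb x ≤ (1 + N₁) * √(V x) := by
      simp only [hbbd]
      nlinarith [mul_le_mul_of_nonneg_left h1 hN₁.le]
    calc bb x ^ 2 ≤ ((1 + N₁) * √(V x)) ^ 2 :=
          pow_le_pow_left₀ (one_pos.le.trans (hbb1 x)) h3 2
      _ = (1 + N₁) ^ 2 * V x := by rw [mul_pow, sq_sqrt (hVpos x).le]
  have hWc : Continuous W := hW ▸ hV.continuous.rpow_const fun x => Or.inl (hVpos x).ne'
  have hW1 : ∀ x, 1 ≤ W x := fun x => hW ▸ one_le_rpow (hV1 x) hγ0.le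
  have hWV : ∀ x, W x ≤ V x := fun x => by
    rw [hW]
    simpa using rpow_le_rpow_of_exponent_le (hV1 x) (show γ ≤ 1 by linarith)
  have hWinf : Tendsto W (cocompact (Ed d)) atTop := hW ▸ (tendsto_rpow_atTop hγ0).comp hVinf
  obtain ⟨ε, hε, K, hK, lam, hlam, hdec⟩ := exists_exp_decay hd (A := A) (C := 1 + K₁ + K₂) hbb
    (fun x => one_pos.le.trans (hW1 x)) hWinf (by linarith) (mul_pos hγ0 hΛ₁).le (mul_pos hγ0 hΛ)
  refine ⟨K * (1 / 2 + ε) / ε, by positivity, lam, hlam,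
    fun β hβ hL hβV μ hμ hst μ₀ hμ₀ η hη H t ht => ?_⟩
  have hc : Coef A β bb (1 + K₁ + K₂) := coef_of_elliptic hK₁ hK₂ hAsymm hAlow hAup hALip hβ hbb
    hbb1 fun x => (hβV x).trans (by simp only [hbbd]; linarith)
  have lV : IsLyap A β V Λ₁ Λ := ⟨hV, fun x => (hVpos x).le, hVinf, hL⟩
  have lW : IsLyap A β W (γ * Λ₁) (γ * Λ) :=
    ⟨hW ▸ hV.rpow_const_of_ne fun x => (hVpos x).ne', fun x => one_pos.le.trans (hW1 x), hWinf,
      fun x => by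
        rw [hW]
        exact lyapunov_rpow hc hV hV1 hγ0 (by linarith) hΛ₁.le hL x⟩
  exact wDist_le_of_decay hc hbbV lV hΛ₁.le hΛ.le hWc hW1 hWV hε hK
    (fun t N P Q h1 h2 h3 => hdec β t N P Q hc lW h1 h2 h3) hμ hst hμ₀ hη H ht
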